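/- For an integer p ≥ 2 let T_p : ℝ/ℤ → ℝ/ℤ be T_p(x) = p·x. Let p_1,…,p_d ≥ 2 be pairwise multiplicatively independent integers (log p_i / log p_j ∉ ℚ for all i ≠ j), and let A_1,…,A_d ⊆ ℝ/ℤ be closed sets with T_{p_j}(A_j) ⊆ A_j for each j, identified with subsets of [0,1) ⊂ ℝ. Set s = Σ_{j=1}^d hdim(A_j). Then: (1) for any 1 ≤ k ≤ d and any (d−k)-dimensional affine subspace P ⊂ ℝ^d whose orthogonal complement π = P^⊥ ∈ G(d,k) satisfies Z(π) ≤ k−1, one has ubdim((A_1×⋯×A_d) ∩ P) ≤ max{s−k, 0}; (2) moreover, for every ε > 0 and η > 0 there is a constant C = C(d,k,ε,η) > 0 such that for all π ∈ G(d,k) with Z_η(π) ≤ k−1 and all affine subspaces P of ℝ^d orthogonal to π, |(A_1×⋯×A_d) ∩ P|_δ ≤ C·δ^{−max{s−k,0}−ε} for all 0 < δ ≤ 1. -/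

import Mathlib

open Filter Topology Set MeasureTheory
open scoped Pointwise ENNReal

noncomputable section

abbrev Euc (d : ℕ) := EuclideanSpace ℝ (Fin d)

/-- Half-open dyadic cube of generation `m` indexed by `k ∈ ℤ^d`. -/
def dyadicCube (d m : ℕ) (k : Fin d → ℤ) : Set (Euc d) :=
  {x | ∀ i, (k i : ℝ) / 2 ^ m ≤ x i ∧ x i < ((k i : ℝ) + 1) / 2 ^ m}

/-- A finite set is `δ`-separated. -/
def IsDeltaSep {X : Type*} [PseudoMetricSpace X] (F : Finset X) (δ : ℝ) : Prop :=
  ∀ a ∈ F, ∀ b ∈ F, a ≠ b → δ ≤ dist a b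

/-- `|E|_δ`: the packing number, i.e. the largest cardinality of a `δ`-separated subset. -/
def packingNumber {X : Type*} [PseudoMetricSpace X] (E : Set X) (δ : ℝ) : ℕ :=
  sSup {n : ℕ | ∃ F : Finset X, ↑F ⊆ E ∧ IsDeltaSep F δ ∧ F.card = n}

/-- Upper box dimension via packing numbers: `limsup_{δ→0⁺} log|E|_δ / log(1/δ)`. -/
def ubdim {X : Type*} [PseudoMetricSpace X] (E : Set X) : ℝ :=
  Filter.limsup (fun δ : ℝ => Real.log (packingNumber E δ) / Real.log (1 / δ))
    (nhdsWithin 0 (Set.Ioi 0))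

/-- The number of zero coordinates of a vector in `ℝ^d`. -/
def zeroCount {d : ℕ} (v : Euc d) : ℕ := {i : Fin d | v i = 0}.ncard

/-- `Z(π)`: the largest number of zero coordinates of a unit vector contained in `π`. -/
def Zzero {d : ℕ} (V : Submodule ℝ (Euc d)) : ℕ :=
  sSup {n : ℕ | ∃ v ∈ V, ‖v‖ = 1 ∧ zeroCount v = n}

/-- `Z_η(v)`: the number of coordinates of `v` of absolute value less than `η`. -/
def etaCount {d : ℕ} (η : ℝ) (v : Euc d) : ℕ := {i : Fin d | |v i| < η}.ncard

/-- `Z_η(π) = max{Z_η(v) : v ∈ π, |v| = 1}`. -/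
def Zeta {d : ℕ} (η : ℝ) (V : Submodule ℝ (Euc d)) : ℕ :=
  sSup {n : ℕ | ∃ v ∈ V, ‖v‖ = 1 ∧ etaCount η v = n}


set_option linter.unusedVariables false
set_option linter.unusedSectionVars false


namespace FHR

/-- finitely additive mean -/
structure St (α : Type) where
  E : (α → ℝ) →ₗ[ℝ] ℝ
  pos : ∀ f : α → ℝ, (∃ C, ∀ a, f a ≤ C) → (∀ a, 0 ≤ f a) → 0 ≤ E f
  one : E (fun _ => 1) = 1

/-- finite partitions -/
structure RV (α : Type) where
  rel : α → α → Prop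
  eqv : Equivalence rel
  fin : Finite (Quotient (⟨rel, eqv⟩ : Setoid α))

namespace RV
variable {α β : Type}

@[ext] theorem ext' {X Y : RV α} (h : ∀ a b, X.rel a b ↔ Y.rel a b) : X = Y := by
  cases X with
  | mk r e f =>
    cases Y with
    | mk r' e' f' =>
      have : r = r' := by
        funext a b
        exact propext (h a b)
      subst this
      rfl

def sd (X : RV α) : Setoid α := ⟨X.rel, X.eqv⟩

abbrev Q (X : RV α) : Type := Quotient X.sd

instance (X : RV α) : Finite X.Q := X.fin
noncomputable instance (X : RV α) : Fintype X.Q := Fintype.ofFinite _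

theorem refl (X : RV α) (a : α) : X.rel a a := X.eqv.refl a
theorem symm (X : RV α) {a b : α} (h : X.rel a b) : X.rel b a := X.eqv.symm h
theorem trans (X : RV α) {a b c : α} (h : X.rel a b) (h' : X.rel b c) : X.rel a c := X.eqv.trans h h'
theorem comm (X : RV α) {a b : α} : X.rel a b ↔ X.rel b a := ⟨X.symm, X.symm⟩

def mkq (X : RV α) (a : α) : X.Q := Quotient.mk X.sd a
theorem mkq_eq (X : RV α) {a b : α} : X.mkq a = X.mkq b ↔ X.rel a b :=
  ⟨fun h => Quotient.exact h, fun h => Quotient.sound (s := X.sd) h⟩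
theorem mkq_out (X : RV α) (c : X.Q) : X.mkq c.out = c := Quotient.out_eq c
theorem rel_out (X : RV α) (a : α) : X.rel (X.mkq a).out a := by
  rw [← mkq_eq, mkq_out]

instance : LE (RV α) := ⟨fun X Y => ∀ a b, Y.rel a b → X.rel a b⟩

theorem le_def {X Y : RV α} : X ≤ Y ↔ ∀ a b, Y.rel a b → X.rel a b := Iff.rfl

instance : Max (RV α) := ⟨fun X Y =>
  { rel := fun a b => X.rel a b ∧ Y.rel a b
    eqv := ⟨fun a => ⟨X.refl a, Y.refl a⟩, fun h => ⟨X.symm h.1, Y.symm h.2⟩,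
      fun h h' => ⟨X.trans h.1 h'.1, Y.trans h.2 h'.2⟩⟩
    fin := by
      let f : α → X.Q × Y.Q := fun a => (X.mkq a, Y.mkq a)
      refine Finite.of_injective (β := X.Q × Y.Q) (fun c => Quotient.lift f ?_ c) ?_
      · intro a b h
        exact Prod.ext (X.mkq_eq.2 h.1) (Y.mkq_eq.2 h.2)
      · intro a b
        refine Quotient.inductionOn₂ a b ?_
        intro a b h
        have h' : f a = f b := h
        exact Quotient.sound ⟨X.mkq_eq.1 (congrArg Prod.fst h'), Y.mkq_eq.1 (congrArg Prod.snd h')⟩ }⟩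

@[simp] theorem sup_rel {X Y : RV α} {a b : α} : (X ⊔ Y).rel a b ↔ X.rel a b ∧ Y.rel a b := Iff.rfl

instance : SemilatticeSup (RV α) where
  le_refl := fun X a b h => h
  le_trans := fun X Y Z h h' a b k => h a b (h' a b k)
  le_antisymm := fun X Y h h' => ext' fun a b => ⟨h' a b, h a b⟩
  sup := fun X Y => X ⊔ Y
  le_sup_left := fun X Y a b h => h.1
  le_sup_right := fun X Y a b h => h.2
  sup_le := fun X Y Z h h' a b k => ⟨h a b k, h' a b k⟩

instance : OrderBot (RV α) where
  bot :=
    { rel := fun _ _ => True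
      eqv := ⟨fun _ => trivial, fun _ => trivial, fun _ _ => trivial⟩
      fin := by
        refine Finite.of_injective (β := Unit) (fun _ => ()) ?_
        intro a b
        refine Quotient.inductionOn₂ a b ?_
        intro a b _
        exact Quotient.sound trivial }
  bot_le := fun _ _ _ _ => trivial

/-- partition given by a function of finite range -/
def of (f : α → β) (h : (Set.range f).Finite) : RV α where
  rel := fun a b => f a = f b
  eqv := ⟨fun _ => rfl, fun h => h.symm, fun h h' => h.trans h'⟩
  fin := by
    have : Finite (Set.range f) := h
    refine Finite.of_injective (β := Set.range f)
      (fun c => Quotient.lift (fun a => (⟨f a, a, rfl⟩ : Set.range f)) ?_ c) ?_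
    · intro a b h
      exact Subtype.ext h
    · intro a b
      refine Quotient.inductionOn₂ a b ?_
      intro a b h
      exact Quotient.sound (congrArg Subtype.val h)

@[simp] theorem of_rel {f : α → β} {h} {a b : α} : (of f h).rel a b ↔ f a = f b := Iff.rfl

def ofF [Finite β] (f : α → β) : RV α := of f (Set.toFinite _)

@[simp] theorem ofF_rel [Finite β] {f : α → β} {a b : α} : (ofF f).rel a b ↔ f a = f b := Iff.rfl

def comap (φ : α → β) (X : RV β) : RV α where
  rel := fun a b => X.rel (φ a) (φ b)
  eqv := ⟨fun _ => X.refl _, fun h => X.symm h, fun h h' => X.trans h h'⟩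
  fin := by
    refine Finite.of_injective (β := X.Q)
      (fun c => Quotient.lift (fun a => X.mkq (φ a)) ?_ c) ?_
    · intro a b h
      exact X.mkq_eq.2 h
    · intro a b
      refine Quotient.inductionOn₂ a b ?_
      intro a b h
      exact Quotient.sound (X.mkq_eq.1 h)

@[simp] theorem comap_rel {φ : α → β} {X : RV β} {a b : α} :
    (X.comap φ).rel a b ↔ X.rel (φ a) (φ b) := Iff.rfl

theorem comap_sup (φ : α → β) (X Y : RV β) : (X ⊔ Y).comap φ = X.comap φ ⊔ Y.comap φ := rfl

theorem comap_mono (φ : α → β) {X Y : RV β} (h : X ≤ Y) : X.comap φ ≤ Y.comap φ :=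
  fun _ _ k => h _ _ k

end RV

/-- indicator -/
def ind {α : Type} (s : α → Prop) : α → ℝ := Set.indicator {a | s a} (fun _ => 1)

theorem ind_pos {α : Type} {s : α → Prop} {a : α} (h : s a) : ind s a = 1 := by
  simp [ind, h]
theorem ind_neg {α : Type} {s : α → Prop} {a : α} (h : ¬ s a) : ind s a = 0 := by
  simp [ind, h]
theorem ind_nonneg {α : Type} (s : α → Prop) (a : α) : 0 ≤ ind s a := by
  by_cases h : s a
  · simp [ind_pos h]
  · simp [ind_neg h]
theorem ind_le_one {α : Type} (s : α → Prop) (a : α) : ind s a ≤ 1 := by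
  by_cases h : s a
  · simp [ind_pos h]
  · simp [ind_neg h]

namespace St
variable {α β : Type} (E : St α)

def map (φ : α → β) : St β where
  E :=
    { toFun := fun f => E.E (fun a => f (φ a))
      map_add' := fun f g => E.E.map_add (fun a => f (φ a)) (fun a => g (φ a))
      map_smul' := fun c f => E.E.map_smul c (fun a => f (φ a)) }
  pos := fun f hf h => E.pos _ (hf.imp fun C hC a => hC _) fun a => h _
  one := E.one

theorem map_E (φ : α → β) (f : β → ℝ) : (E.map φ).E f = E.E (fun a => f (φ a)) := rfl

theorem const (c : ℝ) : E.E (fun _ => c) = c := by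
  have : (fun _ : α => c) = c • (fun _ => (1 : ℝ)) := by
    funext a
    simp
  rw [this, map_smul, E.one]
  simp

theorem add (f g : α → ℝ) : E.E (fun a => f a + g a) = E.E f + E.E g := E.E.map_add f g
theorem sub (f g : α → ℝ) : E.E (fun a => f a - g a) = E.E f - E.E g := E.E.map_sub f g
theorem neg (f : α → ℝ) : E.E (fun a => - f a) = - E.E f := E.E.map_neg f
theorem smul (c : ℝ) (f : α → ℝ) : E.E (fun a => c * f a) = c * E.E f := E.E.map_smul c f
theorem smul' (c : ℝ) (f : α → ℝ) : E.E (fun a => f a * c) = E.E f * c := by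
  rw [mul_comm, ← smul]
  simp only [mul_comm]
theorem sum {ι : Type*} (s : Finset ι) (f : ι → α → ℝ) :
    E.E (fun a => ∑ i ∈ s, f i a) = ∑ i ∈ s, E.E (f i) := by
  rw [← map_sum]
  congr 1
  funext a
  simp

theorem mono {f g : α → ℝ} (hb : ∃ C, ∀ a, g a - f a ≤ C) (h : ∀ a, f a ≤ g a) : E.E f ≤ E.E g := by
  have := E.pos (fun a => g a - f a) hb (fun a => sub_nonneg.2 (h a))
  rw [E.sub] at this
  linarith

/-- probability of the cell of `a` -/
def pr (X : RV α) (a : α) : ℝ := E.E (ind (X.rel a))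

def H (X : RV α) : ℝ := E.E (fun a => - Real.log (E.pr X a))

def cH (X Y : RV α) : ℝ := E.H (X ⊔ Y) - E.H Y

theorem pr_congr {X : RV α} {a b : α} (h : X.rel a b) : E.pr X a = E.pr X b := by
  have : X.rel a = X.rel b := by
    funext c
    exact propext ⟨fun k => X.trans (X.symm h) k, fun k => X.trans h k⟩
  rw [pr, pr, this]

theorem E_ind_nonneg (s : α → Prop) : 0 ≤ E.E (ind s) :=
  E.pos _ ⟨1, ind_le_one s⟩ (ind_nonneg s)

theorem E_ind_mono {s t : α → Prop} (h : ∀ a, s a → t a) : E.E (ind s) ≤ E.E (ind t) := by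
  refine E.mono ⟨1, fun a => ?_⟩ fun a => ?_
  · linarith [ind_le_one t a, ind_nonneg s a]
  · by_cases hs : s a
    · rw [ind_pos hs, ind_pos (h a hs)]
    · rw [ind_neg hs]
      exact ind_nonneg _ _

theorem E_ind_le_one (s : α → Prop) : E.E (ind s) ≤ 1 := by
  rw [← E.one]
  exact E.mono ⟨1, fun a => by linarith [ind_nonneg s a]⟩ (ind_le_one s)

theorem pr_nonneg (X : RV α) (a : α) : 0 ≤ E.pr X a := E.E_ind_nonneg _
theorem pr_le_one (X : RV α) (a : α) : E.pr X a ≤ 1 := E.E_ind_le_one _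
theorem pr_anti {X Y : RV α} (h : X ≤ Y) (a : α) : E.pr Y a ≤ E.pr X a :=
  E.E_ind_mono fun b => h a b

theorem E_meas (X : RV α) (f : α → ℝ) (hf : ∀ a b, X.rel a b → f a = f b) :
    E.E f = ∑ c : X.Q, f c.out * E.pr X c.out := by
  have h1 : f = fun a => ∑ c : X.Q, f c.out * ind (X.rel c.out) a := by
    funext a
    rw [Finset.sum_eq_single (X.mkq a)]
    · rw [ind_pos (X.rel_out a), mul_one]
      exact (hf _ _ (X.rel_out a)).symm
    · intro c _ hc
      rw [ind_neg, mul_zero]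
      intro h
      apply hc
      rw [← X.mkq_out c, X.mkq_eq]
      exact h
    · intro h
      exact absurd (Finset.mem_univ _) h
  conv_lhs => rw [h1]
  rw [E.sum]
  refine Finset.sum_congr rfl fun c _ => ?_
  rw [E.smul, pr]

theorem sum_pr (X : RV α) : ∑ c : X.Q, E.pr X c.out = 1 := by
  have := E.E_meas X (fun _ => 1) (fun _ _ _ => rfl)
  rw [E.one] at this
  simpa using this.symm

/-- a.e. comparison for measurable functions -/
theorem E_meas_le (X : RV α) (f g : α → ℝ) (hf : ∀ a b, X.rel a b → f a = f b)
    (hg : ∀ a b, X.rel a b → g a = g b) (h : ∀ a, 0 < E.pr X a → f a ≤ g a) : E.E f ≤ E.E g := by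
  rw [E.E_meas X f hf, E.E_meas X g hg]
  refine Finset.sum_le_sum fun c _ => ?_
  rcases (E.pr_nonneg X c.out).eq_or_lt with h0 | h0
  · rw [← h0]
    simp
  · exact mul_le_mul_of_nonneg_right (h _ h0) h0.le

theorem E_meas_congr (X : RV α) (f g : α → ℝ) (hf : ∀ a b, X.rel a b → f a = f b)
    (hg : ∀ a b, X.rel a b → g a = g b) (h : ∀ a, 0 < E.pr X a → f a = g a) : E.E f = E.E g :=
  le_antisymm (E.E_meas_le X f g hf hg fun a ha => (h a ha).le)
    (E.E_meas_le X g f hg hf fun a ha => (h a ha).ge)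

theorem H_map (φ : α → β) (X : RV β) : (E.map φ).H X = E.H (X.comap φ) := rfl
theorem cH_map (φ : α → β) (X Y : RV β) : (E.map φ).cH X Y = E.cH (X.comap φ) (Y.comap φ) := rfl

theorem H_nonneg (X : RV α) : 0 ≤ E.H X := by
  have : E.E (fun _ : α => (0:ℝ)) ≤ E.H X := by
    refine E.E_meas_le X _ _ (fun _ _ _ => rfl) (fun a b h => by rw [E.pr_congr h]) fun a _ => ?_
    have := Real.log_nonpos (E.pr_nonneg X a) (E.pr_le_one X a)
    linarith
  rwa [E.const] at this

theorem H_mono {X Y : RV α} (h : X ≤ Y) : E.H X ≤ E.H Y := by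
  refine E.E_meas_le Y _ _ (fun a b k => by rw [E.pr_congr (h _ _ k)])
    (fun a b k => by rw [E.pr_congr k]) fun a ha => ?_
  have := Real.log_le_log ha (E.pr_anti h a)
  linarith

/-- sum of the cells of `Y` inside a cell of `X ≤ Y` -/
theorem sum_fiber {X Y : RV α} (h : X ≤ Y) (a : α) :
    ∑ c : Y.Q, ind (X.rel a) c.out * E.pr Y c.out = E.pr X a := by
  rw [pr, E.E_meas Y (ind (X.rel a))]
  intro b c hbc
  by_cases hb : X.rel a b
  · rw [ind_pos hb, ind_pos (X.trans hb (h _ _ hbc))]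
  · rw [ind_neg hb, ind_neg]
    exact fun hc => hb (X.trans hc (X.symm (h _ _ hbc)))

/-- Gibbs inequality -/
theorem gibbs {X Z : RV α} (hZX : Z ≤ X) (q : α → ℝ) (hq : ∀ a b, X.rel a b → q a = q b)
    (hpos : ∀ a, 0 < E.pr X a → 0 < q a) (h0 : ∀ a, 0 ≤ q a)
    (hsum : ∀ a, ∑ c : X.Q, ind (Z.rel a) c.out * q c.out ≤ 1) :
    E.H X - E.H Z ≤ E.E (fun a => - Real.log (q a)) := by
  have hm : ∀ a b, X.rel a b → E.pr Z a = E.pr Z b := fun a b h => E.pr_congr (hZX _ _ h)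
  have hm' : ∀ a b, X.rel a b → E.pr X a = E.pr X b := fun a b h => E.pr_congr h
  have key : E.E (fun a => (- Real.log (E.pr X a) - - Real.log (E.pr Z a)) - - Real.log (q a))
      ≤ 0 := by
    rw [E.E_meas X _ (fun a b h => by rw [hm a b h, hm' a b h, hq a b h])]
    have step : ∀ c : X.Q, (- Real.log (E.pr X c.out) - - Real.log (E.pr Z c.out)
        - - Real.log (q c.out)) * E.pr X c.out ≤ q c.out * E.pr Z c.out - E.pr X c.out := by
      intro c
      rcases (E.pr_nonneg X c.out).eq_or_lt with hx | hx
      · rw [← hx]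
        simp only [mul_zero, sub_zero]
        exact mul_nonneg (h0 _) (E.pr_nonneg _ _)
      · have hz : 0 < E.pr Z c.out := hx.trans_le (E.pr_anti hZX _)
        have hqq := hpos _ hx
        have h1 : - Real.log (E.pr X c.out) - - Real.log (E.pr Z c.out)
          - - Real.log (q c.out) = Real.log (q c.out * E.pr Z c.out / E.pr X c.out) := by
          rw [Real.log_div (by positivity) hx.ne', Real.log_mul hqq.ne' hz.ne']
          ring
        rw [h1]
        have h2 := Real.log_le_sub_one_of_pos (show 0 < q c.out * E.pr Z c.out / E.pr X c.out by
          positivity)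
        calc _ ≤ (q c.out * E.pr Z c.out / E.pr X c.out - 1) * E.pr X c.out :=
              mul_le_mul_of_nonneg_right h2 hx.le
          _ = _ := by
              field_simp
    refine (Finset.sum_le_sum fun c _ => step c).trans ?_
    rw [Finset.sum_sub_distrib, E.sum_pr]
    have h3 : ∑ c : X.Q, q c.out * E.pr Z c.out ≤ 1 := by
      have h4 : ∀ c : X.Q, q c.out * E.pr Z c.out
          = ∑ z : Z.Q, (ind (Z.rel z.out) c.out * q c.out) * E.pr Z z.out := by
        intro c
        rw [Finset.sum_eq_single (Z.mkq c.out)]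
        · rw [ind_pos (Z.rel_out _), one_mul, E.pr_congr (Z.rel_out c.out)]
        · intro z _ hz
          rw [ind_neg, zero_mul, zero_mul]
          intro k
          apply hz
          rw [← Z.mkq_out z, Z.mkq_eq]
          exact k
        · intro h
          exact absurd (Finset.mem_univ _) h
      rw [Finset.sum_congr rfl fun c _ => h4 c, Finset.sum_comm, ← E.sum_pr Z]
      refine Finset.sum_le_sum fun z _ => ?_
      rw [← Finset.sum_mul]
      calc _ ≤ 1 * E.pr Z z.out := mul_le_mul_of_nonneg_right (hsum _) (E.pr_nonneg _ _)
        _ = _ := one_mul _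
    linarith
  rw [E.sub, E.sub] at key
  unfold H
  linarith

/-- Gibbs inequality against a conditional law of another state -/
theorem gibbs_cond {X Z : RV α} (hZX : Z ≤ X) (E' : St β) (g : α → β) (q : α → ℝ)
    (U V : α → RV β) (hUV : ∀ a, V a ≤ U a)
    (hU : ∀ a b, Z.rel a b → U a = U b) (hV : ∀ a b, Z.rel a b → V a = V b)
    (hq : ∀ a, q a = E'.pr (U a) (g a) / E'.pr (V a) (g a))
    (hXU : ∀ a b, Z.rel a b → (U a).rel (g a) (g b) → X.rel a b)
    (hUX : ∀ a b, X.rel a b → (U a).rel (g a) (g b))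
    (hZV : ∀ a b, Z.rel a b → (V a).rel (g a) (g b))
    (hpos : ∀ a, 0 < E.pr X a → 0 < E'.pr (U a) (g a)) :
    E.H X - E.H Z ≤ E.E (fun a => - Real.log (q a)) := by
  refine E.gibbs hZX q ?_ ?_ ?_ ?_
  · intro a b h
    have hz := hZX _ _ h
    rw [hq, hq, ← hU a b hz, ← hV a b hz, E'.pr_congr (hUX a b h), E'.pr_congr (hZV a b hz)]
  · intro a h
    have := hpos a h
    rw [hq]
    exact div_pos this (this.trans_le (E'.pr_anti (hUV a) _))
  · intro a
    rw [hq]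
    exact div_nonneg (E'.pr_nonneg _ _) (E'.pr_nonneg _ _)
  · intro a
    have h1 : ∀ c : X.Q, ind (Z.rel a) c.out * q c.out
        = ind (Z.rel a) c.out * E'.pr (U a) (g c.out) / E'.pr (V a) (g a) := by
      intro c
      by_cases h : Z.rel a c.out
      · rw [hq, ← hU _ _ h, ← hV _ _ h, ind_pos h, one_mul, one_mul, E'.pr_congr (hZV _ _ h)]
      · rw [ind_neg h, zero_mul, zero_mul, zero_div]
    rw [Finset.sum_congr rfl fun c _ => h1 c, ← Finset.sum_div]
    refine div_le_one_of_le₀ ?_ (E'.pr_nonneg _ _)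
    rw [← E'.sum_fiber (hUV a) (g a)]
    classical
    have h2 : ∀ c : X.Q, ind (Z.rel a) c.out * E'.pr (U a) (g c.out)
        = if Z.rel a c.out then E'.pr (U a) (g c.out) else 0 := by
      intro c
      by_cases h : Z.rel a c.out
      · rw [ind_pos h, one_mul, if_pos h]
      · rw [ind_neg h, zero_mul, if_neg h]
    rw [Finset.sum_congr rfl fun c _ => h2 c, ← Finset.sum_filter]
    have h3 : ∀ c ∈ Finset.univ.filter (fun c : X.Q => Z.rel a c.out), E'.pr (U a) (g c.out)
        = ind ((V a).rel (g a)) ((U a).mkq (g c.out)).out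
          * E'.pr (U a) ((U a).mkq (g c.out)).out := by
      intro c hc
      have hc' : Z.rel a c.out := by simpa using hc
      have h4 := (U a).rel_out (g c.out)
      rw [ind_pos, one_mul, E'.pr_congr h4]
      exact (V a).trans (hZV _ _ hc') ((V a).symm (hUV a _ _ h4))
    rw [Finset.sum_congr rfl h3,
      ← Finset.sum_image (f := fun u : (U a).Q => ind ((V a).rel (g a)) u.out * E'.pr (U a) u.out)]
    · exact Finset.sum_le_sum_of_subset_of_nonneg (Finset.subset_univ _)
        fun u _ _ => mul_nonneg (ind_nonneg _ _) (E'.pr_nonneg _ _)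
    · intro c hc c' hc' h
      have k : Z.rel a c.out := by simpa using hc
      have k' : Z.rel a c'.out := by simpa using hc'
      have h5 : (U a).rel (g c.out) (g c'.out) := (U a).mkq_eq.1 h
      rw [hU _ _ k] at h5
      have h6 := hXU _ _ (Z.trans (Z.symm k) k') h5
      rw [← X.mkq_out c, ← X.mkq_out c', X.mkq_eq]
      exact h6

theorem cH_nonneg (X Y : RV α) : 0 ≤ E.cH X Y := sub_nonneg.2 (E.H_mono le_sup_right)

theorem cH_anti (A : RV α) {Y Y' : RV α} (h : Y ≤ Y') : E.cH A Y' ≤ E.cH A Y := by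
  have h1 : Y ≤ A ⊔ Y' := h.trans le_sup_right
  have := E.gibbs_cond (X := A ⊔ Y') (Z := Y') le_sup_right E id
    (fun a => E.pr (A ⊔ Y) a / E.pr Y a) (fun _ => A ⊔ Y) (fun _ => Y) (fun _ => le_sup_right)
    (fun _ _ _ => rfl) (fun _ _ _ => rfl) (fun _ => rfl) (fun a b h2 h3 => ⟨h3.1, h2⟩)
    (fun a b h2 => ⟨h2.1, h _ _ h2.2⟩) (fun a b h2 => h _ _ h2)
    (fun a ha => ha.trans_le (E.pr_anti (sup_le_sup_left h A) a))
  refine this.trans ?_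
  have h3 : E.cH A Y = E.E (fun a => - Real.log (E.pr (A ⊔ Y) a) - - Real.log (E.pr Y a)) := by
    rw [E.sub]
    rfl
  rw [h3]
  have m1 : ∀ a b, (A ⊔ Y).rel a b → E.pr (A ⊔ Y) a = E.pr (A ⊔ Y) b := fun a b h => E.pr_congr h
  have m2 : ∀ a b, (A ⊔ Y).rel a b → E.pr Y a = E.pr Y b := fun a b h => E.pr_congr h.2
  refine E.E_meas_le (A ⊔ Y) _ _ (fun a b h => by rw [m1 a b h, m2 a b h])
    (fun a b h => by rw [m1 a b h, m2 a b h]) fun a ha => ?_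
  rw [Real.log_div ha.ne' (ha.trans_le (E.pr_anti le_sup_right a)).ne']
  linarith

theorem cH_mono {X X' : RV α} (h : X ≤ X') (Y : RV α) : E.cH X Y ≤ E.cH X' Y :=
  sub_le_sub_right (E.H_mono (sup_le_sup_right h Y)) _

/-- chain rule -/
theorem cH_sup (X Y Z : RV α) : E.cH (X ⊔ Y) Z = E.cH X Z + E.cH Y (X ⊔ Z) := by
  unfold cH
  have : X ⊔ Y ⊔ Z = Y ⊔ (X ⊔ Z) := by
    rw [sup_comm X Y, sup_assoc]
  rw [this]
  ring

theorem cH_symm (X Y Z : RV α) : E.cH X Z + E.cH Y (X ⊔ Z) = E.cH Y Z + E.cH X (Y ⊔ Z) := by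
  rw [← cH_sup, ← cH_sup, sup_comm]

theorem cH_trans (A f g : RV α) : E.cH A g ≤ E.cH A f + E.cH f g := by
  have h1 := E.cH_sup f A g
  have h2 := E.cH_anti A (le_sup_left : f ≤ f ⊔ g)
  have h3 := E.cH_mono (le_sup_right : A ≤ f ⊔ A) g
  linarith

theorem cH_sup_le (X Y Z : RV α) : E.cH (X ⊔ Y) Z ≤ E.cH X Z + E.cH Y Z := by
  rw [cH_sup]
  linarith [E.cH_anti Y (le_sup_right : Z ≤ X ⊔ Z)]

theorem cH_of_le {X Y : RV α} (h : X ≤ Y) : E.cH X Y = 0 := by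
  unfold cH
  rw [sup_eq_right.2 h, sub_self]

theorem cH_absorb (X Y : RV α) : E.cH (X ⊔ Y) Y = E.cH X Y := by
  unfold cH
  rw [sup_assoc, sup_idem]

theorem H_bot : E.H ⊥ = 0 := by
  have : ∀ a, E.pr ⊥ a = 1 := by
    intro a
    have h : ind ((⊥ : RV α).rel a) = fun _ => 1 := by
      funext b
      exact ind_pos trivial
    rw [pr, h, E.one]
  unfold H
  simp only [this, Real.log_one, neg_zero]
  exact E.const 0

theorem cH_bot (X : RV α) : E.cH X ⊥ = E.H X := by
  unfold cH
  rw [E.H_bot, sup_bot_eq, sub_zero]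

theorem cH_le_H (X Y : RV α) : E.cH X Y ≤ E.H X := by
  rw [← E.cH_bot X]
  exact E.cH_anti X bot_le

theorem H_sup (X Y : RV α) : E.H (X ⊔ Y) = E.H Y + E.cH X Y := by
  unfold cH
  ring

theorem nonempty_of (E : St α) : Nonempty α := by
  by_contra h
  rw [not_nonempty_iff] at h
  have h1 := E.one
  have h2 : (fun _ : α => (1:ℝ)) = 0 := by
    funext a
    exact (h.false a).elim
  rw [h2, map_zero] at h1
  exact zero_ne_one h1

/-- a partition with at most `N` cells -/
theorem H_le_card (X : RV α) {κ : Type} [Fintype κ] (Ψ : α → κ)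
    (h : ∀ a b, Ψ a = Ψ b → X.rel a b) : E.H X ≤ Real.log (Fintype.card κ) := by
  obtain ⟨a0⟩ := E.nonempty_of
  have hc : (0:ℝ) < Fintype.card κ := by
    have : Nonempty κ := ⟨Ψ a0⟩
    exact_mod_cast Fintype.card_pos
  have := E.gibbs (X := X) (Z := ⊥) bot_le (fun _ => (Fintype.card κ : ℝ)⁻¹) (fun _ _ _ => rfl)
    (fun _ _ => inv_pos.2 hc) (fun _ => (inv_pos.2 hc).le) (fun a => ?_)
  · rw [E.H_bot, E.const, Real.log_inv, neg_neg, sub_zero] at this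
    exact this
  · have h1 : ∀ c : X.Q, ind ((⊥ : RV α).rel a) c.out * (Fintype.card κ : ℝ)⁻¹
        = (Fintype.card κ : ℝ)⁻¹ := by
      intro c
      rw [ind_pos trivial, one_mul]
    rw [Finset.sum_congr rfl fun c _ => h1 c, Finset.sum_const, nsmul_eq_mul, Finset.card_univ]
    rw [← div_eq_mul_inv]
    refine div_le_one_of_le₀ ?_ hc.le
    exact_mod_cast Fintype.card_le_of_injective (fun c : X.Q => Ψ c.out) (fun c c' hcc => by
      rw [← X.mkq_out c, ← X.mkq_out c', X.mkq_eq]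
      exact h _ _ hcc)

theorem cH_le_card (X Y : RV α) {κ : Type} [Fintype κ] (Ψ : α → κ)
    (h : ∀ a b, Y.rel a b → Ψ a = Ψ b → X.rel a b) : E.cH X Y ≤ Real.log (Fintype.card κ) := by
  have h1 : E.cH X Y ≤ E.cH (RV.ofF Ψ) Y := by
    rw [← E.cH_absorb (RV.ofF Ψ)]
    exact E.cH_mono (show X ≤ RV.ofF Ψ ⊔ Y from fun a b k => h a b k.2 k.1) Y
  refine h1.trans ((E.cH_le_H _ _).trans (E.H_le_card _ Ψ fun a b k => k))

/-- event-dependent count: `Ψ` constant on `e` -/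
theorem cH_event (e : α → Prop) {κ : Type} [Fintype κ] (Ψ : α → κ)
    (h : ∀ a b, e a → e b → Ψ a = Ψ b) :
    E.cH (RV.ofF Ψ) (RV.ofF e) ≤ E.E (ind fun a => ¬ e a) * Real.log (Fintype.card κ) := by
  classical
  obtain ⟨a0⟩ := E.nonempty_of
  have hc : (0:ℝ) < Fintype.card κ := by
    have : Nonempty κ := ⟨Ψ a0⟩
    exact_mod_cast Fintype.card_pos
  set N : ℝ := (Fintype.card κ : ℝ) with hN
  set X := RV.ofF Ψ ⊔ RV.ofF e with hX
  have := E.gibbs (X := X) (Z := RV.ofF e) le_sup_right (fun a => if e a then 1 else N⁻¹)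
    (fun a b k => by
      have : e a = e b := k.2
      simp only [this])
    (fun a _ => by
      have := inv_pos.2 hc
      split_ifs <;> linarith)
    (fun a => by
      have := inv_pos.2 hc
      split_ifs <;> linarith) (fun a => ?_)
  · refine this.trans (le_of_eq ?_)
    rw [← E.smul']
    congr 1
    funext a
    by_cases ha : e a
    · simp [ha, ind_neg]
    · rw [ind_pos (s := fun a => ¬ e a) ha]
      simp [ha]
  · by_cases ha : e a
    · have h1 : ∀ c : X.Q, c ≠ X.mkq a →
          ind ((RV.ofF e).rel a) c.out * (if e c.out then 1 else N⁻¹) = 0 := by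
        intro c hcc
        rw [ind_neg, zero_mul]
        intro k
        apply hcc
        have k' : e a = e c.out := k
        rw [← X.mkq_out c, X.mkq_eq]
        exact ⟨h _ _ (k' ▸ ha) ha, k'.symm⟩
      rw [Finset.sum_eq_single (X.mkq a) (fun c _ => h1 c) (fun h => absurd (Finset.mem_univ _) h)]
      have h2 := ind_le_one ((RV.ofF e).rel a) (X.mkq a).out
      have h3 : e (X.mkq a).out = e a := (X.rel_out a).2
      rw [h3, if_pos ha, mul_one]
      exact h2
    · have h1 : ∀ c : X.Q, ind ((RV.ofF e).rel a) c.out * (if e c.out then 1 else N⁻¹)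
          = if e c.out = e a then N⁻¹ else 0 := by
        intro c
        by_cases k : e c.out = e a
        · rw [ind_pos (show (RV.ofF e).rel a c.out from k.symm), if_pos k, k, if_neg ha, one_mul]
        · rw [ind_neg, if_neg k, zero_mul]
          exact fun k' => k (Eq.symm k')
      rw [Finset.sum_congr rfl fun c _ => h1 c, ← Finset.sum_filter, Finset.sum_const,
        nsmul_eq_mul, ← div_eq_mul_inv]
      refine div_le_one_of_le₀ ?_ hc.le
      rw [hN]
      norm_cast
      rw [← Finset.card_univ]
      refine Finset.card_le_card_of_injOn (fun c => Ψ c.out) (fun _ _ => Finset.mem_univ _) ?_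
      intro c hcc c' hcc' k
      have q1 : e c.out = e a := by simpa using hcc
      have q2 : e c'.out = e a := by simpa using hcc'
      rw [← X.mkq_out c, ← X.mkq_out c', X.mkq_eq]
      exact ⟨k, q1.trans q2.symm⟩

end St

/-- bounded vector valued functions -/
def Bd {α ι : Type} (u : α → ι → ℝ) : Prop := ∃ C : ℝ, ∀ a i, |u a i| ≤ C

theorem Bd.finite {α ι : Type} [Finite ι] {u : α → ι → ℝ} (h : Bd u) :
    (Set.range fun a i => ⌊u a i⌋).Finite := by
  obtain ⟨C, hC⟩ := h
  refine (Set.Finite.pi' (ι := ι) (t := fun _ => Set.Icc ⌊-C⌋ ⌊C⌋) fun i => Set.finite_Icc _ _).subset ?_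
  rintro _ ⟨a, rfl⟩ i
  have := abs_le.1 (hC a i)
  exact ⟨Int.floor_le_floor this.1, Int.floor_le_floor this.2⟩

/-- floor partition -/
def fl {α ι : Type} [Finite ι] (u : α → ι → ℝ) (h : Bd u) : RV α :=
  RV.of (fun a i => ⌊u a i⌋) h.finite

theorem fl_rel {α ι : Type} [Finite ι] {u : α → ι → ℝ} {h : Bd u} {a b : α} :
    (fl u h).rel a b ↔ ∀ i, ⌊u a i⌋ = ⌊u b i⌋ := by
  unfold fl
  rw [RV.of_rel, funext_iff]

theorem fl_close {α ι : Type} [Finite ι] {u : α → ι → ℝ} {h : Bd u} {a b : α}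
    (k : (fl u h).rel a b) (i : ι) : |u a i - u b i| ≤ 1 := by
  have := fl_rel.1 k i
  have h1 := Int.floor_le (u a i)
  have h2 := Int.floor_le (u b i)
  have h3 := Int.lt_floor_add_one (u a i)
  have h4 := Int.lt_floor_add_one (u b i)
  rw [this] at h1 h3
  rw [abs_le]
  constructor <;> linarith

theorem floor_mod {x y : ℝ} {c : ℝ} {K : ℕ} (hK : c + 1 ≤ K) (h : |x - y| ≤ c)
    (hm : ((⌊x⌋ : ℤ) : ZMod (K + 1)) = (⌊y⌋ : ℤ)) : ⌊x⌋ = ⌊y⌋ := by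
  have h1 := Int.floor_le x
  have h2 := Int.floor_le y
  have h3 := Int.lt_floor_add_one x
  have h4 := Int.lt_floor_add_one y
  rw [abs_le] at h
  have hlt : |⌊y⌋ - ⌊x⌋| < ((K + 1 : ℕ) : ℤ) := by
    rw [abs_lt]
    constructor
    · have : (-((K:ℝ)+1)) < (⌊y⌋ : ℝ) - ⌊x⌋ := by linarith
      have h' : (((-((K:ℤ)+1)) : ℤ) : ℝ) < ((⌊y⌋ - ⌊x⌋ : ℤ) : ℝ) := by
        push_cast
        linarith
      have := Int.cast_lt.1 h'
      push_cast
      linarith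
    · have : (⌊y⌋ : ℝ) - ⌊x⌋ < ((K:ℝ)+1) := by linarith
      have h' : ((⌊y⌋ - ⌊x⌋ : ℤ) : ℝ) < ((((K:ℤ)+1) : ℤ) : ℝ) := by
        push_cast
        linarith
      have := Int.cast_lt.1 h'
      push_cast
      linarith
  rw [ZMod.intCast_eq_intCast_iff_dvd_sub] at hm
  have := Int.eq_zero_of_abs_lt_dvd hm hlt
  linarith

/-- floor lemma -/
theorem cH_fl_le {α ι : Type} [Fintype ι] (E : St α) (u : α → ι → ℝ) (h : Bd u) (Y : RV α)
    (c : ℝ) (K : ℕ) (hK : c + 1 ≤ K) (hY : ∀ a b, Y.rel a b → ∀ i, |u a i - u b i| ≤ c) :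
    E.cH (fl u h) Y ≤ Fintype.card ι * Real.log (K + 1) := by
  classical
  have := E.cH_le_card (fl u h) Y (fun a (i : ι) => ((⌊u a i⌋ : ℤ) : ZMod (K + 1))) ?_
  · refine this.trans (le_of_eq ?_)
    rw [Fintype.card_fun, ZMod.card]
    push_cast
    rw [Real.log_pow]
  · intro a b k kk
    rw [fl_rel]
    intro i
    exact floor_mod hK (hY a b k i) (congrFun kk i)

/-- constant of the floor lemma -/
def KK (c : ℝ) : ℝ := Real.log (⌈c + 1⌉₊ + 1)

theorem KK_nonneg (c : ℝ) : 0 ≤ KK c := by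
  refine Real.log_nonneg ?_
  have : (0:ℝ) ≤ ⌈c + 1⌉₊ := Nat.cast_nonneg _
  linarith

theorem cH_fl {α ι : Type} [Fintype ι] (E : St α) (u : α → ι → ℝ) (h : Bd u) (Y : RV α)
    (c : ℝ) (hY : ∀ a b, Y.rel a b → ∀ i, |u a i - u b i| ≤ c) :
    E.cH (fl u h) Y ≤ Fintype.card ι * KK c :=
  cH_fl_le E u h Y c _ (Nat.le_ceil _) hY

end FHR

namespace FHR
namespace St
variable {α β : Type}

theorem ext' {E E' : St α} (h : ∀ f, E.E f = E'.E f) : E = E' := by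
  cases E with
  | mk e p o =>
    cases E' with
    | mk e' p' o' =>
      have : e = e' := LinearMap.ext h
      subst this
      rfl

/-- mixture state -/
def mix {κ : Type} [Fintype κ] [Nonempty κ] (E : κ → St α) : St (α × κ) where
  E := (Fintype.card κ : ℝ)⁻¹ • ∑ s, (E s).E ∘ₗ
    { toFun := fun F a => F (a, s)
      map_add' := fun _ _ => rfl
      map_smul' := fun _ _ => rfl }
  pos := by
    rintro f ⟨C, hC⟩ h
    simp only [LinearMap.smul_apply, smul_eq_mul, LinearMap.coe_sum, Finset.sum_apply,
      LinearMap.comp_apply, LinearMap.coe_mk, AddHom.coe_mk]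
    refine mul_nonneg (by positivity) (Finset.sum_nonneg fun s _ => ?_)
    exact (E s).pos _ ⟨C, fun a => hC _⟩ fun a => h _
  one := by
    simp only [LinearMap.smul_apply, smul_eq_mul, LinearMap.coe_sum, Finset.sum_apply,
      LinearMap.comp_apply, LinearMap.coe_mk, AddHom.coe_mk]
    rw [Finset.sum_congr rfl fun s _ => (E s).one]
    simp

section mix
variable {κ : Type} [Fintype κ] [Nonempty κ] (E : κ → St α)

theorem mix_E (f : α × κ → ℝ) :
    (mix E).E f = (Fintype.card κ : ℝ)⁻¹ * ∑ s, (E s).E (fun a => f (a, s)) := by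
  simp only [mix, LinearMap.smul_apply, smul_eq_mul, LinearMap.coe_sum, Finset.sum_apply,
      LinearMap.comp_apply, LinearMap.coe_mk, AddHom.coe_mk]

/-- the label variable -/
def lab : RV (α × κ) := RV.ofF Prod.snd

theorem mix_pr (X : RV (α × κ)) (a : α) (s : κ) :
    (mix E).pr (X ⊔ lab) (a, s)
      = (Fintype.card κ : ℝ)⁻¹ * (E s).pr (X.comap fun a => (a, s)) a := by
  rw [pr, mix_E, Finset.sum_eq_single s]
  · congr 2
    funext b
    by_cases h : X.rel (a, s) (b, s)
    · rw [ind_pos (show (X ⊔ lab).rel (a, s) (b, s) from ⟨h, rfl⟩),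
        ind_pos (show (X.comap fun a => (a, s)).rel a b from h)]
    · rw [ind_neg (fun k : (X ⊔ lab).rel (a, s) (b, s) => h k.1),
        ind_neg (show ¬ (X.comap fun a => (a, s)).rel a b from h)]
  · intro t _ ht
    have : (fun b => ind ((X ⊔ lab).rel (a, s)) (b, t)) = fun _ => 0 := by
      funext b
      exact ind_neg (fun k : (X ⊔ lab).rel (a, s) (b, t) => ht k.2.symm)
    rw [this, (E t).const]
  · intro h
    exact absurd (Finset.mem_univ _) h

theorem mix_H (X : RV (α × κ)) : (mix E).H (X ⊔ lab) = Real.log (Fintype.card κ)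
    + (Fintype.card κ : ℝ)⁻¹ * ∑ s, (E s).H (X.comap fun a => (a, s)) := by
  have hc : (0:ℝ) < Fintype.card κ := by exact_mod_cast Fintype.card_pos
  rw [H, mix_E]
  have : ∀ s, (E s).E (fun a => - Real.log ((mix E).pr (X ⊔ lab) (a, s)))
      = Real.log (Fintype.card κ) + (E s).H (X.comap fun a => (a, s)) := by
    intro s
    have h1 := (E s).const (Real.log (Fintype.card κ))
    rw [← h1, H, ← (E s).add]
    simp only [mix_pr]
    have m : ∀ a b, (X.comap fun a => (a, s)).rel a b → (E s).pr (X.comap fun a => (a, s)) a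
      = (E s).pr (X.comap fun a => (a, s)) b := fun a b h => (E s).pr_congr h
    refine (E s).E_meas_congr (X.comap fun a => (a, s)) _ _ (fun a b h => by rw [m a b h])
      (fun a b h => by rw [m a b h]) fun a ha => ?_
    rw [Real.log_mul (inv_pos.2 hc).ne' ha.ne', Real.log_inv]
    ring
  rw [Finset.sum_congr rfl fun s _ => this s, Finset.sum_add_distrib, mul_add, Finset.sum_const,
    nsmul_eq_mul, Finset.card_univ]
  field_simp

theorem mix_H_lab : (mix E).H (lab : RV (α × κ)) = Real.log (Fintype.card κ) := by
  have := mix_H E ⊥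
  rw [bot_sup_eq] at this
  rw [this]
  have h : ∀ s, (E s).H ((⊥ : RV (α × κ)).comap fun a => (a, s)) = 0 := fun s => (E s).H_bot
  rw [Finset.sum_congr rfl fun s _ => h s]
  simp

theorem mix_cH (X Y : RV (α × κ)) : (mix E).cH X (Y ⊔ lab)
    = (Fintype.card κ : ℝ)⁻¹ *
      ∑ s, (E s).cH (X.comap fun a => (a, s)) (Y.comap fun a => (a, s)) := by
  unfold cH
  rw [← sup_assoc, mix_H, mix_H, Finset.sum_sub_distrib, mul_sub]
  simp only [RV.comap_sup]
  ring

theorem mix_cH_le {X Y : RV (α × κ)} {C : ℝ}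
    (h : ∀ s, (E s).cH (X.comap fun a => (a, s)) (Y.comap fun a => (a, s)) ≤ C) :
    (mix E).cH X (Y ⊔ lab) ≤ C := by
  have hc : (0:ℝ) < Fintype.card κ := by exact_mod_cast Fintype.card_pos
  rw [mix_cH]
  have := Finset.sum_le_sum fun s (_ : s ∈ Finset.univ) => h s
  rw [Finset.sum_const, nsmul_eq_mul, Finset.card_univ] at this
  rw [inv_mul_le_iff₀ hc]
  exact this

theorem le_mix_cH {X Y : RV (α × κ)} {C : ℝ}
    (h : ∀ s, C ≤ (E s).cH (X.comap fun a => (a, s)) (Y.comap fun a => (a, s))) :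
    C ≤ (mix E).cH X (Y ⊔ lab) := by
  have hc : (0:ℝ) < Fintype.card κ := by exact_mod_cast Fintype.card_pos
  rw [mix_cH]
  have := Finset.sum_le_sum fun s (_ : s ∈ Finset.univ) => h s
  rw [Finset.sum_const, nsmul_eq_mul, Finset.card_univ] at this
  rw [le_inv_mul_iff₀ hc]
  exact this

theorem mix_map (E : St α) (E' : St β) (φ : α × κ → β)
    (h : ∀ s, E.map (fun a => φ (a, s)) = E') : (mix fun _ : κ => E).map φ = E' := by
  have hc : (0:ℝ) < Fintype.card κ := by exact_mod_cast Fintype.card_pos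
  apply ext'
  intro f
  rw [map_E, mix_E]
  have : ∀ s, E.E (fun a => f (φ (a, s))) = E'.E f := by
    intro s
    rw [← h s]
    rfl
  rw [Finset.sum_congr rfl fun s _ => this s, Finset.sum_const, nsmul_eq_mul, Finset.card_univ]
  field_simp

end mix

/-- relatively independent self coupling -/
abbrev Cop (R : RV α) : Type := {p : α × α // R.rel p.1 p.2}

def Cop.fst {R : RV α} (p : Cop R) : α := p.1.1
def Cop.snd {R : RV α} (p : Cop R) : α := p.1.2

theorem Cop.rel {R : RV α} (p : Cop R) : R.rel p.fst p.snd := p.2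

open Classical in
def Cop.ext0 {R : RV α} (F : Cop R → ℝ) (x y : α) : ℝ :=
  if h : R.rel x y then F ⟨(x, y), h⟩ else 0

variable (E : St α) (R : RV α)

theorem E_zero_of_null (X : RV α) (s : α → Prop) (f : α → ℝ) (hs : E.E (ind s) = 0)
    (hf : ∃ C, ∀ a, |f a| ≤ C) : E.E (fun a => ind s a * f a) = 0 := by
  obtain ⟨C, hC⟩ := hf
  have hb : ∀ a, |ind s a * f a| ≤ ind s a * C := by
    intro a
    rw [abs_mul, abs_of_nonneg (ind_nonneg s a)]
    exact mul_le_mul_of_nonneg_left (hC a) (ind_nonneg s a)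
  have hC0 : ∀ a : α, 0 ≤ C := fun a => (abs_nonneg _).trans (hC a)
  have h1 : E.E (fun a => ind s a * f a) ≤ E.E (fun a => ind s a * C) := by
    refine E.mono ⟨2 * C, fun a => ?_⟩ fun a => (abs_le.1 (hb a)).2
    have := (abs_le.1 (hb a)).1
    have h2 := mul_le_mul_of_nonneg_right (ind_le_one s a) (hC0 a)
    linarith
  have h2 : E.E (fun a => - (ind s a * C)) ≤ E.E (fun a => ind s a * f a) := by
    refine E.mono ⟨2 * C, fun a => ?_⟩ fun a => (abs_le.1 (hb a)).1
    have := (abs_le.1 (hb a)).2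
    have h2 := mul_le_mul_of_nonneg_right (ind_le_one s a) (hC0 a)
    linarith
  rw [E.neg] at h2
  rw [E.smul', hs, zero_mul] at h1 h2
  linarith

theorem ext0_bound {F : Cop R → ℝ} {C : ℝ} (h0 : ∀ p, 0 ≤ F p) (hC : ∀ p, F p ≤ C) (x : α) :
    0 ≤ E.E (Cop.ext0 F x) ∧ E.E (Cop.ext0 F x) ≤ E.pr R x * C := by
  have h1 : ∀ y, 0 ≤ Cop.ext0 F x y := by
    intro y
    unfold Cop.ext0
    split_ifs
    · exact h0 _
    · exact le_rfl
  have h2 : ∀ y, Cop.ext0 F x y ≤ ind (R.rel x) y * C := by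
    intro y
    unfold Cop.ext0
    split_ifs with h
    · rw [ind_pos h, one_mul]
      exact hC _
    · rw [ind_neg h, zero_mul]
  have h3 : 0 ≤ C := (h0 ⟨(x, x), R.refl x⟩).trans (hC _)
  have h4 : ∀ y, ind (R.rel x) y * C ≤ C := by
    intro y
    have := mul_le_mul_of_nonneg_right (ind_le_one (R.rel x) y) h3
    linarith
  constructor
  · exact E.pos _ ⟨C, fun y => (h2 y).trans (h4 y)⟩ h1
  · rw [pr, ← E.smul']
    refine E.mono ⟨C, fun y => ?_⟩ h2
    linarith [h1 y, h4 y]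

theorem cop_one : E.E (fun x => (E.pr R x)⁻¹ * E.E (Cop.ext0 (R := R) (fun _ => 1) x)) = 1 := by
  have h1 : ∀ x, Cop.ext0 (R := R) (fun _ => (1:ℝ)) x = ind (R.rel x) := by
    intro x
    funext y
    unfold Cop.ext0
    split_ifs with h
    · rw [ind_pos h]
    · rw [ind_neg h]
  simp only [h1]
  rw [← E.const 1]
  have m : ∀ a b, R.rel a b → E.pr R a = E.pr R b := fun a b h => E.pr_congr h
  refine E.E_meas_congr R _ _ (fun a b h => ?_) (fun _ _ _ => rfl) fun a ha => ?_
  · change (E.pr R a)⁻¹ * E.pr R a = (E.pr R b)⁻¹ * E.pr R b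
    rw [m a b h]
  · change (E.pr R a)⁻¹ * E.pr R a = 1
    rw [inv_mul_cancel₀ ha.ne']

def cop : St (Cop R) where
  E :=
    { toFun := fun F => E.E (fun x => (E.pr R x)⁻¹ * E.E (Cop.ext0 F x))
      map_add' := by
        intro F G
        rw [← E.add]
        congr 1
        funext x
        rw [← mul_add, ← E.add]
        congr 2
        funext y
        unfold Cop.ext0
        split_ifs <;> simp
      map_smul' := by
        intro c F
        rw [RingHom.id_apply, smul_eq_mul, ← E.smul]
        congr 1
        funext x
        rw [mul_left_comm, ← E.smul c]
        congr 2
        funext y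
        unfold Cop.ext0
        split_ifs <;> simp }
  pos := by
    rintro F ⟨C, hC⟩ h
    refine E.pos _ ⟨C, fun x => ?_⟩ fun x => ?_
    · have h1 := E.ext0_bound R h hC x
      have h3 : 0 ≤ C := (h ⟨(x, x), R.refl x⟩).trans (hC _)
      rcases (E.pr_nonneg R x).eq_or_lt with h0 | h0
      · rw [← h0]
        simpa using h3
      · rw [inv_mul_le_iff₀ h0]
        exact h1.2
    · exact mul_nonneg (inv_nonneg.2 (E.pr_nonneg _ _)) (E.ext0_bound R h hC x).1
  one := E.cop_one R

theorem cop_E (F : Cop R → ℝ) :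
    (E.cop R).E F = E.E (fun x => (E.pr R x)⁻¹ * E.E (Cop.ext0 F x)) := rfl

theorem ext0_eq (f : α → α → ℝ) (x : α) :
    Cop.ext0 (R := R) (fun p => f p.fst p.snd) x = fun y => ind (R.rel x) y * f x y := by
  funext y
  unfold Cop.ext0
  split_ifs with h
  · rw [ind_pos h, one_mul]
    rfl
  · rw [ind_neg h, zero_mul]

theorem cop_fst (X : RV α) (f : α → ℝ) (hf : ∀ a b, X.rel a b → f a = f b) :
    (E.cop R).E (fun p => f p.fst) = E.E f := by
  rw [cop_E]
  simp only [ext0_eq R (fun x _ => f x), E.smul']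
  have m : ∀ a b, R.rel a b → E.pr R a = E.pr R b := fun a b h => E.pr_congr h
  refine E.E_meas_congr (X ⊔ R) _ _ (fun a b h => ?_) (fun a b h => hf a b h.1) fun a ha => ?_
  · change (E.pr R a)⁻¹ * (E.pr R a * f a) = (E.pr R b)⁻¹ * (E.pr R b * f b)
    rw [m a b h.2, hf a b h.1]
  · change (E.pr R a)⁻¹ * (E.pr R a * f a) = f a
    rw [inv_mul_cancel_left₀ (ha.trans_le (E.pr_anti le_sup_right a)).ne']

theorem meas_bdd (X : RV α) (f : α → ℝ) (hf : ∀ a b, X.rel a b → f a = f b) :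
    ∃ C, ∀ a, |f a| ≤ C := by
  refine ⟨∑ c : X.Q, |f c.out|, fun a => ?_⟩
  rw [← hf _ _ (X.rel_out a)]
  exact Finset.single_le_sum (f := fun c : X.Q => |f c.out|) (fun _ _ => abs_nonneg _)
    (Finset.mem_univ (X.mkq a))

theorem cop_snd (X : RV α) (f : α → ℝ) (hf : ∀ a b, X.rel a b → f a = f b) :
    (E.cop R).E (fun p => f p.snd) = E.E f := by
  rw [cop_E]
  simp only [ext0_eq R (fun _ y => f y)]
  have hR : ∀ a b, R.rel a b → R.rel a = R.rel b := by
    intro a b h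
    funext c
    exact propext ⟨fun k => R.trans (R.symm h) k, fun k => R.trans h k⟩
  rw [E.E_meas R _ (fun a b h => by rw [E.pr_congr h, hR a b h])]
  have h1 : ∀ c : R.Q, (E.pr R c.out)⁻¹ * E.E (fun y => ind (R.rel c.out) y * f y) * E.pr R c.out
      = E.E (fun y => ind (R.rel c.out) y * f y) := by
    intro c
    rcases (E.pr_nonneg R c.out).eq_or_lt with h0 | h0
    · rw [E.E_zero_of_null X _ f h0.symm (meas_bdd X f hf)]
      simp
    · field_simp
  rw [Finset.sum_congr rfl fun c _ => h1 c, ← E.sum]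
  congr 1
  funext a
  rw [← Finset.sum_mul, Finset.sum_eq_single (R.mkq a)]
  · rw [ind_pos (R.rel_out a), one_mul]
  · intro c _ hc
    rw [ind_neg]
    intro h
    apply hc
    rw [← R.mkq_out c, R.mkq_eq]
    exact h
  · intro h
    exact absurd (Finset.mem_univ _) h

theorem ind_meas (X : RV α) (a : α) : ∀ b c, X.rel b c → ind (X.rel a) b = ind (X.rel a) c := by
  intro b c hbc
  by_cases hb : X.rel a b
  · rw [ind_pos hb, ind_pos (X.trans hb hbc)]
  · rw [ind_neg hb, ind_neg]
    exact fun hc => hb (X.trans hc (X.symm hbc))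

theorem cop_pr_fst (X : RV α) (p : Cop R) : (E.cop R).pr (X.comap Cop.fst) p = E.pr X p.fst :=
  E.cop_fst R X (ind (X.rel p.fst)) (ind_meas X _)

theorem cop_pr_snd (X : RV α) (p : Cop R) : (E.cop R).pr (X.comap Cop.snd) p = E.pr X p.snd :=
  E.cop_snd R X (ind (X.rel p.snd)) (ind_meas X _)

theorem cop_H_fst (X : RV α) : (E.cop R).H (X.comap Cop.fst) = E.H X := by
  unfold H
  simp only [cop_pr_fst]
  exact E.cop_fst R X (fun a => - Real.log (E.pr X a)) (fun a b h => by rw [E.pr_congr h])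

theorem cop_H_snd (X : RV α) : (E.cop R).H (X.comap Cop.snd) = E.H X := by
  unfold H
  simp only [cop_pr_snd]
  exact E.cop_snd R X (fun a => - Real.log (E.pr X a)) (fun a b h => by rw [E.pr_congr h])

theorem cop_cH_fst (X Y : RV α) :
    (E.cop R).cH (X.comap Cop.fst) (Y.comap Cop.fst) = E.cH X Y := by
  unfold cH
  rw [← RV.comap_sup, cop_H_fst, cop_H_fst]

theorem cop_cH_snd (X Y : RV α) :
    (E.cop R).cH (X.comap Cop.snd) (Y.comap Cop.snd) = E.cH X Y := by
  unfold cH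
  rw [← RV.comap_sup, cop_H_snd, cop_H_snd]

theorem cop_comap {X : RV α} (h : X ≤ R) :
    X.comap (Cop.fst : Cop R → α) = X.comap (Cop.snd : Cop R → α) := by
  apply RV.ext'
  intro p p'
  have h1 := h _ _ p.rel
  have h2 := h _ _ p'.rel
  exact ⟨fun k => X.trans (X.trans (X.symm h1) k) h2, fun k => X.trans (X.trans h1 k) (X.symm h2)⟩

theorem cop_pr (X Y : RV α) (hX : R ≤ X) (p : Cop R) :
    (E.cop R).pr (X.comap Cop.fst ⊔ Y.comap Cop.snd) p
      = E.pr X p.fst * ((E.pr R p.fst)⁻¹ * E.pr (Y ⊔ R) p.snd) := by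
  have h1 : ind ((X.comap Cop.fst ⊔ Y.comap Cop.snd : RV (Cop R)).rel p)
      = fun p' => ind (X.rel p.fst) p'.fst * ind (Y.rel p.snd) p'.snd := by
    funext p'
    by_cases hx : X.rel p.fst p'.fst
    · by_cases hy : Y.rel p.snd p'.snd
      · rw [ind_pos hx, ind_pos hy, ind_pos, mul_one]
        exact ⟨hx, hy⟩
      · rw [ind_neg hy, mul_zero, ind_neg]
        exact fun h => hy h.2
    · rw [ind_neg hx, zero_mul, ind_neg]
      exact fun h => hx h.1
  rw [pr, h1, cop_E]
  simp only [ext0_eq R (fun x y => ind (X.rel p.fst) x * ind (Y.rel p.snd) y)]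
  rw [show E.pr X p.fst = E.E (ind (X.rel p.fst)) from rfl, ← E.smul']
  congr 1
  funext x
  by_cases hx : X.rel p.fst x
  · rw [ind_pos hx, one_mul]
    have hr : R.rel p.fst x := hX _ _ hx
    rw [← E.pr_congr hr]
    congr 1
    rw [pr]
    congr 1
    funext y
    have hr2 : R.rel p.snd x := R.trans (R.symm p.rel) hr
    rw [one_mul]
    by_cases hy : Y.rel p.snd y
    · by_cases hry : R.rel x y
      · rw [ind_pos hy, ind_pos hry, ind_pos, mul_one]
        exact ⟨hy, R.trans hr2 hry⟩
      · rw [ind_neg hry, zero_mul, ind_neg]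
        exact fun h => hry (R.trans (R.symm hr2) h.2)
    · rw [ind_neg hy, mul_zero, ind_neg]
      exact fun h => hy h.1
  · rw [ind_neg hx, zero_mul]
    simp only [zero_mul, mul_zero]
    rw [E.const, mul_zero]

/-- relative independence -/
theorem cop_H (X Y : RV α) (hX : R ≤ X) :
    (E.cop R).H (X.comap Cop.fst ⊔ Y.comap Cop.snd) = E.H X + E.cH Y R := by
  have hR2 : (R.comap Cop.snd : RV (Cop R)) = R.comap Cop.fst := (cop_comap R le_rfl).symm
  have m1 : ∀ p p' : Cop R, (X.comap Cop.fst ⊔ Y.comap Cop.snd : RV (Cop R)).rel p p' →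
      E.pr X p.fst = E.pr X p'.fst := fun p p' h => E.pr_congr h.1
  have m2 : ∀ p p' : Cop R, (X.comap Cop.fst ⊔ Y.comap Cop.snd : RV (Cop R)).rel p p' →
      E.pr R p.fst = E.pr R p'.fst := fun p p' h => E.pr_congr (hX _ _ h.1)
  have m3 : ∀ p p' : Cop R, (X.comap Cop.fst ⊔ Y.comap Cop.snd : RV (Cop R)).rel p p' →
      E.pr (Y ⊔ R) p.snd = E.pr (Y ⊔ R) p'.snd := fun p p' h => E.pr_congr (X := Y ⊔ R) ⟨h.2, by
        have : (R.comap Cop.snd : RV (Cop R)).rel p p' := by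
          rw [hR2]
          exact hX _ _ h.1
        exact this⟩
  have h1 : (E.cop R).H (X.comap Cop.fst ⊔ Y.comap Cop.snd)
      = (E.cop R).E (fun p => (- Real.log (E.pr X p.fst) - - Real.log (E.pr R p.fst))
        + - Real.log (E.pr (Y ⊔ R) p.snd)) := by
    refine (E.cop R).E_meas_congr (X.comap Cop.fst ⊔ Y.comap Cop.snd) _ _
      (fun a b h => by rw [pr_congr _ h]) (fun a b h => by rw [m1 a b h, m2 a b h, m3 a b h])
      fun p hp => ?_
    rw [cop_pr E R X Y hX] at hp ⊢
    have n1 : E.pr X p.fst ≠ 0 := fun h => by simp [h] at hp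
    have n2 : E.pr R p.fst ≠ 0 := fun h => by simp [h] at hp
    have n3 : E.pr (Y ⊔ R) p.snd ≠ 0 := fun h => by simp [h] at hp
    rw [Real.log_mul n1 (mul_ne_zero (inv_ne_zero n2) n3), Real.log_mul (inv_ne_zero n2) n3,
      Real.log_inv]
    ring
  rw [h1, add, sub]
  rw [E.cop_fst R X (fun a => - Real.log (E.pr X a)) (fun a b h => by rw [E.pr_congr h]),
    E.cop_fst R R (fun a => - Real.log (E.pr R a)) (fun a b h => by rw [E.pr_congr h]),
    E.cop_snd R (Y ⊔ R) (fun a => - Real.log (E.pr (Y ⊔ R) a)) (fun a b h => by rw [E.pr_congr h])]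
  unfold cH H
  ring

theorem cop_cH (X Y : RV α) (hX : R ≤ X) :
    (E.cop R).cH (Y.comap Cop.snd) (X.comap Cop.fst) = E.cH Y R := by
  rw [cH, sup_comm, cop_H E R X Y hX, cop_H_fst]
  ring

/-- agreement on bounded functions -/
def Ag (E E' : St α) : Prop := ∀ f : α → ℝ, (∃ C, ∀ a, |f a| ≤ C) → E.E f = E'.E f

theorem Ag.pr {E E' : St α} (h : Ag E E') (X : RV α) (a : α) : E.pr X a = E'.pr X a :=
  h _ ⟨1, fun b => by
    rw [abs_of_nonneg (ind_nonneg _ _)]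
    exact ind_le_one _ _⟩

theorem Ag.H {E E' : St α} (h : Ag E E') (X : RV α) : E.H X = E'.H X := by
  unfold St.H
  rw [h _ (meas_bdd X _ fun a b hab => by rw [E.pr_congr hab])]
  simp only [h.pr]

theorem Ag.cH {E E' : St α} (h : Ag E E') (X Y : RV α) : E.cH X Y = E'.cH X Y := by
  unfold St.cH
  rw [h.H, h.H]

theorem mix_ag {κ : Type} [Fintype κ] [Nonempty κ] (E : St α) (E' : St β) (φ : α × κ → β)
    (h : ∀ s, Ag (E.map (fun a => φ (a, s))) E') : Ag ((mix fun _ : κ => E).map φ) E' := by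
  have hc : (0:ℝ) < Fintype.card κ := by exact_mod_cast Fintype.card_pos
  intro f hf
  rw [map_E, mix_E]
  have : ∀ s, E.E (fun a => f (φ (a, s))) = E'.E f := fun s => h s f hf
  rw [Finset.sum_congr rfl fun s _ => this s, Finset.sum_const, nsmul_eq_mul, Finset.card_univ,
    inv_mul_cancel_left₀ hc.ne']

end St
end FHR

namespace FHR

theorem Bd.of_norm {α ι : Type} [Fintype ι] {u : α → ι → ℝ} {C : ℝ} (h : ∀ a, ‖u a‖ ≤ C) : Bd u :=
  ⟨C, fun a i => (norm_le_pi_norm (u a) i).trans (h a)⟩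

theorem cH_fln {α ι : Type} [Fintype ι] (E : St α) {u : α → ι → ℝ} {h : Bd u} {Y : RV α}
    {c : ℝ} (hY : ∀ a b, Y.rel a b → ‖u a - u b‖ ≤ c) :
    E.cH (fl u h) Y ≤ Fintype.card ι * KK c :=
  cH_fl E u h Y c fun a b k i => (norm_le_pi_norm (u a - u b) i).trans (hY a b k)

theorem fl_closen {α ι : Type} [Fintype ι] {u : α → ι → ℝ} {h : Bd u} {a b : α}
    (k : (fl u h).rel a b) : ‖u a - u b‖ ≤ 1 :=
  (pi_norm_le_iff_of_nonneg zero_le_one).2 fun i => fl_close k i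

/-- the dynamical system -/
structure Sys (d : ℕ) where
  p : Fin d → ℕ
  hp : ∀ j, 2 ≤ p j
  A : Fin d → Set ℝ
  hA : ∀ j, ∀ t ∈ A j, 0 ≤ t ∧ t < 1
  inv : ∀ j, ∀ t ∈ A j, Int.fract ((p j : ℝ) * t) ∈ A j

namespace Sys
variable {d : ℕ} (S : Sys d)

abbrev Om : Type := {x : Fin d → ℝ // ∀ j, x j ∈ S.A j} × ℕ

def sh (m : ℕ) (ω : S.Om) : S.Om := (ω.1, ω.2 + m)

theorem sh_sh (m n : ℕ) (ω : S.Om) : S.sh m (S.sh n ω) = S.sh (n + m) ω := by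
  simp [sh, add_assoc]

theorem sh_zero (ω : S.Om) : S.sh 0 ω = ω := rfl

def M : ℝ := 1 + ∑ j, (S.p j : ℝ)

theorem p_le_M (j : Fin d) : (S.p j : ℝ) ≤ S.M := by
  have := Finset.single_le_sum (f := fun j => (S.p j : ℝ)) (fun _ _ => Nat.cast_nonneg _)
    (Finset.mem_univ j)
  unfold M
  linarith

theorem one_le_M : 1 ≤ S.M := by
  have : 0 ≤ ∑ j, (S.p j : ℝ) := Finset.sum_nonneg fun _ _ => Nat.cast_nonneg _
  unfold M
  linarith

theorem M_pos : 0 < S.M := zero_lt_one.trans_le S.one_le_M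

theorem two_le_p (j : Fin d) : (2:ℝ) ≤ S.p j := by exact_mod_cast S.hp j
theorem p_pos (j : Fin d) : (0:ℝ) < S.p j := by linarith [S.two_le_p j]

def nn (i : ℕ) (j : Fin d) : ℕ := Nat.log (S.p j) (2 ^ i)

theorem nn_mono {i i' : ℕ} (h : i ≤ i') (j : Fin d) : S.nn i j ≤ S.nn i' j :=
  Nat.log_mono_right (Nat.pow_le_pow_right (by norm_num) h)

theorem nn_zero (j : Fin d) : S.nn 0 j = 0 := by
  simp [nn]

def lam (ω : S.Om) : Fin d → ℝ := fun j => 2 ^ ω.2 / (S.p j : ℝ) ^ (S.nn ω.2 j)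

def y (ω : S.Om) : Fin d → ℝ := fun j => Int.fract ((S.p j : ℝ) ^ (S.nn ω.2 j) * ω.1.1 j)

def q (ω : S.Om) : Fin d → ℝ := S.lam ω * S.y ω

theorem lam_ge (ω : S.Om) (j : Fin d) : 1 ≤ S.lam ω j := by
  unfold lam
  have hp := S.p_pos j
  rw [le_div_iff₀ (by positivity), one_mul]
  exact_mod_cast Nat.pow_log_le_self (S.p j) (by positivity)

theorem lam_lt (ω : S.Om) (j : Fin d) : S.lam ω j < S.p j := by
  unfold lam
  have hp := S.p_pos j
  rw [div_lt_iff₀ (by positivity), ← pow_succ']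
  exact_mod_cast Nat.lt_pow_succ_log_self (b := S.p j) (by linarith [S.hp j]) (2 ^ ω.2)

theorem lam_le_M (ω : S.Om) (j : Fin d) : S.lam ω j ≤ S.M := (S.lam_lt ω j).le.trans (S.p_le_M j)

theorem lam_norm (ω : S.Om) : ‖S.lam ω‖ ≤ S.M := by
  refine (pi_norm_le_iff_of_nonneg S.M_pos.le).2 fun j => ?_
  rw [Real.norm_eq_abs, abs_of_nonneg (zero_le_one.trans (S.lam_ge ω j))]
  exact S.lam_le_M ω j

theorem y_nonneg (ω : S.Om) (j : Fin d) : 0 ≤ S.y ω j := Int.fract_nonneg _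
theorem y_lt (ω : S.Om) (j : Fin d) : S.y ω j < 1 := Int.fract_lt_one _

theorem y_norm (ω : S.Om) : ‖S.y ω‖ ≤ 1 := by
  refine (pi_norm_le_iff_of_nonneg zero_le_one).2 fun j => ?_
  rw [Real.norm_eq_abs, abs_of_nonneg (S.y_nonneg ω j)]
  exact (S.y_lt ω j).le

theorem q_norm (ω : S.Om) : ‖S.q ω‖ ≤ S.M := by
  refine (norm_mul_le _ _).trans ?_
  calc _ ≤ S.M * 1 := mul_le_mul (S.lam_norm ω) (S.y_norm ω) (norm_nonneg _) S.M_pos.le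
    _ = _ := mul_one _

theorem fract_mul_nat (k : ℕ) (t : ℝ) : Int.fract ((k : ℝ) * Int.fract t) = Int.fract (k * t) := by
  rw [Int.fract.eq_1 t, mul_sub, ← Int.cast_natCast k, ← Int.cast_mul, Int.fract_sub_intCast]

theorem fract_pow_mem (j : Fin d) (t : ℝ) (ht : t ∈ S.A j) (n : ℕ) :
    Int.fract ((S.p j : ℝ) ^ n * t) ∈ S.A j := by
  induction n with
  | zero =>
    have := S.hA j t ht
    rw [pow_zero, one_mul, Int.fract_eq_self.2 ⟨this.1, this.2⟩]
    exact ht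
  | succ n ih =>
    have := S.inv j _ ih
    rw [fract_mul_nat, ← mul_assoc, ← pow_succ'] at this
    exact this

theorem y_mem (ω : S.Om) (j : Fin d) : S.y ω j ∈ S.A j := S.fract_pow_mem j _ (ω.1.2 j) _

/-- exponent increments -/
def N (n : ℕ) (ω : S.Om) (j : Fin d) : ℕ := S.nn (ω.2 + n) j - S.nn ω.2 j

theorem nn_add (n : ℕ) (ω : S.Om) (j : Fin d) : S.nn (ω.2 + n) j = S.nn ω.2 j + S.N n ω j := by
  unfold N
  have := S.nn_mono (Nat.le_add_right ω.2 n) j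
  omega

theorem N_add (n m : ℕ) (ω : S.Om) (j : Fin d) :
    S.N (n + m) ω j = S.N n ω j + S.N m (S.sh n ω) j := by
  have h1 := S.nn_add n ω j
  have h2 := S.nn_add (n + m) ω j
  have h3 := S.nn_add m (S.sh n ω) j
  simp only [sh] at h3
  rw [← add_assoc] at h2
  have h4 : S.N m (S.sh n ω) j = S.N m (ω.1, ω.2 + n) j := rfl
  omega

theorem N_mono {n m : ℕ} (h : n ≤ m) (ω : S.Om) (j : Fin d) : S.N n ω j ≤ S.N m ω j := by
  obtain ⟨k, rfl⟩ := Nat.exists_eq_add_of_le h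
  rw [N_add]
  omega

theorem lam_sh (n : ℕ) (ω : S.Om) (j : Fin d) :
    S.lam (S.sh n ω) j = 2 ^ n / (S.p j : ℝ) ^ (S.N n ω j) * S.lam ω j := by
  have hp := S.p_pos j
  unfold lam
  simp only [sh]
  rw [S.nn_add, pow_add, pow_add]
  field_simp

theorem y_sh (n : ℕ) (ω : S.Om) (j : Fin d) :
    S.y (S.sh n ω) j = Int.fract ((S.p j : ℝ) ^ (S.N n ω j) * S.y ω j) := by
  unfold y
  simp only [sh]
  rw [S.nn_add, ← Nat.cast_pow (S.p j) (S.N n ω j), fract_mul_nat, ← mul_assoc]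
  congr 2
  push_cast
  rw [← pow_add, add_comm]

theorem ratio_le (n : ℕ) (ω : S.Om) (j : Fin d) : 2 ^ n / (S.p j : ℝ) ^ (S.N n ω j) ≤ S.M := by
  have h1 := S.lam_le_M (S.sh n ω) j
  rw [lam_sh] at h1
  have h2 := S.lam_ge ω j
  have hp := S.p_pos j
  have h3 : 0 ≤ 2 ^ n / (S.p j : ℝ) ^ (S.N n ω j) := by positivity
  nlinarith

theorem ratio_pos (n : ℕ) (ω : S.Om) (j : Fin d) : 0 < 2 ^ n / (S.p j : ℝ) ^ (S.N n ω j) := by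
  have hp := S.p_pos j
  positivity

theorem ratio_inv_le (n : ℕ) (ω : S.Om) (j : Fin d) : (S.p j : ℝ) ^ (S.N n ω j) / 2 ^ n ≤ S.M := by
  have h1 := S.lam_ge (S.sh n ω) j
  rw [lam_sh] at h1
  have h2 := S.lam_le_M ω j
  have hp := S.p_pos j
  rw [div_le_iff₀ (by positivity)]
  rw [div_mul_eq_mul_div, le_div_iff₀ (by positivity), one_mul] at h1
  refine h1.trans ?_
  rw [mul_comm]
  exact mul_le_mul_of_nonneg_right h2 (by positivity)

/-- leading digits -/
def rho (n : ℕ) (ω : S.Om) : Fin d → ℝ := fun j =>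
  (⌊(S.p j : ℝ) ^ (S.N n ω j) * S.y ω j⌋ : ℝ) / (S.p j : ℝ) ^ (S.N n ω j)

theorem y_sub_rho (n : ℕ) (ω : S.Om) (j : Fin d) :
    S.y ω j - S.rho n ω j = S.y (S.sh n ω) j / (S.p j : ℝ) ^ (S.N n ω j) := by
  have hp := S.p_pos j
  rw [y_sh, rho, Int.fract]
  field_simp

theorem rho_nonneg (n : ℕ) (ω : S.Om) (j : Fin d) : 0 ≤ S.rho n ω j := by
  have hp := S.p_pos j
  have hy := S.y_nonneg ω j
  unfold rho
  have : (0:ℤ) ≤ ⌊(S.p j : ℝ) ^ (S.N n ω j) * S.y ω j⌋ := Int.floor_nonneg.2 (by positivity)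
  have : (0:ℝ) ≤ ⌊(S.p j : ℝ) ^ (S.N n ω j) * S.y ω j⌋ := by exact_mod_cast this
  positivity

theorem rho_norm (n : ℕ) (ω : S.Om) : ‖S.rho n ω‖ ≤ 1 := by
  refine (pi_norm_le_iff_of_nonneg zero_le_one).2 fun j => ?_
  rw [Real.norm_eq_abs, abs_of_nonneg (S.rho_nonneg n ω j)]
  have h1 := S.y_sub_rho n ω j
  have h2 := S.y_lt ω j
  have hp := S.p_pos j
  have h3 : 0 ≤ S.y (S.sh n ω) j / (S.p j : ℝ) ^ (S.N n ω j) :=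
    div_nonneg (S.y_nonneg _ j) (by positivity)
  linarith

/-- `q ∘ σ^n = 2^n (q - lam ρ)` -/
theorem q_sh (n : ℕ) (ω : S.Om) :
    S.q (S.sh n ω) = (2:ℝ) ^ n • (S.q ω - S.lam ω * S.rho n ω) := by
  funext j
  have hp := S.p_pos j
  have h1 := S.y_sub_rho n ω j
  have h2 := S.lam_sh n ω j
  simp only [q, Pi.mul_apply, Pi.smul_apply, Pi.sub_apply, smul_eq_mul]
  rw [← mul_sub, h1, h2]
  field_simp

/-- cell code -/
def cd (n : ℕ) (ω : S.Om) (j : Fin d) : ℕ × ℤ :=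
  (S.N n ω j, ⌊(S.p j : ℝ) ^ (S.N n ω j) * S.y ω j⌋)

theorem N_le (n : ℕ) (ω : S.Om) (j : Fin d) : S.N n ω j ≤ S.p j * 2 ^ n := by
  have h1 := S.lam_ge (S.sh n ω) j
  rw [lam_sh] at h1
  have h2 := S.lam_lt ω j
  have hp := S.p_pos j
  rw [div_mul_eq_mul_div, le_div_iff₀ (by positivity), one_mul] at h1
  have h3 : ((S.p j : ℝ) ^ (S.N n ω j)) ≤ S.p j * 2 ^ n := by
    refine h1.trans ?_
    rw [mul_comm]
    exact mul_le_mul_of_nonneg_right h2.le (by positivity)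
  have h4 : S.p j ^ (S.N n ω j) ≤ S.p j * 2 ^ n := by exact_mod_cast h3
  exact (Nat.lt_pow_self (by linarith [S.hp j])).le.trans h4

theorem cd_finite (n : ℕ) : (Set.range fun ω (t : Fin (n + 1)) j => S.cd t ω j).Finite := by
  refine (Set.Finite.pi' (t := fun _ => {f : Fin d → ℕ × ℤ | ∀ j, f j ∈
    Set.Icc 0 (S.p j * 2 ^ n) ×ˢ Set.Icc (0:ℤ) ((S.p j : ℤ) ^ (S.p j * 2 ^ n))}) fun t => ?_).subset ?_
  · exact Set.Finite.pi' fun j => (Set.finite_Icc _ _).prod (Set.finite_Icc _ _)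
  · rintro _ ⟨ω, rfl⟩ t j
    have hp := S.p_pos j
    have hy := S.y_nonneg ω j
    have hN : S.N t ω j ≤ S.p j * 2 ^ n := (S.N_le t ω j).trans
      (Nat.mul_le_mul_left _ (Nat.pow_le_pow_right (by norm_num) (Nat.lt_succ_iff.1 t.2)))
    refine ⟨⟨Nat.zero_le _, hN⟩, Int.floor_nonneg.2 (by positivity), ?_⟩
    refine Int.floor_le_iff.2 ?_
    push_cast
    have h1 : (S.p j : ℝ) ^ (S.N t ω j) ≤ (S.p j : ℝ) ^ (S.p j * 2 ^ n) :=
      pow_le_pow_right₀ (by linarith [S.two_le_p j]) hN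
    have h2 : (S.p j : ℝ) ^ (S.N t ω j) * S.y ω j ≤ (S.p j : ℝ) ^ (S.N t ω j) * 1 :=
      mul_le_mul_of_nonneg_left (S.y_lt ω j).le (by positivity)
    linarith

/-- words of length `n` -/
def Wv (n : ℕ) : RV S.Om := RV.of (fun ω (t : Fin (n + 1)) j => S.cd t ω j) (S.cd_finite n)

theorem Wv_rel {n : ℕ} {a b : S.Om} :
    (S.Wv n).rel a b ↔ ∀ t, t ≤ n → ∀ j, S.cd t a j = S.cd t b j := by
  unfold Wv
  rw [RV.of_rel]
  constructor
  · intro h t ht j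
    exact congrFun (congrFun h ⟨t, Nat.lt_succ_of_le ht⟩) j
  · intro h
    funext t j
    exact h t (Nat.lt_succ_iff.1 t.2) j

theorem Wv_mono {n m : ℕ} (h : n ≤ m) : S.Wv n ≤ S.Wv m := by
  intro a b k
  rw [Wv_rel] at k ⊢
  exact fun t ht => k t (ht.trans h)

theorem floor_pow_add (k l p : ℕ) (y : ℝ) :
    ⌊(p : ℝ) ^ (k + l) * y⌋ = (p : ℤ) ^ l * ⌊(p : ℝ) ^ k * y⌋
      + ⌊(p : ℝ) ^ l * Int.fract ((p : ℝ) ^ k * y)⌋ := by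
  have : (p : ℝ) ^ (k + l) * y = (((p : ℤ) ^ l * ⌊(p : ℝ) ^ k * y⌋ : ℤ) : ℝ)
      + (p : ℝ) ^ l * Int.fract ((p : ℝ) ^ k * y) := by
    rw [Int.fract]
    push_cast
    ring
  rw [this, Int.floor_intCast_add]

theorem cd_add (n m : ℕ) (ω : S.Om) (j : Fin d) : S.cd (n + m) ω j =
    ((S.cd n ω j).1 + (S.cd m (S.sh n ω) j).1,
      (S.p j : ℤ) ^ (S.cd m (S.sh n ω) j).1 * (S.cd n ω j).2 + (S.cd m (S.sh n ω) j).2) := by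
  unfold cd
  rw [S.N_add, floor_pow_add, S.y_sh]

theorem cd_snd_lt (n : ℕ) (ω : S.Om) (j : Fin d) :
    0 ≤ (S.cd n ω j).2 ∧ (S.cd n ω j).2 < (S.p j : ℤ) ^ (S.cd n ω j).1 := by
  have hp := S.p_pos j
  have hy := S.y_nonneg ω j
  refine ⟨Int.floor_nonneg.2 (by positivity), Int.floor_lt.2 ?_⟩
  simp only [cd]
  push_cast
  have h2 : (S.p j : ℝ) ^ (S.N n ω j) * S.y ω j < (S.p j : ℝ) ^ (S.N n ω j) * 1 :=
    mul_lt_mul_of_pos_left (S.y_lt ω j) (by positivity)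
  linarith

/-- the word factors: `W_{n+m} = W_n ⊔ W_m ∘ σ^n` -/
theorem Wv_add (n m : ℕ) : S.Wv (n + m) = S.Wv n ⊔ (S.Wv m).comap (S.sh n) := by
  apply RV.ext'
  intro a b
  rw [RV.sup_rel, RV.comap_rel, Wv_rel, Wv_rel, Wv_rel]
  constructor
  · intro h
    refine ⟨fun t ht => h t (by omega), fun t ht j => ?_⟩
    have h1 := h (n + t) (by omega) j
    have h2 := h n (by omega) j
    rw [S.cd_add, S.cd_add, h2] at h1
    have h3 := congrArg Prod.fst h1
    have h4 := congrArg Prod.snd h1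
    simp only at h3 h4
    have h5 : (S.cd t (S.sh n a) j).1 = (S.cd t (S.sh n b) j).1 := by omega
    rw [h5] at h4
    exact Prod.ext h5 (by linarith)
  · rintro ⟨h1, h2⟩ t ht j
    rcases le_total t n with h | h
    · exact h1 t h j
    · obtain ⟨k, rfl⟩ := Nat.exists_eq_add_of_le h
      rw [S.cd_add, S.cd_add, h1 n le_rfl j, h2 k (by omega) j]

theorem Wv_N {n : ℕ} {a b : S.Om} (h : (S.Wv n).rel a b) (j : Fin d) : S.N n a j = S.N n b j :=
  congrArg Prod.fst (S.Wv_rel.1 h n le_rfl j)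

theorem Wv_rho {n : ℕ} {a b : S.Om} (h : (S.Wv n).rel a b) : S.rho n a = S.rho n b := by
  funext j
  have h1 := S.Wv_N h j
  have h2 : ⌊(S.p j : ℝ) ^ (S.N n a j) * S.y a j⌋ = ⌊(S.p j : ℝ) ^ (S.N n b j) * S.y b j⌋ :=
    congrArg Prod.snd (S.Wv_rel.1 h n le_rfl j)
  unfold rho
  rw [h2, h1]

theorem y_rho_norm (n : ℕ) (ω : S.Om) (j : Fin d) :
    0 ≤ S.y ω j - S.rho n ω j ∧ S.y ω j - S.rho n ω j ≤ S.M / 2 ^ n := by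
  have hp := S.p_pos j
  have hy := S.y_nonneg (S.sh n ω) j
  have hy' := S.y_lt (S.sh n ω) j
  rw [S.y_sub_rho]
  refine ⟨by positivity, ?_⟩
  have h1 := S.ratio_le n ω j
  rw [div_le_div_iff₀ (by positivity) (by positivity)]
  rw [div_le_iff₀ (by positivity)] at h1
  have h2 : S.y (S.sh n ω) j * 2 ^ n ≤ 1 * 2 ^ n :=
    mul_le_mul_of_nonneg_right hy'.le (by positivity)
  linarith

/-- G1 -/
theorem y_close {n : ℕ} {a b : S.Om} (h : (S.Wv n).rel a b) : ‖S.y a - S.y b‖ ≤ S.M / 2 ^ n := by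
  have hM := S.M_pos
  refine (pi_norm_le_iff_of_nonneg (by positivity)).2 fun j => ?_
  have h1 := S.y_rho_norm n a j
  have h2 := S.y_rho_norm n b j
  rw [S.Wv_rho h] at h1
  rw [Pi.sub_apply, Real.norm_eq_abs, abs_le]
  constructor <;> linarith

theorem q_close {a b : S.Om} {e e' : ℝ} (h : ‖S.lam a - S.lam b‖ ≤ e) (h' : ‖S.y a - S.y b‖ ≤ e') :
    ‖S.q a - S.q b‖ ≤ e + S.M * e' := by
  have : S.q a - S.q b = (S.lam a - S.lam b) * S.y a + S.lam b * (S.y a - S.y b) := by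
    unfold q
    ring
  rw [this]
  refine (norm_add_le _ _).trans (add_le_add ?_ ?_)
  · refine (norm_mul_le _ _).trans ?_
    have := mul_le_mul h (S.y_norm a) (norm_nonneg _) ((norm_nonneg _).trans h)
    linarith
  · exact (norm_mul_le _ _).trans (mul_le_mul (S.lam_norm b) h' (norm_nonneg _) S.M_pos.le)

/-- G3 -/
theorem lam_sh_close {n : ℕ} {a b : S.Om} (hN : ∀ j, S.N n a j = S.N n b j) {e : ℝ}
    (h : ‖S.lam a - S.lam b‖ ≤ e) : ‖S.lam (S.sh n a) - S.lam (S.sh n b)‖ ≤ S.M * e := by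
  have he : 0 ≤ e := (norm_nonneg _).trans h
  refine (pi_norm_le_iff_of_nonneg (mul_nonneg S.M_pos.le he)).2 fun j => ?_
  rw [Pi.sub_apply, S.lam_sh, S.lam_sh, hN j, ← mul_sub, norm_mul, Real.norm_eq_abs,
    abs_of_pos (S.ratio_pos n b j)]
  exact mul_le_mul (S.ratio_le n b j) ((norm_le_pi_norm (S.lam a - S.lam b) j).trans h)
    (norm_nonneg _) S.M_pos.le

theorem lam_sh_close' {n : ℕ} {a b : S.Om} (hN : ∀ j, S.N n a j = S.N n b j) {e : ℝ}
    (h : ‖S.lam (S.sh n a) - S.lam (S.sh n b)‖ ≤ e) : ‖S.lam a - S.lam b‖ ≤ S.M * e := by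
  have he : 0 ≤ e := (norm_nonneg _).trans h
  refine (pi_norm_le_iff_of_nonneg (mul_nonneg S.M_pos.le he)).2 fun j => ?_
  have key : ∀ c : S.Om, S.lam c j = (S.p j : ℝ) ^ (S.N n c j) / 2 ^ n * S.lam (S.sh n c) j := by
    intro c
    have hp := S.p_pos j
    rw [S.lam_sh]
    field_simp
  have hp := S.p_pos j
  rw [Pi.sub_apply, key a, key b, hN j, ← mul_sub, norm_mul, Real.norm_eq_abs,
    abs_of_pos (by positivity)]
  exact mul_le_mul (S.ratio_inv_le n b j)
    ((norm_le_pi_norm (S.lam (S.sh n a) - S.lam (S.sh n b)) j).trans h) (norm_nonneg _) S.M_pos.le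

/-- G4 -/
theorem q_sh_close {n : ℕ} {a b : S.Om} (hW : S.rho n a = S.rho n b) {e : ℝ}
    (h : ‖S.lam a - S.lam b‖ ≤ e) :
    ‖(S.q (S.sh n a) - S.q (S.sh n b)) - (2:ℝ) ^ n • (S.q a - S.q b)‖ ≤ 2 ^ n * e := by
  have : (S.q (S.sh n a) - S.q (S.sh n b)) - (2:ℝ) ^ n • (S.q a - S.q b)
      = -((2:ℝ) ^ n • ((S.lam a - S.lam b) * S.rho n b)) := by
    rw [S.q_sh, S.q_sh, hW]
    funext j
    simp only [Pi.sub_apply, Pi.smul_apply, Pi.mul_apply, Pi.neg_apply, smul_eq_mul]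
    ring
  rw [this, norm_neg, norm_smul, Real.norm_eq_abs, abs_of_pos (by positivity)]
  refine mul_le_mul_of_nonneg_left ?_ (by positivity)
  refine (norm_mul_le _ _).trans ?_
  have := mul_le_mul h (S.rho_norm n b) (norm_nonneg _) ((norm_nonneg _).trans h)
  linarith

/-- exponents are nearly determined by `lam` -/
theorem N_near {n : ℕ} {a b : S.Om} (h : ‖S.lam a - S.lam b‖ ≤ 1) (j : Fin d) :
    S.N n a j ≤ S.N n b j + 1 := by
  by_contra hc
  have hp := S.p_pos j
  have hp2 := S.two_le_p j
  have h1 := S.lam_ge (S.sh n a) j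
  have h2 := S.lam_lt (S.sh n b) j
  rw [S.lam_sh] at h1 h2
  have h3 := (norm_le_pi_norm (S.lam a - S.lam b) j).trans h
  rw [Pi.sub_apply, Real.norm_eq_abs, abs_le] at h3
  have h4 := S.lam_ge b j
  rw [div_mul_eq_mul_div, le_div_iff₀ (by positivity), one_mul] at h1
  rw [div_mul_eq_mul_div, div_lt_iff₀ (by positivity)] at h2
  have h5 : (S.p j : ℝ) ^ (S.N n b j + 2) ≤ (S.p j : ℝ) ^ (S.N n a j) :=
    pow_le_pow_right₀ (by linarith) (by omega)
  have h6 : (2:ℝ) ^ n * S.lam a j ≤ 2 ^ n * (2 * S.lam b j) :=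
    mul_le_mul_of_nonneg_left (by linarith) (by positivity)
  have h7 : (S.p j : ℝ) ^ (S.N n b j + 2) = S.p j * (S.p j * (S.p j : ℝ) ^ (S.N n b j)) := by ring
  have h8 : 2 * (S.p j * (S.p j : ℝ) ^ (S.N n b j)) ≤ S.p j * (S.p j * (S.p j : ℝ) ^ (S.N n b j)) :=
    mul_le_mul_of_nonneg_right hp2 (by positivity)
  linarith

theorem N_near' {n : ℕ} {a b : S.Om} (h : ‖S.lam (S.sh n a) - S.lam (S.sh n b)‖ ≤ 1) (j : Fin d) :
    S.N n a j ≤ S.N n b j + 1 := by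
  by_contra hc
  have hp := S.p_pos j
  have hp2 := S.two_le_p j
  have h3 := (norm_le_pi_norm (S.lam (S.sh n a) - S.lam (S.sh n b)) j).trans h
  rw [Pi.sub_apply, Real.norm_eq_abs, abs_le] at h3
  have h1 := S.lam_ge (S.sh n a) j
  have hb : S.lam (S.sh n b) j ≤ 2 * S.lam (S.sh n a) j := by linarith
  rw [S.lam_sh, S.lam_sh] at hb
  have h4 := S.lam_ge b j
  have h5 := S.lam_lt a j
  have h6 : (S.p j : ℝ) ^ (S.N n b j + 2) ≤ (S.p j : ℝ) ^ (S.N n a j) :=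
    pow_le_pow_right₀ (by linarith) (by omega)
  have h7 : (S.p j : ℝ) ^ (S.N n b j + 2) = S.p j * (S.p j * (S.p j : ℝ) ^ (S.N n b j)) := by ring
  set u := (S.p j : ℝ) ^ (S.N n b j) with hu
  set v := (S.p j : ℝ) ^ (S.N n a j) with hv
  have hu0 : 0 < u := by positivity
  have hv0 : 0 < v := by positivity
  rw [div_mul_eq_mul_div, div_mul_eq_mul_div, ← mul_div_assoc, div_le_div_iff₀ hu0 hv0] at hb
  have h2n : (0:ℝ) < 2 ^ n := by positivity
  have hb' : S.lam b j * v ≤ 2 * S.lam a j * u := by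
    have : 2 ^ n * (S.lam b j * v) ≤ 2 ^ n * (2 * S.lam a j * u) := by linarith
    exact le_of_mul_le_mul_left this h2n
  have h8 : 1 * v ≤ S.lam b j * v := mul_le_mul_of_nonneg_right h4 hv0.le
  have h9 : 2 * S.lam a j * u < 2 * S.p j * u :=
    mul_lt_mul_of_pos_right (by linarith) hu0
  have h10 : 2 * (S.p j * u) ≤ S.p j * (S.p j * u) :=
    mul_le_mul_of_nonneg_right hp2 (by positivity)
  linarith

theorem eq_of_near_mod {a b : ℕ} (h : a ≤ b + 1) (h' : b ≤ a + 1)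
    (hm : ((a : ℕ) : ZMod 3) = b) : a = b := by
  rw [ZMod.natCast_eq_natCast_iff'] at hm
  omega

end Sys
end FHR

namespace FHR

theorem St.cH_add {α : Type} (E : St α) (A Y Z : RV α) :
    E.cH A Y ≤ E.cH A (Z ⊔ Y) + E.cH Z Y := by
  have h := E.cH_trans A (Z ⊔ Y) Y
  rwa [E.cH_absorb] at h

theorem St.cH_sub {α : Type} (E : St α) (A Y Z : RV α) :
    E.cH A Y - E.cH Z Y ≤ E.cH A (Z ⊔ Y) := by
  linarith [E.cH_add A Y Z]

/-- bounded linear maps -/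
def Bn {d : ℕ} {ι : Type} [Fintype ι] (P : (Fin d → ℝ) →ₗ[ℝ] (ι → ℝ)) (c : ℝ) : Prop :=
  0 ≤ c ∧ ∀ x, ‖P x‖ ≤ c * ‖x‖

theorem exists_Bn {d : ℕ} {ι : Type} [Fintype ι] (P : (Fin d → ℝ) →ₗ[ℝ] (ι → ℝ)) :
    ∃ c, Bn P c :=
  ⟨‖LinearMap.toContinuousLinearMap P‖, norm_nonneg _,
    fun x => (LinearMap.toContinuousLinearMap P).le_opNorm x⟩

theorem fl_pow_mono {α ι : Type} [Fintype ι] (u : α → ι → ℝ) {n n' : ℕ} (hn : n ≤ n')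
    (h : Bd fun a => (2:ℝ) ^ n • u a) (h' : Bd fun a => (2:ℝ) ^ n' • u a) :
    fl _ h ≤ fl _ h' := by
  intro a b k
  rw [fl_rel] at k ⊢
  intro i
  have key : ∀ c, ⌊((2:ℝ) ^ n • u c) i⌋ = ⌊((2:ℝ) ^ n' • u c) i⌋ / ((2 ^ (n' - n) : ℕ) : ℤ) := by
    intro c
    rw [← Int.floor_div_natCast]
    congr 1
    obtain ⟨m, rfl⟩ := Nat.exists_eq_add_of_le hn
    simp only [Pi.smul_apply, smul_eq_mul, Nat.add_sub_cancel_left]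
    push_cast
    rw [pow_add]
    field_simp
  rw [key, key, k i]

theorem KK_mono {c c' : ℝ} (h : c ≤ c') : KK c ≤ KK c' := by
  unfold KK
  refine Real.log_le_log (by positivity) ?_
  have : ⌈c + 1⌉₊ ≤ ⌈c' + 1⌉₊ := Nat.ceil_mono (by linarith)
  have : (⌈c + 1⌉₊ : ℝ) ≤ ⌈c' + 1⌉₊ := by exact_mod_cast this
  linarith

theorem KK_pow (c : ℝ) (hc : 0 ≤ c) (n : ℕ) : KK (c * 2 ^ n) ≤ n * Real.log 2 + Real.log (c + 3) := by
  unfold KK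
  rw [← Real.log_pow, ← Real.log_mul (by positivity) (by positivity)]
  refine Real.log_le_log (by positivity) ?_
  have h1 := (Nat.ceil_lt_add_one (a := c * 2 ^ n + 1) (by positivity)).le
  have h2 : (1:ℝ) ≤ 2 ^ n := one_le_pow₀ (by norm_num)
  nlinarith

namespace Sys
variable {d : ℕ} (S : Sys d) {ι κ : Type} [Fintype ι] [Fintype κ]

abbrev W (d : ℕ) : Type := Fin d → ℝ

theorem Bd_lam (n : ℕ) : Bd fun ω : S.Om => (2:ℝ) ^ n • S.lam ω := by
  refine Bd.of_norm (C := 2 ^ n * S.M) fun ω => ?_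
  rw [norm_smul, Real.norm_eq_abs, abs_of_pos (by positivity)]
  exact mul_le_mul_of_nonneg_left (S.lam_norm ω) (by positivity)

theorem Bd_q (P : W d →ₗ[ℝ] (ι → ℝ)) (n : ℕ) : Bd fun ω : S.Om => (2:ℝ) ^ n • P (S.q ω) := by
  obtain ⟨c, hc, hP⟩ := exists_Bn P
  refine Bd.of_norm (C := 2 ^ n * (c * S.M)) fun ω => ?_
  rw [norm_smul, Real.norm_eq_abs, abs_of_pos (by positivity)]
  exact mul_le_mul_of_nonneg_left ((hP _).trans (mul_le_mul_of_nonneg_left (S.q_norm ω) hc))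
    (by positivity)

def Lv (n : ℕ) : RV S.Om := fl _ (S.Bd_lam n)
def Gv (P : W d →ₗ[ℝ] (ι → ℝ)) (n : ℕ) : RV S.Om := fl _ (S.Bd_q P n)
def Dv (P : W d →ₗ[ℝ] (ι → ℝ)) (n : ℕ) : RV S.Om := S.Gv P n ⊔ S.Lv n

theorem Lv_mono {n n' : ℕ} (h : n ≤ n') : S.Lv n ≤ S.Lv n' := fl_pow_mono _ h _ _
theorem Gv_mono (P : W d →ₗ[ℝ] (ι → ℝ)) {n n' : ℕ} (h : n ≤ n') : S.Gv P n ≤ S.Gv P n' :=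
  fl_pow_mono (fun ω => P (S.q ω)) h _ _
theorem Dv_mono (P : W d →ₗ[ℝ] (ι → ℝ)) {n n' : ℕ} (h : n ≤ n') : S.Dv P n ≤ S.Dv P n' :=
  sup_le_sup (S.Gv_mono P h) (S.Lv_mono h)

theorem norm_le_of_smul {E : Type*} [NormedAddCommGroup E] [NormedSpace ℝ E] {n : ℕ} {x y : E} {c : ℝ}
    (h : ‖(2:ℝ) ^ n • x - (2:ℝ) ^ n • y‖ ≤ c) : ‖x - y‖ ≤ c / 2 ^ n := by
  rw [← smul_sub, norm_smul, Real.norm_eq_abs, abs_of_pos (by positivity)] at h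
  rw [le_div_iff₀ (by positivity), mul_comm]
  exact h

theorem smul_norm_le {E : Type*} [NormedAddCommGroup E] [NormedSpace ℝ E] {n : ℕ} {x y : E} {c : ℝ}
    (h : ‖x - y‖ ≤ c / 2 ^ n) : ‖(2:ℝ) ^ n • x - (2:ℝ) ^ n • y‖ ≤ c := by
  rw [← smul_sub, norm_smul, Real.norm_eq_abs, abs_of_pos (by positivity)]
  rwa [le_div_iff₀ (by positivity), mul_comm] at h

theorem Lv_close {n : ℕ} {a b : S.Om} (h : (S.Lv n).rel a b) : ‖S.lam a - S.lam b‖ ≤ 1 / 2 ^ n :=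
  norm_le_of_smul (fl_closen (h := S.Bd_lam n) h)

theorem Lv_close1 {n : ℕ} {a b : S.Om} (h : (S.Lv n).rel a b) : ‖S.lam a - S.lam b‖ ≤ 1 := by
  refine (S.Lv_close h).trans ?_
  rw [div_le_one (by positivity)]
  exact one_le_pow₀ (by norm_num)

theorem Gv_close {P : W d →ₗ[ℝ] (ι → ℝ)} {n : ℕ} {a b : S.Om} (h : (S.Gv P n).rel a b) :
    ‖P (S.q a - S.q b)‖ ≤ 1 / 2 ^ n := by
  rw [map_sub]
  exact norm_le_of_smul (fl_closen (h := S.Bd_q P n) h)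

theorem cH_Gv (E : St S.Om) {P : W d →ₗ[ℝ] (ι → ℝ)} {n : ℕ} {Y : RV S.Om} {c : ℝ}
    (h : ∀ a b, Y.rel a b → ‖P (S.q a - S.q b)‖ ≤ c / 2 ^ n) :
    E.cH (S.Gv P n) Y ≤ Fintype.card ι * KK c :=
  cH_fln E fun a b k => smul_norm_le (by rw [← map_sub]; exact h a b k)

theorem cH_Lv (E : St S.Om) {n : ℕ} {Y : RV S.Om} {c : ℝ}
    (h : ∀ a b, Y.rel a b → ‖S.lam a - S.lam b‖ ≤ c / 2 ^ n) :
    E.cH (S.Lv n) Y ≤ d * KK c := by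
  have := cH_fln E (h := S.Bd_lam n) (Y := Y) (c := c) fun a b k => smul_norm_le (h a b k)
  rwa [Fintype.card_fin] at this

/-- Fact A -/
theorem factA (E : St S.Om) {P : W d →ₗ[ℝ] (ι → ℝ)} {c : ℝ} (hP : Bn P c) (n : ℕ) :
    E.cH (S.Gv P n) (S.Wv n ⊔ S.Lv n) ≤ Fintype.card ι * KK (c * (1 + S.M * S.M)) := by
  refine S.cH_Gv E fun a b h => ?_
  have h1 := S.q_close (S.Lv_close h.2) (S.y_close h.1)
  refine (hP.2 _).trans ?_
  rw [mul_div_assoc]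
  refine mul_le_mul_of_nonneg_left (h1.trans (le_of_eq ?_)) hP.1
  ring

/-- exponent residues -/
def Nm (m : ℕ) : RV S.Om := RV.ofF (fun ω (j : Fin d) => ((S.N m ω j : ℕ) : ZMod 3))

theorem Nm_rel {m : ℕ} {a b : S.Om} : (S.Nm m).rel a b ↔ ∀ j, ((S.N m a j : ℕ) : ZMod 3) = S.N m b j := by
  unfold Nm
  rw [RV.ofF, RV.of_rel]
  exact funext_iff

theorem Nm_le (E : St S.Om) (m : ℕ) (Y : RV S.Om) : E.cH (S.Nm m) Y ≤ d * Real.log 3 := by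
  have := E.cH_le_card (S.Nm m) Y (fun ω (j : Fin d) => ((S.N m ω j : ℕ) : ZMod 3))
    (fun a b _ h => h)
  refine this.trans (le_of_eq ?_)
  rw [Fintype.card_fun, ZMod.card, Fintype.card_fin]
  push_cast
  rw [Real.log_pow]

theorem N_eq_of {m : ℕ} {a b : S.Om} (h : ‖S.lam a - S.lam b‖ ≤ 1) (h' : (S.Nm m).rel a b) (j : Fin d) :
    S.N m a j = S.N m b j := by
  have h2 : ‖S.lam b - S.lam a‖ ≤ 1 := by rwa [norm_sub_rev]
  exact eq_of_near_mod (S.N_near h j) (S.N_near h2 j) (S.Nm_rel.1 h' j)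

theorem N_eq_of' {m : ℕ} {a b : S.Om} (h : ‖S.lam (S.sh m a) - S.lam (S.sh m b)‖ ≤ 1)
    (h' : (S.Nm m).rel a b) (j : Fin d) : S.N m a j = S.N m b j := by
  have h2 : ‖S.lam (S.sh m b) - S.lam (S.sh m a)‖ ≤ 1 := by rwa [norm_sub_rev]
  exact eq_of_near_mod (S.N_near' h j) (S.N_near' h2 j) (S.Nm_rel.1 h' j)

def cL : ℝ := d * KK S.M + d * Real.log 3

theorem cL_nonneg : 0 ≤ S.cL := by
  have := KK_nonneg S.M
  have : 0 ≤ Real.log 3 := Real.log_nonneg (by norm_num)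
  unfold cL
  positivity

theorem comap_fl {α β : Type} (φ : α → β) (u : β → ι → ℝ) (h : Bd u) (h' : Bd fun a => u (φ a)) :
    (fl u h).comap φ = fl (fun a => u (φ a)) h' := rfl

theorem Bd_comp {α β : Type} {φ : α → β} {u : β → ι → ℝ} (h : Bd u) : Bd fun a => u (φ a) :=
  h.imp fun _ hC a => hC _

/-- Fact C -/
theorem factC (E : St S.Om) (k m : ℕ) : E.cH ((S.Lv k).comap (S.sh m)) (S.Lv k) ≤ S.cL := by
  refine (E.cH_add _ _ (S.Nm m)).trans (add_le_add ?_ (S.Nm_le E m _))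
  have := cH_fln E (h := Bd_comp (φ := S.sh m) (S.Bd_lam k)) (Y := S.Nm m ⊔ S.Lv k) (c := S.M) ?_
  · rwa [Fintype.card_fin] at this
  · intro a b h
    refine smul_norm_le ((S.lam_sh_close (fun j => S.N_eq_of (S.Lv_close1 h.2) h.1 j)
      (S.Lv_close h.2)).trans (le_of_eq ?_))
    ring

theorem factC' (E : St S.Om) (k m : ℕ) : E.cH (S.Lv k) ((S.Lv k).comap (S.sh m)) ≤ S.cL := by
  refine (E.cH_add _ _ (S.Nm m)).trans (add_le_add ?_ (S.Nm_le E m _))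
  refine S.cH_Lv E fun a b h => ?_
  refine (S.lam_sh_close' (fun j => S.N_eq_of' (S.Lv_close1 h.2) h.1 j)
      (S.Lv_close h.2)).trans (le_of_eq ?_)
  ring

/-- Fact D -/
theorem factD (E : St S.Om) {P : W d →ₗ[ℝ] (ι → ℝ)} {c : ℝ} (hP : Bn P c) (n m : ℕ) :
    E.cH ((S.Gv P n).comap (S.sh m)) (S.Wv m ⊔ S.Dv P (m + n)) ≤ Fintype.card ι * KK (c + 1) := by
  refine cH_fln E (h := Bd_comp (φ := S.sh m) (S.Bd_q P n)) ?_
  intro a b h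
  have h1 := S.q_sh_close (S.Wv_rho h.1) (S.Lv_close h.2.2)
  have h2 := S.Gv_close h.2.1
  refine smul_norm_le ?_
  rw [← map_sub]
  have h3 : S.q (S.sh m a) - S.q (S.sh m b) =
    ((S.q (S.sh m a) - S.q (S.sh m b)) - (2:ℝ) ^ m • (S.q a - S.q b)) + (2:ℝ) ^ m • (S.q a - S.q b) := by
    abel
  rw [h3, map_add, map_smul]
  refine (norm_add_le _ _).trans ?_
  rw [norm_smul, Real.norm_eq_abs, abs_of_pos (by positivity)]
  have h4 := (hP.2 _).trans (mul_le_mul_of_nonneg_left h1 hP.1)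
  have h5 := mul_le_mul_of_nonneg_left h2 (show (0:ℝ) ≤ 2 ^ m by positivity)
  refine (add_le_add h4 h5).trans (le_of_eq ?_)
  rw [pow_add]
  field_simp

theorem factD' (E : St S.Om) {P : W d →ₗ[ℝ] (ι → ℝ)} {c : ℝ} (hP : Bn P c) (n m : ℕ) :
    E.cH (S.Gv P (m + n)) (S.Wv m ⊔ S.Lv (m + n) ⊔ (S.Gv P n).comap (S.sh m))
      ≤ Fintype.card ι * KK (c + 1) := by
  refine S.cH_Gv E ?_
  intro a b h
  have h1 := S.q_sh_close (S.Wv_rho h.1.1) (S.Lv_close h.1.2)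
  have h2 := S.Gv_close (P := P) (n := n) h.2
  have h3 : S.q a - S.q b =
    ((2:ℝ) ^ m)⁻¹ • ((S.q (S.sh m a) - S.q (S.sh m b))
     - ((S.q (S.sh m a) - S.q (S.sh m b)) - (2:ℝ) ^ m • (S.q a - S.q b))) := by
    rw [sub_sub_cancel, smul_smul, inv_mul_cancel₀ (by positivity), one_smul]
  rw [h3, map_smul, map_sub, norm_smul, Real.norm_eq_abs, abs_of_pos (by positivity)]
  have h4 := (hP.2 _).trans (mul_le_mul_of_nonneg_left h1 hP.1)
  have h6 := (norm_sub_le (P (S.q (S.sh m a) - S.q (S.sh m b)))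
    (P ((S.q (S.sh m a) - S.q (S.sh m b)) - (2:ℝ) ^ m • (S.q a - S.q b)))).trans (add_le_add h2 h4)
  refine (mul_le_mul_of_nonneg_left h6 (by positivity)).trans (le_of_eq ?_)
  rw [pow_add]
  field_simp
  ring

/-- stationarity -/
def Stat (E : St S.Om) : Prop := ∀ n, St.Ag (E.map (S.sh n)) E

variable {S}

theorem Stat.cH {E : St S.Om} (hE : S.Stat E) (n : ℕ) (X Y : RV S.Om) :
    E.cH (X.comap (S.sh n)) (Y.comap (S.sh n)) = E.cH X Y := by
  rw [← St.cH_map, (hE n).cH]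

theorem Stat.H {E : St S.Om} (hE : S.Stat E) (n : ℕ) (X : RV S.Om) :
    E.H (X.comap (S.sh n)) = E.H X := by
  rw [← St.H_map, (hE n).H]

variable (S)

def gam (E : St S.Om) (P : W d →ₗ[ℝ] (ι → ℝ)) (n : ℕ) : ℝ := E.cH (S.Wv n) (S.Dv P n)

theorem gam_nonneg (E : St S.Om) (P : W d →ₗ[ℝ] (ι → ℝ)) (n : ℕ) : 0 ≤ S.gam E P n :=
  E.cH_nonneg _ _

def cS (ι : Type) [Fintype ι] (c : ℝ) : ℝ := Fintype.card ι * KK (c + 1) + S.cL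

theorem cS_nonneg (ι : Type) [Fintype ι] (c : ℝ) : 0 ≤ S.cS ι c := by
  have := KK_nonneg (c + 1)
  have := S.cL_nonneg
  unfold cS
  positivity

/-- the shifted data -/
theorem Dv_shift (E : St S.Om) {P : W d →ₗ[ℝ] (ι → ℝ)} {c : ℝ} (hP : Bn P c) (n m : ℕ) :
    E.cH ((S.Dv P n).comap (S.sh m)) (S.Wv m ⊔ S.Dv P (m + n)) ≤ S.cS ι c := by
  have h1 : (S.Dv P n).comap (S.sh m) = (S.Gv P n).comap (S.sh m) ⊔ (S.Lv n).comap (S.sh m) := rfl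
  rw [h1]
  refine (E.cH_sup_le _ _ _).trans (add_le_add (S.factD E hP n m) ?_)
  refine (E.cH_anti _ (Y := S.Lv n) ?_).trans (S.factC E n m)
  exact (S.Lv_mono (by omega)).trans (le_sup_right.trans le_sup_right)

theorem block (E : St S.Om) (hE : S.Stat E) {P : W d →ₗ[ℝ] (ι → ℝ)} {c : ℝ} (hP : Bn P c) (n m k : ℕ) :
    E.cH (S.Wv (m + n)) (S.Dv P (m + k)) ≤ E.cH (S.Wv m) (S.Dv P (m + k))
      + E.cH (S.Wv n) (S.Dv P k) + S.cS ι c := by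
  rw [S.Wv_add, E.cH_sup]
  have h1 := E.cH_trans ((S.Wv n).comap (S.sh m)) ((S.Dv P k).comap (S.sh m)) (S.Wv m ⊔ S.Dv P (m + k))
  have h2 := S.Dv_shift E hP k m
  rw [hE.cH] at h1
  linarith

theorem gam_sub (E : St S.Om) (hE : S.Stat E) {P : W d →ₗ[ℝ] (ι → ℝ)} {c : ℝ} (hP : Bn P c) (m n : ℕ) :
    S.gam E P (m + n) ≤ S.gam E P m + S.gam E P n + S.cS ι c := by
  have h1 := S.block E hE hP n m n
  have h2 := E.cH_anti (S.Wv m) (S.Dv_mono P (Nat.le_add_right m n))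
  unfold gam
  linarith

theorem lim_exists (u : ℕ → ℝ) (C : ℝ) (h0 : ∀ n, 0 ≤ u n) (hC : 0 ≤ C)
    (h : ∀ m n, u (m + n) ≤ u m + u n + C) :
    ∃ g, Tendsto (fun n => u n / n) atTop (𝓝 g) ∧ ∀ n : ℕ, g * n - C ≤ u n := by
  have hs : Subadditive fun n => u n + C := fun m n => by
    have := h m n
    linarith
  have hb : BddBelow (Set.range fun n => (u n + C) / n) := by
    refine ⟨0, ?_⟩
    rintro _ ⟨n, rfl⟩
    have := h0 n
    positivity
  have ht := hs.tendsto_lim hb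
  refine ⟨hs.lim, ?_, fun n => ?_⟩
  · have h2 : Tendsto (fun n : ℕ => C / (n:ℝ)) atTop (𝓝 0) := tendsto_const_div_atTop_nhds_zero_nat C
    have := ht.sub h2
    rw [sub_zero] at this
    refine this.congr fun n => ?_
    ring
  · rcases Nat.eq_zero_or_pos n with rfl | hn
    · have := h0 0
      push_cast
      linarith
    · have := hs.lim_le_div hb (n := n) (by omega)
      rw [le_div_iff₀ (by exact_mod_cast hn)] at this
      linarith

def gamma (E : St S.Om) (P : W d →ₗ[ℝ] (ι → ℝ)) : ℝ := limUnder atTop fun n : ℕ => S.gam E P n / n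

variable {S}

theorem gamma_tendsto {E : St S.Om} (hE : S.Stat E) (P : W d →ₗ[ℝ] (ι → ℝ)) :
    Tendsto (fun n : ℕ => S.gam E P n / n) atTop (𝓝 (S.gamma E P)) := by
  obtain ⟨c, hP⟩ := exists_Bn P
  obtain ⟨g, h1, _⟩ := lim_exists (S.gam E P) _ (S.gam_nonneg E P) (S.cS_nonneg ι c) (S.gam_sub E hE hP)
  unfold gamma
  rwa [h1.limUnder_eq]

theorem gamma_le {E : St S.Om} (hE : S.Stat E) {P : W d →ₗ[ℝ] (ι → ℝ)} {c : ℝ} (hP : Bn P c) (n : ℕ) :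
    S.gamma E P * n - S.cS ι c ≤ S.gam E P n := by
  obtain ⟨g, h1, h2⟩ := lim_exists (S.gam E P) _ (S.gam_nonneg E P) (S.cS_nonneg ι c) (S.gam_sub E hE hP)
  unfold gamma
  rw [h1.limUnder_eq]
  exact h2 n

end Sys
end FHR

namespace FHR

theorem le_of_nat_mul {A B K : ℝ} (h : ∀ t : ℕ, A * t ≤ B * t + K) : A ≤ B := by
  by_contra hc
  push Not at hc
  obtain ⟨t, ht⟩ := exists_nat_gt (K / (A - B))
  rw [div_lt_iff₀ (by linarith)] at ht
  have := h t
  nlinarith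

theorem lim_le_lim {u v : ℕ → ℝ} {a b e C : ℝ} (hu : Tendsto (fun n : ℕ => u n / n) atTop (𝓝 a))
    (hv : Tendsto (fun n : ℕ => v n / n) atTop (𝓝 b)) (h : ∀ n : ℕ, u n ≤ v n + n * e + C) :
    a ≤ b + e := by
  have h2 : Tendsto (fun n : ℕ => C / (n:ℝ)) atTop (𝓝 0) := tendsto_const_div_atTop_nhds_zero_nat C
  have h3 := (hv.add (tendsto_const_nhds (x := e))).add h2
  rw [add_zero] at h3
  refine le_of_tendsto_of_tendsto hu h3 ?_
  filter_upwards [eventually_gt_atTop 0] with n hn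
  have hn' : (0:ℝ) < n := by exact_mod_cast hn
  rw [div_le_iff₀ hn']
  have := h n
  have e1 : (v n / n + e + C / n) * n = v n + n * e + C := by
    field_simp
  linarith

namespace Sys
variable {d : ℕ} {S : Sys d} {ι κ : Type} [Fintype ι] [Fintype κ]

theorem gamma_star {E : St S.Om} (hE : S.Stat E) {P : W d →ₗ[ℝ] (ι → ℝ)} {c : ℝ} (hP : Bn P c)
    (m n : ℕ) : S.gamma E P * m - S.cS ι c ≤ E.cH (S.Wv m) (S.Dv P n) := by
  set x := E.cH (S.Wv m) (S.Dv P n) with hx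
  have h1 : ∀ t : ℕ, S.gam E P (m * t + n) ≤ S.gam E P n + t * (x + S.cS ι c) := by
    intro t
    induction t with
    | zero => simp
    | succ t ih =>
      have e1 : m * (t + 1) + n = m + (m * t + n) := by ring
      have h2 := S.block E hE hP (m * t + n) m (m * t + n)
      have h3 := E.cH_anti (S.Wv m) (S.Dv_mono P (show n ≤ m + (m * t + n) by omega))
      rw [e1]
      unfold gam at *
      push_cast
      linarith
  have h4 : S.gamma E P * m ≤ x + S.cS ι c := by
    refine le_of_nat_mul (K := S.gam E P n + S.cS ι c + |S.gamma E P * n|) fun t => ?_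
    have h5 := h1 t
    have h6 := gamma_le hE hP (m * t + n)
    push_cast at h6
    have := neg_abs_le (S.gamma E P * n)
    linarith
  linarith

variable (S)
def hh (E : St S.Om) : ℝ := limUnder atTop fun n : ℕ => E.H (S.Wv n) / n
variable {S}

theorem hh_aux {E : St S.Om} (hE : S.Stat E) : Tendsto (fun n : ℕ => E.H (S.Wv n) / n) atTop (𝓝 (S.hh E))
    ∧ ∀ n : ℕ, S.hh E * n ≤ E.H (S.Wv n) := by
  obtain ⟨g, h1, h2⟩ := lim_exists (fun n => E.H (S.Wv n)) 0 (fun n => E.H_nonneg _) le_rfl fun m n => by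
    rw [S.Wv_add, sup_comm, E.H_sup]
    have h3 := E.cH_le_H ((S.Wv n).comap (S.sh m)) (S.Wv m)
    rw [hE.H] at h3
    linarith
  unfold hh
  rw [h1.limUnder_eq]
  exact ⟨h1, fun n => by linarith [h2 n]⟩

theorem hL {E : St S.Om} (hE : S.Stat E) (n k : ℕ) : S.hh E * n - S.cL ≤ E.cH (S.Wv n) (S.Lv k) := by
  set x := E.cH (S.Wv n) (S.Lv k) with hx
  have h1 : ∀ t : ℕ, E.cH (S.Wv (n * t)) (S.Lv k) ≤ t * (x + S.cL) + E.H (S.Wv 0) := by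
    intro t
    induction t with
    | zero => simpa using E.cH_le_H _ _
    | succ t ih =>
      rw [show n * (t + 1) = n * t + n by ring, S.Wv_add]
      have h2 := E.cH_sup_le (S.Wv (n * t)) ((S.Wv n).comap (S.sh (n * t))) (S.Lv k)
      have h3 := E.cH_trans ((S.Wv n).comap (S.sh (n * t))) ((S.Lv k).comap (S.sh (n * t))) (S.Lv k)
      rw [hE.cH] at h3
      have h4 := S.factC E k (n * t)
      push_cast
      linarith
  have h4 : S.hh E * n ≤ x + S.cL := by
    refine le_of_nat_mul (K := E.H (S.Wv 0) + E.H (S.Lv k)) fun t => ?_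
    have h5 := h1 t
    have h6 := (hh_aux hE).2 (n * t)
    have h7 := E.H_mono (le_sup_left : S.Wv (n * t) ≤ S.Wv (n * t) ⊔ S.Lv k)
    rw [E.H_sup] at h7
    push_cast at h6
    linarith
  linarith

theorem gamma_le_hh {E : St S.Om} (hE : S.Stat E) (P : W d →ₗ[ℝ] (ι → ℝ)) : S.gamma E P ≤ S.hh E := by
  have := lim_le_lim (e := 0) (C := 0) (gamma_tendsto hE P) (hh_aux hE).1 fun n => by
    have := E.cH_le_H (S.Wv n) (S.Dv P n)
    unfold gam
    linarith
  linarith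

theorem gamma_nonneg {E : St S.Om} (hE : S.Stat E) (P : W d →ₗ[ℝ] (ι → ℝ)) : 0 ≤ S.gamma E P := by
  refine ge_of_tendsto (gamma_tendsto hE P) (Eventually.of_forall fun n => ?_)
  have := S.gam_nonneg E P n
  positivity

theorem gam_cmp (E : St S.Om) {P : W d →ₗ[ℝ] (ι → ℝ)} {P' : W d →ₗ[ℝ] (κ → ℝ)} {n : ℕ} {C : ℝ}
    (h : E.cH (S.Gv P n) (S.Dv P' n) ≤ C) : S.gam E P' n ≤ S.gam E P n + C := by
  have h1 := E.cH_add (S.Wv n) (S.Dv P' n) (S.Gv P n)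
  have h2 := E.cH_anti (S.Wv n) (Y := S.Dv P n) (Y' := S.Gv P n ⊔ S.Dv P' n)
    (sup_le le_sup_left (le_sup_right.trans le_sup_right))
  unfold gam
  linarith

theorem exists_factor {P : W d →ₗ[ℝ] (ι → ℝ)} {P' : W d →ₗ[ℝ] (κ → ℝ)}
    (h : LinearMap.ker P' ≤ LinearMap.ker P) : ∃ c, 0 ≤ c ∧ ∀ x, ‖P x‖ ≤ c * ‖P' x‖ := by
  obtain ⟨T, hT⟩ := LinearMap.exists_extend
    (((LinearMap.ker P').liftQ P h) ∘ₗ P'.quotKerEquivRange.symm.toLinearMap)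
  have hTP : ∀ x, T (P' x) = P x := by
    intro x
    have h1 := LinearMap.congr_fun hT ⟨P' x, LinearMap.mem_range_self P' x⟩
    simp only [LinearMap.comp_apply, Submodule.subtype_apply, LinearEquiv.coe_coe] at h1
    rw [h1, LinearMap.quotKerEquivRange_symm_apply_image P' x, Submodule.mkQ_apply, Submodule.liftQ_apply]
  refine ⟨‖LinearMap.toContinuousLinearMap T‖, norm_nonneg _, fun x => ?_⟩
  rw [← hTP]
  exact (LinearMap.toContinuousLinearMap T).le_opNorm (P' x)

theorem Gv_of_ker {P : W d →ₗ[ℝ] (ι → ℝ)} {P' : W d →ₗ[ℝ] (κ → ℝ)}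
    (h : LinearMap.ker P' ≤ LinearMap.ker P) :
    ∃ C, 0 ≤ C ∧ ∀ (E : St S.Om) n, E.cH (S.Gv P n) (S.Gv P' n) ≤ C := by
  obtain ⟨c, hc, hT⟩ := exists_factor h
  refine ⟨Fintype.card ι * KK c, mul_nonneg (Nat.cast_nonneg _) (KK_nonneg _), fun E n => ?_⟩
  refine S.cH_Gv E fun a b k => ?_
  refine (hT _).trans ?_
  have := mul_le_mul_of_nonneg_left (S.Gv_close k) hc
  rwa [mul_one_div] at this

theorem gamma_mono {E : St S.Om} (hE : S.Stat E) {P : W d →ₗ[ℝ] (ι → ℝ)} {P' : W d →ₗ[ℝ] (κ → ℝ)}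
    (h : LinearMap.ker P' ≤ LinearMap.ker P) : S.gamma E P' ≤ S.gamma E P := by
  obtain ⟨C, _, hC⟩ := Gv_of_ker (S := S) h
  have := lim_le_lim (e := 0) (C := C) (gamma_tendsto hE P') (gamma_tendsto hE P) fun n => by
    have h1 := gam_cmp E (P := P) (P' := P') ((E.cH_anti _ le_sup_left).trans (hC E n))
    linarith
  linarith

theorem gamma_ker {E : St S.Om} (hE : S.Stat E) {P : W d →ₗ[ℝ] (ι → ℝ)} {P' : W d →ₗ[ℝ] (κ → ℝ)}
    (h : LinearMap.ker P' = LinearMap.ker P) : S.gamma E P' = S.gamma E P :=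
  le_antisymm (gamma_mono hE h.le) (gamma_mono hE h.ge)

/-- pairing of linear maps -/
def prd (P : W d →ₗ[ℝ] (ι → ℝ)) (Q : W d →ₗ[ℝ] (κ → ℝ)) : W d →ₗ[ℝ] (ι ⊕ κ → ℝ) where
  toFun x := Sum.elim (P x) (Q x)
  map_add' x y := by
    funext i
    cases i <;> simp
  map_smul' c x := by
    funext i
    cases i <;> simp

theorem ker_prd (P : W d →ₗ[ℝ] (ι → ℝ)) (Q : W d →ₗ[ℝ] (κ → ℝ)) :
    LinearMap.ker (prd P Q) = LinearMap.ker P ⊓ LinearMap.ker Q := by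
  ext x
  simp only [Submodule.mem_inf, LinearMap.mem_ker]
  constructor
  · intro h
    exact ⟨funext fun i => congrFun h (Sum.inl i), funext fun i => congrFun h (Sum.inr i)⟩
  · rintro ⟨h1, h2⟩
    funext i
    cases i with
    | inl i => exact congrFun h1 i
    | inr i => exact congrFun h2 i

theorem Gv_prd (P : W d →ₗ[ℝ] (ι → ℝ)) (Q : W d →ₗ[ℝ] (κ → ℝ)) (n : ℕ) :
    S.Gv (prd P Q) n = S.Gv P n ⊔ S.Gv Q n := by
  apply RV.ext'
  intro a b
  rw [RV.sup_rel]
  unfold Gv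
  rw [fl_rel, fl_rel, fl_rel]
  constructor
  · intro h
    exact ⟨fun i => h (Sum.inl i), fun i => h (Sum.inr i)⟩
  · rintro ⟨h1, h2⟩ i
    cases i with
    | inl i => exact h1 i
    | inr i => exact h2 i

theorem Dv_prd (P : W d →ₗ[ℝ] (ι → ℝ)) (Q : W d →ₗ[ℝ] (κ → ℝ)) (n : ℕ) :
    S.Dv (prd P Q) n = S.Gv Q n ⊔ S.Dv P n := by
  unfold Dv
  rw [Gv_prd, sup_assoc, sup_left_comm]

theorem gam_prd (E : St S.Om) (P : W d →ₗ[ℝ] (ι → ℝ)) (Q : W d →ₗ[ℝ] (κ → ℝ)) (n : ℕ) :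
    S.gam E P n + E.cH (S.Gv Q n) (S.Wv n ⊔ S.Dv P n)
      = E.cH (S.Gv Q n) (S.Dv P n) + S.gam E (prd P Q) n := by
  unfold gam
  rw [Dv_prd, E.cH_symm]

theorem gam_prd_le (E : St S.Om) (P : W d →ₗ[ℝ] (ι → ℝ)) (Q : W d →ₗ[ℝ] (κ → ℝ)) (n : ℕ) :
    S.gam E P n - S.gam E (prd P Q) n ≤ E.cH (S.Gv Q n) (S.Dv P n) := by
  have := gam_prd E P Q n
  have := E.cH_nonneg (S.Gv Q n) (S.Wv n ⊔ S.Dv P n)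
  linarith

theorem le_gam_prd (E : St S.Om) (P : W d →ₗ[ℝ] (ι → ℝ)) {Q : W d →ₗ[ℝ] (κ → ℝ)} {c : ℝ} (hQ : Bn Q c)
    (n : ℕ) : E.cH (S.Gv Q n) (S.Dv P n) ≤ S.gam E P n - S.gam E (prd P Q) n
      + Fintype.card κ * KK (c * (1 + S.M * S.M)) := by
  have := gam_prd E P Q n
  have := E.cH_anti (S.Gv Q n) (Y := S.Wv n ⊔ S.Lv n) (Y' := S.Wv n ⊔ S.Dv P n)
    (sup_le_sup_left le_sup_right _)
  have := S.factA E hQ n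
  linarith

/-- entropy of an observed projection -/
theorem H_Gv_le (E : St S.Om) {Q : W d →ₗ[ℝ] (κ → ℝ)} {c : ℝ} (hQ : Bn Q c) (n : ℕ) (Y : RV S.Om) :
    E.cH (S.Gv Q n) Y ≤ Fintype.card κ * (n * Real.log 2 + Real.log (c * (2 * S.M) + 3)) := by
  have hM := S.M_pos
  refine (S.cH_Gv E (c := c * (2 * S.M) * 2 ^ n) fun a b _ => ?_).trans
    (mul_le_mul_of_nonneg_left (KK_pow _ (mul_nonneg hQ.1 (by positivity)) n) (Nat.cast_nonneg _))
  rw [mul_div_assoc, div_self (by positivity), mul_one]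
  refine (hQ.2 _).trans (mul_le_mul_of_nonneg_left ?_ hQ.1)
  have := norm_sub_le (S.q a) (S.q b)
  linarith [S.q_norm a, S.q_norm b]

theorem gamma_prd_le {E : St S.Om} (hE : S.Stat E) (P : W d →ₗ[ℝ] (ι → ℝ)) (Q : W d →ₗ[ℝ] (κ → ℝ)) :
    S.gamma E P ≤ S.gamma E (prd P Q) + Fintype.card κ * Real.log 2 := by
  obtain ⟨c, hQ⟩ := exists_Bn Q
  refine lim_le_lim (C := Fintype.card κ * Real.log (c * (2 * S.M) + 3)) (gamma_tendsto hE P)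
    (gamma_tendsto hE (prd P Q)) fun n => ?_
  have h1 := gam_prd_le E P Q n
  have h2 := H_Gv_le E hQ n (S.Dv P n)
  linarith

theorem gamma_submod {E : St S.Om} (hE : S.Stat E) {τ : Type} [Fintype τ] {P : W d →ₗ[ℝ] (ι → ℝ)}
    {P' : W d →ₗ[ℝ] (κ → ℝ)} (h : LinearMap.ker P' ≤ LinearMap.ker P) (Q : W d →ₗ[ℝ] (τ → ℝ)) :
    S.gamma E P' - S.gamma E (prd P' Q) ≤ S.gamma E P - S.gamma E (prd P Q) := by
  obtain ⟨c, hQ⟩ := exists_Bn Q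
  obtain ⟨C, _, hC⟩ := Gv_of_ker (S := S) h
  have t1 : Tendsto (fun n : ℕ => (S.gam E P' n - S.gam E (prd P' Q) n) / n) atTop
      (𝓝 (S.gamma E P' - S.gamma E (prd P' Q))) := by
    simp only [sub_div]
    exact (gamma_tendsto hE P').sub (gamma_tendsto hE (prd P' Q))
  have t2 : Tendsto (fun n : ℕ => (S.gam E P n - S.gam E (prd P Q) n) / n) atTop
      (𝓝 (S.gamma E P - S.gamma E (prd P Q))) := by
    simp only [sub_div]
    exact (gamma_tendsto hE P).sub (gamma_tendsto hE (prd P Q))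
  have := lim_le_lim (e := 0) (C := Fintype.card τ * KK (c * (1 + S.M * S.M)) + C) t1 t2 fun n => by
    have h1 := gam_prd_le E P' Q n
    have h2 := le_gam_prd E P hQ n
    have h3 := E.cH_trans (S.Gv Q n) (S.Dv P n) (S.Dv P' n)
    have h4 : E.cH (S.Dv P n) (S.Dv P' n) ≤ C := by
      have h5 : E.cH (S.Dv P n) (S.Dv P' n) ≤ E.cH (S.Gv P n ⊔ S.Dv P' n) (S.Dv P' n) :=
        E.cH_mono (sup_le le_sup_left (le_sup_right.trans le_sup_right)) _
      rw [E.cH_absorb] at h5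
      exact h5.trans ((E.cH_anti _ le_sup_left).trans (hC E n))
    linarith
  linarith

theorem gam_perturb (E : St S.Om) {P P' : W d →ₗ[ℝ] (ι → ℝ)} {n : ℕ} {c : ℝ}
    (h : ∀ x, ‖P x - P' x‖ ≤ c / 2 ^ n * ‖x‖) (hc : 0 ≤ c) :
    S.gam E P' n ≤ S.gam E P n + Fintype.card ι * KK (c * (2 * S.M) + 1) := by
  refine gam_cmp E ((E.cH_anti _ le_sup_left).trans ?_)
  refine S.cH_Gv E fun a b k => ?_
  have h1 := h (S.q a - S.q b)
  have h2 := S.Gv_close k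
  have h3 : ‖S.q a - S.q b‖ ≤ 2 * S.M := by
    have := norm_sub_le (S.q a) (S.q b)
    linarith [S.q_norm a, S.q_norm b]
  have h4 : P (S.q a - S.q b) = (P (S.q a - S.q b) - P' (S.q a - S.q b)) + P' (S.q a - S.q b) := by abel
  rw [h4]
  refine (norm_add_le _ _).trans ?_
  have h5 := mul_le_mul_of_nonneg_left h3 (show 0 ≤ c / 2 ^ n by positivity)
  refine (add_le_add (h1.trans h5) h2).trans (le_of_eq ?_)
  ring

theorem N_mono_lam {t : ℕ} {a b : S.Om} {j : Fin d} (h : S.lam a j ≤ S.lam b j) :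
    S.N t a j ≤ S.N t b j := by
  by_contra hc
  have hp := S.p_pos j
  have hp2 := S.two_le_p j
  have h1 := S.lam_ge (S.sh t a) j
  have h2 := S.lam_lt (S.sh t b) j
  rw [S.lam_sh] at h1 h2
  rw [div_mul_eq_mul_div, le_div_iff₀ (by positivity), one_mul] at h1
  rw [div_mul_eq_mul_div, div_lt_iff₀ (by positivity), ← pow_succ'] at h2
  have h5 : (S.p j : ℝ) ^ (S.N t b j + 1) ≤ (S.p j : ℝ) ^ (S.N t a j) :=
    pow_le_pow_right₀ (by linarith) (by omega)
  have h6 : (2:ℝ) ^ t * S.lam a j ≤ 2 ^ t * S.lam b j := mul_le_mul_of_nonneg_left h (by positivity)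
  linarith

theorem sum_mod_eq {n : ℕ} {f g : ℕ → ℕ} (h : ∀ t, f t ≤ g t) (h' : ∀ t, g t ≤ f t + 1)
    (hm : ((∑ t ∈ Finset.range (n + 1), f t : ℕ) : ZMod (n + 2)) = (∑ t ∈ Finset.range (n + 1), g t : ℕ)) :
    ∀ t, t ≤ n → f t = g t := by
  have h1 : ∑ t ∈ Finset.range (n + 1), f t ≤ ∑ t ∈ Finset.range (n + 1), g t :=
    Finset.sum_le_sum fun t _ => h t
  have h2 : ∑ t ∈ Finset.range (n + 1), g t ≤ ∑ t ∈ Finset.range (n + 1), f t + (n + 1) := by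
    have := Finset.sum_le_sum fun t (_ : t ∈ Finset.range (n + 1)) => h' t
    rw [Finset.sum_add_distrib] at this
    simpa using this
  have h3 : ∑ t ∈ Finset.range (n + 1), f t = ∑ t ∈ Finset.range (n + 1), g t := by
    rw [ZMod.natCast_eq_natCast_iff] at hm
    have := (Nat.modEq_iff_dvd' h1).1 hm
    have := Nat.eq_zero_of_dvd_of_lt this (by omega)
    omega
  have := (Finset.sum_eq_sum_iff_of_le fun t _ => h t).1 h3
  intro t ht
  exact this t (Finset.mem_range.2 (by omega))

/-- the exponent sequence costs `O(log n)` -/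
theorem N_seq_eq {n : ℕ} {a b : S.Om} (h : ‖S.lam a - S.lam b‖ ≤ 1)
    (hm : ∀ j, ((∑ t ∈ Finset.range (n + 1), S.N t a j : ℕ) : ZMod (n + 2))
      = (∑ t ∈ Finset.range (n + 1), S.N t b j : ℕ)) :
    ∀ j t, t ≤ n → S.N t a j = S.N t b j := by
  intro j t ht
  have h2 : ‖S.lam b - S.lam a‖ ≤ 1 := by rwa [norm_sub_rev]
  rcases le_total (S.lam a j) (S.lam b j) with h1 | h1
  · exact sum_mod_eq (fun t => N_mono_lam h1) (fun t => S.N_near h2 j) (hm j) t ht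
  · exact (sum_mod_eq (fun t => N_mono_lam h1) (fun t => S.N_near h j) (hm j).symm t ht).symm

/-- the digits at the last time determine the others -/
theorem cd_of_last {n : ℕ} {a b : S.Om} (hN : ∀ j t, t ≤ n → S.N t a j = S.N t b j)
    (hl : ∀ j, (S.cd n a j).2 = (S.cd n b j).2) : (S.Wv n).rel a b := by
  rw [Wv_rel]
  intro t ht j
  obtain ⟨k, rfl⟩ := Nat.exists_eq_add_of_le ht
  have h1 := S.cd_add t k a j
  have h2 := S.cd_add t k b j
  have e1 : (S.cd k (S.sh t a) j).1 = (S.cd k (S.sh t b) j).1 := by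
    have h3 : S.N (t + k) a j = S.N (t + k) b j := hN j (t + k) le_rfl
    rw [S.N_add, S.N_add, hN j t ht] at h3
    exact Nat.add_left_cancel h3
  have h5 := hl j
  rw [h1, h2] at h5
  simp only [e1] at h5
  have b1 := S.cd_snd_lt k (S.sh t a) j
  have b2 := S.cd_snd_lt k (S.sh t b) j
  rw [e1] at b1
  have hpos : (0:ℤ) < (S.p j : ℤ) ^ (S.cd k (S.sh t b) j).1 := lt_of_le_of_lt b2.1 b2.2
  have key : (S.cd t a j).2 = (S.cd t b j).2 := by
    have e3 : ((S.p j : ℤ) ^ (S.cd k (S.sh t b) j).1 * (S.cd t a j).2 + (S.cd k (S.sh t a) j).2)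
        / (S.p j : ℤ) ^ (S.cd k (S.sh t b) j).1 = (S.cd t a j).2 := by
      rw [Int.mul_add_ediv_left _ _ hpos.ne', Int.ediv_eq_zero_of_lt b1.1 b1.2, add_zero]
    have e4 : ((S.p j : ℤ) ^ (S.cd k (S.sh t b) j).1 * (S.cd t b j).2 + (S.cd k (S.sh t b) j).2)
        / (S.p j : ℤ) ^ (S.cd k (S.sh t b) j).1 = (S.cd t b j).2 := by
      rw [Int.mul_add_ediv_left _ _ hpos.ne', Int.ediv_eq_zero_of_lt b2.1 b2.2, add_zero]
    rw [← e3, ← e4, h5]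
  exact Prod.ext (hN j t ht) key

/-- `W_n` from `q` and `lam` -/
theorem gam_inj {P : W d →ₗ[ℝ] (ι → ℝ)} (h : LinearMap.ker P = ⊥) :
    ∃ C, ∀ (E : St S.Om) (n : ℕ), S.gam E P n ≤ d * Real.log (n + 2) + C := by
  obtain ⟨c, hc, hT⟩ := exists_factor (P := LinearMap.id (R := ℝ) (M := W d)) (P' := P)
    (by rw [h]; exact bot_le)
  have hM := S.M_pos
  refine ⟨d * KK (S.M * (c + 1)), fun E n => ?_⟩
  set Z : RV S.Om := RV.ofF (fun ω (j : Fin d) =>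
    ((∑ t ∈ Finset.range (n + 1), S.N t ω j : ℕ) : ZMod (n + 2))) with hZ
  have hZrel : ∀ a b, (Z ⊔ S.Dv P n).rel a b → ∀ j t, t ≤ n → S.N t a j = S.N t b j := by
    intro a b k
    exact N_seq_eq (S.Lv_close1 k.2.2) fun j => congrFun k.1 j
  have h1 : E.cH Z (S.Dv P n) ≤ d * Real.log (n + 2) := by
    have := E.cH_le_card Z (S.Dv P n) (fun ω (j : Fin d) =>
      ((∑ t ∈ Finset.range (n + 1), S.N t ω j : ℕ) : ZMod (n + 2))) (fun a b _ k => k)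
    refine this.trans (le_of_eq ?_)
    rw [Fintype.card_fun, ZMod.card, Fintype.card_fin]
    push_cast
    rw [Real.log_pow]
  set u : S.Om → Fin d → ℝ := fun ω j => (S.p j : ℝ) ^ (S.N n ω j) * S.y ω j with hu
  have hBu : Bd u := by
    refine ⟨S.M * 2 ^ n, fun ω j => ?_⟩
    have h2 := S.ratio_inv_le n ω j
    rw [div_le_iff₀ (by positivity)] at h2
    have hp := S.p_pos j
    have hy := S.y_nonneg ω j
    rw [hu]
    simp only
    rw [abs_of_nonneg (by positivity)]
    have h3 := mul_le_mul h2 (S.y_lt ω j).le hy (by positivity)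
    linarith
  have h2 : E.cH (fl u hBu) (Z ⊔ S.Dv P n) ≤ d * KK (S.M * (c + 1)) := by
    have := cH_fln E (h := hBu) (Y := Z ⊔ S.Dv P n) (c := S.M * (c + 1)) fun a b k => ?_
    · rwa [Fintype.card_fin] at this
    refine (pi_norm_le_iff_of_nonneg (by positivity)).2 fun j => ?_
    have hp := S.p_pos j
    rw [Pi.sub_apply, hu]
    simp only
    rw [hZrel a b k j n le_rfl, ← mul_sub, norm_mul, Real.norm_eq_abs, abs_of_pos (by positivity)]
    have h3 := S.ratio_inv_le n b j
    rw [div_le_iff₀ (by positivity)] at h3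
    have h4 : ‖S.q a - S.q b‖ ≤ c * (1 / 2 ^ n) :=
      (hT _).trans (mul_le_mul_of_nonneg_left (S.Gv_close k.2.1) hc)
    have h5 : ‖S.y a j - S.y b j‖ ≤ (c + 1) / 2 ^ n := by
      have h6 := (norm_le_pi_norm (S.q a - S.q b) j).trans h4
      have h7 := (norm_le_pi_norm (S.lam a - S.lam b) j).trans (S.Lv_close k.2.2)
      have e : S.lam a j * (S.y a j - S.y b j) = (S.q a - S.q b) j - (S.lam a - S.lam b) j * S.y b j := by
        simp only [q, Pi.sub_apply, Pi.mul_apply]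
        ring
      have h8 : ‖S.lam a j * (S.y a j - S.y b j)‖ ≤ (c + 1) / 2 ^ n := by
        rw [e]
        refine (norm_sub_le _ _).trans ?_
        rw [norm_mul, Real.norm_eq_abs (S.y b j), abs_of_nonneg (S.y_nonneg b j)]
        have h9 := mul_le_mul h7 (S.y_lt b j).le (S.y_nonneg b j) (by positivity)
        refine (add_le_add h6 h9).trans (le_of_eq ?_)
        ring
      rw [norm_mul, Real.norm_eq_abs (S.lam a j), abs_of_nonneg (zero_le_one.trans (S.lam_ge a j))] at h8
      have h9 := mul_le_mul_of_nonneg_right (S.lam_ge a j) (norm_nonneg (S.y a j - S.y b j))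
      linarith
    refine (mul_le_mul h3 h5 (norm_nonneg _) (by positivity)).trans (le_of_eq ?_)
    field_simp
  have h3 : E.cH (S.Wv n) (Z ⊔ S.Dv P n) ≤ E.cH (fl u hBu) (Z ⊔ S.Dv P n) := by
    rw [← E.cH_absorb (fl u hBu)]
    refine E.cH_mono ?_ _
    intro a b k
    refine cd_of_last (hZrel a b k.2) fun j => ?_
    have := fl_rel.1 k.1 j
    exact this
  have h4 := E.cH_add (S.Wv n) (S.Dv P n) Z
  unfold gam
  linarith

theorem gamma_inj {E : St S.Om} (hE : S.Stat E) {P : W d →ₗ[ℝ] (ι → ℝ)} (h : LinearMap.ker P = ⊥) :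
    S.gamma E P = 0 := by
  refine le_antisymm ?_ (gamma_nonneg hE P)
  obtain ⟨C, hC⟩ := gam_inj (S := S) h
  have t1 : Tendsto (fun n : ℕ => ((d * Real.log (n + 2) + C) : ℝ) / n) atTop (𝓝 0) := by
    have h1 : Tendsto (fun n : ℕ => Real.log ((n:ℝ) + 2) / ((n:ℝ) + 2)) atTop (𝓝 0) := by
      have := (Real.isLittleO_log_id_atTop.tendsto_div_nhds_zero).comp
        (tendsto_atTop_add_const_right atTop (2:ℝ) tendsto_natCast_atTop_atTop)
      exact this
    have h2 : Tendsto (fun n : ℕ => ((n:ℝ) + 2) / n) atTop (𝓝 1) := by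
      have h3 : Tendsto (fun n : ℕ => 1 + 2 / (n:ℝ)) atTop (𝓝 (1 + 0)) :=
        tendsto_const_nhds.add (tendsto_const_div_atTop_nhds_zero_nat 2)
      rw [add_zero] at h3
      refine h3.congr' ?_
      filter_upwards [eventually_gt_atTop 0] with n hn
      have hn' : (0:ℝ) < n := by exact_mod_cast hn
      field_simp
    have h4 := ((h1.mul h2).const_mul (d:ℝ)).add (tendsto_const_div_atTop_nhds_zero_nat C)
    simp only [zero_mul, mul_zero, add_zero] at h4
    refine h4.congr fun n => ?_
    have hn2 : (0:ℝ) < (n:ℝ) + 2 := by positivity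
    field_simp
  refine le_of_tendsto_of_tendsto (gamma_tendsto hE P) t1 (Eventually.of_forall fun n => ?_)
  exact div_le_div_of_nonneg_right (hC E n) (Nat.cast_nonneg n)

end Sys
end FHR

namespace FHR

/-- small elements of a closed subgroup lie on lines of the subgroup -/
theorem small_line {d : ℕ} (Γ : AddSubgroup (Fin d → ℝ)) (hΓ : IsClosed (Γ : Set (Fin d → ℝ))) :
    ∃ ε : ℝ, 0 < ε ∧ ∀ x ∈ Γ, ‖x‖ < ε → ∀ t : ℝ, t • x ∈ Γ := by
  let L : Submodule ℝ (Fin d → ℝ) :=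
    { carrier := {a | ∀ t : ℝ, t • a ∈ Γ}
      add_mem' := fun {a b} ha hb t => by
        rw [smul_add]
        exact Γ.add_mem (ha t) (hb t)
      zero_mem' := fun t => by
        rw [smul_zero]
        exact Γ.zero_mem
      smul_mem' := fun c a ha t => by
        rw [smul_smul]
        exact ha _ }
  have hLΓ : ∀ a ∈ L, a ∈ Γ := fun a ha => by simpa using ha 1
  obtain ⟨L', hL'⟩ := L.exists_isCompl
  by_contra hc
  push Not at hc
  have hx : ∀ n : ℕ, ∃ x ∈ Γ, ‖x‖ < 1 / ((n:ℝ) + 1) ∧ x ∉ L := by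
    intro n
    obtain ⟨x, h1, h2, t, h3⟩ := hc (1 / ((n:ℝ) + 1)) (by positivity)
    exact ⟨x, h1, h2, fun h => h3 (h t)⟩
  choose x hxΓ hxn hxL using hx
  let pr : (Fin d → ℝ) →ₗ[ℝ] (Fin d → ℝ) := L'.subtype ∘ₗ L'.projectionOnto L hL'.symm
  have hpr : ∀ z, z - pr z ∈ L := by
    intro z
    rw [← Submodule.ker_projectionOnto hL'.symm, LinearMap.mem_ker, map_sub]
    simp only [pr, LinearMap.comp_apply, Submodule.subtype_apply]
    rw [Submodule.projectionOnto_apply_left, sub_self]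
  have hprL : ∀ z, pr z ∈ L' := fun z => (L'.projectionOnto L hL'.symm z).2
  let y : ℕ → (Fin d → ℝ) := fun n => pr (x n)
  have hyΓ : ∀ n, y n ∈ Γ := by
    intro n
    have := Γ.sub_mem (hxΓ n) (hLΓ _ (hpr (x n)))
    simpa [y] using this
  have hy0 : ∀ n, y n ≠ 0 := by
    intro n h
    have := hpr (x n)
    have h' : pr (x n) = 0 := h
    rw [h', sub_zero] at this
    exact hxL n this
  have hxt : Tendsto x atTop (𝓝 0) := by
    rw [tendsto_zero_iff_norm_tendsto_zero]
    exact squeeze_zero (fun n => norm_nonneg _) (fun n => (hxn n).le) tendsto_one_div_add_atTop_nhds_zero_nat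
  have hyt : Tendsto y atTop (𝓝 0) := by
    have := (LinearMap.continuous_of_finiteDimensional pr).tendsto 0
    rw [map_zero] at this
    exact this.comp hxt
  have hynt := tendsto_zero_iff_norm_tendsto_zero.1 hyt
  have hpos : ∀ n, 0 < ‖y n‖ := fun n => norm_pos_iff.2 (hy0 n)
  let u : ℕ → (Fin d → ℝ) := fun n => ‖y n‖⁻¹ • y n
  have hu1 : ∀ n, u n ∈ Metric.sphere (0 : Fin d → ℝ) 1 := by
    intro n
    rw [mem_sphere_zero_iff_norm, norm_smul, norm_inv, norm_norm, inv_mul_cancel₀ (hpos n).ne']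
  obtain ⟨v, hv, φ, hφ, hlim⟩ := (isCompact_sphere (0 : Fin d → ℝ) 1).tendsto_subseq hu1
  have hvL' : v ∈ L' := by
    refine (Submodule.closed_of_finiteDimensional L').mem_of_tendsto hlim (Eventually.of_forall fun n => ?_)
    exact L'.smul_mem _ (hprL _)
  have hvL : v ∈ L := by
    intro t
    have hk : ∀ n, (⌊t / ‖y n‖⌋ : ℤ) • y n ∈ Γ := fun n => Γ.zsmul_mem (hyΓ n) _
    refine hΓ.mem_of_tendsto (b := atTop) (f := fun n => (⌊t / ‖y (φ n)‖⌋ : ℤ) • y (φ n)) ?_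
      (Eventually.of_forall fun n => hk _)
    have h1 : Tendsto (fun n => t • u (φ n)) atTop (𝓝 (t • v)) := hlim.const_smul t
    have h2 : Tendsto (fun n => (⌊t / ‖y (φ n)‖⌋ : ℤ) • y (φ n) - t • u (φ n)) atTop (𝓝 0) := by
      rw [tendsto_zero_iff_norm_tendsto_zero]
      refine squeeze_zero (fun n => norm_nonneg _) (fun n => ?_) (hynt.comp hφ.tendsto_atTop)
      have e : (⌊t / ‖y (φ n)‖⌋ : ℤ) • y (φ n) - t • u (φ n)
          = ((⌊t / ‖y (φ n)‖⌋ : ℝ) - t / ‖y (φ n)‖) • y (φ n) := by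
        simp only [u]
        rw [smul_smul, sub_smul, ← Int.cast_smul_eq_zsmul ℝ, div_eq_mul_inv]
      rw [e, norm_smul, Real.norm_eq_abs]
      have h3 := Int.floor_le (t / ‖y (φ n)‖)
      have h4 := Int.lt_floor_add_one (t / ‖y (φ n)‖)
      have h5 : |(⌊t / ‖y (φ n)‖⌋ : ℝ) - t / ‖y (φ n)‖| ≤ 1 := by
        rw [abs_le]
        constructor <;> linarith
      simpa using mul_le_mul_of_nonneg_right h5 (norm_nonneg (y (φ n)))
    have h3 := h2.add h1
    simpa using h3
  have : v ∈ L ⊓ L' := ⟨hvL, hvL'⟩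
  rw [hL'.inf_eq_bot, Submodule.mem_bot] at this
  rw [mem_sphere_zero_iff_norm, this, norm_zero] at hv
  exact zero_ne_one hv

/-- simultaneous Dirichlet -/
theorem dirichlet {d : ℕ} (l : Fin d → ℝ) (hl : ∀ j, 0 < l j) (x : ℝ) (ε : ℝ) (hε : 0 < ε) :
    ∃ K : ℕ, 1 ≤ K ∧ ∃ k : Fin d → ℤ, ∀ j, |K * x - k j * l j| ≤ ε := by
  let f : ℕ → Fin d → ℝ := fun n j => Int.fract (n * x / l j)
  have hf : ∀ n, f n ∈ Set.Icc (0 : Fin d → ℝ) 1 := fun n =>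
    ⟨fun j => Int.fract_nonneg _, fun j => (Int.fract_lt_one _).le⟩
  obtain ⟨v, _, φ, hφ, hlim⟩ := (isCompact_Icc (a := (0 : Fin d → ℝ)) (b := 1)).tendsto_subseq hf
  have hc := hlim.cauchySeq
  rw [Metric.cauchySeq_iff] at hc
  let m : ℝ := 1 + ∑ j, l j
  have hm : ∀ j, l j ≤ m := fun j => by
    have := Finset.single_le_sum (f := l) (fun j _ => (hl j).le) (Finset.mem_univ j)
    simp only [m]
    linarith
  have hm0 : 0 < m := by
    have : 0 ≤ ∑ j, l j := Finset.sum_nonneg fun j _ => (hl j).le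
    simp only [m]
    linarith
  obtain ⟨N, hN⟩ := hc (ε / m) (by positivity)
  have h1 := hN (N + 1) (by omega) N le_rfl
  have h2 : φ N < φ (N + 1) := hφ (Nat.lt_succ_self N)
  refine ⟨φ (N + 1) - φ N, by omega, fun j => ⌊(φ (N + 1) : ℝ) * x / l j⌋ - ⌊(φ N : ℝ) * x / l j⌋, fun j => ?_⟩
  have h3 : |f (φ (N + 1)) j - f (φ N) j| ≤ ε / m := by
    have := (dist_le_pi_dist (f (φ (N + 1))) (f (φ N)) j).trans h1.le
    rwa [Real.dist_eq] at this
  rw [Nat.cast_sub h2.le]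
  have e : ((φ (N + 1) : ℝ) - φ N) * x - ((⌊(φ (N + 1) : ℝ) * x / l j⌋ - ⌊(φ N : ℝ) * x / l j⌋ : ℤ) : ℝ) * l j
      = (f (φ (N + 1)) j - f (φ N) j) * l j := by
    simp only [f, Int.fract]
    have := (hl j).ne'
    push_cast
    field_simp
    ring
  rw [e, abs_mul, abs_of_pos (hl j)]
  calc _ ≤ ε / m * m := mul_le_mul h3 (hm j) (hl j).le (by positivity)
    _ = ε := by field_simp

theorem kronecker {d : ℕ} (l : Fin d → ℝ) (hl : ∀ j, 0 < l j) (x : ℝ) (hx : 0 < x)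
    (hind : ∀ i j, i ≠ j → Irrational (l i / l j)) :
    ∃ a : Fin d → ℝ, (∀ i j, i ≠ j → a i ≠ a j) ∧
      ∀ t ε : ℝ, 0 < ε → ∃ (K : ℕ) (k : Fin d → ℤ), ∀ j, |K * x - k j * l j - t * a j| ≤ ε := by
  let G : AddSubgroup (Fin d → ℝ) :=
    { carrier := {v | ∃ (K : ℤ) (k : Fin d → ℤ), v = fun j => K * x - k j * l j}
      add_mem' := by
        rintro _ _ ⟨K, k, rfl⟩ ⟨K', k', rfl⟩
        refine ⟨K + K', k + k', ?_⟩
        funext j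
        simp only [Pi.add_apply]
        push_cast
        ring
      zero_mem' := ⟨0, 0, by funext j; simp⟩
      neg_mem' := by
        rintro _ ⟨K, k, rfl⟩
        refine ⟨-K, -k, ?_⟩
        funext j
        simp only [Pi.neg_apply]
        push_cast
        ring }
  obtain ⟨ε0, hε0, hline⟩ := small_line G.topologicalClosure G.isClosed_topologicalClosure
  obtain ⟨K, hK, k, hk⟩ := dirichlet l hl x (min (ε0 / 2) (x / 2)) (by positivity)
  let a : Fin d → ℝ := fun j => K * x - k j * l j
  have haG : a ∈ G := ⟨K, k, by funext j; simp [a]⟩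
  have han : ‖a‖ < ε0 := by
    refine lt_of_le_of_lt ((pi_norm_le_iff_of_nonneg (by positivity)).2 fun j =>
      (hk j).trans (min_le_left _ _)) (by linarith)
  have hk0 : ∀ j, k j ≠ 0 := by
    intro j h
    have h1 := (hk j).trans (min_le_right _ _)
    rw [h] at h1
    have h2 : (1:ℝ) ≤ K := by exact_mod_cast hK
    rw [Int.cast_zero, zero_mul, sub_zero, abs_of_pos (by positivity)] at h1
    nlinarith
  refine ⟨a, ?_, ?_⟩
  · intro i j hij h
    have h1 : (k i : ℝ) * l i = k j * l j := by
      simp only [a] at h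
      linarith
    have h2 : l i / l j = ((k j : ℚ) / (k i : ℚ) : ℚ) := by
      have h3 : (k i : ℝ) ≠ 0 := by exact_mod_cast hk0 i
      have h4 := (hl j).ne'
      push_cast
      rw [div_eq_div_iff h4 h3]
      linarith
    exact hind i j hij ⟨_, h2.symm⟩
  · intro t ε hε
    have h1 := hline a (G.le_topologicalClosure haG) han t
    have h2 : t • a ∈ closure (G : Set (Fin d → ℝ)) := h1
    rw [Metric.mem_closure_iff] at h2
    obtain ⟨_, ⟨K1, k1, rfl⟩, h3⟩ := h2 (ε / 2) (by positivity)
    have h4 : ∀ j, |K1 * x - k1 j * l j - t * a j| ≤ ε / 2 := by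
      intro j
      have := (dist_le_pi_dist _ _ j).trans h3.le
      rw [Real.dist_eq, abs_sub_comm] at this
      exact this
    obtain ⟨K2, hK2, k2, h5⟩ := dirichlet l hl x (ε / 2 / (K1.natAbs + 1)) (by positivity)
    have h6 : (0:ℤ) ≤ K1 + K1.natAbs * K2 := by
      have h7 : (K1.natAbs : ℤ) ≤ K1.natAbs * K2 := by
        have : (1:ℤ) ≤ K2 := by exact_mod_cast hK2
        nlinarith [Int.natCast_nonneg K1.natAbs]
      omega
    obtain ⟨Kn, hKn⟩ := Int.eq_ofNat_of_zero_le h6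
    refine ⟨Kn, fun j => k1 j + K1.natAbs * k2 j, fun j => ?_⟩
    have h7 : (Kn : ℝ) = K1 + ((K1.natAbs : ℕ) : ℝ) * K2 := by
      have := congrArg (fun z : ℤ => (z : ℝ)) hKn
      simp only [Int.cast_add, Int.cast_mul, Int.cast_natCast] at this
      exact this.symm
    rw [h7]
    set A : ℝ := (K1.natAbs : ℝ) with hA
    have hA0 : 0 ≤ A := Nat.cast_nonneg _
    have e : ((K1 : ℝ) + A * K2) * x - ((k1 j + K1.natAbs * k2 j : ℤ) : ℝ) * l j - t * a j
        = (K1 * x - k1 j * l j - t * a j) + A * (K2 * x - k2 j * l j) := by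
      push_cast
      rw [hA, Nat.cast_natAbs]
      push_cast
      ring
    rw [e]
    refine (abs_add_le _ _).trans ?_
    rw [abs_mul, abs_of_nonneg hA0]
    have h8 := mul_le_mul_of_nonneg_left (h5 j) hA0
    have h9 : A * (ε / 2 / (A + 1)) ≤ ε / 2 := by
      rw [← mul_div_assoc, div_le_iff₀ (by positivity)]
      nlinarith
    linarith [h4 j]

end FHR

namespace FHR
variable {α β : Type}

/-- bounded functions -/
def BF (α : Type) : Submodule ℝ (α → ℝ) where
  carrier := {f | ∃ C, ∀ a, |f a| ≤ C}
  add_mem' := by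
    rintro f g ⟨C, hC⟩ ⟨D, hD⟩
    exact ⟨C + D, fun a => (abs_add_le _ _).trans (add_le_add (hC a) (hD a))⟩
  zero_mem' := ⟨0, fun a => by simp⟩
  smul_mem' := by
    rintro c f ⟨C, hC⟩
    refine ⟨|c| * C, fun a => ?_⟩
    rw [Pi.smul_apply, smul_eq_mul, abs_mul]
    exact mul_le_mul_of_nonneg_left (hC a) (abs_nonneg _)

theorem BF_const (c : ℝ) : (fun _ : α => c) ∈ BF α := ⟨|c|, fun _ => le_rfl⟩

theorem BF_ind (s : α → Prop) : ind s ∈ BF α := ⟨1, fun b => by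
    rw [abs_of_nonneg (ind_nonneg _ _)]
    exact ind_le_one _ _⟩

theorem BF_comp (φ : β → α) {f : α → ℝ} (h : f ∈ BF α) : (fun b => f (φ b)) ∈ BF β := by
  obtain ⟨C, hC⟩ := h
  exact ⟨C, fun b => hC _⟩

theorem BF_mul {f g : α → ℝ} (hf : f ∈ BF α) (hg : g ∈ BF α) : (fun a => f a * g a) ∈ BF α := by
  obtain ⟨C, hC⟩ := hf
  obtain ⟨D, hD⟩ := hg
  refine ⟨C * D, fun a => ?_⟩
  rw [abs_mul]
  exact mul_le_mul (hC a) (hD a) (abs_nonneg _) ((abs_nonneg _).trans (hC a))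

structure IsMean (x : BF α → ℝ) : Prop where
  add : ∀ f g, x (f + g) = x f + x g
  smul : ∀ (c : ℝ) f, x (c • f) = c * x f
  pos : ∀ f : BF α, (∀ a, 0 ≤ f.1 a) → 0 ≤ x f
  one : x ⟨fun _ => 1, BF_const 1⟩ = 1

theorem IsMean.exists_st {x : BF α → ℝ} (h : IsMean x) : ∃ E : St α, ∀ f : BF α, E.E f.1 = x f := by
  let L : BF α →ₗ[ℝ] ℝ := { toFun := x, map_add' := h.add, map_smul' := h.smul }
  obtain ⟨g, hg⟩ := LinearMap.exists_extend L
  have hg' : ∀ f : BF α, g f.1 = x f := fun f => LinearMap.congr_fun hg f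
  refine ⟨⟨g, ?_, ?_⟩, hg'⟩
  · rintro f ⟨C, hC⟩ hf
    have hb : f ∈ BF α := ⟨C, fun a => by
      rw [abs_of_nonneg (hf a)]
      exact hC a⟩
    rw [hg' ⟨f, hb⟩]
    exact h.pos _ hf
  · rw [hg' ⟨_, BF_const 1⟩]
    exact h.one

theorem St.bdd (E : St α) {f : α → ℝ} {C : ℝ} (h : ∀ a, |f a| ≤ C) : |E.E f| ≤ C := by
  rw [abs_le]
  constructor
  · have := E.mono (f := fun _ => -C) (g := f) ⟨C + C, fun a => by
      have := (abs_le.1 (h a)).2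
      linarith⟩ (fun a => (abs_le.1 (h a)).1)
    rwa [E.const] at this
  · have := E.mono (f := f) (g := fun _ => C) ⟨C + C, fun a => by
      have := (abs_le.1 (h a)).1
      linarith⟩ (fun a => (abs_le.1 (h a)).2)
    rwa [E.const] at this

theorem St.isMean (E : St α) : IsMean (fun f : BF α => E.E f.1) where
  add := fun f g => E.E.map_add _ _
  smul := fun c f => E.E.map_smul _ _
  pos := fun f hf => by
    obtain ⟨C, hC⟩ := f.2
    exact E.pos _ ⟨C, fun a => (le_abs_self _).trans (hC a)⟩ hf
  one := E.one

theorem ulim_real (U : Ultrafilter ℕ) (u : ℕ → ℝ) (C : ℝ) (h : ∀ l, |u l| ≤ C) :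
    ∃ a, Tendsto u U (𝓝 a) := by
  have hm : (U.map u : Filter ℝ) ≤ 𝓟 (Set.Icc (-C) C) := by
    rw [le_principal_iff]
    exact Filter.mem_map.2 (Filter.univ_mem' fun l => abs_le.1 (h l))
  obtain ⟨a, _, ha⟩ := isCompact_Icc.ultrafilter_le_nhds (U.map u) hm
  exact ⟨a, ha⟩

theorem St.ulim (E : ℕ → St α) (U : Ultrafilter ℕ) :
    ∃ E' : St α, ∀ f ∈ BF α, Tendsto (fun l => (E l).E f) U (𝓝 (E'.E f)) := by
  have h : ∀ f : BF α, ∃ a, Tendsto (fun l => (E l).E f.1) U (𝓝 a) := by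
    intro f
    obtain ⟨C, hC⟩ := f.2
    exact ulim_real U _ C fun l => (E l).bdd hC
  choose x hx using h
  have hm : IsMean x :=
    { add := fun f g => by
        refine tendsto_nhds_unique (hx _) (((hx f).add (hx g)).congr fun l => ?_)
        exact ((E l).E.map_add _ _).symm
      smul := fun c f => by
        refine tendsto_nhds_unique (hx _) (((hx f).const_mul c).congr fun l => ?_)
        exact ((E l).E.map_smul _ _).symm
      pos := fun f hf => ge_of_tendsto (hx f) (Eventually.of_forall fun l => (E l).isMean.pos f hf)
      one := by
        refine tendsto_nhds_unique (hx _) (tendsto_const_nhds.congr fun l => ?_)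
        exact (E l).one.symm }
  obtain ⟨E', hE'⟩ := hm.exists_st
  refine ⟨E', fun f hf => ?_⟩
  rw [hE' ⟨f, hf⟩]
  exact hx ⟨f, hf⟩

theorem St.H_eq (E : St α) (X : RV α) : E.H X = ∑ c : X.Q, Real.negMulLog (E.pr X c.out) := by
  unfold St.H
  rw [E.E_meas X _ fun a b hab => by rw [E.pr_congr hab]]
  refine Finset.sum_congr rfl fun c _ => ?_
  unfold Real.negMulLog
  ring

theorem St.tendsto_cH {E : ℕ → St α} {U : Ultrafilter ℕ} {E' : St α}
    (h : ∀ f ∈ BF α, Tendsto (fun l => (E l).E f) U (𝓝 (E'.E f))) (X Y : RV α) :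
    Tendsto (fun l => (E l).cH X Y) U (𝓝 (E'.cH X Y)) := by
  have h1 : ∀ Z : RV α, Tendsto (fun l => (E l).H Z) U (𝓝 (E'.H Z)) := by
    intro Z
    simp only [St.H_eq]
    exact tendsto_finsetSum _ fun c _ => (Real.continuous_negMulLog.tendsto _).comp (h _ (BF_ind _))
  exact (h1 _).sub (h1 _)

/-- entropy functionals on means -/
def xH (x : BF α → ℝ) (X : RV α) : ℝ := ∑ c : X.Q, Real.negMulLog (x ⟨ind (X.rel c.out), BF_ind _⟩)

theorem xH_eq {x : BF α → ℝ} {E : St α} (h : ∀ f : BF α, E.E f.1 = x f) (X : RV α) : xH x X = E.H X := by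
  rw [E.H_eq]
  unfold xH St.pr
  simp only [← h]

theorem xH_cont (X : RV α) : Continuous fun x : BF α → ℝ => xH x X :=
  continuous_finsetSum _ fun c _ => Real.continuous_negMulLog.comp (continuous_apply _)

def half (E E' : St α) : St α := (St.mix (κ := Bool) fun b => cond b E E').map Prod.fst

theorem half_E (E E' : St α) (f : α → ℝ) : (half E E').E f = (E.E f + E'.E f) / 2 := by
  unfold half
  rw [St.map_E, St.mix_E]
  simp
  ring

theorem half_cH (E E' : St α) (X Y : RV α) :
    (half E E').cH X Y ≤ (E.cH X Y + E'.cH X Y) / 2 + Real.log 2 := by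
  unfold half
  rw [St.cH_map]
  refine (St.cH_add _ _ _ St.lab).trans ?_
  rw [sup_comm, St.mix_cH]
  have h2 := (St.mix (κ := Bool) fun b => cond b E E').cH_le_H St.lab (Y.comap Prod.fst)
  rw [St.mix_H_lab] at h2
  simp only [Fintype.card_bool, Fintype.sum_bool] at h2 ⊢
  have e : ∀ (E : St α) (b : Bool), E.cH ((X.comap Prod.fst).comap fun a => (a, b)) ((Y.comap Prod.fst).comap fun a => (a, b))
    = E.cH X Y := fun _ _ => rfl
  rw [e, e]
  norm_num at h2 ⊢
  linarith

end FHR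

namespace FHR
namespace Sys
variable {d : ℕ} {S : Sys d} {ι κ : Type} [Fintype ι] [Fintype κ]

theorem half_stat {E E' : St S.Om} (hE : S.Stat E) (hE' : S.Stat E') : S.Stat (half E E') := by
  intro n f hf
  have h1 := hE n f hf
  have h2 := hE' n f hf
  rw [St.map_E] at h1 h2 ⊢
  rw [half_E, half_E, h1, h2]

theorem gamma_half {E E' : St S.Om} (hE : S.Stat E) (hE' : S.Stat E') (P : W d →ₗ[ℝ] (ι → ℝ)) :
    S.gamma (half E E') P ≤ (S.gamma E P + S.gamma E' P) / 2 := by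
  have h1 := gamma_tendsto (half_stat hE hE') P
  have h2 := ((gamma_tendsto hE P).add (gamma_tendsto hE' P)).div_const 2
  have h3 : Tendsto (fun n : ℕ => Real.log 2 / n) atTop (𝓝 0) := tendsto_const_div_atTop_nhds_zero_nat _
  have h4 := h2.add h3
  rw [add_zero] at h4
  refine le_of_tendsto_of_tendsto' h1 h4 fun n => ?_
  have := half_cH E E' (S.Wv n) (S.Dv P n)
  have e : (S.gam E P n / n + S.gam E' P n / n) / 2 + Real.log 2 / n
    = ((S.gam E P n + S.gam E' P n) / 2 + Real.log 2) / n := by ring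
  rw [e]
  exact div_le_div_of_nonneg_right this (Nat.cast_nonneg _)

theorem stat_of_lim {E : ℕ → St S.Om} {U : Ultrafilter ℕ} {E' : St S.Om}
    (h : ∀ f ∈ BF S.Om, Tendsto (fun l => (E l).E f) U (𝓝 (E'.E f))) (hE : ∀ l, S.Stat (E l)) : S.Stat E' := by
  intro n f hf
  rw [St.map_E]
  refine tendsto_nhds_unique (h _ (BF_comp (S.sh n) hf)) ((h f hf).congr fun l => ?_)
  exact (hE l n f hf).symm

theorem gamma_ge {E : St S.Om} (hE : S.Stat E) (P : W d →ₗ[ℝ] (ι → ℝ)) (c C : ℝ)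
    (h : ∀ n : ℕ, c * n - C ≤ S.gam E P n) : c ≤ S.gamma E P := by
  have h3 : Tendsto (fun n : ℕ => c - C / n) atTop (𝓝 (c - 0)) :=
    tendsto_const_nhds.sub (tendsto_const_div_atTop_nhds_zero_nat _)
  rw [sub_zero] at h3
  refine le_of_tendsto_of_tendsto h3 (gamma_tendsto hE P) ?_
  filter_upwards [eventually_gt_atTop 0] with n hn
  have hn' : (0:ℝ) < n := by exact_mod_cast hn
  rw [le_div_iff₀ hn', sub_mul, div_mul_cancel₀ _ hn'.ne']
  exact h n

theorem exists_max {E0 : St S.Om} (hE0 : S.Stat E0) (P : W d →ₗ[ℝ] (ι → ℝ)) :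
    ∃ E, S.Stat E ∧ S.gamma E0 P ≤ S.gamma E P ∧ ∀ E', S.Stat E' → S.gamma E' P ≤ S.gamma E P := by
  obtain ⟨c, hP⟩ := exists_Bn P
  let A : Set ℝ := {g | ∃ E, S.Stat E ∧ S.gamma E P = g}
  have hb : BddAbove A := by
    refine ⟨Real.log (Nat.card (S.Wv 1).Q) + S.cS ι c, ?_⟩
    rintro _ ⟨E, hE, rfl⟩
    have h1 := gamma_le hE hP 1
    have h2 : S.gam E P 1 ≤ E.H (S.Wv 1) := E.cH_le_H _ _
    have h3 := E.H_le_card (S.Wv 1) (S.Wv 1).mkq (fun a b h => (S.Wv 1).mkq_eq.1 h)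
    simp only [Nat.cast_one, mul_one] at h1
    have h4 : ((Fintype.card (S.Wv 1).Q : ℕ) : ℝ) = Nat.card (S.Wv 1).Q := by
      rw [Nat.card_eq_fintype_card]
    rw [← h4]
    linarith
  have hne : A.Nonempty := ⟨_, E0, hE0, rfl⟩
  obtain ⟨u, -, hu, huA⟩ := exists_seq_tendsto_sSup hne hb
  choose E hE hEu using huA
  obtain ⟨E', hE'⟩ := St.ulim E (hyperfilter ℕ)
  have hs : S.Stat E' := stat_of_lim hE' hE
  have key : sSup A ≤ S.gamma E' P := by
    refine gamma_ge hs P _ (S.cS ι c) fun n => ?_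
    have h1 : Tendsto u (hyperfilter ℕ) (𝓝 (sSup A)) := hu.mono_left Nat.hyperfilter_le_atTop
    refine le_of_tendsto_of_tendsto' ((h1.mul_const (n:ℝ)).sub_const (S.cS ι c)) (St.tendsto_cH hE' _ _) fun l => ?_
    rw [← hEu l]
    exact gamma_le (hE l) hP n
  exact ⟨E', hs, (le_csSup hb ⟨E0, hE0, rfl⟩).trans key, fun E'' h => (le_csSup hb ⟨E'', h, rfl⟩).trans key⟩

theorem exists_extreme {E0 : St S.Om} (hE0 : S.Stat E0) (P : W d →ₗ[ℝ] (ι → ℝ)) :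
    ∃ E, S.Stat E ∧ S.gamma E0 P ≤ S.gamma E P ∧
      ∀ E1 E2, S.Stat E1 → S.Stat E2 → St.Ag (half E1 E2) E → St.Ag E1 E := by
  obtain ⟨Em, hEm, hm0, hmax⟩ := exists_max hE0 P
  obtain ⟨c, hP⟩ := exists_Bn P
  set g := S.gamma Em P with hg
  let K : Set (BF S.Om → ℝ) := {x | (((∀ f g, x (f + g) = x f + x g) ∧ (∀ (c : ℝ) f, x (c • f) = c * x f)) ∧
    ((∀ f : BF S.Om, (∀ a, 0 ≤ f.1 a) → 0 ≤ x f) ∧ x ⟨fun _ => 1, BF_const 1⟩ = 1)) ∧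
    ((∀ (n : ℕ) (f : BF S.Om), x ⟨fun a => f.1 (S.sh n a), BF_comp _ f.2⟩ = x f) ∧
    (∀ n : ℕ, g * n - S.cS ι c ≤ xH x (S.Wv n ⊔ S.Dv P n) - xH x (S.Dv P n)))}
  have hK : ∀ x ∈ K, IsMean x := fun x hx => ⟨hx.1.1.1, hx.1.1.2, hx.1.2.1, hx.1.2.2⟩
  have hKs : ∀ x ∈ K, ∃ E, (∀ f : BF S.Om, E.E f.1 = x f) ∧ S.Stat E ∧ g ≤ S.gamma E P := by
    intro x hx
    obtain ⟨E, hE⟩ := (hK x hx).exists_st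
    have hs : S.Stat E := by
      intro n f hf
      rw [St.map_E]
      have := hx.2.1 n ⟨f, hf⟩
      rwa [← hE, ← hE] at this
    refine ⟨E, hE, hs, gamma_ge hs P _ (S.cS ι c) fun n => ?_⟩
    have := hx.2.2 n
    rwa [xH_eq hE, xH_eq hE] at this
  have hmem : ∀ E, S.Stat E → g ≤ S.gamma E P → (fun f : BF S.Om => E.E f.1) ∈ K := by
    intro E hE hge
    have hM := E.isMean
    refine ⟨⟨⟨hM.add, hM.smul⟩, hM.pos, hM.one⟩, fun n f => hE n f.1 f.2, fun n => ?_⟩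
    rw [xH_eq (E := E) fun _ => rfl, xH_eq (E := E) fun _ => rfl]
    have h1 := gamma_le hE hP n
    have h2 := mul_le_mul_of_nonneg_right hge (Nat.cast_nonneg (α := ℝ) n)
    have h3 : S.gam E P n = E.H (S.Wv n ⊔ S.Dv P n) - E.H (S.Dv P n) := rfl
    linarith
  have hcl : IsClosed K := by
    have ev : ∀ f : BF S.Om, Continuous fun x : BF S.Om → ℝ => x f := fun f => continuous_apply f
    have c1 : IsClosed {x : BF S.Om → ℝ | ∀ f g, x (f + g) = x f + x g} := by
      simp only [Set.ofPred_forall]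
      exact isClosed_iInter fun f => isClosed_iInter fun g => isClosed_eq (ev _) ((ev _).add (ev _))
    have c2 : IsClosed {x : BF S.Om → ℝ | ∀ (c : ℝ) f, x (c • f) = c * x f} := by
      simp only [Set.ofPred_forall]
      exact isClosed_iInter fun c => isClosed_iInter fun g => isClosed_eq (ev _) (continuous_const.mul (ev _))
    have c3 : IsClosed {x : BF S.Om → ℝ | ∀ f : BF S.Om, (∀ a, 0 ≤ f.1 a) → 0 ≤ x f} := by
      simp only [Set.ofPred_forall]
      exact isClosed_iInter fun f => isClosed_iInter fun g => isClosed_le continuous_const (ev _)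
    have c4 : IsClosed {x : BF S.Om → ℝ | x ⟨fun _ => 1, BF_const 1⟩ = 1} := isClosed_eq (ev _) continuous_const
    have c5 : IsClosed {x : BF S.Om → ℝ | ∀ (n : ℕ) (f : BF S.Om), x ⟨fun a => f.1 (S.sh n a), BF_comp _ f.2⟩ = x f} := by
      simp only [Set.ofPred_forall]
      exact isClosed_iInter fun n => isClosed_iInter fun g => isClosed_eq (ev _) (ev _)
    have c6 : IsClosed {x : BF S.Om → ℝ | ∀ n : ℕ, g * n - S.cS ι c ≤ xH x (S.Wv n ⊔ S.Dv P n) - xH x (S.Dv P n)} := by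
      simp only [Set.ofPred_forall]
      exact isClosed_iInter fun n => isClosed_le continuous_const ((xH_cont _).sub (xH_cont _))
    exact ((c1.inter c2).inter (c3.inter c4)).inter (c5.inter c6)
  have hcomp : IsCompact K := by
    choose C hC using fun f : BF S.Om => f.2
    refine IsCompact.of_isClosed_subset (isCompact_univ_pi fun f : BF S.Om =>
      isCompact_Icc (a := -C f) (b := C f)) hcl ?_
    intro x hx f _
    obtain ⟨E, hE, -⟩ := hKs x hx
    rw [← hE]
    exact abs_le.1 (E.bdd (hC f))
  obtain ⟨x, hx⟩ := hcomp.extremePoints_nonempty ⟨_, hmem Em hEm le_rfl⟩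
  obtain ⟨E, hE, hs, hge⟩ := hKs x hx.1
  refine ⟨E, hs, hm0.trans hge, fun E1 E2 h1 h2 hh => ?_⟩
  have hg1 := hmax E1 h1
  have hg2 := hmax E2 h2
  have hg3 := gamma_half h1 h2 P
  have hg4 : S.gamma (half E1 E2) P = S.gamma E P := by
    unfold gamma
    congr 1
    funext n
    unfold gam
    rw [hh.cH]
  have m1 := hmem E1 h1 (by linarith)
  have m2 := hmem E2 h2 (by linarith)
  have h3 : x ∈ openSegment ℝ (fun f : BF S.Om => E1.E f.1) (fun f : BF S.Om => E2.E f.1) := by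
    refine ⟨1/2, 1/2, by norm_num, by norm_num, by norm_num, ?_⟩
    funext f
    have := hh f.1 f.2
    rw [half_E, hE] at this
    simp only [Pi.add_apply, Pi.smul_apply, smul_eq_mul]
    linarith
  have h4 := (mem_extremePoints_iff_left.1 hx).2 _ m1 _ m2 h3
  intro f hf
  have := congrFun h4 ⟨f, hf⟩
  rw [hE ⟨f, hf⟩]
  exact this

/-- partial sums along the orbit -/
def Ts (S : Sys d) (f : S.Om → ℝ) (B : ℕ) (ω : S.Om) : ℝ := ∑ k ∈ Finset.range B, f (S.sh k ω)

theorem Ts_bdd {f : S.Om → ℝ} {C : ℝ} (h : ∀ a, |f a| ≤ C) (B : ℕ) (ω : S.Om) : |S.Ts f B ω| ≤ B * C := by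
  unfold Ts
  refine (Finset.abs_sum_le_sum_abs _ _).trans ?_
  refine (Finset.sum_le_sum fun k _ => h (S.sh k ω)).trans ?_
  simp

theorem Ts_succ (f : S.Om → ℝ) (B : ℕ) (ω : S.Om) : S.Ts f (B + 1) ω = f ω + S.Ts f B (S.sh 1 ω) := by
  unfold Ts
  rw [Finset.sum_range_succ', add_comm]
  congr 1
  refine Finset.sum_congr rfl fun k _ => ?_
  rw [S.sh_sh, add_comm]

theorem Ts_succ' (f : S.Om → ℝ) (B : ℕ) (ω : S.Om) : S.Ts f (B + 1) ω = S.Ts f B ω + f (S.sh B ω) :=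
  Finset.sum_range_succ _ _

theorem Ts_mean {E : St S.Om} (hE : S.Stat E) {f : S.Om → ℝ} (hf : f ∈ BF S.Om) (B : ℕ) :
    E.E (S.Ts f B) = B * E.E f := by
  have h : ∀ k, E.E (fun a => f (S.sh k a)) = E.E f := fun k => hE k f hf
  have : S.Ts f B = fun a => ∑ k ∈ Finset.range B, f (S.sh k a) := rfl
  rw [this, E.sum]
  simp [h]

def Erg (S : Sys d) (E : St S.Om) : Prop := ∀ f ∈ BF S.Om, ∀ ε > 0, ∃ B0 : ℕ, ∀ B ≥ B0,
  E.E (fun a => (S.Ts f B a - B * E.E f) ^ 2) ≤ ε * B ^ 2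

theorem erg_corr {E : St S.Om} (hE : S.Stat E)
    (hx : ∀ E1 E2, S.Stat E1 → S.Stat E2 → St.Ag (half E1 E2) E → St.Ag E1 E)
    (f : S.Om → ℝ) (C : ℝ) (hC : ∀ a, |f a| ≤ C) (hf0 : E.E f = 0) :
    Tendsto (fun B : ℕ => E.E (fun a => f a * (S.Ts f B a / B))) atTop (𝓝 0) := by
  rw [tendsto_iff_ultrafilter]
  intro U hU
  have hav : ∀ (B : ℕ) a, |S.Ts f B a / B| ≤ C := by
    intro B a
    rw [abs_div, Nat.abs_cast]
    rcases Nat.eq_zero_or_pos B with h | h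
    · subst h
      simpa using (abs_nonneg _).trans (hC a)
    · rw [div_le_iff₀ (by exact_mod_cast h), mul_comm]
      exact Ts_bdd hC B a
  have hC0 : 0 ≤ C := by
    obtain ⟨a⟩ := E.nonempty_of
    exact (abs_nonneg _).trans (hC a)
  have hC1 : (0:ℝ) < C + 1 := by linarith
  have hlim : ∀ g : BF S.Om, ∃ z, Tendsto (fun B : ℕ => E.E (fun a => g.1 a * (S.Ts f B a / B))) U (𝓝 z) := by
    intro g
    obtain ⟨D, hD⟩ := g.2
    refine ulim_real U _ (D * C) fun B => E.bdd fun a => ?_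
    rw [abs_mul]
    exact mul_le_mul (hD a) (hav B a) (abs_nonneg _) ((abs_nonneg _).trans (hD a))
  choose z hz using hlim
  have zadd : ∀ g h, z (g + h) = z g + z h := fun g h => by
    refine tendsto_nhds_unique (hz _) (((hz g).add (hz h)).congr fun B => ?_)
    rw [← E.add]
    congr 1
    funext a
    show _ = (g.1 a + h.1 a) * _
    ring
  have zsmul : ∀ (c : ℝ) g, z (c • g) = c * z g := fun c g => by
    refine tendsto_nhds_unique (hz _) (((hz g).const_mul c).congr fun B => ?_)
    rw [← E.smul]
    congr 1
    funext a
    show _ = (c * g.1 a) * _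
    ring
  have zone : z ⟨fun _ => 1, BF_const 1⟩ = 0 := by
    refine tendsto_nhds_unique (hz _) (tendsto_const_nhds.congr fun B => ?_)
    have : (fun a => (1:ℝ) * (S.Ts f B a / B)) = fun a => S.Ts f B a * (B:ℝ)⁻¹ := by
      funext a
      rw [one_mul, div_eq_mul_inv]
    rw [this, E.smul', Ts_mean hE ⟨C, hC⟩, hf0]
    simp
  have zpos : ∀ g : BF S.Om, (∀ a, 0 ≤ g.1 a) → |z g| ≤ (C + 1) * E.E g.1 := fun g hg => by
    obtain ⟨D, hD⟩ := g.2
    have h2 : ∀ B : ℕ, |E.E (fun a => g.1 a * (S.Ts f B a / B))| ≤ (C + 1) * E.E g.1 := by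
      intro B
      rw [← E.smul, abs_le, ← E.neg]
      have hb : ∀ a, -(g.1 a * C) ≤ g.1 a * (S.Ts f B a / B) ∧ g.1 a * (S.Ts f B a / B) ≤ g.1 a * C := by
        intro a
        have := abs_le.1 (hav B a)
        constructor
        · rw [← mul_neg]
          exact mul_le_mul_of_nonneg_left this.1 (hg a)
        · exact mul_le_mul_of_nonneg_left this.2 (hg a)
      have hD' : ∀ a, g.1 a ≤ D := fun a => (le_abs_self _).trans (hD a)
      have hDC : ∀ a, (2 * C + 1) * g.1 a ≤ (2 * C + 1) * D := fun a =>
        mul_le_mul_of_nonneg_left (hD' a) (by linarith)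
      constructor
      · refine E.mono ⟨(2 * C + 1) * D, fun a => ?_⟩ fun a => ?_
        · linarith [(hb a).2, hDC a]
        · linarith [(hb a).1, hg a]
      · refine E.mono ⟨(2 * C + 1) * D, fun a => ?_⟩ fun a => ?_
        · linarith [(hb a).1, hDC a]
        · linarith [(hb a).2, hg a]
    exact le_of_tendsto' (hz g).abs h2
  have zstat : ∀ (n : ℕ) (g : BF S.Om), z ⟨fun a => g.1 (S.sh n a), BF_comp _ g.2⟩ = z g := by
    have h1 : ∀ g : BF S.Om, z ⟨fun a => g.1 (S.sh 1 a), BF_comp _ g.2⟩ = z g := by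
      intro g
      obtain ⟨D, hD⟩ := g.2
      refine sub_eq_zero.1 (tendsto_nhds_unique ((hz _).sub (hz g)) ?_)
      rw [tendsto_zero_iff_abs_tendsto_zero]
      have h0 : Tendsto (fun B : ℕ => D * (2 * C) / B) U (𝓝 0) :=
        (tendsto_const_div_atTop_nhds_zero_nat (D * (2 * C))).mono_left hU
      refine squeeze_zero (fun B => abs_nonneg _) (fun B => ?_) h0
      have hst := hE 1 (fun a => g.1 a * (S.Ts f B a / B)) ⟨D * C, fun a => by
        rw [abs_mul]
        exact mul_le_mul (hD a) (hav B a) (abs_nonneg _) ((abs_nonneg _).trans (hD a))⟩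
      rw [St.map_E] at hst
      show |E.E (fun a => g.1 (S.sh 1 a) * (S.Ts f B a / B)) - E.E (fun a => g.1 a * (S.Ts f B a / B))| ≤ _
      rw [← hst, ← E.sub]
      refine E.bdd fun a => ?_
      rw [← mul_sub, ← sub_div, abs_mul, abs_div, Nat.abs_cast, mul_div_assoc]
      refine mul_le_mul (hD _) ?_ (by positivity) ((abs_nonneg _).trans (hD a))
      refine div_le_div_of_nonneg_right ?_ (Nat.cast_nonneg _)
      have e1 := Ts_succ f B a
      have e2 := Ts_succ' f B a
      have e3 : S.Ts f B a - S.Ts f B (S.sh 1 a) = f a - f (S.sh B a) := by linarith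
      rw [e3]
      have := abs_sub (f a) (f (S.sh B a))
      linarith [hC a, hC (S.sh B a)]
    intro n
    induction n with
    | zero => intro g; rfl
    | succ n ih =>
      intro g
      rw [← ih g, ← h1 ⟨fun a => g.1 (S.sh n a), BF_comp _ g.2⟩]
      congr 1
      apply Subtype.ext
      funext a
      show g.1 (S.sh (n + 1) a) = g.1 (S.sh n (S.sh 1 a))
      rw [S.sh_sh, add_comm]
  have split : ∀ e : ℝ, |e| = 1 → ∃ E1 : St S.Om, S.Stat E1 ∧ ∀ g : BF S.Om, E1.E g.1 = E.E g.1 + e * ((C + 1)⁻¹ * z g) := by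
    intro e he
    have hM := E.isMean
    have hm : IsMean fun g : BF S.Om => E.E g.1 + e * ((C + 1)⁻¹ * z g) :=
      { add := fun g h => by
          have : E.E (g + h).1 = E.E g.1 + E.E h.1 := hM.add g h
          rw [this, zadd]
          ring
        smul := fun c g => by
          have : E.E (c • g).1 = c * E.E g.1 := hM.smul c g
          rw [this, zsmul]
          ring
        pos := fun g hg => by
          have h1 := zpos g hg
          have h2 : |e * ((C + 1)⁻¹ * z g)| ≤ E.E g.1 := by
            rw [abs_mul, he, one_mul, abs_mul, abs_of_pos (inv_pos.2 hC1), inv_mul_le_iff₀ hC1]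
            exact h1
          have := (abs_le.1 h2).1
          linarith
        one := by
          rw [zone]
          simp only [mul_zero, add_zero]
          exact hM.one }
    obtain ⟨E1, h1⟩ := hm.exists_st
    refine ⟨E1, fun n g hg => ?_, h1⟩
    rw [St.map_E, h1 ⟨g, hg⟩, h1 ⟨_, BF_comp (S.sh n) hg⟩, zstat n ⟨g, hg⟩]
    simp only
    rw [← hE n g hg, St.map_E]
  obtain ⟨E1, hs1, h1⟩ := split 1 (by simp)
  obtain ⟨E2, hs2, h2⟩ := split (-1) (by simp)
  have h3 := hx E1 E2 hs1 hs2 (fun g hg => by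
    rw [half_E, h1 ⟨g, hg⟩, h2 ⟨g, hg⟩]
    ring)
  have h4 := h3 f ⟨C, hC⟩
  rw [h1 ⟨f, ⟨C, hC⟩⟩] at h4
  have h5 : z ⟨f, ⟨C, hC⟩⟩ = 0 := by
    have h6 : (C + 1)⁻¹ * z ⟨f, ⟨C, hC⟩⟩ = 0 := by linarith
    rcases mul_eq_zero.1 h6 with h | h
    · exact absurd h (inv_pos.2 hC1).ne'
    · exact h
  have := hz ⟨f, ⟨C, hC⟩⟩
  rw [h5] at this
  exact this

theorem erg_of_extreme {E : St S.Om} (hE : S.Stat E)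
    (hx : ∀ E1 E2, S.Stat E1 → S.Stat E2 → St.Ag (half E1 E2) E → St.Ag E1 E) : S.Erg E := by
  intro f0 hf0 ε hε
  let f : S.Om → ℝ := fun a => f0 a - E.E f0
  have hfB : f ∈ BF S.Om := (BF S.Om).sub_mem hf0 (BF_const _)
  obtain ⟨C, hC⟩ := hfB
  have hfE : E.E f = 0 := by
    rw [E.sub, E.const, sub_self]
  have hT : ∀ B a, S.Ts f0 B a - B * E.E f0 = S.Ts f B a := by
    intro B a
    simp [Ts, f]
  simp only [hT]
  have hcor := erg_corr hE hx f C hC hfE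
  have hTB : ∀ B, S.Ts f B ∈ BF S.Om := fun B => ⟨B * C, fun a => Ts_bdd hC B a⟩
  have hfB : f ∈ BF S.Om := ⟨C, hC⟩
  have hrec : ∀ B : ℕ, E.E (fun a => S.Ts f (B + 1) a ^ 2) ≤ E.E (fun a => S.Ts f B a ^ 2)
      + 2 * E.E (fun a => f a * S.Ts f (B + 1) a) := by
    intro B
    have h1 := hE 1 (fun a => S.Ts f B a ^ 2) (by
      have := BF_mul (hTB B) (hTB B)
      simp only [pow_two]
      exact this)
    rw [St.map_E] at h1
    rw [← h1, ← E.smul, ← E.add]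
    refine E.mono ?_ fun a => ?_
    · refine ⟨C ^ 2, fun a => ?_⟩
      rw [Ts_succ]
      have : f a ^ 2 ≤ C ^ 2 := sq_le_sq' (abs_le.1 (hC a)).1 (abs_le.1 (hC a)).2
      nlinarith
    · rw [Ts_succ]
      nlinarith [sq_nonneg (f a)]
  have hε' : (0:ℝ) < ε / 4 := by positivity
  have hev := hcor.eventually (gt_mem_nhds hε')
  rw [eventually_atTop] at hev
  obtain ⟨B1, hB1⟩ := hev
  have hcs : ∀ B : ℕ, B1 ≤ B + 1 → E.E (fun a => f a * S.Ts f (B + 1) a) ≤ ε / 4 * (B + 1) := by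
    intro B hB
    have h1 := (hB1 (B + 1) hB).le
    have hB0 : (0:ℝ) < B + 1 := by positivity
    have e : (fun a => f a * S.Ts f (B + 1) a) = fun a => f a * (S.Ts f (B + 1) a / ((B + 1 : ℕ) : ℝ)) * (B + 1 : ℝ) := by
      funext a
      push_cast
      field_simp
    rw [e, E.smul']
    exact mul_le_mul_of_nonneg_right h1 hB0.le
  set Q := E.E (fun a => S.Ts f B1 a ^ 2) with hQ
  have hind : ∀ t : ℕ, E.E (fun a => S.Ts f (B1 + t) a ^ 2) ≤ Q + ε / 4 * (((B1 + t : ℕ) : ℝ) ^ 2 + (B1 + t : ℕ)) := by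
    intro t
    induction t with
    | zero =>
      rw [add_zero, ← hQ]
      have : 0 ≤ ε / 4 * ((B1 : ℝ) ^ 2 + B1) := by positivity
      linarith
    | succ t ih =>
      have h1 := hrec (B1 + t)
      have h2 := hcs (B1 + t) (by omega)
      rw [← add_assoc]
      push_cast at ih h2 ⊢
      nlinarith
  obtain ⟨N, hN⟩ := exists_nat_gt (|Q| * 2 / ε)
  refine ⟨B1 + N + 1, fun B hB => ?_⟩
  obtain ⟨t, rfl⟩ := Nat.exists_eq_add_of_le (show B1 ≤ B by omega)
  refine (hind t).trans ?_
  have h1 : (1:ℝ) ≤ ((B1 + t : ℕ) : ℝ) := by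
    have : 1 ≤ B1 + t := by omega
    exact_mod_cast this
  have h2 : (N:ℝ) ≤ ((B1 + t : ℕ) : ℝ) := by
    have : N ≤ B1 + t := by omega
    exact_mod_cast this
  set b := ((B1 + t : ℕ) : ℝ)
  rw [div_lt_iff₀ hε] at hN
  have h3 : Q ≤ ε / 2 * b := by
    have := le_abs_self Q
    nlinarith
  have h4 : b ≤ b ^ 2 := by nlinarith
  nlinarith

/-- ergodic states with large entropy -/
theorem exists_erg {E0 : St S.Om} (hE0 : S.Stat E0) (P : W d →ₗ[ℝ] (ι → ℝ)) :
    ∃ E, S.Stat E ∧ S.gamma E0 P ≤ S.gamma E P ∧ S.Erg E := by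
  obtain ⟨E, h1, h2, h3⟩ := exists_extreme hE0 P
  exact ⟨E, h1, h2, erg_of_extreme h1 h3⟩

end Sys
end FHR
namespace FHR

namespace Sys
variable {d : ℕ} (S : Sys d)

abbrev FA (m : ℕ) : Type := S.Om × Fin (2 ^ m)

def mu (E : St S.Om) (m : ℕ) : St (S.FA m) := St.mix (fun _ : Fin (2 ^ m) => E)

/-- the time parameter -/
def sg (m : ℕ) (x : S.FA m) : ℝ := (x.2 : ℕ) / 2 ^ (2 * m)

theorem sg_nonneg (m : ℕ) (x : S.FA m) : 0 ≤ S.sg m x := by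
  unfold sg
  positivity

theorem sg_le (m : ℕ) (x : S.FA m) : S.sg m x ≤ 1 / 2 ^ m := by
  unfold sg
  have h : ((x.2 : ℕ) : ℝ) ≤ 2 ^ m := by exact_mod_cast x.2.2.le
  rw [div_le_div_iff₀ (by positivity) (by positivity), two_mul, pow_add, one_mul]
  have : (0:ℝ) < 2 ^ m := by positivity
  nlinarith

/-- a frame: perturbed phase data -/
structure Frame (E : St S.Om) (a : W d) (C : ℝ) (m : ℕ) where
  om : S.FA m → S.Om
  lt : S.FA m → W d
  B : RV (S.FA m)
  lt_norm : ∀ x, ‖lt x‖ ≤ C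
  near : ∀ x, ‖S.lam (om x) - lt x‖ ≤ C / 2 ^ m
  near2 : ∀ x, ‖S.lam (om x) - lt x - S.sg m x • (a * lt x)‖ ≤ C / 2 ^ (2 * m)
  Bclose : ∀ x y, B.rel x y → ‖lt x - lt y‖ ≤ C / 2 ^ (2 * m)
  law : St.Ag ((S.mu E m).map om) E
  low : ∀ X Z : RV S.Om, E.cH X (Z ⊔ S.Lv (2 * m)) - C ≤
    (S.mu E m).cH (X.comap om) (B ⊔ Z.comap om ⊔ St.lab)
  indep : m * Real.log 2 - C ≤ (S.mu E m).cH St.lab B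

theorem exp_bounds {θ : ℝ} (h : |θ| ≤ 1) : 1 / 3 ≤ Real.exp θ ∧ Real.exp θ ≤ 3 := by
  have h3 : Real.exp 1 ≤ 3 := Real.exp_one_lt_d9.le.trans (by norm_num)
  have h1 := abs_le.1 h
  refine ⟨?_, (Real.exp_le_exp.2 h1.2).trans h3⟩
  have h4 : Real.exp (-θ) ≤ 3 := (Real.exp_le_exp.2 (by linarith)).trans h3
  have h5 : Real.exp θ * Real.exp (-θ) = 1 := by rw [← Real.exp_add]; simp
  have := Real.exp_pos θ
  nlinarith

theorem zpow_bound {p : ℝ} (hp : 2 ≤ p) (w : ℤ) {D : ℝ} (h1 : p ^ w ≤ D) (h2 : (p ^ w)⁻¹ ≤ D) :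
    |w| ≤ (⌈D⌉₊ : ℤ) := by
  have key : ∀ n : ℕ, p ^ n ≤ D → (n : ℤ) ≤ (⌈D⌉₊ : ℤ) := by
    intro n hn
    have h3 : (n : ℝ) ≤ 2 ^ n := by exact_mod_cast Nat.lt_two_pow_self.le
    have h4 : (2:ℝ) ^ n ≤ p ^ n := pow_le_pow_left₀ (by norm_num) hp n
    have h5 := Nat.le_ceil D
    have : (n : ℝ) ≤ (⌈D⌉₊ : ℝ) := by linarith
    exact_mod_cast this
  obtain ⟨n, rfl | rfl⟩ := w.eq_nat_or_neg
  · rw [abs_of_nonneg (by positivity)]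
    exact key n (by simpa using h1)
  · rw [abs_neg, abs_of_nonneg (by positivity)]
    exact key n (by simpa using h2)

theorem exists_frame (a : W d) (ha : ∀ t ε : ℝ, 0 < ε → ∃ (K : ℕ) (k : Fin d → ℤ),
      ∀ j, |K * Real.log 2 - k j * Real.log (S.p j) - t * a j| ≤ ε) :
    ∃ C : ℝ, 0 < C ∧ ∃ m0 : ℕ, ∀ E : St S.Om, S.Stat E → ∀ m, m0 ≤ m →
      Nonempty (S.Frame E a C m) := by
  set A0 : ℝ := ‖a‖ + 1 with hA0
  have hA1 : 1 ≤ A0 := by have := norm_nonneg a; linarith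
  have hM := S.one_le_M
  obtain ⟨m0, hm0⟩ := pow_unbounded_of_one_lt A0 (by norm_num : (1:ℝ) < 2)
  set b : ℕ := ⌈3 * S.M⌉₊ with hb
  set c1 : ℝ := 6 * (A0 ^ 2 + 1) * S.M with hc1
  have hc1p : 0 < c1 := by positivity
  set cl : ℝ := Real.log (Fintype.card (Fin d → Set.Icc (-(b:ℤ)) b)) + S.cL with hcl
  refine ⟨max c1 cl, lt_max_of_lt_left hc1p, m0, fun E hE m hm => ?_⟩
  have hmA : A0 ≤ 2 ^ m := hm0.le.trans (pow_le_pow_right₀ (by norm_num) hm)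
  choose K k hKk using fun s : Fin (2 ^ m) => ha (((s : ℕ) : ℝ) / 2 ^ (2 * m)) (1 / 2 ^ (2 * m))
    (by positivity)
  -- the logarithmic error
  set th : S.FA m → W d := fun x j => K x.2 * Real.log 2 - k x.2 j * Real.log (S.p j) with hth
  have hth1 : ∀ x j, |th x j - S.sg m x * a j| ≤ 1 / 2 ^ (2 * m) := fun x j => hKk x.2 j
  have hp2 : (2:ℝ) ^ (2 * m) = 2 ^ m * 2 ^ m := by rw [two_mul, pow_add]
  have hpm : (1:ℝ) ≤ 2 ^ m := one_le_pow₀ (by norm_num)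
  have hth2 : ∀ x j, |th x j| ≤ A0 / 2 ^ m := by
    intro x j
    have h1 := hth1 x j
    have h2 : |S.sg m x * a j| ≤ (1 / 2 ^ m) * ‖a‖ := by
      rw [abs_mul, abs_of_nonneg (S.sg_nonneg m x)]
      exact mul_le_mul (S.sg_le m x) (norm_le_pi_norm a j) (abs_nonneg _) (by positivity)
    have h3 : (1:ℝ) / 2 ^ (2 * m) ≤ 1 / 2 ^ m := by
      apply one_div_le_one_div_of_le (by positivity)
      nlinarith
    have h4 : A0 / 2 ^ m = (1 / 2 ^ m) * ‖a‖ + 1 / 2 ^ m := by rw [hA0]; ring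
    have h5 := abs_add_le (th x j - S.sg m x * a j) (S.sg m x * a j)
    rw [sub_add_cancel] at h5
    linarith
  have hth3 : ∀ x j, |th x j| ≤ 1 := fun x j => (hth2 x j).trans ((div_le_one (by positivity)).2 hmA)
  let om : S.FA m → S.Om := fun x => S.sh (K x.2) x.1
  let w : S.FA m → Fin d → ℤ := fun x j => k x.2 j - S.N (K x.2) x.1 j
  let lt : S.FA m → W d := fun x j => S.lam x.1 j * (S.p j : ℝ) ^ (w x j)
  have hlam : ∀ x j, S.lam (om x) j = lt x j * Real.exp (th x j) := by
    intro x j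
    have hp := S.p_pos j
    change S.lam (S.sh (K x.2) x.1) j = S.lam x.1 j * (S.p j : ℝ) ^ (w x j) * _
    rw [lam_sh, hth]
    simp only [w]
    rw [Real.exp_sub, zpow_sub₀ hp.ne', zpow_natCast]
    have e1 : Real.exp (K x.2 * Real.log 2) = 2 ^ (K x.2) := by
      rw [← Real.log_pow, Real.exp_log (by positivity)]
    have e2 : Real.exp (k x.2 j * Real.log (S.p j)) = (S.p j : ℝ) ^ (k x.2 j) := by
      rw [← Real.log_zpow, Real.exp_log (by positivity)]
    rw [e1, e2]
    have : (S.p j : ℝ) ^ (k x.2 j) ≠ 0 := by positivity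
    field_simp
  have hlpos : ∀ x j, 0 < lt x j := fun x j => by
    have := S.lam_ge x.1 j
    have hp := S.p_pos j
    simp only [lt]
    positivity
  have hlt : ∀ x j, 1 / 3 ≤ lt x j ∧ lt x j ≤ 3 * S.M := by
    intro x j
    have h1 := S.lam_ge (om x) j
    have h2 := S.lam_le_M (om x) j
    have h3 := exp_bounds (hth3 x j)
    have h4 := hlpos x j
    rw [hlam] at h1 h2
    constructor
    · nlinarith
    · nlinarith
  have hpw : ∀ x j, (S.p j : ℝ) ^ (w x j) ≤ 3 * S.M ∧ ((S.p j : ℝ) ^ (w x j))⁻¹ ≤ 3 * S.M := by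
    intro x j
    have hp := S.p_pos j
    have h1 := hlt x j
    have h2 := S.lam_ge x.1 j
    have h3 := S.lam_le_M x.1 j
    have h4 : (0:ℝ) < (S.p j : ℝ) ^ (w x j) := by positivity
    simp only [lt] at h1
    refine ⟨by nlinarith, ?_⟩
    rw [inv_le_comm₀ h4 (by positivity), ← one_div, div_le_iff₀ (by positivity)]
    nlinarith
  have hwb : ∀ x j, w x j ∈ Set.Icc (-(b:ℤ)) b := fun x j =>
    abs_le.1 (zpow_bound (S.two_le_p j) _ (hpw x j).1 (hpw x j).2)
  let wv : S.FA m → Fin d → Set.Icc (-(b:ℤ)) b := fun x j => ⟨w x j, hwb x j⟩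
  have hmx : c1 ≤ max c1 cl := le_max_left _ _
  have hA2 : A0 ≤ A0 ^ 2 := by nlinarith
  refine ⟨⟨om, lt, (S.Lv (2 * m)).comap Prod.fst ⊔ RV.ofF wv, ?_, ?_, ?_, ?_, ?_, ?_, ?_⟩⟩
  · intro x
    refine le_trans ((pi_norm_le_iff_of_nonneg hc1p.le).2 fun j => ?_) hmx
    rw [Real.norm_eq_abs, abs_of_pos (hlpos x j)]
    have := (hlt x j).2
    rw [hc1]
    nlinarith
  · intro x
    refine le_trans ((pi_norm_le_iff_of_nonneg (by positivity)).2 fun j => ?_)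
      (div_le_div_of_nonneg_right hmx (by positivity))
    rw [Pi.sub_apply, hlam, Real.norm_eq_abs]
    have h1 := Real.abs_exp_sub_one_le (hth3 x j)
    have h2 : lt x j * Real.exp (th x j) - lt x j = lt x j * (Real.exp (th x j) - 1) := by ring
    rw [h2, abs_mul, abs_of_pos (hlpos x j)]
    have h3 := hth2 x j
    calc _ ≤ (3 * S.M) * (2 * (A0 / 2 ^ m)) := by
          refine mul_le_mul (hlt x j).2 (by linarith) (abs_nonneg _) (by positivity)
      _ = (6 * A0 * S.M) / 2 ^ m := by ring
      _ ≤ _ := by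
        apply div_le_div_of_nonneg_right _ (by positivity)
        rw [hc1]
        nlinarith
  · intro x
    refine le_trans ((pi_norm_le_iff_of_nonneg (by positivity)).2 fun j => ?_)
      (div_le_div_of_nonneg_right hmx (by positivity))
    rw [Pi.sub_apply, Pi.sub_apply, hlam, Real.norm_eq_abs]
    have h1 := Real.abs_exp_sub_one_sub_id_le (hth3 x j)
    have h2 : lt x j * Real.exp (th x j) - lt x j - (S.sg m x • (a * lt x)) j
        = lt x j * ((Real.exp (th x j) - 1 - th x j) + (th x j - S.sg m x * a j)) := by
      simp only [Pi.smul_apply, Pi.mul_apply, smul_eq_mul]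
      ring
    rw [h2, abs_mul, abs_of_pos (hlpos x j)]
    have h3 := hth2 x j
    have h4 : (th x j) ^ 2 ≤ A0 ^ 2 / 2 ^ (2 * m) := by
      rw [← sq_abs, mul_comm 2 m, pow_mul, ← div_pow]
      exact pow_le_pow_left₀ (abs_nonneg _) h3 2
    have h5 := hth1 x j
    calc _ ≤ (3 * S.M) * (A0 ^ 2 / 2 ^ (2 * m) + 1 / 2 ^ (2 * m)) := by
          refine mul_le_mul (hlt x j).2 ?_ (abs_nonneg _) (by positivity)
          exact (abs_add_le _ _).trans (add_le_add (h1.trans h4) h5)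
      _ = (3 * (A0 ^ 2 + 1) * S.M) / 2 ^ (2 * m) := by ring
      _ ≤ _ := by
        apply div_le_div_of_nonneg_right _ (by positivity)
        rw [hc1]
        have : 0 ≤ (A0 ^ 2 + 1) * S.M := by positivity
        nlinarith
  · intro x y h
    have h1 := S.Lv_close h.1
    have h2 : wv x = wv y := h.2
    have h3 : ∀ j, w x j = w y j := fun j => congrArg Subtype.val (congrFun h2 j)
    refine le_trans ((pi_norm_le_iff_of_nonneg (by positivity)).2 fun j => ?_)
      (div_le_div_of_nonneg_right hmx (by positivity))
    have h4 : (lt x - lt y) j = (S.lam x.1 j - S.lam y.1 j) * (S.p j : ℝ) ^ (w x j) := by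
      simp only [lt, Pi.sub_apply, h3 j]
      ring
    have hp := S.p_pos j
    rw [h4, Real.norm_eq_abs, abs_mul, abs_of_pos (a := (S.p j : ℝ) ^ (w x j)) (by positivity)]
    have h5 := (norm_le_pi_norm (S.lam x.1 - S.lam y.1) j).trans h1
    calc _ ≤ (1 / 2 ^ (2 * m)) * (3 * S.M) :=
          mul_le_mul h5 (hpw x j).1 (by positivity) (by positivity)
      _ = (3 * S.M) / 2 ^ (2 * m) := by ring
      _ ≤ _ := by
        apply div_le_div_of_nonneg_right _ (by positivity)
        rw [hc1]
        nlinarith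
  · exact St.mix_ag E E om fun s => hE (K s)
  · intro X Z
    unfold mu
    refine St.le_mix_cH _ fun s => ?_
    set sh := S.sh (K s)
    have e1 : (X.comap om).comap (fun ω => (ω, s)) = X.comap sh := rfl
    set L := S.Lv (2 * m)
    set wz : RV S.Om := RV.ofF (fun ω => wv (ω, s))
    have e2 : ((L.comap Prod.fst ⊔ RV.ofF wv ⊔ Z.comap om : RV (S.FA m))).comap (fun ω => (ω, s))
      = L ⊔ wz ⊔ Z.comap sh := rfl
    rw [e1, e2]
    have h1 := E.cH_anti (X.comap sh) (Y := L ⊔ wz ⊔ Z.comap sh)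
      (Y' := (L ⊔ wz) ⊔ (Z ⊔ L).comap sh) (by
        rw [RV.comap_sup, ← sup_assoc]
        exact le_sup_left)
    have h2 := E.cH_add (X.comap sh) ((Z ⊔ L).comap sh) (L ⊔ wz)
    have h3 : E.cH (X.comap sh) ((Z ⊔ L).comap sh) = E.cH X (Z ⊔ L) := hE.cH _ _ _
    have h4 := E.cH_sup_le L wz ((Z ⊔ L).comap sh)
    have h5 : E.cH L ((Z ⊔ L).comap sh) ≤ S.cL :=
      (E.cH_anti _ (Y := L.comap sh) (by rw [RV.comap_sup]; exact le_sup_right)).trans (S.factC' E _ _)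
    have h6 : E.cH wz ((Z ⊔ L).comap sh) ≤ Real.log (Fintype.card (Fin d → Set.Icc (-(b:ℤ)) b)) :=
      E.cH_le_card _ _ (fun ω => wv (ω, s)) (fun a b _ h => h)
    have h7 : cl ≤ max c1 cl := le_max_right _ _
    linarith
  · set L : RV (S.FA m) := (S.Lv (2 * m)).comap Prod.fst with hL
    have h1 : (S.mu E m).H (L ⊔ St.lab) = m * Real.log 2 + E.H (S.Lv (2 * m)) := by
      unfold mu
      rw [St.mix_H, Fintype.card_fin]
      have e : ∀ s : Fin (2 ^ m), L.comap (fun ω => (ω, s)) = S.Lv (2 * m) := fun s => rfl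
      simp only [e, Finset.sum_const, Finset.card_univ, Fintype.card_fin, nsmul_eq_mul]
      push_cast
      rw [Real.log_pow, inv_mul_cancel_left₀ (by positivity)]
    have h2 : (S.mu E m).H L = E.H (S.Lv (2 * m)) := by
      have := St.mix_ag E E (Prod.fst : S.FA m → S.Om) (fun s => fun f hf => rfl)
      rw [← this.H]
      rfl
    have h3 := (S.mu E m).cH_add St.lab L (RV.ofF wv)
    have h4 : (S.mu E m).cH (RV.ofF wv) L ≤ Real.log (Fintype.card (Fin d → Set.Icc (-(b:ℤ)) b)) :=
      (S.mu E m).cH_le_card _ _ wv (fun a b _ h => h)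
    have h5 : (S.mu E m).cH St.lab L = m * Real.log 2 := by
      rw [St.cH, sup_comm, h1, h2]
      ring
    rw [sup_comm] at h3
    have h7 : cl ≤ max c1 cl := le_max_right _ _
    have := S.cL_nonneg
    linarith

end Sys
end FHR
namespace FHR

namespace Sys
variable {d : ℕ} (S : Sys d) {ι : Type} [Fintype ι]

/-- a pair of points with the same time label, same coarse phases and same projection -/
structure Pair (E : St S.Om) (a : W d) (P : W d →ₗ[ℝ] (ι → ℝ)) (C : ℝ) (m : ℕ) where
  T : Type
  F : St T
  o : T → S.Om
  o' : T → S.Om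
  l : T → W d
  s : T → Fin (2 ^ m)
  B : RV T
  l_norm : ∀ x, ‖l x‖ ≤ C
  near : ∀ x, ‖S.lam (o x) - l x‖ ≤ C / 2 ^ m
  near' : ∀ x, ‖S.lam (o' x) - l x‖ ≤ C / 2 ^ m
  near2 : ∀ x, ‖S.lam (o x) - l x - (((s x : ℕ) : ℝ) / 2 ^ (2 * m)) • (a * l x)‖ ≤ C / 2 ^ (2 * m)
  near2' : ∀ x, ‖S.lam (o' x) - l x - (((s x : ℕ) : ℝ) / 2 ^ (2 * m)) • (a * l x)‖ ≤ C / 2 ^ (2 * m)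
  Bclose : ∀ x y, B.rel x y → ‖l x - l y‖ ≤ C / 2 ^ (2 * m)
  G : ∀ x, ‖P (S.q (o x) - S.q (o' x))‖ ≤ 1 / 2 ^ (2 * m)
  lawE : ∀ (X : RV S.Om) (f : S.Om → ℝ), (∀ u v, X.rel u v → f u = f v) →
    F.E (fun x => f (o x)) = E.E f
  law : ∀ X Y : RV S.Om, F.cH (X.comap o) (Y.comap o) = E.cH X Y
  law' : ∀ X Y : RV S.Om, F.cH (X.comap o') (Y.comap o') = E.cH X Y
  low : ∀ X : RV S.Om, E.cH X (S.Lv (2 * m)) - C ≤ F.cH (X.comap o) (B ⊔ RV.ofF s)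
  copy : ∀ X Z : RV S.Om, E.cH X (S.Dv P (2 * m)) - C ≤
    F.cH (X.comap o') (Z.comap o ⊔ B ⊔ RV.ofF s)
  indep : m * Real.log 2 - C ≤ F.cH (RV.ofF s) B

theorem exists_pair {E : St S.Om} {a : W d} {C : ℝ} (hC : 0 < C) (P : W d →ₗ[ℝ] (ι → ℝ)) {m : ℕ}
    (fr : S.Frame E a C m) : Nonempty (S.Pair E a P (C * (3 + ‖a‖)) m) := by
  set R : RV (S.FA m) := fr.B ⊔ (S.Gv P (2 * m)).comap fr.om ⊔ St.lab with hR
  set D := C * (3 + ‖a‖) with hD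
  have hna := norm_nonneg a
  have hCD : C ≤ D := by nlinarith
  have hBR : fr.B ≤ R := le_sup_left.trans le_sup_left
  have hGR : (S.Gv P (2 * m)).comap fr.om ≤ R := le_sup_right.trans le_sup_left
  have hlR : St.lab ≤ R := le_sup_right
  let F := (S.mu E m).cop R
  have hp2 : (2:ℝ) ^ (2 * m) = 2 ^ m * 2 ^ m := by rw [two_mul, pow_add]
  have hpm : (1:ℝ) ≤ 2 ^ m := one_le_pow₀ (by norm_num)
  have hpp : C / 2 ^ (2 * m) ≤ C / 2 ^ m :=
    div_le_div_of_nonneg_left hC.le (by positivity) (by nlinarith)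
  have hx : ∀ x : St.Cop R, ‖fr.lt x.snd - fr.lt x.fst‖ ≤ C / 2 ^ (2 * m) := fun x => by
    rw [norm_sub_rev]
    exact fr.Bclose _ _ (hBR _ _ x.rel)
  have hs : ∀ x : St.Cop R, x.fst.2 = x.snd.2 := fun x => hlR _ _ x.rel
  have hsg1 : ∀ x : S.FA m, S.sg m x ≤ 1 := fun x =>
    (S.sg_le m x).trans ((div_le_one (by positivity)).2 hpm)
  refine ⟨⟨St.Cop R, F, fun x => fr.om x.fst, fun x => fr.om x.snd, fun x => fr.lt x.fst,
    fun x => x.fst.2, fr.B.comap St.Cop.fst, fun x => (fr.lt_norm _).trans hCD, fun x => ?_,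
    fun x => ?_, fun x => ?_, fun x => ?_, fun x y h => ?_, fun x => ?_, fun X f hf => ?_,
    fun X Y => ?_, fun X Y => ?_, fun X => ?_, fun X Z => ?_, ?_⟩⟩
  · exact (fr.near _).trans (div_le_div_of_nonneg_right hCD (by positivity))
  · have h1 := fr.near x.snd
    have h2 := (hx x).trans hpp
    have h3 := norm_add_le (S.lam (fr.om x.snd) - fr.lt x.snd) (fr.lt x.snd - fr.lt x.fst)
    rw [sub_add_sub_cancel] at h3
    refine (h3.trans (add_le_add h1 h2)).trans ?_
    rw [← add_div]
    apply div_le_div_of_nonneg_right _ (by positivity)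
    nlinarith
  · exact (fr.near2 _).trans (div_le_div_of_nonneg_right hCD (by positivity))
  · have h1 := fr.near2 x.snd
    have h2 := hx x
    have h4 : ‖S.sg m x.snd • (a * (fr.lt x.snd - fr.lt x.fst))‖ ≤ ‖a‖ * (C / 2 ^ (2 * m)) := by
      rw [norm_smul, Real.norm_eq_abs, abs_of_nonneg (S.sg_nonneg m _)]
      have h5 := (norm_mul_le a (fr.lt x.snd - fr.lt x.fst)).trans
        (mul_le_mul_of_nonneg_left h2 hna)
      calc _ ≤ 1 * (‖a‖ * (C / 2 ^ (2 * m))) :=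
            mul_le_mul (hsg1 _) h5 (norm_nonneg _) zero_le_one
        _ = _ := one_mul _
    have e : S.lam (fr.om x.snd) - fr.lt x.fst - (((x.fst.2 : ℕ) : ℝ) / 2 ^ (2 * m)) • (a * fr.lt x.fst)
        = (S.lam (fr.om x.snd) - fr.lt x.snd - S.sg m x.snd • (a * fr.lt x.snd))
          + (fr.lt x.snd - fr.lt x.fst) + S.sg m x.snd • (a * (fr.lt x.snd - fr.lt x.fst)) := by
      rw [hs x, mul_sub, smul_sub]
      unfold sg
      abel
    rw [e]
    refine (norm_add₃_le).trans ((add_le_add (add_le_add h1 h2) h4).trans ?_)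
    rw [← mul_div_assoc, ← add_div, ← add_div]
    apply div_le_div_of_nonneg_right _ (by positivity)
    nlinarith
  · exact (fr.Bclose _ _ h).trans (div_le_div_of_nonneg_right hCD (by positivity))
  · exact S.Gv_close (hGR _ _ x.rel)
  · have h1 := (S.mu E m).cop_fst R (X.comap fr.om) (fun u => f (fr.om u)) (fun u v h => hf _ _ h)
    refine h1.trans ?_
    have h2 := fr.law f (St.meas_bdd X f hf)
    exact h2
  · have h1 := (S.mu E m).cop_cH_fst R (X.comap fr.om) (Y.comap fr.om)
    refine h1.trans ?_
    rw [← fr.law.cH]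
    rfl
  · have h1 := (S.mu E m).cop_cH_snd R (X.comap fr.om) (Y.comap fr.om)
    refine h1.trans ?_
    rw [← fr.law.cH]
    rfl
  · have h1 := (S.mu E m).cop_cH_fst R (X.comap fr.om) (fr.B ⊔ St.lab)
    have h2 := fr.low X ⊥
    have h3 : fr.B ⊔ (⊥ : RV S.Om).comap fr.om = fr.B := by
      have : (⊥ : RV S.Om).comap fr.om = ⊥ := rfl
      rw [this, sup_bot_eq]
    rw [h3, bot_sup_eq] at h2
    rw [← h1] at h2
    refine le_trans ?_ h2
    linarith
  · have h1 := (S.mu E m).cop_cH R ((Z.comap fr.om) ⊔ R) (X.comap fr.om) le_sup_right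
    have h2 := fr.low X (S.Gv P (2 * m))
    rw [← hR, ← h1] at h2
    have h3 := F.cH_anti ((X.comap fr.om).comap St.Cop.snd)
      (Y := (Z.comap fr.om).comap St.Cop.fst ⊔ fr.B.comap St.Cop.fst ⊔ St.lab.comap St.Cop.fst)
      (Y' := ((Z.comap fr.om) ⊔ R).comap St.Cop.fst) (by
        rw [RV.comap_sup]
        refine sup_le (sup_le le_sup_left (le_trans ?_ le_sup_right)) (le_trans ?_ le_sup_right)
        · exact RV.comap_mono _ hBR
        · exact RV.comap_mono _ hlR)
    have h4 := h2.trans h3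
    refine le_trans ?_ h4
    unfold Dv
    linarith
  · have h1 := (S.mu E m).cop_cH_fst R St.lab fr.B
    have h2 := fr.indep
    rw [← h1] at h2
    refine le_trans ?_ h2
    linarith

end Sys
end FHR
namespace FHR

namespace Sys
variable {d : ℕ} (S : Sys d) {ι : Type} [Fintype ι]

def eta (E : St S.Om) (n : ℕ) : ℝ := E.H (S.Wv n) - S.hh E * n

/-- the sublinear error -/
def er (E : St S.Om) (P : W d →ₗ[ℝ] (ι → ℝ)) (m : ℕ) : ℝ :=
  S.eta E m + S.eta E (2 * m) + (S.gam E P m - S.gamma E P * m)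

variable {S}

theorem eta_nonneg {E : St S.Om} (hE : S.Stat E) (n : ℕ) : 0 ≤ S.eta E n := by
  have := (hh_aux hE).2 n
  unfold eta
  linarith

theorem er_tendsto {E : St S.Om} (hE : S.Stat E) (P : W d →ₗ[ℝ] (ι → ℝ)) :
    Tendsto (fun m : ℕ => S.er E P m / m) atTop (𝓝 0) := by
  have h1 : Tendsto (fun n : ℕ => S.eta E n / n) atTop (𝓝 0) := by
    have := ((hh_aux hE).1).sub (tendsto_const_nhds (x := S.hh E))
    rw [sub_self] at this
    refine this.congr' ?_
    filter_upwards [eventually_gt_atTop 0] with n hn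
    have : (n : ℝ) ≠ 0 := by positivity
    unfold eta
    field_simp
  have h2 : Tendsto (fun m : ℕ => 2 * (S.eta E (2 * m) / (2 * m : ℕ))) atTop (𝓝 (2 * 0)) :=
    (h1.comp (tendsto_id.const_mul_atTop' (by norm_num : 0 < 2))).const_mul 2
  have h3 : Tendsto (fun m : ℕ => S.gam E P m / m - S.gamma E P) atTop (𝓝 0) := by
    have := (gamma_tendsto hE P).sub (tendsto_const_nhds (x := S.gamma E P))
    rwa [sub_self] at this
  have := (h1.add h2).add h3
  rw [mul_zero, add_zero, add_zero] at this
  refine this.congr' ?_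
  filter_upwards [eventually_gt_atTop 0] with n hn
  have : (n : ℝ) ≠ 0 := by positivity
  unfold er
  push_cast
  field_simp

namespace Pair
variable {E : St S.Om} {a : W d} {P : W d →ₗ[ℝ] (ι → ℝ)} {C : ℝ} {m : ℕ} (t : S.Pair E a P C m)

def X (k : ℕ) : RV t.T := (S.Wv k).comap t.o
def X' (k : ℕ) : RV t.T := (S.Wv k).comap t.o'
def lb : RV t.T := RV.ofF t.s

theorem H_X (k : ℕ) : t.F.H (t.X k) = E.H (S.Wv k) := by
  rw [← St.cH_bot, ← St.cH_bot, ← t.law]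
  rfl

theorem X_mono {k l : ℕ} (h : k ≤ l) : t.X k ≤ t.X l := RV.comap_mono _ (S.Wv_mono h)

theorem one (hE : S.Stat E) (k : ℕ) : S.hh E * k - S.cL - C ≤ t.F.cH (t.X k) (t.B ⊔ t.lb) := by
  have h1 := t.low (S.Wv k)
  have h2 := hL hE k (2 * m)
  unfold X lb
  linarith

theorem three (hE : S.Stat E) : m * Real.log 2 - S.cL - 2 * C - S.eta E (2 * m)
    ≤ t.F.cH t.lb (t.X (2 * m) ⊔ t.B) := by
  have h1 := t.one hE (2 * m)
  have h2 := t.indep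
  have h3 := t.F.cH_symm t.lb (t.X (2 * m)) t.B
  have h4 := t.F.cH_le_H (t.X (2 * m)) t.B
  rw [t.H_X] at h4
  rw [sup_comm t.B t.lb] at h1
  unfold eta
  unfold lb at h3 ⊢ h1
  linarith

theorem four (hE : S.Stat E) {c : ℝ} (hP : Bn P c) (k : ℕ) : S.gamma E P * k - S.cS ι c - C
    ≤ t.F.cH (t.X' k) (t.X (2 * m) ⊔ t.B ⊔ t.lb) := by
  have h1 := gamma_star hE hP k (2 * m)
  have h2 := t.copy (S.Wv k) (S.Wv (2 * m))
  unfold X X' lb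
  linarith

theorem pow_le : C / 2 ^ (2 * m) ≤ C / 2 ^ m ∨ C < 0 := by
  by_cases h : 0 ≤ C
  · left
    exact div_le_div_of_nonneg_left h (by positivity)
      (pow_le_pow_right₀ (by norm_num) (by omega))
  · right
    linarith

theorem pow2 (m : ℕ) : (2:ℝ) ^ (2 * m) = 2 ^ m * 2 ^ m := by rw [two_mul, pow_add]

theorem lam_close (hC : 0 ≤ C) {x z : t.T} (h : t.B.rel x z) :
    ‖S.lam (t.o x) - S.lam (t.o z)‖ ≤ (3 * C) / 2 ^ m ∧
      ‖S.lam (t.o' x) - S.lam (t.o' z)‖ ≤ (3 * C) / 2 ^ m := by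
  have h0 : C / 2 ^ (2 * m) ≤ C / 2 ^ m := by
    rcases pow_le (C := C) (m := m) with h | h
    · exact h
    · linarith
  have h1 := (t.Bclose _ _ h).trans h0
  have key : ∀ u v : W d, ‖u - t.l x‖ ≤ C / 2 ^ m → ‖v - t.l z‖ ≤ C / 2 ^ m →
      ‖u - v‖ ≤ (3 * C) / 2 ^ m := by
    intro u v hu hv
    have e : u - v = (u - t.l x) + (t.l x - t.l z) + (t.l z - v) := by abel
    rw [norm_sub_rev] at hv
    rw [e]
    refine norm_add₃_le.trans ((add_le_add (add_le_add hu h1) hv).trans (le_of_eq ?_))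
    ring
  exact ⟨key _ _ (t.near x) (t.near z), key _ _ (t.near' x) (t.near' z)⟩

def K5 (S : Sys d) (ι : Type) [Fintype ι] (C c : ℝ) : ℝ :=
  Fintype.card ι * KK (2 + c * (3 * C + S.M * S.M)) + d * KK (3 * C)

theorem five (hC : 0 ≤ C) {c : ℝ} (hP : Bn P c) :
    t.F.cH (t.X' m) (t.X m ⊔ t.B) ≤ S.gam E P m + K5 S ι C c := by
  have h1 := t.F.cH_trans (t.X' m) ((S.Dv P m).comap t.o') (t.X m ⊔ t.B)
  have h2 := t.law' (S.Wv m) (S.Dv P m)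
  have h3 : (S.Dv P m).comap t.o' = (S.Gv P m).comap t.o' ⊔ (S.Lv m).comap t.o' := rfl
  have h4 := t.F.cH_sup_le ((S.Gv P m).comap t.o') ((S.Lv m).comap t.o') (t.X m ⊔ t.B)
  have h5 : t.F.cH ((S.Gv P m).comap t.o') (t.X m ⊔ t.B)
      ≤ Fintype.card ι * KK (2 + c * (3 * C + S.M * S.M)) := by
    refine cH_fln t.F (h := Bd_comp (φ := t.o') (S.Bd_q P m)) ?_
    intro x z h
    refine smul_norm_le ?_
    have g1 := t.G x
    have g2 := t.G z
    have g3 := S.q_close (t.lam_close hC h.2).1 (S.y_close h.1)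
    have g4 := (hP.2 _).trans (mul_le_mul_of_nonneg_left g3 hP.1)
    have e : P (S.q (t.o' x)) - P (S.q (t.o' z)) = -P (S.q (t.o x) - S.q (t.o' x))
        + P (S.q (t.o x) - S.q (t.o z)) + P (S.q (t.o z) - S.q (t.o' z)) := by
      simp only [map_sub]
      abel
    rw [e]
    refine norm_add₃_le.trans ?_
    rw [norm_neg]
    refine (add_le_add (add_le_add g1 g4) g2).trans ?_
    have : (1:ℝ) / 2 ^ (2 * m) ≤ 1 / 2 ^ m :=
      one_div_le_one_div_of_le (by positivity) (pow_le_pow_right₀ (by norm_num) (by omega))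
    refine (add_le_add (add_le_add this le_rfl) this).trans (le_of_eq ?_)
    ring
  have h6 : t.F.cH ((S.Lv m).comap t.o') (t.X m ⊔ t.B) ≤ d * KK (3 * C) := by
    have := cH_fln t.F (h := Bd_comp (φ := t.o') (S.Bd_lam m)) (Y := t.X m ⊔ t.B) (c := 3 * C)
      fun x z h => smul_norm_le (t.lam_close hC h.2).2
    rwa [Fintype.card_fin] at this
  rw [← h3] at h4
  unfold X' K5 gam at *
  linarith

theorem six (hE : S.Stat E) (hC : 0 ≤ C) {c : ℝ} (hP : Bn P c) :
    m * Real.log 2 - S.er E P m - (S.cL + 3 * C + S.cS ι c + K5 S ι C c)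
      ≤ t.F.cH t.lb (t.X' m ⊔ (t.X (2 * m) ⊔ t.B)) := by
  have h1 := t.three hE
  have h2 := t.four hE hP m
  have h3 := t.five hC hP
  have h4 := t.F.cH_symm t.lb (t.X' m) (t.X (2 * m) ⊔ t.B)
  have h5 := t.F.cH_anti (t.X' m) (Y := t.X m ⊔ t.B) (Y' := t.X (2 * m) ⊔ t.B)
    (sup_le_sup_right (t.X_mono (by omega)) _)
  have h6 := eta_nonneg hE m
  rw [sup_comm _ t.lb] at h2
  unfold er
  linarith

theorem seven (hE : S.Stat E) (hC : 0 ≤ C) {c : ℝ} (hP : Bn P c) :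
    S.hh E * m - S.er E P m - (S.cL + 2 * C + S.cS ι c + K5 S ι C c)
      ≤ t.F.cH (t.X (2 * m)) (t.X' m ⊔ (t.X m ⊔ (t.B ⊔ t.lb))) := by
  have h1 := t.one hE (2 * m)
  have h2 := t.F.cH_sup (t.X m) (t.X (2 * m)) (t.B ⊔ t.lb)
  rw [sup_eq_right.2 (t.X_mono (by omega : m ≤ 2 * m))] at h2
  have h3 := t.F.cH_le_H (t.X m) (t.B ⊔ t.lb)
  rw [t.H_X] at h3
  have h4 := t.F.cH_symm (t.X (2 * m)) (t.X' m) (t.X m ⊔ (t.B ⊔ t.lb))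
  have h5 := t.four hE hP m
  have h6 : t.X (2 * m) ⊔ (t.X m ⊔ (t.B ⊔ t.lb)) = t.X (2 * m) ⊔ t.B ⊔ t.lb := by
    rw [← sup_assoc, sup_eq_left.2 (t.X_mono (by omega : m ≤ 2 * m)), sup_assoc]
  rw [← h6] at h5
  have h7 := t.five hC hP
  have h8 := t.F.cH_anti (t.X' m) (Y := t.X m ⊔ t.B) (Y' := t.X m ⊔ (t.B ⊔ t.lb))
    (sup_le_sup_left le_sup_left _)
  have h9 := eta_nonneg hE (2 * m)
  unfold er
  unfold eta at *
  push_cast at *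
  linarith

end Pair

def K9 (S : Sys d) (ι : Type) [Fintype ι] (K c : ℝ) : ℝ :=
  Fintype.card ι * KK (1 + c * (K + 2 * K * S.M)) + d * KK (S.M * (3 * K))

theorem y_rho_norm' (n : ℕ) (ω : S.Om) : ‖S.y ω - S.rho n ω‖ ≤ S.M / 2 ^ n := by
  have := S.M_pos
  refine (pi_norm_le_iff_of_nonneg (by positivity)).2 fun j => ?_
  have h := S.y_rho_norm n ω j
  rw [Pi.sub_apply, Real.norm_eq_abs, abs_of_nonneg h.1]
  exact h.2

/-- fine projection given the coarse word -/
theorem nine {T : Type} (F : St T) {E : St S.Om} (hE : S.Stat E) (g : T → S.Om) (l : T → W d) (B : RV T)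
    {P : W d →ₗ[ℝ] (ι → ℝ)} {c : ℝ} (hP : Bn P c) {K : ℝ} (hK : 0 ≤ K) (m : ℕ)
    (law : ∀ X Y : RV S.Om, F.cH (X.comap g) (Y.comap g) = E.cH X Y)
    (near : ∀ x, ‖S.lam (g x) - l x‖ ≤ K / 2 ^ m)
    (Bclose : ∀ x y, B.rel x y → ‖l x - l y‖ ≤ K / 2 ^ (2 * m))
    (hb : Bd fun x => (2:ℝ) ^ (2 * m) • P (l x * S.y (g x))) :
    F.cH (fl _ hb) ((S.Wv m).comap g ⊔ B) ≤ E.cH (S.Gv P m) (S.Lv m) + K9 S ι K c := by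
  have hM := S.M_pos
  set Y := (S.Wv m).comap g ⊔ B with hY
  set G := ((S.Gv P m).comap (S.sh m)).comap g with hG
  set L := ((S.Lv m).comap (S.sh m)).comap g with hL
  have h1 := F.cH_trans (fl _ hb) (G ⊔ Y) Y
  rw [F.cH_absorb] at h1
  have h2 := F.cH_trans G L Y
  have h3 : F.cH G L = E.cH (S.Gv P m) (S.Lv m) := by
    rw [hG, hL, law, hE.cH]
  have hlam : ∀ x z, B.rel x z → ‖S.lam (g x) - S.lam (g z)‖ ≤ 3 * K / 2 ^ m := by
    intro x z h
    have h0 : K / 2 ^ (2 * m) ≤ K / 2 ^ m :=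
      div_le_div_of_nonneg_left hK (by positivity) (pow_le_pow_right₀ (by norm_num) (by omega))
    have e : S.lam (g x) - S.lam (g z) = (S.lam (g x) - l x) + (l x - l z) + (l z - S.lam (g z)) := by
      abel
    have hv := near z
    rw [norm_sub_rev] at hv
    rw [e]
    refine norm_add₃_le.trans ((add_le_add (add_le_add (near x) ((Bclose _ _ h).trans h0)) hv).trans
      (le_of_eq ?_))
    ring
  have h4 : F.cH L Y ≤ d * KK (S.M * (3 * K)) := by
    have := cH_fln F (h := Bd_comp (φ := fun x => S.sh m (g x)) (S.Bd_lam m)) (Y := Y)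
      (c := S.M * (3 * K)) fun x z h => smul_norm_le ((S.lam_sh_close (fun j => S.Wv_N h.1 j)
        (hlam x z h.2)).trans (le_of_eq (by ring)))
    rwa [Fintype.card_fin] at this
  have h5 : F.cH (fl _ hb) (G ⊔ Y) ≤ Fintype.card ι * KK (1 + c * (K + 2 * K * S.M)) := by
    refine cH_fln F ?_
    intro x z h
    have r : S.rho m (g x) = S.rho m (g z) := S.Wv_rho h.2.1
    have g1 : ‖P (S.q (S.sh m (g x)) - S.q (S.sh m (g z)))‖ ≤ 1 / 2 ^ m := S.Gv_close h.1
    have g2 := Bclose _ _ h.2.2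
    let w : T → W d := fun x => (l x - S.lam (g x)) * (S.y (g x) - S.rho m (g x))
    have hw : ∀ x, ‖w x‖ ≤ (K * S.M) / 2 ^ (2 * m) := by
      intro x
      have k1 := near x
      rw [norm_sub_rev] at k1
      refine (norm_mul_le _ _).trans ((mul_le_mul k1 (y_rho_norm' m (g x)) (norm_nonneg _)
        (by positivity)).trans (le_of_eq ?_))
      rw [Pair.pow2]
      field_simp
    have e0 : ∀ x, l x * S.y (g x) = l x * S.rho m (g x)
        + ((2:ℝ) ^ m)⁻¹ • S.q (S.sh m (g x)) + w x := by
      intro x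
      rw [q_sh, smul_smul, inv_mul_cancel₀ (by positivity), one_smul]
      simp only [w, q]
      ring
    have e : l x * S.y (g x) - l z * S.y (g z) = (l x - l z) * S.rho m (g z)
        + ((2:ℝ) ^ m)⁻¹ • (S.q (S.sh m (g x)) - S.q (S.sh m (g z))) + (w x - w z) := by
      rw [e0 x, e0 z, r, smul_sub, sub_mul]
      abel
    refine smul_norm_le ?_
    rw [← map_sub, e, map_add, map_add, map_smul]
    have k1 : ‖P ((l x - l z) * S.rho m (g z))‖ ≤ c * (K / 2 ^ (2 * m)) := by
      refine (hP.2 _).trans (mul_le_mul_of_nonneg_left ?_ hP.1)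
      refine (norm_mul_le _ _).trans ?_
      calc _ ≤ K / 2 ^ (2 * m) * 1 :=
            mul_le_mul g2 (S.rho_norm m (g z)) (norm_nonneg _) (by positivity)
        _ = _ := mul_one _
    have k2 : ‖((2:ℝ) ^ m)⁻¹ • P (S.q (S.sh m (g x)) - S.q (S.sh m (g z)))‖ ≤ 1 / 2 ^ (2 * m) := by
      rw [norm_smul, Real.norm_eq_abs, abs_of_pos (by positivity)]
      refine (mul_le_mul_of_nonneg_left g1 (by positivity)).trans (le_of_eq ?_)
      rw [Pair.pow2]
      field_simp
    have k3 : ‖P (w x - w z)‖ ≤ c * (2 * ((K * S.M) / 2 ^ (2 * m))) := by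
      refine (hP.2 _).trans (mul_le_mul_of_nonneg_left ?_ hP.1)
      refine (norm_sub_le _ _).trans ?_
      linarith [hw x, hw z]
    refine norm_add₃_le.trans ((add_le_add (add_le_add k1 k2) k3).trans (le_of_eq ?_))
    ring
  unfold K9
  linarith

/-- entropy of the projection -/
theorem cH_Gv_Lv {E : St S.Om} (hE : S.Stat E) {P : W d →ₗ[ℝ] (ι → ℝ)} {c : ℝ} (hP : Bn P c) (m : ℕ) :
    E.cH (S.Gv P m) (S.Lv m) ≤ S.hh E * m - S.gamma E P * m + S.eta E m
      + (Fintype.card ι * KK (c * (1 + S.M * S.M)) + S.cS ι c) := by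
  have h1 := E.cH_symm (S.Gv P m) (S.Wv m) (S.Lv m)
  have h2 := S.factA E hP m
  have h3 := E.cH_le_H (S.Wv m) (S.Lv m)
  have h4 := gamma_le hE hP m
  unfold gam Dv at h4
  unfold eta
  linarith

end Sys
end FHR
namespace FHR

section Rv
variable {ι : Type} [Fintype ι]

def dt (v w : ι → ℝ) : ℝ := ∑ i, v i * w i

/-- projection along `v` (identity if `v = 0`) -/
def Rv (v : ι → ℝ) : (ι → ℝ) →ₗ[ℝ] (ι → ℝ) where
  toFun w := w - (dt v w / dt v v) • v
  map_add' w w' := by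
    have : dt v (w + w') = dt v w + dt v w' := by
      simp only [dt, Pi.add_apply, mul_add, Finset.sum_add_distrib]
    rw [this, add_div, add_smul]
    abel
  map_smul' r w := by
    have : dt v (r • w) = r * dt v w := by
      simp only [dt, Pi.smul_apply, smul_eq_mul, Finset.mul_sum]
      exact Finset.sum_congr rfl fun i _ => by ring
    rw [this, mul_div_assoc, mul_smul, smul_sub]
    rfl

theorem Rv_apply (v w : ι → ℝ) : Rv v w = w - (dt v w / dt v v) • v := rfl

theorem dt_self_ge (v : ι → ℝ) : ‖v‖ ^ 2 ≤ dt v v := by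
  have h : ∀ i, ‖v i‖ ≤ Real.sqrt (dt v v) := by
    intro i
    rw [Real.norm_eq_abs]
    apply Real.abs_le_sqrt
    rw [sq]
    exact Finset.single_le_sum (f := fun i => v i * v i) (fun i _ => mul_self_nonneg _)
      (Finset.mem_univ i)
  have h1 := (pi_norm_le_iff_of_nonneg (Real.sqrt_nonneg _)).2 h
  have h2 : 0 ≤ dt v v := Finset.sum_nonneg fun i _ => mul_self_nonneg _
  calc _ ≤ (Real.sqrt (dt v v)) ^ 2 := pow_le_pow_left₀ (norm_nonneg _) h1 2
    _ = _ := Real.sq_sqrt h2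

theorem dt_le (v w : ι → ℝ) : |dt v w| ≤ Fintype.card ι * (‖v‖ * ‖w‖) := by
  unfold dt
  refine (Finset.abs_sum_le_sum_abs _ _).trans ?_
  have : ∀ i ∈ Finset.univ, |v i * w i| ≤ ‖v‖ * ‖w‖ := fun i _ => by
    rw [abs_mul]
    exact mul_le_mul (norm_le_pi_norm v i) (norm_le_pi_norm w i) (abs_nonneg _) (norm_nonneg _)
  refine (Finset.sum_le_sum this).trans (le_of_eq ?_)
  rw [Finset.sum_const, nsmul_eq_mul, Finset.card_univ]

theorem Rv_self {v : ι → ℝ} (hv : v ≠ 0) : Rv v v = 0 := by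
  have h := dt_self_ge v
  have h1 : 0 < ‖v‖ := norm_pos_iff.2 hv
  have h2 : dt v v ≠ 0 := by nlinarith
  rw [Rv_apply, div_self h2, one_smul, sub_self]

theorem Rv_zero : Rv (0 : ι → ℝ) = LinearMap.id := by
  apply LinearMap.ext
  intro x
  simp [Rv_apply]

def cR (ι : Type) [Fintype ι] : ℝ := 1 + Fintype.card ι

theorem cR_ge : 1 ≤ cR ι := by
  unfold cR
  have : (0:ℝ) ≤ Fintype.card ι := Nat.cast_nonneg _
  linarith

theorem Rv_norm (v w : ι → ℝ) : ‖Rv v w‖ ≤ cR ι * ‖w‖ := by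
  by_cases hv : v = 0
  · rw [hv, Rv_zero, LinearMap.id_apply]
    have := cR_ge (ι := ι)
    have := norm_nonneg w
    nlinarith
  · have h := dt_self_ge v
    have h1 : 0 < ‖v‖ := norm_pos_iff.2 hv
    have h2 : 0 < dt v v := by nlinarith
    have h3 := dt_le v w
    rw [Rv_apply]
    refine (norm_sub_le _ _).trans ?_
    rw [norm_smul, Real.norm_eq_abs, abs_div, abs_of_pos h2]
    have h4 : |dt v w| / dt v v * ‖v‖ ≤ Fintype.card ι * ‖w‖ := by
      rw [div_mul_eq_mul_div, div_le_iff₀ h2]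
      have h5 : (0:ℝ) ≤ Fintype.card ι * ‖w‖ := by positivity
      calc |dt v w| * ‖v‖ ≤ Fintype.card ι * (‖v‖ * ‖w‖) * ‖v‖ :=
            mul_le_mul_of_nonneg_right h3 h1.le
        _ = (Fintype.card ι * ‖w‖) * ‖v‖ ^ 2 := by ring
        _ ≤ _ := mul_le_mul_of_nonneg_left h h5
    unfold cR
    linarith

end Rv

namespace Sys
variable {d : ℕ} {S : Sys d} {ι : Type} [Fintype ι]

theorem Bn_Rv {P : W d →ₗ[ℝ] (ι → ℝ)} {c : ℝ} (hP : Bn P c) (v : ι → ℝ) :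
    Bn (Rv v ∘ₗ P) (cR ι * c) := by
  have h := cR_ge (ι := ι)
  refine ⟨mul_nonneg (by linarith) hP.1, fun x => ?_⟩
  rw [LinearMap.comp_apply, mul_assoc]
  exact (Rv_norm _ _).trans (mul_le_mul_of_nonneg_left (hP.2 x) (by linarith))

namespace Pair
variable {E : St S.Om} {a : W d} {P : W d →ₗ[ℝ] (ι → ℝ)} {C : ℝ} {m : ℕ} (t : S.Pair E a P C m)

/-- time parameter -/
def sg (x : t.T) : ℝ := ((t.s x : ℕ) : ℝ) / 2 ^ (2 * m)

theorem sg_nonneg (x : t.T) : 0 ≤ t.sg x := by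
  unfold sg
  positivity

theorem sg_le (x : t.T) : t.sg x ≤ 1 / 2 ^ m := by
  unfold sg
  have h : ((t.s x : ℕ) : ℝ) ≤ 2 ^ m := by exact_mod_cast (t.s x).2.le
  rw [div_le_div_iff₀ (by positivity) (by positivity), pow2, one_mul]
  have : (0:ℝ) < 2 ^ m := by positivity
  nlinarith

def u (x : t.T) : ι → ℝ := P (t.l x * S.y (t.o x))
def u' (x : t.T) : ι → ℝ := P (t.l x * S.y (t.o' x))
def pv (x : t.T) : ι → ℝ := P (a * (t.l x * (S.y (t.o x) - S.y (t.o' x))))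

theorem ly_norm (x : t.T) (ω : S.Om) : ‖t.l x * S.y ω‖ ≤ C :=
  (norm_mul_le _ _).trans ((mul_le_mul (t.l_norm x) (S.y_norm _) (norm_nonneg _)
    ((norm_nonneg _).trans (t.l_norm x))).trans (le_of_eq (mul_one _)))

theorem u_norm {c : ℝ} (hP : Bn P c) (x : t.T) : ‖t.u x‖ ≤ c * C :=
  (hP.2 _).trans (mul_le_mul_of_nonneg_left (t.ly_norm _ _) hP.1)

theorem u'_norm {c : ℝ} (hP : Bn P c) (x : t.T) : ‖t.u' x‖ ≤ c * C :=
  (hP.2 _).trans (mul_le_mul_of_nonneg_left (t.ly_norm _ _) hP.1)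

theorem pv_norm {c : ℝ} (hP : Bn P c) (x : t.T) : ‖t.pv x‖ ≤ c * (‖a‖ * (2 * C)) := by
  refine (hP.2 _).trans (mul_le_mul_of_nonneg_left ?_ hP.1)
  refine (norm_mul_le _ _).trans (mul_le_mul_of_nonneg_left ?_ (norm_nonneg _))
  rw [mul_sub]
  refine (norm_sub_le _ _).trans ?_
  linarith [t.ly_norm x (t.o x), t.ly_norm x (t.o' x)]

def K1 (C c : ℝ) : ℝ := 1 + 2 * (c * C)

theorem e_bound {c : ℝ} (hP : Bn P c) (x : t.T) :
    ‖t.u' x - t.u x - t.sg x • t.pv x‖ ≤ K1 C c / 2 ^ (2 * m) := by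
  have hC : 0 ≤ C := (norm_nonneg _).trans (t.l_norm x)
  set e1 := S.lam (t.o x) - t.l x - t.sg x • (a * t.l x) with he1
  set e2 := S.lam (t.o' x) - t.l x - t.sg x • (a * t.l x) with he2
  have h1 : ‖e1‖ ≤ C / 2 ^ (2 * m) := t.near2 x
  have h2 : ‖e2‖ ≤ C / 2 ^ (2 * m) := t.near2' x
  have e : t.u' x - t.u x - t.sg x • t.pv x
      = -P (S.q (t.o x) - S.q (t.o' x)) + P (e1 * S.y (t.o x)) - P (e2 * S.y (t.o' x)) := by
    unfold u u' pv
    rw [← map_smul, ← map_neg, ← map_add, ← map_sub, ← map_sub, ← map_sub]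
    congr 1
    rw [he1, he2]
    unfold q
    funext j
    simp only [Pi.sub_apply, Pi.add_apply, Pi.neg_apply, Pi.mul_apply, Pi.smul_apply, smul_eq_mul]
    ring
  have k : ∀ (e : W d) (ω : S.Om), ‖e‖ ≤ C / 2 ^ (2 * m) → ‖P (e * S.y ω)‖ ≤ c * (C / 2 ^ (2 * m)) := by
    intro e ω he
    refine (hP.2 _).trans (mul_le_mul_of_nonneg_left ?_ hP.1)
    exact (norm_mul_le _ _).trans ((mul_le_mul he (S.y_norm _) (norm_nonneg _)
      (by positivity)).trans (le_of_eq (mul_one _)))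
  have h3 := t.G x
  rw [e]
  refine (norm_sub_le _ _).trans ((add_le_add_left (norm_add_le _ _) _).trans ?_)
  rw [norm_neg]
  refine (add_le_add (add_le_add h3 (k _ _ h1)) (k _ _ h2)).trans (le_of_eq ?_)
  unfold K1
  ring

theorem Bd_smul {T : Type} {g : T → ι → ℝ} {K : ℝ} (h : ∀ x, ‖g x‖ ≤ K) (n : ℕ) :
    Bd fun x => (2:ℝ) ^ n • g x := by
  refine Bd.of_norm (C := 2 ^ n * K) fun x => ?_
  rw [norm_smul, Real.norm_eq_abs, abs_of_pos (by positivity)]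
  exact mul_le_mul_of_nonneg_left (h x) (by positivity)

theorem Bd_u : Bd fun x => (2:ℝ) ^ (2 * m) • t.u x := by
  obtain ⟨c, hP⟩ := exists_Bn P
  exact Bd_smul (t.u_norm hP) _
theorem Bd_u' : Bd fun x => (2:ℝ) ^ (2 * m) • t.u' x := by
  obtain ⟨c, hP⟩ := exists_Bn P
  exact Bd_smul (t.u'_norm hP) _
theorem Bd_pv : Bd fun x => (2:ℝ) ^ m • t.pv x := by
  obtain ⟨c, hP⟩ := exists_Bn P
  exact Bd_smul (t.pv_norm hP) _

def Y : RV t.T := fl _ t.Bd_u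
def Y' : RV t.T := fl _ t.Bd_u'
def V : RV t.T := fl _ t.Bd_pv

def vh (x : t.T) : ι → ℝ := fun i => (⌊(2:ℝ) ^ m * t.pv x i⌋ : ℝ) / 2 ^ m

theorem vh_eq {x z : t.T} (h : t.V.rel x z) : t.vh x = t.vh z := by
  funext i
  unfold V at h
  rw [fl_rel] at h
  have := h i
  simp only [Pi.smul_apply, smul_eq_mul] at this
  unfold vh
  rw [this]

theorem vh_close (x : t.T) : ‖t.pv x - t.vh x‖ ≤ 1 / 2 ^ m := by
  refine (pi_norm_le_iff_of_nonneg (by positivity)).2 fun i => ?_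
  have h1 := Int.floor_le ((2:ℝ) ^ m * t.pv x i)
  have h2 := (Int.lt_floor_add_one ((2:ℝ) ^ m * t.pv x i)).le
  have hp : (0:ℝ) < 2 ^ m := by positivity
  rw [Pi.sub_apply, Real.norm_eq_abs, abs_le]
  unfold vh
  have e : t.pv x i = ((2:ℝ) ^ m * t.pv x i) / 2 ^ m := by field_simp
  rw [e, ← sub_div, mul_div_cancel_left₀ _ hp.ne', ← neg_div]
  constructor
  · apply div_le_div_of_nonneg_right _ hp.le
    linarith
  · apply div_le_div_of_nonneg_right _ hp.le
    linarith

/-- the event that the direction is not small -/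
def Ev (κ : ℝ) (x : t.T) : Prop := κ ≤ ‖t.vh x‖

open Classical in
def ve (κ : ℝ) (x : t.T) : ι → ℝ := if t.Ev κ x then t.vh x else 0

open Classical in
def sE (κ : ℝ) (x : t.T) : Fin (2 ^ m) := if t.Ev κ x then 0 else t.s x

def Ch : RV t.T := t.X' m ⊔ (t.X m ⊔ (t.B ⊔ t.V))

theorem Bd_R (κ : ℝ) : Bd fun x => (2:ℝ) ^ (2 * m) • Rv (t.ve κ x) (t.u x) := by
  obtain ⟨c, hP⟩ := exists_Bn P
  refine Bd_smul (K := cR ι * (c * C)) (fun x => (Rv_norm _ _).trans ?_) _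
  have := cR_ge (ι := ι)
  exact mul_le_mul_of_nonneg_left (t.u_norm hP x) (by linarith)

/-- projected fine position -/
def Z (κ : ℝ) : RV t.T := fl _ (t.Bd_R κ)

theorem ve_eq {κ : ℝ} {x z : t.T} (h : t.V.rel x z) : t.ve κ x = t.ve κ z := by
  unfold ve Ev
  rw [t.vh_eq h]

theorem norm_three {A B D : ι → ℝ} {p q r : ℝ} (hA : ‖A‖ ≤ p) (hB : ‖B‖ ≤ q) (hD : ‖D‖ ≤ r) :
    ‖A - B - D‖ ≤ p + q + r :=
  (norm_sub_le _ _).trans (add_le_add ((norm_sub_le _ _).trans (add_le_add hA hB)) hD)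

theorem iv1 (κ : ℝ) : t.F.cH (t.Z κ) (t.Y ⊔ (t.Ch ⊔ RV.ofF (t.sE κ))) ≤ Fintype.card ι * KK (cR ι) := by
  refine cH_fln t.F ?_
  intro x z h
  have h1 : ‖t.u x - t.u z‖ ≤ 1 / 2 ^ (2 * m) := norm_le_of_smul (fl_closen (h := t.Bd_u) h.1)
  have h2 := t.ve_eq (κ := κ) h.2.1.2.2.2
  refine smul_norm_le ?_
  rw [h2, ← map_sub]
  refine (Rv_norm _ _).trans ?_
  have := cR_ge (ι := ι)
  refine (mul_le_mul_of_nonneg_left h1 (by linarith)).trans (le_of_eq ?_)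
  ring

theorem iv2 {κ : ℝ} (hκ : 0 < κ) {c : ℝ} (hP : Bn P c) :
    t.F.cH (t.Z κ) (t.Y' ⊔ (t.Ch ⊔ RV.ofF (t.sE κ)))
      ≤ Fintype.card ι * KK (cR ι * (3 + 2 * K1 C c)) := by
  refine cH_fln t.F ?_
  intro x z h
  have h1 : ‖t.u' x - t.u' z‖ ≤ 1 / 2 ^ (2 * m) := norm_le_of_smul (fl_closen (h := t.Bd_u') h.1)
  have hV := h.2.1.2.2.2
  have h2 := t.ve_eq (κ := κ) hV
  have hvh := t.vh_eq hV
  have hs : t.sE κ x = t.sE κ z := h.2.2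
  have hR := cR_ge (ι := ι)
  have ex := t.e_bound hP x
  have ez := t.e_bound hP z
  refine smul_norm_le ?_
  rw [h2, ← map_sub]
  set R := Rv (t.ve κ z) with hRd
  set dx := t.u' x - t.u x - t.sg x • t.pv x with hdx
  set dz := t.u' z - t.u z - t.sg z • t.pv z with hdz
  have e : t.u x - t.u z = (t.u' x - t.u' z) - (t.sg x • t.pv x - t.sg z • t.pv z) - (dx - dz) := by
    rw [hdx, hdz]
    abel
  rw [e, map_sub, map_sub]
  have k1 : ‖R (t.u' x - t.u' z)‖ ≤ cR ι * (1 / 2 ^ (2 * m)) :=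
    (Rv_norm _ _).trans (mul_le_mul_of_nonneg_left h1 (by linarith))
  have k3 : ‖R (dx - dz)‖ ≤ cR ι * (2 * (K1 C c / 2 ^ (2 * m))) :=
    (Rv_norm _ _).trans (mul_le_mul_of_nonneg_left ((norm_sub_le _ _).trans (by linarith)) (by linarith))
  have hpw : (1:ℝ) / 2 ^ m * (1 / 2 ^ m) = 1 / 2 ^ (2 * m) := by
    rw [pow2]
    field_simp
  have k2 : ‖R (t.sg x • t.pv x - t.sg z • t.pv z)‖ ≤ cR ι * (2 * (1 / 2 ^ (2 * m))) := by
    have cx := t.vh_close x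
    have cz := t.vh_close z
    rw [hvh] at cx
    have g : ∀ y : t.T, ∀ w : ι → ℝ, ‖w‖ ≤ 1 / 2 ^ m → ‖t.sg y • w‖ ≤ 1 / 2 ^ (2 * m) := by
      intro y w hw
      rw [norm_smul, Real.norm_eq_abs, abs_of_nonneg (t.sg_nonneg y), ← hpw]
      exact mul_le_mul (t.sg_le y) hw (norm_nonneg _) (by positivity)
    by_cases hE : t.Ev κ z
    · have hve : t.ve κ z = t.vh z := if_pos hE
      have hne : t.vh z ≠ 0 := by
        intro h0
        unfold Ev at hE
        rw [h0, norm_zero] at hE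
        linarith
      have hz : R (t.vh z) = 0 := by rw [hRd, hve, Rv_self hne]
      have e2 : R (t.sg x • t.pv x - t.sg z • t.pv z)
          = R (t.sg x • (t.pv x - t.vh z) - t.sg z • (t.pv z - t.vh z)) := by
        simp only [map_sub, map_smul, hz, sub_zero]
      rw [e2]
      refine (Rv_norm _ _).trans (mul_le_mul_of_nonneg_left ((norm_sub_le _ _).trans ?_) (by linarith))
      linarith [g x _ cx, g z _ cz]
    · have hEx : ¬ t.Ev κ x := by
        unfold Ev at hE ⊢
        rwa [hvh]
      have h3 : t.s x = t.s z := by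
        unfold sE at hs
        rwa [if_neg hE, if_neg hEx] at hs
      have h4 : t.sg x = t.sg z := by
        unfold sg
        rw [h3]
      have e2 : t.sg x • t.pv x - t.sg z • t.pv z
        = t.sg z • (t.pv x - t.vh z) - t.sg z • (t.pv z - t.vh z) := by
        rw [h4, ← smul_sub, ← smul_sub]
        congr 1
        abel
      rw [e2]
      refine (Rv_norm _ _).trans (mul_le_mul_of_nonneg_left ((norm_sub_le _ _).trans ?_) (by linarith))
      linarith [g z _ cx, g z _ cz]
  refine (norm_three k1 k2 k3).trans (le_of_eq ?_)
  ring

theorem v5 {κ : ℝ} (hκ : 0 < κ) {c : ℝ} (hP : Bn P c) :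
    t.F.cH t.lb (t.Y' ⊔ (t.Y ⊔ (t.Ch ⊔ RV.ofF (t.sE κ)))) ≤ KK ((4 + 2 * K1 C c) / κ) := by
  let us : t.T → Fin 1 → ℝ := fun x _ => ((t.s x : ℕ) : ℝ)
  have hb : Bd us := Bd.of_norm (C := 2 ^ m) fun x => by
    refine (pi_norm_le_iff_of_nonneg (by positivity)).2 fun i => ?_
    rw [Real.norm_eq_abs, abs_of_nonneg (Nat.cast_nonneg _)]
    show ((t.s x : ℕ) : ℝ) ≤ 2 ^ m
    exact_mod_cast (t.s x).2.le
  have h0 : t.lb ≤ fl us hb := by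
    intro x z h
    rw [fl_rel] at h
    have := h 0
    simp only [us, Int.floor_natCast] at this
    have h1 : t.s x = t.s z := Fin.ext (by exact_mod_cast this)
    exact h1
  refine (t.F.cH_mono h0 _).trans ?_
  have key : t.F.cH (fl us hb) (t.Y' ⊔ (t.Y ⊔ (t.Ch ⊔ RV.ofF (t.sE κ))))
      ≤ Fintype.card (Fin 1) * KK ((4 + 2 * K1 C c) / κ) := by
    refine cH_fln t.F ?_
    intro x z h
    have h1 : ‖t.u' x - t.u' z‖ ≤ 1 / 2 ^ (2 * m) := norm_le_of_smul (fl_closen (h := t.Bd_u') h.1)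
    have h1' : ‖t.u x - t.u z‖ ≤ 1 / 2 ^ (2 * m) := norm_le_of_smul (fl_closen (h := t.Bd_u) h.2.1)
    have hV := h.2.2.1.2.2.2
    have hvh := t.vh_eq hV
    have hs : t.sE κ x = t.sE κ z := h.2.2.2
    have ex := t.e_bound hP x
    have ez := t.e_bound hP z
    have hK : 0 ≤ K1 C c := by
      have hC : 0 ≤ C := (norm_nonneg _).trans (t.l_norm x)
      have := hP.1
      unfold K1
      positivity
    refine (pi_norm_le_iff_of_nonneg (by positivity)).2 fun i => ?_
    simp only [us, Pi.sub_apply]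
    rw [Real.norm_eq_abs]
    by_cases hE : t.Ev κ z
    · set dx := t.u' x - t.u x - t.sg x • t.pv x with hdx
      set dz := t.u' z - t.u z - t.sg z • t.pv z with hdz
      have cx := t.vh_close x
      have cz := t.vh_close z
      rw [hvh] at cx
      have hpw : (1:ℝ) / 2 ^ m * (1 / 2 ^ m) = 1 / 2 ^ (2 * m) := by
        rw [pow2]
        field_simp
      have g : ∀ y : t.T, ∀ w : ι → ℝ, ‖w‖ ≤ 1 / 2 ^ m → ‖t.sg y • w‖ ≤ 1 / 2 ^ (2 * m) := by
        intro y w hw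
        rw [norm_smul, Real.norm_eq_abs, abs_of_nonneg (t.sg_nonneg y), ← hpw]
        exact mul_le_mul (t.sg_le y) hw (norm_nonneg _) (by positivity)
      have e : (t.sg x - t.sg z) • t.vh z = ((t.u' x - t.u' z) - (t.u x - t.u z) - (dx - dz))
          - t.sg x • (t.pv x - t.vh z) - (-(t.sg z • (t.pv z - t.vh z))) := by
        rw [hdx, hdz]
        simp only [smul_sub, sub_smul]
        abel
      have k := norm_three (norm_three h1 h1' ((norm_sub_le dx dz).trans (add_le_add ex ez)))
        (g x _ cx) (show ‖-(t.sg z • (t.pv z - t.vh z))‖ ≤ 1 / 2 ^ (2 * m) by rw [norm_neg]; exact g z _ cz)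
      rw [← e, norm_smul, Real.norm_eq_abs] at k
      have e2 : t.sg x - t.sg z = (((t.s x : ℕ) : ℝ) - ((t.s z : ℕ) : ℝ)) / 2 ^ (2 * m) := by
        unfold sg
        ring
      rw [e2, abs_div, abs_of_pos (a := (2:ℝ) ^ (2 * m)) (by positivity)] at k
      rw [le_div_iff₀ hκ]
      have hE' : κ ≤ ‖t.vh z‖ := hE
      have hp : (0:ℝ) < 2 ^ (2 * m) := by positivity
      have k2 : |((t.s x : ℕ) : ℝ) - ((t.s z : ℕ) : ℝ)| * ‖t.vh z‖ ≤ 4 + 2 * K1 C c := by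
        rw [div_mul_eq_mul_div] at k
        have : (1:ℝ) / 2 ^ (2 * m) + 1 / 2 ^ (2 * m) + (K1 C c / 2 ^ (2 * m) + K1 C c / 2 ^ (2 * m))
          + 1 / 2 ^ (2 * m) + 1 / 2 ^ (2 * m) = (4 + 2 * K1 C c) / 2 ^ (2 * m) := by ring
        rw [this, div_le_div_iff_of_pos_right hp] at k
        exact k
      exact (mul_le_mul_of_nonneg_left hE' (abs_nonneg _)).trans k2
    · have hEx : ¬ t.Ev κ x := by
        unfold Ev at hE ⊢
        rwa [hvh]
      have h3 : t.s x = t.s z := by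
        unfold sE at hs
        rwa [if_neg hE, if_neg hEx] at hs
      rw [h3, sub_self, abs_zero]
      positivity
  simpa using key

theorem viiV {c : ℝ} (hC : 0 ≤ C) (hP : Bn P c) :
    t.F.cH t.V (t.X' m ⊔ (t.X m ⊔ t.B)) ≤
      Fintype.card ι * KK (c * (‖a‖ * (2 * C + C * (2 * S.M)))) := by
  have hM := S.M_pos
  refine cH_fln t.F ?_
  intro x z h
  refine smul_norm_le ?_
  unfold pv
  rw [← map_sub]
  refine (hP.2 _).trans ?_
  rw [mul_div_assoc]
  refine mul_le_mul_of_nonneg_left ?_ hP.1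
  have h1 := S.y_close h.2.1
  have h1' := S.y_close h.1
  have h2 := t.Bclose _ _ h.2.2
  have h0 : C / 2 ^ (2 * m) ≤ C / 2 ^ m :=
    div_le_div_of_nonneg_left hC (by positivity) (pow_le_pow_right₀ (by norm_num) (by omega))
  rw [← mul_sub]
  refine (norm_mul_le _ _).trans ?_
  rw [mul_div_assoc]
  refine mul_le_mul_of_nonneg_left ?_ (norm_nonneg _)
  have e : t.l x * (S.y (t.o x) - S.y (t.o' x)) - t.l z * (S.y (t.o z) - S.y (t.o' z))
    = (t.l x - t.l z) * (S.y (t.o x) - S.y (t.o' x))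
      + t.l z * ((S.y (t.o x) - S.y (t.o z)) - (S.y (t.o' x) - S.y (t.o' z))) := by ring
  rw [e]
  have k1 : ‖S.y (t.o x) - S.y (t.o' x)‖ ≤ 2 :=
    (norm_sub_le _ _).trans (by linarith [S.y_norm (t.o x), S.y_norm (t.o' x)])
  have k2 := (norm_sub_le (S.y (t.o x) - S.y (t.o z)) (S.y (t.o' x) - S.y (t.o' z))).trans
    (add_le_add h1 h1')
  refine (norm_add_le _ _).trans ((add_le_add ((norm_mul_le _ _).trans (mul_le_mul (h2.trans h0) k1
    (norm_nonneg _) (by positivity))) ((norm_mul_le _ _).trans (mul_le_mul (t.l_norm z) k2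
    (norm_nonneg _) hC))).trans (le_of_eq ?_))
  ring

theorem vii {c : ℝ} (hC : 0 ≤ C) (hP : Bn P c) :
    t.F.cH (t.Y ⊔ t.V) (t.X' m ⊔ (t.X (2 * m) ⊔ t.B)) ≤
      Fintype.card ι * KK (c * (C + C * S.M)) + Fintype.card ι * KK (c * (‖a‖ * (2 * C + C * (2 * S.M)))) := by
  have hM := S.M_pos
  refine (t.F.cH_sup_le _ _ _).trans (add_le_add ?_ ?_)
  · refine cH_fln t.F ?_
    intro x z h
    refine smul_norm_le ?_
    unfold u
    rw [← map_sub]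
    refine (hP.2 _).trans ?_
    rw [mul_div_assoc]
    refine mul_le_mul_of_nonneg_left ?_ hP.1
    have h1 := S.y_close h.2.1
    have h2 := t.Bclose _ _ h.2.2
    have e : t.l x * S.y (t.o x) - t.l z * S.y (t.o z)
      = (t.l x - t.l z) * S.y (t.o x) + t.l z * (S.y (t.o x) - S.y (t.o z)) := by ring
    rw [e]
    refine (norm_add_le _ _).trans ((add_le_add ((norm_mul_le _ _).trans (mul_le_mul h2 (S.y_norm _)
      (norm_nonneg _) (by positivity))) ((norm_mul_le _ _).trans (mul_le_mul (t.l_norm z) h1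
      (norm_nonneg _) hC))).trans (le_of_eq ?_))
    ring
  · exact (t.F.cH_anti _ (sup_le_sup le_rfl (sup_le_sup (t.X_mono (by omega)) le_rfl))).trans
      (t.viiV hC hP)

end Pair
end Sys
end FHR
namespace FHR
namespace Sys
variable {d : ℕ} {S : Sys d} {ι : Type} [Fintype ι]

/-- the main lower bound -/
theorem star2 {E : St S.Om} (hE : S.Stat E) (a : W d) {P : W d →ₗ[ℝ] (ι → ℝ)} {C : ℝ} (hC : 0 ≤ C)
    {κ : ℝ} (hκ : 0 < κ) : ∃ D : ℝ, ∀ (m : ℕ) (t : S.Pair E a P C m),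
      S.gamma E P * m + t.F.E (ind (t.Ev κ)) * (m * Real.log 2) - 3 * S.er E P m - D
        ≤ t.F.cH (t.X (2 * m)) (t.Z κ ⊔ (t.Ch ⊔ t.lb)) := by
  obtain ⟨c, hP⟩ := exists_Bn P
  refine ⟨(Fintype.card ι * KK (c * (1 + S.M * S.M)) + S.cS ι c) + K9 S ι C c
    + Fintype.card ι * KK (cR ι * (3 + 2 * Pair.K1 C c)) + Fintype.card ι * KK (cR ι)
    + KK ((4 + 2 * Pair.K1 C c) / κ) + (S.cL + 3 * C + S.cS ι c + Pair.K5 S ι C c)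
    + (Fintype.card ι * KK (c * (C + C * S.M)) + Fintype.card ι * KK (c * (‖a‖ * (2 * C + C * (2 * S.M)))))
    + (S.cL + 2 * C + S.cS ι c + Pair.K5 S ι C c) +
    Fintype.card ι * KK (c * (‖a‖ * (2 * C + C * (2 * S.M)))) + S.cS ι c, fun m t => ?_⟩
  set F := t.F with hF
  set Dd := t.Ch ⊔ RV.ofF (t.sE κ) with hDd
  have n1 : F.cH t.Y' Dd ≤ E.cH (S.Gv P m) (S.Lv m) + K9 S ι C c := by
    have h0 : t.X' m ⊔ t.B ≤ Dd := fun x z h => ⟨h.1.1, h.1.2.2.1⟩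
    refine (F.cH_anti _ h0).trans ?_
    exact nine F hE t.o' t.l t.B hP hC m t.law' t.near' t.Bclose t.Bd_u'
  have n2 := cH_Gv_Lv hE hP m
  have h1 := F.cH_symm t.Y' (t.Z κ) Dd
  have h2 := t.iv2 hκ hP
  have h3 : F.cH t.Y' (t.Z κ ⊔ (t.Y ⊔ Dd)) ≤ F.cH t.Y' (t.Z κ ⊔ Dd) :=
    F.cH_anti _ (sup_le_sup le_rfl le_sup_right)
  have h4 := F.cH_symm t.Y' (t.Z κ) (t.Y ⊔ Dd)
  have h4' := F.cH_nonneg (t.Z κ) (t.Y' ⊔ (t.Y ⊔ Dd))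
  have h5 := t.iv1 κ
  have h6 := F.cH_symm t.Y' t.lb (t.Y ⊔ Dd)
  have h6' := F.cH_nonneg t.Y' (t.lb ⊔ (t.Y ⊔ Dd))
  have h7 := t.v5 hκ hP
  have h8 := F.cH_symm t.lb (RV.ofF (t.sE κ)) (t.Y ⊔ t.Ch)
  have e8 : RV.ofF (t.sE κ) ⊔ (t.Y ⊔ t.Ch) = t.Y ⊔ Dd := by
    rw [hDd, sup_comm, sup_assoc]
  rw [e8] at h8
  have h8' := F.cH_nonneg (RV.ofF (t.sE κ)) (t.lb ⊔ (t.Y ⊔ t.Ch))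
  have h9 : F.cH (RV.ofF (t.sE κ)) (t.Y ⊔ t.Ch) ≤ F.E (ind fun x => ¬ t.Ev κ x) * (m * Real.log 2) := by
    have h0 : RV.ofF (t.Ev κ) ≤ t.Y ⊔ t.Ch := by
      intro x z h
      have hv := t.vh_eq h.2.2.2.2
      rw [RV.ofF_rel]
      unfold Pair.Ev
      rw [hv]
    refine (F.cH_anti _ h0).trans ?_
    refine (F.cH_event (t.Ev κ) (t.sE κ) ?_).trans (le_of_eq ?_)
    · intro x z hx hz
      unfold Pair.sE
      rw [if_pos hx, if_pos hz]
    · rw [Fintype.card_fin]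
      push_cast
      rw [Real.log_pow]
  have hc : F.E (ind fun x => ¬ t.Ev κ x) = 1 - F.E (ind (t.Ev κ)) := by
    have : (ind fun x => ¬ t.Ev κ x) = fun x => 1 - ind (t.Ev κ) x := by
      funext x
      by_cases h : t.Ev κ x
      · rw [ind_neg (by simpa using h), ind_pos h]
        norm_num
      · rw [ind_pos (by simpa using h), ind_neg h]
        norm_num
    rw [this, F.sub, F.const]
  rw [hc] at h9
  have s6 := t.six hE hC hP
  have s7 := t.seven hE hC hP
  have h10 := F.cH_add t.lb (t.X' m ⊔ (t.X (2 * m) ⊔ t.B)) (t.Y ⊔ t.V)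
  have h11 : F.cH t.lb ((t.Y ⊔ t.V) ⊔ (t.X' m ⊔ (t.X (2 * m) ⊔ t.B))) ≤ F.cH t.lb (t.Y ⊔ t.Ch) := by
    refine F.cH_anti _ ?_
    intro x z h
    exact ⟨h.1.1, h.2.1, t.X_mono (by omega : m ≤ 2 * m) _ _ h.2.2.1, h.2.2.2, h.1.2⟩
  have h12 := t.vii hC hP
  have h13 : F.cH (t.Z κ) (t.Ch ⊔ t.lb) ≤ F.cH (t.Z κ) Dd := by
    refine F.cH_anti _ ?_
    intro x z h
    refine ⟨h.1, ?_⟩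
    have hv := t.vh_eq h.1.2.2.2
    have hs : t.s x = t.s z := h.2
    show t.sE κ x = t.sE κ z
    unfold Pair.sE Pair.Ev
    rw [hv, hs]
  have h14 := F.cH_symm (t.X (2 * m)) (t.Z κ) (t.Ch ⊔ t.lb)
  have h14' := F.cH_nonneg (t.Z κ) (t.X (2 * m) ⊔ (t.Ch ⊔ t.lb))
  have h15 := F.cH_add (t.X (2 * m)) (t.X' m ⊔ (t.X m ⊔ (t.B ⊔ t.lb))) t.V
  have h16 : F.cH (t.X (2 * m)) (t.V ⊔ (t.X' m ⊔ (t.X m ⊔ (t.B ⊔ t.lb)))) ≤ F.cH (t.X (2 * m)) (t.Ch ⊔ t.lb) := by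
    refine F.cH_anti _ ?_
    intro x z h
    exact ⟨⟨h.2.1, h.2.2.1, h.2.2.2.1, h.1⟩, h.2.2.2.2⟩
  have h17 : F.cH t.V (t.X' m ⊔ (t.X m ⊔ (t.B ⊔ t.lb))) ≤ F.cH t.V (t.X' m ⊔ (t.X m ⊔ t.B)) :=
    F.cH_anti _ (sup_le_sup le_rfl (sup_le_sup le_rfl le_sup_left))
  have h18 := t.viiV hC hP
  have h19 := gamma_le hE hP m
  have h20 := eta_nonneg hE (2 * m)
  have hm : S.eta E m ≤ S.er E P m + S.cS ι c := by
    unfold er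
    linarith
  linarith

end Sys
end FHR
namespace FHR

section Net
variable {ι : Type} [Fintype ι]

theorem Rv_near {v0 : ι → ℝ} (h0 : v0 ≠ 0) {ε : ℝ} (hε : 0 < ε) :
    ∀ᶠ v in 𝓝 v0, ∀ w, ‖Rv v w - Rv v0 w‖ ≤ ε * ‖w‖ := by
  have h := dt_self_ge v0
  have h1 : 0 < ‖v0‖ := norm_pos_iff.2 h0
  have h2 : dt v0 v0 ≠ 0 := by nlinarith
  let f : (ι → ℝ) → ℝ := fun v => ∑ i, ∑ k, |v i * v k / dt v v - v0 i * v0 k / dt v0 v0|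
  have hf : ContinuousAt f v0 := by
    have hd : Continuous fun v : ι → ℝ => dt v v := by
      unfold dt
      fun_prop
    have : ∀ i k, ContinuousAt (fun v : ι → ℝ => |v i * v k / dt v v - v0 i * v0 k / dt v0 v0|) v0 := by
      intro i k
      have hik : Continuous fun v : ι → ℝ => v i * v k := by fun_prop
      exact ((hik.continuousAt.div hd.continuousAt h2).sub continuousAt_const).abs
    exact tendsto_finsetSum _ fun i _ => tendsto_finsetSum _ fun k _ => this i k
  have hf0 : f v0 = 0 := by simp [f]
  have : ∀ᶠ v in 𝓝 v0, f v < ε := hf.eventually_lt_const (by rw [hf0]; exact hε)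
  filter_upwards [this] with v hv w
  refine (pi_norm_le_iff_of_nonneg (by positivity)).2 fun i => ?_
  have e : (Rv v w - Rv v0 w) i = -∑ k, (v i * v k / dt v v - v0 i * v0 k / dt v0 v0) * w k := by
    rw [Rv_apply, Rv_apply]
    simp only [Pi.sub_apply, Pi.smul_apply, smul_eq_mul, sub_mul, Finset.sum_sub_distrib]
    have k : ∀ u : ι → ℝ, dt u w / dt u u * u i = ∑ k, u i * u k / dt u u * w k := by
      intro u
      rw [dt, Finset.sum_div, Finset.sum_mul]
      exact Finset.sum_congr rfl fun k _ => by ring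
    rw [k, k]
    ring
  rw [e, norm_neg]
  refine (norm_sum_le _ _).trans ?_
  calc ∑ k, ‖(v i * v k / dt v v - v0 i * v0 k / dt v0 v0) * w k‖
      ≤ ∑ k, |v i * v k / dt v v - v0 i * v0 k / dt v0 v0| * ‖w‖ := by
        refine Finset.sum_le_sum fun k _ => ?_
        rw [norm_mul]
        exact mul_le_mul_of_nonneg_left (norm_le_pi_norm w k) (norm_nonneg _)
    _ = (∑ k, |v i * v k / dt v v - v0 i * v0 k / dt v0 v0|) * ‖w‖ := by rw [Finset.sum_mul]
    _ ≤ f v * ‖w‖ := by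
        refine mul_le_mul_of_nonneg_right ?_ (norm_nonneg _)
        exact Finset.single_le_sum (f := fun i => ∑ k, |v i * v k / dt v v - v0 i * v0 k / dt v0 v0|)
          (fun i _ => Finset.sum_nonneg fun k _ => abs_nonneg _) (Finset.mem_univ i)
    _ ≤ _ := mul_le_mul_of_nonneg_right hv.le (norm_nonneg _)

theorem exists_net {κ : ℝ} (hκ : 0 < κ) (V0 : ℝ) {ε : ℝ} (hε : 0 < ε) :
    ∃ (N : Finset (ι → ℝ)) (nt : (ι → ℝ) → N), (nt 0 : ι → ℝ) = 0 ∧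
      ∀ v, κ ≤ ‖v‖ → ‖v‖ ≤ V0 → (nt v : ι → ℝ) ≠ 0 ∧ ∀ w, ‖Rv v w - Rv (nt v) w‖ ≤ ε * ‖w‖ := by
  classical
  let K : Set (ι → ℝ) := Metric.closedBall 0 V0 ∩ {v | κ ≤ ‖v‖}
  have hK : IsCompact K := (isCompact_closedBall _ _).inter_right (isClosed_le continuous_const continuous_norm)
  have hne : ∀ v ∈ K, v ≠ 0 := by
    rintro v ⟨_, hv⟩ rfl
    have : κ ≤ ‖(0 : ι → ℝ)‖ := hv
    rw [norm_zero] at this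
    linarith
  obtain ⟨s, hs, hcov⟩ := hK.elim_nhds_subcover
    (fun v0 => {v | v0 ≠ 0 → ∀ w, ‖Rv v w - Rv v0 w‖ ≤ ε * ‖w‖}) (fun v0 hv0 => by
      filter_upwards [Rv_near (hne v0 hv0) hε] with v hv _
      exact hv)
  have hch : ∀ v : ι → ℝ, ∃ n ∈ insert 0 s, (v = 0 → n = 0) ∧
      (κ ≤ ‖v‖ → ‖v‖ ≤ V0 → n ≠ 0 ∧ ∀ w, ‖Rv v w - Rv n w‖ ≤ ε * ‖w‖) := by
    intro v
    by_cases hv : v ∈ K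
    · have := hcov hv
      simp only [Set.mem_iUnion] at this
      obtain ⟨n, hn, h⟩ := this
      exact ⟨n, Finset.mem_insert_of_mem hn, fun h0 => absurd h0 (hne v hv),
        fun _ _ => ⟨hne n (hs n hn), h (hne n (hs n hn))⟩⟩
    · refine ⟨0, Finset.mem_insert_self _ _, fun _ => rfl, fun h1 h2 => absurd ⟨?_, h1⟩ hv⟩
      simpa using h2
  choose n h1 h2 h3 using hch
  exact ⟨insert 0 s, fun v => ⟨n v, h1 v⟩, h2 0 rfl, h3⟩

end Net

namespace Sys
variable {d : ℕ} {S : Sys d} {ι : Type} [Fintype ι]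

/-- conditional information function -/
def phi (S : Sys d) (E : St S.Om) (Q : W d →ₗ[ℝ] (ι → ℝ)) (r : ℕ) (ω : S.Om) : ℝ :=
  - Real.log (E.pr (S.Wv r ⊔ S.Dv Q r) ω / E.pr (S.Dv Q r) ω)

theorem phi_meas (E : St S.Om) (Q : W d →ₗ[ℝ] (ι → ℝ)) (r : ℕ) :
    ∀ a b, (S.Wv r ⊔ S.Dv Q r).rel a b → S.phi E Q r a = S.phi E Q r b := by
  intro a b h
  unfold phi
  rw [E.pr_congr h, E.pr_congr h.2]

theorem E_phi (E : St S.Om) (Q : W d →ₗ[ℝ] (ι → ℝ)) (r : ℕ) : E.E (S.phi E Q r) = S.gam E Q r := by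
  have h : S.gam E Q r = E.E (fun a => - Real.log (E.pr (S.Wv r ⊔ S.Dv Q r) a) - - Real.log (E.pr (S.Dv Q r) a)) := by
    rw [E.sub]
    rfl
  rw [h]
  refine E.E_meas_congr (S.Wv r ⊔ S.Dv Q r) _ _ (S.phi_meas E Q r) ?_ ?_
  · intro a b h
    rw [E.pr_congr h, E.pr_congr h.2]
  · intro a ha
    have hb := ha.trans_le (E.pr_anti (le_sup_right : S.Dv Q r ≤ S.Wv r ⊔ S.Dv Q r) a)
    unfold phi
    rw [Real.log_div ha.ne' hb.ne']
    ring

namespace Pair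
variable {E : St S.Om} {a : W d} {P : W d →ₗ[ℝ] (ι → ℝ)} {C : ℝ} {m : ℕ} (t : S.Pair E a P C m)

def KB (S : Sys d) (ι : Type) [Fintype ι] (C c : ℝ) : ℝ :=
  Fintype.card ι * KK (c * (2 * S.M) + (1 + cR ι * (c * (C + 2 * (C * S.M))))) + d * KK (S.M * (3 * C))

theorem Dq (hC : 0 ≤ C) {j : ℕ} (hj : m ≤ j) {x z : t.T} (hX : (t.X j).rel x z) (hB : t.B.rel x z) :
    ∃ e : W d, ‖e‖ ≤ (C + 2 * (C * S.M)) / 2 ^ (2 * m) ∧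
      S.q (S.sh j (t.o x)) - S.q (S.sh j (t.o z)) =
        (2:ℝ) ^ j • ((t.l x * S.y (t.o x) - t.l z * S.y (t.o z)) + e) := by
  have hr := S.Wv_rho hX
  have hM := S.M_pos
  refine ⟨-((t.l x - t.l z) * S.rho j (t.o z)) + (S.lam (t.o x) - t.l x) * (S.y (t.o x) - S.rho j (t.o x))
    - (S.lam (t.o z) - t.l z) * (S.y (t.o z) - S.rho j (t.o z)), ?_, ?_⟩
  · have k1 : ‖-((t.l x - t.l z) * S.rho j (t.o z))‖ ≤ C / 2 ^ (2 * m) := by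
      rw [norm_neg]
      exact (norm_mul_le _ _).trans ((mul_le_mul (t.Bclose _ _ hB) (S.rho_norm _ _) (norm_nonneg _)
        (by positivity)).trans (le_of_eq (mul_one _)))
    have k2 : ∀ x, ‖(S.lam (t.o x) - t.l x) * (S.y (t.o x) - S.rho j (t.o x))‖ ≤ C * S.M / 2 ^ (2 * m) := by
      intro x
      have h1 : S.M / 2 ^ j ≤ S.M / 2 ^ m :=
        div_le_div_of_nonneg_left hM.le (by positivity) (pow_le_pow_right₀ (by norm_num) hj)
      refine (norm_mul_le _ _).trans ((mul_le_mul (t.near x) ((S.y_rho_norm' j _).trans h1) (norm_nonneg _)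
        (by positivity)).trans (le_of_eq ?_))
      rw [pow2]
      field_simp
    refine (norm_sub_le _ _).trans ((add_le_add (norm_add_le _ _) le_rfl).trans ?_)
    refine (add_le_add (add_le_add k1 (k2 x)) (k2 z)).trans (le_of_eq ?_)
    ring
  · rw [S.q_sh, S.q_sh, hr, ← smul_sub]
    congr 1
    unfold q
    ring

theorem Bd_blk {N : Finset (ι → ℝ)} (b : t.T → N) (r j : ℕ) :
    Bd fun x => (2:ℝ) ^ r • Rv (b x : ι → ℝ) (P (S.q (S.sh j (t.o x)))) := by
  obtain ⟨c, hP⟩ := exists_Bn P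
  have := cR_ge (ι := ι)
  have hc := hP.1
  refine Bd_smul (K := cR ι * (c * S.M)) (fun x => (Rv_norm _ _).trans ?_) _
  refine mul_le_mul_of_nonneg_left ((hP.2 _).trans ?_) (by linarith)
  exact mul_le_mul_of_nonneg_left (S.q_norm _) hc

theorem blk1 (hC : 0 ≤ C) {c : ℝ} (hP : Bn P c) {κ : ℝ} {N : Finset (ι → ℝ)} (b : t.T → N) {r j : ℕ}
    (hb : ∀ x z, t.V.rel x z → b x = b z)
    (hn : ∀ x w, ‖Rv (t.ve κ x) w - Rv (b x : ι → ℝ) w‖ ≤ 1 / 2 ^ r * ‖w‖)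
    (hj : m ≤ j) (hjr : j + r ≤ 2 * m) :
    t.F.cH (fl _ (t.Bd_blk b r j) ⊔ (S.Lv r).comap (fun x => S.sh j (t.o x)))
      (t.X j ⊔ (t.Z κ ⊔ (t.Ch ⊔ t.lb))) ≤ KB S ι C c := by
  have hM := S.M_pos
  have hc := hP.1
  have hR := cR_ge (ι := ι)
  refine (t.F.cH_sup_le _ _ _).trans (add_le_add ?_ ?_)
  · refine cH_fln t.F ?_
    intro x z h
    have hV := h.2.2.1.2.2.2
    have hB := h.2.2.1.2.2.1
    have hve := t.ve_eq (κ := κ) hV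
    have hZ : ‖Rv (t.ve κ x) (t.u x) - Rv (t.ve κ z) (t.u z)‖ ≤ 1 / 2 ^ (2 * m) :=
      norm_le_of_smul (fl_closen (h := t.Bd_R κ) h.2.1)
    obtain ⟨e, he, hq⟩ := t.Dq hC hj h.1 hB
    refine smul_norm_le ?_
    rw [← hb x z hV, ← map_sub, ← map_sub]
    set D := S.q (S.sh j (t.o x)) - S.q (S.sh j (t.o z)) with hD
    have hDn : ‖P D‖ ≤ c * (2 * S.M) := by
      refine (hP.2 _).trans (mul_le_mul_of_nonneg_left ((norm_sub_le _ _).trans ?_) hc)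
      linarith [S.q_norm (S.sh j (t.o x)), S.q_norm (S.sh j (t.o z))]
    have k1 := hn x (P D)
    have k2 : Rv (t.ve κ x) (P D) = (2:ℝ) ^ j • (Rv (t.ve κ x) (t.u x) - Rv (t.ve κ z) (t.u z)
        + Rv (t.ve κ x) (P e)) := by
      rw [hq, ← hve]
      unfold u
      simp only [map_smul, map_add, map_sub]
    have k3 : ‖Rv (t.ve κ x) (P D)‖ ≤ (1 + cR ι * (c * (C + 2 * (C * S.M)))) / 2 ^ r := by
      rw [k2, norm_smul, Real.norm_eq_abs, abs_of_pos (by positivity)]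
      have k4 : ‖Rv (t.ve κ x) (P e)‖ ≤ cR ι * (c * ((C + 2 * (C * S.M)) / 2 ^ (2 * m))) :=
        (Rv_norm _ _).trans (mul_le_mul_of_nonneg_left ((hP.2 _).trans
          (mul_le_mul_of_nonneg_left he hc)) (by linarith))
      have k5 : ‖Rv (t.ve κ x) (t.u x) - Rv (t.ve κ z) (t.u z) + Rv (t.ve κ x) (P e)‖
          ≤ (1 + cR ι * (c * (C + 2 * (C * S.M)))) / 2 ^ (2 * m) := by
        refine (norm_add_le _ _).trans ((add_le_add hZ k4).trans (le_of_eq ?_))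
        ring
      have hpos : 0 ≤ 1 + cR ι * (c * (C + 2 * (C * S.M))) := by positivity
      refine (mul_le_mul_of_nonneg_left k5 (by positivity)).trans ?_
      rw [← mul_div_assoc, div_le_div_iff₀ (by positivity) (by positivity)]
      have hp : (2:ℝ) ^ j * 2 ^ r ≤ 2 ^ (2 * m) := by
        rw [← pow_add]
        exact pow_le_pow_right₀ (by norm_num) hjr
      nlinarith
    have e3 : Rv (b x : ι → ℝ) (P D) = Rv (t.ve κ x) (P D)
      - (Rv (t.ve κ x) (P D) - Rv (b x : ι → ℝ) (P D)) := by abel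
    rw [e3]
    refine (norm_sub_le _ _).trans ?_
    have k6 : (1:ℝ) / 2 ^ r * ‖P D‖ ≤ 1 / 2 ^ r * (c * (2 * S.M)) :=
      mul_le_mul_of_nonneg_left hDn (by positivity)
    refine (add_le_add k3 (k1.trans k6)).trans (le_of_eq ?_)
    ring
  · have h0 : t.F.cH ((S.Lv r).comap (fun x => S.sh j (t.o x)))
      (t.X j ⊔ (t.Z κ ⊔ (t.Ch ⊔ t.lb))) ≤ Fintype.card (Fin d) * KK (S.M * (3 * C)) := by
      unfold Lv
      rw [comap_fl _ _ _ (Bd_comp (S.Bd_lam r))]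
      refine cH_fln t.F ?_
      intro x z h
      refine smul_norm_le ?_
      have hB := h.2.2.1.2.2.1
      have k := (t.lam_close hC hB).1
      have k2 := S.lam_sh_close (S.Wv_N h.1) k
      refine k2.trans ?_
      rw [mul_div_assoc S.M (3 * C)]
      refine mul_le_mul_of_nonneg_left ?_ hM.le
      exact div_le_div_of_nonneg_left (by positivity) (by positivity)
        (pow_le_pow_right₀ (by norm_num) (by omega))
    rwa [Fintype.card_fin] at h0

end Pair
end Sys
end FHR
namespace FHR
namespace Sys
variable {d : ℕ} {S : Sys d} {ι : Type} [Fintype ι]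

theorem Stat.E {E : St S.Om} (hE : S.Stat E) (n : ℕ) (f : S.Om → ℝ) (hf : ∃ C, ∀ a, |f a| ≤ C) :
    E.E (fun ω => f (S.sh n ω)) = E.E f := hE n f hf

namespace Pair
variable {E : St S.Om} {a : W d} {P : W d →ₗ[ℝ] (ι → ℝ)} {C : ℝ} {m : ℕ} (t : S.Pair E a P C m)

theorem blk2 (hE : S.Stat E) {N : Finset (ι → ℝ)} (b : t.T → N) (r j : ℕ) :
    t.F.cH ((S.Wv r).comap (fun x => S.sh j (t.o x)))
      (RV.ofF b ⊔ (fl _ (t.Bd_blk b r j) ⊔ (S.Lv r).comap (fun x => S.sh j (t.o x))))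
      ≤ t.F.E (fun x => S.phi E (Rv (b x : ι → ℝ) ∘ₗ P) r (S.sh j (t.o x))) := by
  set g : t.T → S.Om := fun x => S.sh j (t.o x) with hg
  set Zz : RV t.T := RV.ofF b ⊔ (fl _ (t.Bd_blk b r j) ⊔ (S.Lv r).comap g) with hZz
  have hGl : ∀ x z, Zz.rel x z → (S.Dv (Rv (b x : ι → ℝ) ∘ₗ P) r).rel (g x) (g z) := by
    intro x z h
    refine ⟨?_, h.2.2⟩
    have hb : b x = b z := h.1
    have h2 := fl_rel.1 h.2.1
    refine fl_rel.2 fun i => ?_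
    have := h2 i
    rw [← hb] at this
    exact this
  have hUX : ∀ x z, ((S.Wv r).comap g ⊔ Zz).rel x z →
      (S.Wv r ⊔ S.Dv (Rv (b x : ι → ℝ) ∘ₗ P) r).rel (g x) (g z) :=
    fun x z h => ⟨h.1, hGl x z h.2⟩
  refine t.F.gibbs_cond (X := (S.Wv r).comap g ⊔ Zz) (Z := Zz) le_sup_right E g
    (fun x => E.pr (S.Wv r ⊔ S.Dv (Rv (b x : ι → ℝ) ∘ₗ P) r) (g x) / E.pr (S.Dv (Rv (b x : ι → ℝ) ∘ₗ P) r) (g x))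
    (fun x => S.Wv r ⊔ S.Dv (Rv (b x : ι → ℝ) ∘ₗ P) r) (fun x => S.Dv (Rv (b x : ι → ℝ) ∘ₗ P) r)
    (fun x => le_sup_right) ?_ ?_ (fun x => rfl) ?_ hUX hGl ?_
  · intro x z h
    have hb : b x = b z := h.1
    simp only [hb]
  · intro x z h
    have hb : b x = b z := h.1
    simp only [hb]
  · intro x z h h'
    exact ⟨h'.1, h⟩
  · intro x hx
    set U := S.Wv r ⊔ S.Dv (Rv (b x : ι → ℝ) ∘ₗ P) r with hU
    have h1 : E.pr U (g x) = t.F.E (ind fun z => U.rel (g x) (g z)) := by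
      have h2 := hE.E j (ind (U.rel (g x))) ⟨1, fun b => by
        rw [abs_of_nonneg (ind_nonneg _ _)]
        exact ind_le_one _ _⟩
      have h3 := t.lawE (U.comap (S.sh j)) (fun ω => ind (U.rel (g x)) (S.sh j ω))
        (fun u v h => St.ind_meas U (g x) _ _ h)
      unfold St.pr
      rw [← h2, ← h3]
      rfl
    rw [h1]
    exact hx.trans_le (t.F.E_ind_mono fun z h => hUX x z h)

theorem blk (hE : S.Stat E) (hC : 0 ≤ C) {c : ℝ} (hP : Bn P c) {κ : ℝ} {N : Finset (ι → ℝ)} (b : t.T → N) {r j : ℕ}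
    (hb : ∀ x z, t.V.rel x z → b x = b z)
    (hn : ∀ x w, ‖Rv (t.ve κ x) w - Rv (b x : ι → ℝ) w‖ ≤ 1 / 2 ^ r * ‖w‖)
    (hj : m ≤ j) (hjr : j + r ≤ 2 * m) :
    t.F.cH ((S.Wv r).comap (fun x => S.sh j (t.o x))) (t.X j ⊔ (t.Z κ ⊔ (t.Ch ⊔ t.lb)))
      ≤ t.F.E (fun x => S.phi E (Rv (b x : ι → ℝ) ∘ₗ P) r (S.sh j (t.o x))) + KB S ι C c := by
  have h1 := t.F.cH_add ((S.Wv r).comap (fun x => S.sh j (t.o x))) (t.X j ⊔ (t.Z κ ⊔ (t.Ch ⊔ t.lb)))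
    (fl _ (t.Bd_blk b r j) ⊔ (S.Lv r).comap (fun x => S.sh j (t.o x)))
  have h2 := t.blk1 hC hP b hb hn hj hjr
  have h3 := t.blk2 hE b r j
  have h4 := t.F.cH_anti ((S.Wv r).comap (fun x => S.sh j (t.o x)))
    (show RV.ofF b ⊔ (fl _ (t.Bd_blk b r j) ⊔ (S.Lv r).comap (fun x => S.sh j (t.o x))) ≤
      (fl _ (t.Bd_blk b r j) ⊔ (S.Lv r).comap (fun x => S.sh j (t.o x))) ⊔ (t.X j ⊔ (t.Z κ ⊔ (t.Ch ⊔ t.lb)))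
      from fun x z h => ⟨hb x z h.2.2.2.1.2.2.2, h.1⟩)
  linarith

/-- chain over blocks with offset `u` -/
theorem chain (hE : S.Stat E) (hC : 0 ≤ C) {c : ℝ} (hP : Bn P c) {κ : ℝ} {N : Finset (ι → ℝ)} (b : t.T → N)
    {r u M' : ℕ}
    (hb : ∀ x z, t.V.rel x z → b x = b z)
    (hn : ∀ x w, ‖Rv (t.ve κ x) w - Rv (b x : ι → ℝ) w‖ ≤ 1 / 2 ^ r * ‖w‖)
    (hu : u < r) (hM' : (M' + 1) * r ≤ m) (hm : m ≤ (M' + 2) * r) :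
    t.F.cH (t.X (2 * m)) (t.Z κ ⊔ (t.Ch ⊔ t.lb)) ≤
      (∑ l ∈ Finset.range M', t.F.E (fun x => S.phi E (Rv (b x : ι → ℝ) ∘ₗ P) r (S.sh (m + (u + l * r)) (t.o x))))
      + M' * KB S ι C c + (E.H (S.Wv r) + E.H (S.Wv (2 * r))) := by
  set Y := t.Z κ ⊔ (t.Ch ⊔ t.lb) with hY
  have hstep : ∀ k i, t.F.cH (t.X (k + i)) Y ≤ t.F.cH (t.X k) Y
      + t.F.cH ((S.Wv i).comap (fun x => S.sh k (t.o x))) (t.X k ⊔ Y) := by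
    intro k i
    have e : t.X (k + i) = t.X k ⊔ (S.Wv i).comap (fun x => S.sh k (t.o x)) := by
      unfold X
      rw [S.Wv_add]
      rfl
    rw [e, t.F.cH_sup]
  have hrest : ∀ k i, t.F.cH ((S.Wv i).comap (fun x => S.sh k (t.o x))) (t.X k ⊔ Y) ≤ E.H (S.Wv i) := by
    intro k i
    refine (t.F.cH_le_H _ _).trans (le_of_eq ?_)
    have h1 := t.law ((S.Wv i).comap (S.sh k)) ⊥
    have h2 := hE.cH k (S.Wv i) ⊥
    exact ((t.F.cH_bot _).symm.trans (h1.trans h2)).trans (E.cH_bot _)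
  have h0 : t.F.cH (t.X m) Y = 0 := t.F.cH_of_le (fun x z h => h.2.1.2.1)
  have h1 : t.F.cH (t.X (m + u)) Y ≤ E.H (S.Wv r) := by
    have := hstep m u
    have h2 := hrest m u
    have h3 := E.H_mono (S.Wv_mono hu.le)
    linarith
  have hind : ∀ k ≤ M', t.F.cH (t.X (m + (u + k * r))) Y ≤
      (∑ l ∈ Finset.range k, t.F.E (fun x => S.phi E (Rv (b x : ι → ℝ) ∘ₗ P) r (S.sh (m + (u + l * r)) (t.o x))))
      + k * KB S ι C c + E.H (S.Wv r) := by
    intro k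
    induction k with
    | zero =>
      intro _
      simpa using h1
    | succ k ih =>
      intro hk
      have ih' := ih (by omega)
      have h2 := hstep (m + (u + k * r)) r
      have hk2 : (k + 1) * r ≤ M' * r := Nat.mul_le_mul_right _ hk
      have h3 := t.blk hE hC hP b hb hn (j := m + (u + k * r)) (by omega)
        (by rw [add_mul, one_mul] at hM' hk2; omega)
      rw [Finset.sum_range_succ]
      push_cast
      have e : m + (u + (k + 1) * r) = m + (u + k * r) + r := by ring
      rw [e]
      linarith
  have h2 := hind M' le_rfl
  have h3 := hstep (m + (u + M' * r)) (2 * m - (m + (u + M' * r)))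
  have h4 := hrest (m + (u + M' * r)) (2 * m - (m + (u + M' * r)))
  rw [add_mul] at hM' hm
  have e : m + (u + M' * r) + (2 * m - (m + (u + M' * r))) = 2 * m := by omega
  rw [e] at h3
  have h5 := E.H_mono (S.Wv_mono (by omega : 2 * m - (m + (u + M' * r)) ≤ 2 * r))
  linarith

end Pair

theorem sum_blocks (f : ℕ → ℝ) (r M' : ℕ) :
    ∑ u ∈ Finset.range r, ∑ l ∈ Finset.range M', f (u + l * r) = ∑ k ∈ Finset.range (M' * r), f k := by
  induction M' with
  | zero => simp
  | succ n ih =>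
    rw [add_mul, one_mul, Finset.sum_range_add, ← ih, ← Finset.sum_add_distrib]
    refine Finset.sum_congr rfl fun u _ => ?_
    rw [Finset.sum_range_succ, add_comm u (n * r)]

end Sys
end FHR
namespace FHR
namespace Sys
variable {d : ℕ} {S : Sys d} {ι : Type} [Fintype ι]

namespace Pair
variable {E : St S.Om} {a : W d} {P : W d →ₗ[ℝ] (ι → ℝ)} {C : ℝ} {m : ℕ} (t : S.Pair E a P C m)

theorem avg (hE : S.Stat E) {N : Finset (ι → ℝ)} (b : t.T → N) (r L : ℕ) {ε : ℝ} (hε : 0 < ε) (hL : 0 < L)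
    (hB : ∀ i : N, E.E (fun ω => (S.Ts (S.phi E (Rv (i : ι → ℝ) ∘ₗ P) r) L ω
      - L * E.E (S.phi E (Rv (i : ι → ℝ) ∘ₗ P) r)) ^ 2) ≤ ε ^ 2 * L ^ 2) :
    ∑ k ∈ Finset.range L, t.F.E (fun x => S.phi E (Rv (b x : ι → ℝ) ∘ₗ P) r (S.sh (m + k) (t.o x)))
      ≤ L * (t.F.E (fun x => S.gam E (Rv (b x : ι → ℝ) ∘ₗ P) r) + Fintype.card N * ε) := by
  have hLr : (0:ℝ) < L := Nat.cast_pos.2 hL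
  have hεL : 0 < ε * L := mul_pos hε hLr
  set D : N → S.Om → ℝ := fun i ω => S.Ts (S.phi E (Rv (i : ι → ℝ) ∘ₗ P) r) L ω
      - L * E.E (S.phi E (Rv (i : ι → ℝ) ∘ₗ P) r) with hD
  have hb1 : ∀ i : N, ∃ K, 0 ≤ K ∧ ∀ ω, |D i ω| ≤ K := by
    intro i
    obtain ⟨K, hK⟩ := St.meas_bdd _ _ (S.phi_meas E (Rv (i : ι → ℝ) ∘ₗ P) r)
    refine ⟨|L * K| + |L * E.E (S.phi E (Rv (i : ι → ℝ) ∘ₗ P) r)|, by positivity, fun ω => ?_⟩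
    refine (abs_sub _ _).trans ?_
    have := S.Ts_bdd hK L ω
    have := le_abs_self (L * K)
    linarith
  choose K hK0 hK using hb1
  have hsq : ∀ i, t.F.E (fun x => D i (S.sh m (t.o x)) ^ 2) ≤ ε ^ 2 * L ^ 2 := by
    intro i
    refine le_trans (le_of_eq ?_) (hB i)
    have h1 := t.lawE ((Finset.range L).sup fun k =>
      (S.Wv r ⊔ S.Dv (Rv (i : ι → ℝ) ∘ₗ P) r).comap (S.sh (m + k))) (fun ω => D i (S.sh m ω) ^ 2) (by
      intro u v h
      have h2 : S.Ts (S.phi E (Rv (i : ι → ℝ) ∘ₗ P) r) L (S.sh m u)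
          = S.Ts (S.phi E (Rv (i : ι → ℝ) ∘ₗ P) r) L (S.sh m v) := by
        unfold Ts
        refine Finset.sum_congr rfl fun k hk => ?_
        rw [S.sh_sh, S.sh_sh]
        refine S.phi_meas E _ r _ _ ?_
        exact (Finset.le_sup (f := fun k =>
          (S.Wv r ⊔ S.Dv (Rv (i : ι → ℝ) ∘ₗ P) r).comap (S.sh (m + k))) hk) u v h
      simp only [hD, h2])
    rw [h1]
    refine hE.E m (fun ω => D i ω ^ 2) ⟨K i ^ 2, fun ω => ?_⟩
    rw [abs_of_nonneg (sq_nonneg _), ← sq_abs]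
    exact pow_le_pow_left₀ (abs_nonneg _) (hK i ω) 2
  have e1 : ∑ k ∈ Finset.range L, t.F.E (fun x => S.phi E (Rv (b x : ι → ℝ) ∘ₗ P) r (S.sh (m + k) (t.o x)))
      = t.F.E (fun x => L * S.gam E (Rv (b x : ι → ℝ) ∘ₗ P) r + D (b x) (S.sh m (t.o x))) := by
    rw [← t.F.sum]
    congr 1
    funext x
    simp only [hD, Ts, S.sh_sh, E_phi]
    ring
  rw [e1, t.F.add, t.F.smul, mul_add]
  refine add_le_add le_rfl ?_
  have hN : 0 ≤ ∑ i, K i := Finset.sum_nonneg fun i _ => hK0 i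
  have h3 : t.F.E (fun x => D (b x) (S.sh m (t.o x))) ≤
      t.F.E (fun x => ∑ i, (1 / (2 * (ε * L)) * D i (S.sh m (t.o x)) ^ 2 + ε * L / 2)) := by
    refine t.F.mono ⟨(∑ i, (1 / (2 * (ε * L)) * K i ^ 2 + ε * L / 2)) + ∑ i, K i, fun x => ?_⟩ fun x => ?_
    · rw [sub_eq_add_neg]
      refine add_le_add (Finset.sum_le_sum fun i _ => ?_) ?_
      · refine add_le_add (mul_le_mul_of_nonneg_left ?_ (by positivity)) le_rfl
        rw [← sq_abs]
        exact pow_le_pow_left₀ (abs_nonneg _) (hK i _) 2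
      · refine (neg_le_abs _).trans ((hK _ _).trans ?_)
        exact Finset.single_le_sum (f := K) (fun i _ => hK0 i) (Finset.mem_univ _)
    · have h4 : ∀ z : ℝ, z ≤ 1 / (2 * (ε * L)) * z ^ 2 + ε * L / 2 := by
        intro z
        have : 1 / (2 * (ε * L)) * z ^ 2 + ε * L / 2 - z = (z - ε * L) ^ 2 / (2 * (ε * L)) := by
          field_simp
          ring
        have h5 : 0 ≤ (z - ε * L) ^ 2 / (2 * (ε * L)) := by positivity
        linarith
      refine (h4 _).trans ?_
      refine Finset.single_le_sum (f := fun i => 1 / (2 * (ε * L)) * D i (S.sh m (t.o x)) ^ 2 + ε * L / 2)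
        (fun i _ => ?_) (Finset.mem_univ (b x))
      positivity
  refine h3.trans ?_
  rw [t.F.sum]
  have h6 : ∀ i, t.F.E (fun x => 1 / (2 * (ε * L)) * D i (S.sh m (t.o x)) ^ 2 + ε * L / 2) ≤ ε * L := by
    intro i
    rw [t.F.add, t.F.const, t.F.smul]
    have h7 := mul_le_mul_of_nonneg_left (hsq i) (by positivity : 0 ≤ 1 / (2 * (ε * L)))
    have h8 : 1 / (2 * (ε * L)) * (ε ^ 2 * L ^ 2) = ε * L / 2 := by
      field_simp
    linarith
  refine (Finset.sum_le_sum fun i _ => h6 i).trans (le_of_eq ?_)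
  rw [Finset.sum_const, nsmul_eq_mul, Finset.card_univ]
  ring

end Pair

theorem upper {E : St S.Om} (hE : S.Stat E) (hErg : S.Erg E) (a : W d) {P : W d →ₗ[ℝ] (ι → ℝ)} {C : ℝ} (hC : 0 ≤ C)
    {c : ℝ} (hP : Bn P c) {κ : ℝ} (hκ : 0 < κ) {r : ℕ} (hr : 0 < r) {ε : ℝ} (hε : 0 < ε) :
    ∃ D : ℝ, ∃ m0 : ℕ, ∀ m ≥ m0, ∀ t : S.Pair E a P C m, ∀ g0 g1 : ℝ, 0 ≤ g0 → 0 ≤ g1 →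
      (∀ v : ι → ℝ, v ≠ 0 → S.gam E (Rv v ∘ₗ P) r ≤ g1) → S.gam E P r ≤ g0 →
      t.F.cH (t.X (2 * m)) (t.Z κ ⊔ (t.Ch ⊔ t.lb)) ≤ D + m / r * (Pair.KB S ι C c +
        (t.F.E (ind (t.Ev κ)) * g1 + (1 - t.F.E (ind (t.Ev κ))) * g0) + ε) := by
  obtain ⟨N, nt, hnt0, hnt⟩ := exists_net (ι := ι) hκ (c * (‖a‖ * (2 * C)) + 1)
    (by positivity : (0:ℝ) < 1 / 2 ^ r)
  set ε' : ℝ := ε / (Fintype.card N + 1) with hε'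
  have hcN : (0:ℝ) ≤ Fintype.card N := Nat.cast_nonneg _
  have hε'0 : 0 < ε' := by positivity
  have hcε : Fintype.card N * ε' ≤ ε := by
    rw [hε', mul_div_assoc', div_le_iff₀ (by linarith)]
    nlinarith
  have hB : ∀ i : N, ∃ B0 : ℕ, ∀ L ≥ B0, E.E (fun ω => (S.Ts (S.phi E (Rv (i : ι → ℝ) ∘ₗ P) r) L ω
      - L * E.E (S.phi E (Rv (i : ι → ℝ) ∘ₗ P) r)) ^ 2) ≤ ε' ^ 2 * L ^ 2 := fun i =>
    hErg _ (St.meas_bdd _ _ (S.phi_meas E (Rv (i : ι → ℝ) ∘ₗ P) r)) _ (by positivity)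
  choose B0 hB0 using hB
  refine ⟨E.H (S.Wv r) + E.H (S.Wv (2 * r)), ∑ i, B0 i + 3 * r, fun m hm t g0 g1 hg0 hg1 hv h0 => ?_⟩
  set p := t.F.E (ind (t.Ev κ)) with hp
  have hp0 : 0 ≤ p := t.F.E_ind_nonneg _
  have hp1 : p ≤ 1 := t.F.E_ind_le_one _
  obtain ⟨M', hM1, hM2⟩ : ∃ M', (M' + 1) * r ≤ m ∧ m ≤ (M' + 2) * r := by
    have h1 := Nat.div_add_mod m r
    have h2 := Nat.mod_lt m hr
    have h3 : 1 ≤ m / r := (Nat.le_div_iff_mul_le hr).2 (by omega)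
    obtain ⟨M', hM'⟩ := Nat.exists_eq_add_of_le' h3
    refine ⟨M', ?_, ?_⟩
    · rw [← hM']
      exact Nat.div_mul_le_self m r
    · have : (M' + 2) * r = r * (m / r) + r := by
        rw [hM']
        ring
      omega
  have hL0 : ∀ i, B0 i ≤ M' * r := by
    intro i
    have h1 := Finset.single_le_sum (f := B0) (fun i _ => Nat.zero_le _) (Finset.mem_univ i)
    have h2 : (M' + 2) * r = M' * r + 2 * r := by ring
    omega
  have hLpos : 0 < M' * r := by
    have h2 : (M' + 2) * r = M' * r + 2 * r := by ring
    omega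
  set b : t.T → N := fun x => nt (t.ve κ x) with hb
  have hvn : ∀ x, ‖t.vh x‖ ≤ c * (‖a‖ * (2 * C)) + 1 := by
    intro x
    have h1 := t.pv_norm hP x
    have h2 := t.vh_close x
    have h3 : (1:ℝ) / 2 ^ m ≤ 1 := by
      rw [div_le_one (by positivity)]
      exact one_le_pow₀ (by norm_num)
    have h4 := norm_sub_norm_le (t.vh x) (t.pv x)
    rw [norm_sub_rev] at h4
    linarith
  have hn : ∀ x w, ‖Rv (t.ve κ x) w - Rv (b x : ι → ℝ) w‖ ≤ 1 / 2 ^ r * ‖w‖ := by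
    intro x w
    by_cases h : t.Ev κ x
    · have e : t.ve κ x = t.vh x := if_pos h
      simp only [hb, e]
      exact (hnt _ h (hvn x)).2 w
    · have e : t.ve κ x = 0 := if_neg h
      simp only [hb, e, hnt0]
      rw [sub_self, norm_zero]
      positivity
  have hch : ∀ u ∈ Finset.range r, t.F.cH (t.X (2 * m)) (t.Z κ ⊔ (t.Ch ⊔ t.lb)) ≤ 
      (∑ l ∈ Finset.range M', t.F.E (fun x => S.phi E (Rv (b x : ι → ℝ) ∘ₗ P) r (S.sh (m + (u + l * r)) (t.o x))))
      + (M' * Pair.KB S ι C c + (E.H (S.Wv r) + E.H (S.Wv (2 * r)))) := by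
    intro u hu
    rw [← add_assoc]
    exact t.chain hE hC hP b (fun x z h => by simp only [hb, t.ve_eq h]) hn (Finset.mem_range.1 hu) hM1 hM2
  have hsum := Finset.sum_le_sum hch
  rw [Finset.sum_add_distrib, sum_blocks (fun k => t.F.E (fun x =>
    S.phi E (Rv (b x : ι → ℝ) ∘ₗ P) r (S.sh (m + k) (t.o x)))) r M'] at hsum
  rw [Finset.sum_const, Finset.sum_const, Finset.card_range, nsmul_eq_mul, nsmul_eq_mul] at hsum
  have hav := t.avg hE b r (M' * r) hε'0 hLpos (fun i => hB0 i _ (hL0 i))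
  have hg : t.F.E (fun x => S.gam E (Rv (b x : ι → ℝ) ∘ₗ P) r) ≤ p * g1 + (1 - p) * g0 := by
    have e : p * g1 + (1 - p) * g0 = t.F.E (fun x => ind (t.Ev κ) x * g1 + (1 - ind (t.Ev κ) x) * g0) := by
      rw [t.F.add, t.F.smul', t.F.smul', t.F.sub, t.F.const]
    rw [e]
    refine t.F.mono ⟨g1 + g0, fun x => ?_⟩ fun x => ?_
    · have h1 := S.gam_nonneg E (Rv (b x : ι → ℝ) ∘ₗ P) r
      have h2 := ind_nonneg (t.Ev κ) x
      have h3 := ind_le_one (t.Ev κ) x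
      nlinarith
    · by_cases h : t.Ev κ x
      · rw [ind_pos h]
        have e : t.ve κ x = t.vh x := if_pos h
        have := hv (b x) (by
          simp only [hb, e]
          exact (hnt _ h (hvn x)).1)
        linarith
      · rw [ind_neg h]
        have e : t.ve κ x = 0 := if_neg h
        have e2 : Rv (b x : ι → ℝ) ∘ₗ P = P := by
          simp only [hb, e, hnt0, Rv_zero, LinearMap.id_comp]
        rw [e2]
        linarith
  have hrr : (0:ℝ) < r := Nat.cast_pos.2 hr
  have hMr : (M':ℝ) ≤ m / r := by
    rw [le_div_iff₀ hrr]
    have : M' * r ≤ m := le_trans (Nat.mul_le_mul_right _ (Nat.le_succ _)) hM1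
    exact_mod_cast this
  have hKB : 0 ≤ Pair.KB S ι C c := by
    unfold Pair.KB
    have := KK_nonneg (c * (2 * S.M) + (1 + cR ι * (c * (C + 2 * (C * S.M)))))
    have := KK_nonneg (S.M * (3 * C))
    positivity
  have hq : 0 ≤ p * g1 + (1 - p) * g0 := by
    have : 0 ≤ 1 - p := by linarith
    positivity
  push_cast at hav
  have hfin : t.F.cH (t.X (2 * m)) (t.Z κ ⊔ (t.Ch ⊔ t.lb)) ≤
      M' * (p * g1 + (1 - p) * g0 + ε) + (M' * Pair.KB S ι C c + (E.H (S.Wv r) + E.H (S.Wv (2 * r)))) := by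
    refine le_of_mul_le_mul_left ?_ hrr
    have h9 : (M' * r : ℝ) * (t.F.E (fun x => S.gam E (Rv (b x : ι → ℝ) ∘ₗ P) r) + Fintype.card N * ε')
       ≤ (M' * r : ℝ) * (p * g1 + (1 - p) * g0 + ε) :=
      mul_le_mul_of_nonneg_left (by linarith) (by positivity)
    have h10 := hsum.trans (add_le_add (hav.trans h9) le_rfl)
    rw [mul_add (r:ℝ)]
    refine h10.trans (le_of_eq ?_)
    ring
  have := mul_le_mul_of_nonneg_right hMr (by linarith : 0 ≤ Pair.KB S ι C c + (p * g1 + (1 - p) * g0) + ε)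
  linarith

end Sys
end FHR
namespace FHR

theorem Rv_smul {ι : Type} [Fintype ι] (v : ι → ℝ) {s : ℝ} (hs : s ≠ 0) : Rv (s • v) = Rv v := by
  refine LinearMap.ext fun w => ?_
  rw [Rv_apply, Rv_apply, smul_smul]
  have h1 : dt (s • v) w = s * dt v w := by
    unfold dt
    rw [Finset.mul_sum]
    refine Finset.sum_congr rfl fun i _ => ?_
    rw [Pi.smul_apply, smul_eq_mul, mul_assoc]
  have h2 : dt (s • v) (s • v) = s ^ 2 * dt v v := by
    unfold dt
    rw [Finset.mul_sum]
    refine Finset.sum_congr rfl fun i _ => ?_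
    rw [Pi.smul_apply, smul_eq_mul]
    ring
  rw [h1, h2]
  congr 2
  by_cases h : dt v v = 0
  · rw [h]
    simp
  · field_simp

namespace Sys
variable {d : ℕ} {S : Sys d} {ι : Type} [Fintype ι]

theorem gam_mul {E : St S.Om} (hE : S.Stat E) {P : W d →ₗ[ℝ] (ι → ℝ)} {c : ℝ} (hP : Bn P c) (n j k : ℕ) :
    S.gam E P (k * n + j) ≤ k * (S.gam E P n + S.cS ι c) + S.gam E P j := by
  induction k with
  | zero => simp
  | succ k ih =>
    have h := S.gam_sub E hE hP n (k * n + j)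
    have e : (k + 1) * n + j = n + (k * n + j) := by ring
    rw [e]
    push_cast
    linarith

theorem unif {E : St S.Om} (hE : S.Stat E) {P : W d →ₗ[ℝ] (ι → ℝ)} {g : ℝ}
    (h : ∀ v : ι → ℝ, v ≠ 0 → S.gamma E (Rv v ∘ₗ P) < g) :
    ∃ τ > 0, ∃ D : ℝ, ∀ v : ι → ℝ, v ≠ 0 → ∀ r : ℕ, S.gam E (Rv v ∘ₗ P) r ≤ r * (g - τ) + D := by
  obtain ⟨c, hP⟩ := exists_Bn P
  have key : ∃ τ > 0, ∃ D : ℝ, ∀ v ∈ Metric.sphere (0 : ι → ℝ) 1, ∀ r : ℕ,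
      S.gam E (Rv v ∘ₗ P) r ≤ r * (g - τ) + D := by
    refine IsCompact.induction_on (p := fun s => ∃ τ > 0, ∃ D : ℝ, ∀ v ∈ s, ∀ r : ℕ,
      S.gam E (Rv v ∘ₗ P) r ≤ r * (g - τ) + D) (isCompact_sphere (0 : ι → ℝ) 1) ?_ ?_ ?_ ?_
    · exact ⟨1, one_pos, 0, fun v hv => absurd hv (Set.notMem_empty v)⟩
    · rintro s s' hs ⟨τ, hτ, D, hD⟩
      exact ⟨τ, hτ, D, fun v hv => hD v (hs hv)⟩
    · rintro s s' ⟨τ, hτ, D, hD⟩ ⟨τ', hτ', D', hD'⟩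
      refine ⟨min τ τ', lt_min hτ hτ', max D D', fun v hv r => ?_⟩
      have hr : (0:ℝ) ≤ r := Nat.cast_nonneg r
      rcases hv with hv | hv
      · refine (hD v hv r).trans (add_le_add (mul_le_mul_of_nonneg_left ?_ hr) (le_max_left _ _))
        linarith [min_le_left τ τ']
      · refine (hD' v hv r).trans (add_le_add (mul_le_mul_of_nonneg_left ?_ hr) (le_max_right _ _))
        linarith [min_le_right τ τ']
    · intro v0 hv0
      have hv00 : v0 ≠ 0 := by
        rintro rfl
        simp at hv0
      set g0 := S.gamma E (Rv v0 ∘ₗ P) with hg0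
      have hlt := h v0 hv00
      have hg0n : 0 ≤ g0 := S.gamma_nonneg hE _
      set τ := (g - g0) / 2 with hτ
      have hτ0 : 0 < τ := by
        rw [hτ]
        linarith
      set A := Fintype.card ι * KK (1 * (2 * S.M) + 1) + S.cS ι (cR ι * c) with hA
      have ht : Tendsto (fun n : ℕ => S.gam E (Rv v0 ∘ₗ P) n / n + A / n) atTop (𝓝 (g0 + 0)) :=
        (gamma_tendsto hE _).add (tendsto_const_div_atTop_nhds_zero_nat A)
      obtain ⟨n, hn, hn1⟩ := ((ht.eventually (gt_mem_nhds (by linarith : g0 + 0 < g - τ))).and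
        (eventually_gt_atTop 0)).exists
      have hn0 : (0:ℝ) < n := Nat.cast_pos.2 hn1
      rw [← add_div, div_lt_iff₀ hn0] at hn
      have hε : (0:ℝ) < 1 / 2 ^ n / (c + 1) := by
        have := hP.1
        positivity
      have hnear := Rv_near hv00 hε
      refine ⟨_, mem_nhdsWithin_of_mem_nhds hnear, τ, hτ0, E.H (S.Wv n), fun v hv r => ?_⟩
      have hc := hP.1
      have h1 : S.gam E (Rv v ∘ₗ P) n ≤ S.gam E (Rv v0 ∘ₗ P) n + Fintype.card ι * KK (1 * (2 * S.M) + 1) := by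
        refine gam_perturb E (fun x => ?_) zero_le_one
        rw [LinearMap.comp_apply, LinearMap.comp_apply, norm_sub_rev]
        refine (hv (P x)).trans ?_
        calc 1 / 2 ^ n / (c + 1) * ‖P x‖ ≤ 1 / 2 ^ n / (c + 1) * ((c + 1) * ‖x‖) := by
              refine mul_le_mul_of_nonneg_left ((hP.2 x).trans ?_) hε.le
              nlinarith [norm_nonneg x]
          _ = 1 / 2 ^ n * ‖x‖ := by
              field_simp
      have h2 := gam_mul hE (Bn_Rv hP v) n (r % n) (r / n)
      rw [mul_comm (r / n) n, Nat.div_add_mod] at h2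
      have h3 : S.gam E (Rv v ∘ₗ P) (r % n) ≤ E.H (S.Wv n) :=
        (E.cH_le_H _ _).trans (E.H_mono (S.Wv_mono (Nat.mod_lt r hn1).le))
      have h4 : ((r / n : ℕ) : ℝ) * (S.gam E (Rv v ∘ₗ P) n + S.cS ι (cR ι * c)) ≤ r * (g - τ) := by
        have h5 : S.gam E (Rv v ∘ₗ P) n + S.cS ι (cR ι * c) ≤ (g - τ) * n := by linarith
        have h6 : ((r / n : ℕ) : ℝ) * n ≤ r := by
          exact_mod_cast Nat.div_mul_le_self r n
        calc _ ≤ ((r / n : ℕ) : ℝ) * ((g - τ) * n) := mul_le_mul_of_nonneg_left h5 (Nat.cast_nonneg _)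
          _ = (((r / n : ℕ) : ℝ) * n) * (g - τ) := by ring
          _ ≤ _ := mul_le_mul_of_nonneg_right h6 (by linarith)
      linarith
  obtain ⟨τ, hτ, D, hD⟩ := key
  refine ⟨τ, hτ, D, fun v hv r => ?_⟩
  have hn : ‖v‖ ≠ 0 := norm_ne_zero_iff.2 hv
  rw [← Rv_smul v (inv_ne_zero hn)]
  refine hD _ ?_ r
  rw [mem_sphere_zero_iff_norm, norm_smul, norm_inv, norm_norm, inv_mul_cancel₀ hn]

/-- multiplication by `a` -/
def mulL (a : W d) : W d →ₗ[ℝ] W d := LinearMap.mulLeft ℝ a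

theorem mulL_apply (a x : W d) : mulL a x = a * x := rfl

namespace Pair
variable {E : St S.Om} {a : W d} {P : W d →ₗ[ℝ] (ι → ℝ)} {C : ℝ} {m : ℕ} (t : S.Pair E a P C m)

theorem q_pv (hC : 0 ≤ C) {c : ℝ} (hP : Bn P c) (x : t.T) :
    ‖P (a * (S.q (t.o x) - S.q (t.o' x))) - t.pv x‖ ≤ c * (‖a‖ * (2 * C)) / 2 ^ m := by
  unfold pv
  rw [← map_sub, ← mul_sub]
  have e : S.q (t.o x) - S.q (t.o' x) - t.l x * (S.y (t.o x) - S.y (t.o' x))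
      = (S.lam (t.o x) - t.l x) * S.y (t.o x) - (S.lam (t.o' x) - t.l x) * S.y (t.o' x) := by
    unfold q
    ring
  rw [e, mul_div_assoc]
  refine (hP.2 _).trans (mul_le_mul_of_nonneg_left ?_ hP.1)
  rw [mul_div_assoc]
  refine (norm_mul_le _ _).trans (mul_le_mul_of_nonneg_left ?_ (norm_nonneg _))
  have h : ∀ (z : W d) (ω : S.Om), ‖z‖ ≤ C / 2 ^ m → ‖z * S.y ω‖ ≤ C / 2 ^ m := fun z ω hz =>
    (norm_mul_le _ _).trans ((mul_le_mul hz (S.y_norm _) (norm_nonneg _)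
      ((norm_nonneg _).trans hz)).trans (le_of_eq (mul_one _)))
  refine (norm_sub_le _ _).trans ?_
  have h1 := h _ (t.o x) (t.near x)
  have h2 := h _ (t.o' x) (t.near' x)
  have e2 : 2 * C / 2 ^ m = C / 2 ^ m + C / 2 ^ m := by ring
  rw [e2]
  exact add_le_add h1 h2

open Classical in
theorem fano (hC : 0 ≤ C) {c : ℝ} (hP : Bn P c) (k : ℕ) (hm : (1 + c * (‖a‖ * (2 * C))) * 2 ^ k ≤ 2 ^ m) :
    E.cH (S.Gv (P ∘ₗ mulL a) k) (S.Dv P (2 * m)) - C ≤ Fintype.card ι * KK 5 + Real.log 2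
      + t.F.E (ind (t.Ev (1 / 2 ^ k))) * Real.log (Fintype.card (Option (S.Gv (P ∘ₗ mulL a) k).Q)) := by
  set Q := P ∘ₗ mulL a with hQ
  set X := S.Gv Q k with hX
  set e : t.T → Prop := fun x => ¬ t.Ev (1 / 2 ^ k) x with he
  set Ψ : t.T → Option X.Q := fun x => if e x then none else some (Quotient.mk _ (t.o' x)) with hΨ
  have h1 := t.copy X X
  have h2 := t.F.cH_anti (X.comap t.o') (show X.comap t.o ≤ X.comap t.o ⊔ t.B ⊔ RV.ofF t.s from
    fun x z h => h.1.1)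
  have h3 := t.F.cH_add (X.comap t.o') (X.comap t.o) (RV.ofF Ψ ⊔ RV.ofF e)
  have h4 : t.F.cH (RV.ofF Ψ ⊔ RV.ofF e) (X.comap t.o) ≤ t.F.E (ind (t.Ev (1 / 2 ^ k)))
      * Real.log (Fintype.card (Option X.Q)) + Real.log 2 := by
    refine (t.F.cH_le_H _ _).trans ?_
    rw [t.F.H_sup]
    have h5 := t.F.cH_event e Ψ (fun x z hx hz => by simp only [hΨ, if_pos hx, if_pos hz])
    have h6 := t.F.H_le_card (RV.ofF e) e (fun x z h => RV.ofF_rel.2 h)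
    have h7 : (fun x => ¬ e x) = t.Ev (1 / 2 ^ k) := by
      funext x
      simp [he]
    rw [h7] at h5
    have h8 : Fintype.card Prop = 2 := by simp
    rw [h8] at h6
    push_cast at h6
    linarith
  have h5 : t.F.cH (X.comap t.o') (RV.ofF Ψ ⊔ RV.ofF e ⊔ X.comap t.o) ≤ Fintype.card ι * KK 5 := by
    have hcl : ∀ x, e x → ‖Q (S.q (t.o x) - S.q (t.o' x))‖ ≤ 2 / 2 ^ k := by
      intro x hx
      have h1 := t.q_pv hC hP x
      have h2 := t.vh_close x
      have h3 : ‖t.vh x‖ ≤ 1 / 2 ^ k := (not_le.1 hx).le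
      have h4 : c * (‖a‖ * (2 * C)) / 2 ^ m + 1 / 2 ^ m ≤ 1 / 2 ^ k := by
        rw [← add_div, div_le_div_iff₀ (by positivity) (by positivity), one_mul]
        linarith
      have e1 : Q (S.q (t.o x) - S.q (t.o' x)) = (P (a * (S.q (t.o x) - S.q (t.o' x))) - t.pv x)
          + ((t.pv x - t.vh x) + t.vh x) := by
        rw [sub_add_cancel, sub_add_cancel]
        rfl
      rw [e1]
      refine (norm_add_le _ _).trans ((add_le_add h1 ((norm_add_le _ _).trans (add_le_add h2 h3))).trans ?_)
      have e2 : (2:ℝ) / 2 ^ k = 1 / 2 ^ k + 1 / 2 ^ k := by ring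
      linarith
    have := cH_fln t.F (u := fun x => (2:ℝ) ^ k • Q (S.q (t.o' x))) (h := Bd_comp (φ := t.o') (S.Bd_q Q k))
      (Y := RV.ofF Ψ ⊔ RV.ofF e ⊔ X.comap t.o) (c := 5) (fun x z h => by
        rw [← smul_sub, ← map_sub]
        rw [norm_smul, Real.norm_of_nonneg (by positivity)]
        have hee : e x = e z := h.1.2
        have hPsi : Ψ x = Ψ z := h.1.1
        have hpk : (0:ℝ) < 2 ^ k := by positivity
        suffices hs : ‖Q (S.q (t.o' x) - S.q (t.o' z))‖ ≤ 5 / 2 ^ k by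
          rw [le_div_iff₀ hpk] at hs
          linarith
        by_cases hx : e x
        · have hz : e z := hee ▸ hx
          have h1 := hcl x hx
          have h2 := hcl z hz
          have h3 := S.Gv_close (P := Q) h.2
          have e1 : S.q (t.o' x) - S.q (t.o' z) = (S.q (t.o x) - S.q (t.o z)) -
            (S.q (t.o x) - S.q (t.o' x)) + (S.q (t.o z) - S.q (t.o' z)) := by ring
          rw [e1, map_add, map_sub]
          refine (norm_add_le _ _).trans ((add_le_add (norm_sub_le _ _) le_rfl).trans ?_)
          refine (add_le_add (add_le_add h3 h1) h2).trans (le_of_eq ?_)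
          ring
        · have hz : ¬ e z := hee ▸ hx
          simp only [hΨ, if_neg hx, if_neg hz] at hPsi
          have h6 : X.rel (t.o' x) (t.o' z) := Quotient.exact (Option.some.inj hPsi)
          have h3 := S.Gv_close (P := Q) h6
          refine h3.trans ?_
          gcongr
          norm_num)
    exact this
  linarith

end Pair

theorem pEv {E : St S.Om} (hE : S.Stat E) (a : W d) {P : W d →ₗ[ℝ] (ι → ℝ)} {C : ℝ} (hC : 0 ≤ C)
    (hβ : S.gamma E (prd P (P ∘ₗ mulL a)) < S.gamma E P) :
    ∃ κ > 0, ∃ p0 > 0, ∃ m0 : ℕ, ∀ m ≥ m0, ∀ t : S.Pair E a P C m, p0 ≤ t.F.E (ind (t.Ev κ)) := by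
  classical
  obtain ⟨c, hP⟩ := exists_Bn P
  set β := S.gamma E P - S.gamma E (prd P (P ∘ₗ mulL a)) with hβd
  have hβ0 : 0 < β := by linarith
  set A := C + S.cS ι c + (Fintype.card ι * KK 5 + Real.log 2) with hA
  have ht : Tendsto (fun n : ℕ => S.gam E (prd P (P ∘ₗ mulL a)) n / n + A / n) atTop
      (𝓝 (S.gamma E (prd P (P ∘ₗ mulL a)) + 0)) :=
    (gamma_tendsto hE _).add (tendsto_const_div_atTop_nhds_zero_nat A)
  obtain ⟨k, hk, hk1⟩ := ((ht.eventually (gt_mem_nhds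
    (by linarith : S.gamma E (prd P (P ∘ₗ mulL a)) + 0 < S.gamma E P - β / 2))).and
        (eventually_gt_atTop 0)).exists
  have hk0 : (0:ℝ) < k := Nat.cast_pos.2 hk1
  rw [← add_div, div_lt_iff₀ hk0] at hk
  set Lc := Real.log (Fintype.card (Option (S.Gv (P ∘ₗ mulL a) k).Q)) with hLc
  have hLc0 : 0 ≤ Lc := Real.log_natCast_nonneg _
  obtain ⟨m1, hm1⟩ := pow_unbounded_of_one_lt ((1 + c * (‖a‖ * (2 * C))) * 2 ^ k) (one_lt_two (α := ℝ))
  refine ⟨1 / 2 ^ k, by positivity, (β / 2 * k) / (Lc + 1), by positivity, max m1 k, fun m hm t => ?_⟩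
  have hm2 : (1 + c * (‖a‖ * (2 * C))) * 2 ^ k ≤ (2:ℝ) ^ m :=
    hm1.le.trans (pow_le_pow_right₀ (by norm_num) ((le_max_left _ _).trans hm))
  have hmk : k ≤ m := (le_max_right _ _).trans hm
  have h1 := t.fano hC hP k hm2
  have h2 := S.gamma_star hE hP k (2 * m)
  have h3 := E.cH_add (S.Wv k) (S.Dv P (2 * m)) (S.Gv (P ∘ₗ mulL a) k)
  have h4 : E.cH (S.Wv k) (S.Gv (P ∘ₗ mulL a) k ⊔ S.Dv P (2 * m)) ≤ S.gam E (prd P (P ∘ₗ mulL a)) k := by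
    unfold gam
    rw [Dv_prd]
    exact E.cH_anti _ (sup_le_sup le_rfl (S.Dv_mono P (by omega)))
  have hp := t.F.E_ind_nonneg (t.Ev (1 / 2 ^ k))
  rw [div_le_iff₀ (by linarith)]
  rw [← hLc] at h1
  linarith

theorem KC {E : St S.Om} (hE : S.Stat E) (hErg : S.Erg E) (a : W d)
    (hfr : ∃ C > 0, ∃ m0, ∀ E, S.Stat E → ∀ m ≥ m0, Nonempty (S.Frame E a C m))
    (P : W d →ₗ[ℝ] (ι → ℝ))
    (hβ : S.gamma E (prd P (P ∘ₗ mulL a)) < S.gamma E P) :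
    ∃ v : ι → ℝ, v ≠ 0 ∧ S.gamma E P + Real.log 2 ≤ S.gamma E (Rv v ∘ₗ P) := by
  by_contra! hcon
  obtain ⟨C0, hC0, m0, hfr⟩ := hfr
  set C := C0 * (3 + ‖a‖) with hCd
  have hC : 0 ≤ C := by positivity
  obtain ⟨c, hP⟩ := exists_Bn P
  obtain ⟨κ, hκ, p0, hp0, m1, hm1⟩ := S.pEv hE a hC hβ
  obtain ⟨τ', hτ', D, hD'⟩ := S.unif hE hcon
  set γ := S.gamma E P with hγ
  have hγ0 : 0 ≤ γ := S.gamma_nonneg hE P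
  have hl2 : 0 < Real.log 2 := Real.log_pos one_lt_two
  set τ := min τ' (Real.log 2) with hτd
  have hτ : 0 < τ := lt_min hτ' hl2
  have hτl : τ ≤ Real.log 2 := min_le_right _ _
  have hD : ∀ v : ι → ℝ, v ≠ 0 → ∀ r : ℕ, S.gam E (Rv v ∘ₗ P) r ≤ r * (γ + Real.log 2 - τ) + |D| := by
    intro v hv r
    refine (hD' v hv r).trans (add_le_add (mul_le_mul_of_nonneg_left ?_ (Nat.cast_nonneg r)) (le_abs_self D))
    linarith [min_le_left τ' (Real.log 2)]
  set K := Pair.KB S ι C c with hK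
  set δ := p0 * τ / 8 with hδ
  have hδ0 : 0 < δ := by positivity
  -- choose r
  obtain ⟨r, ⟨hr, hr'⟩, hr1⟩ := ((((gamma_tendsto hE P).eventually (gt_mem_nhds (by linarith : γ < γ + δ))).and
    ((tendsto_const_div_atTop_nhds_zero_nat (K + |D| + 1)).eventually (gt_mem_nhds hδ0))).and
        (eventually_gt_atTop 0)).exists
  have hr0 : (0:ℝ) < r := Nat.cast_pos.2 hr1
  rw [div_lt_iff₀ hr0] at hr hr'
  obtain ⟨D1, hD1⟩ := S.star2 hE a (P := P) hC hκ
  obtain ⟨D2, m2, hD2⟩ := S.upper hE hErg a hC hP hκ hr1 (one_pos)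
  have ht2 : Tendsto (fun n : ℕ => 3 * (S.er E P n / n) + (D1 + D2) / n) atTop (𝓝 (3 * 0 + 0)) :=
    ((er_tendsto hE P).const_mul 3).add (tendsto_const_div_atTop_nhds_zero_nat _)
  obtain ⟨m, ⟨hm, hmm⟩, hmpos⟩ := ((((ht2.eventually (gt_mem_nhds (by linarith : 3 * 0 + 0 < δ))).and
        (eventually_ge_atTop (m0 + m1 + m2))).and (eventually_gt_atTop 0))).exists
  have hm0' : (0:ℝ) < m := Nat.cast_pos.2 hmpos
  obtain ⟨fr⟩ := hfr E hE m (by omega)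
  obtain ⟨t⟩ := S.exists_pair hC0 P fr
  have hp := hm1 m (by omega) t
  set p := t.F.E (ind (t.Ev κ)) with hpd
  have hp1 : p ≤ 1 := t.F.E_ind_le_one _
  have h1 := hD1 m t
  have hg1 : 0 ≤ r * (γ + Real.log 2 - τ) + |D| := by
    have : 0 ≤ γ + Real.log 2 - τ := by linarith
    positivity
  have h2 := hD2 m (by omega) t (S.gam E P r) (r * (γ + Real.log 2 - τ) + |D|) (S.gam_nonneg E P r) hg1
    (fun v hv => hD v hv r) le_rfl
  rw [← hpd, ← hK] at h2
  rw [← hpd] at h1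
  have hm3 : 3 * S.er E P m + (D1 + D2) < δ * m := by
    have e : 3 * (S.er E P m / m) + (D1 + D2) / m = (3 * S.er E P m + (D1 + D2)) / m := by ring
    rw [e, div_lt_iff₀ hm0'] at hm
    exact hm
  have hp00 : 0 ≤ p := hp0.le.trans hp
  have h3 : K + (p * (r * (γ + Real.log 2 - τ) + |D|) + (1 - p) * S.gam E P r) + 1 ≤
      r * (γ + p * (Real.log 2 - τ) + 2 * δ) := by
    have h4 : p * |D| ≤ |D| := mul_le_of_le_one_left (abs_nonneg _) hp1
    have h5 : (1 - p) * S.gam E P r ≤ (1 - p) * ((γ + δ) * r) :=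
      mul_le_mul_of_nonneg_left hr.le (by linarith)
    have h6 : 0 ≤ p * (δ * r) := by positivity
    nlinarith
  have h4 := mul_le_mul_of_nonneg_left h3 (by positivity : (0:ℝ) ≤ m / r)
  have h5 : (m:ℝ) / r * (r * (γ + p * (Real.log 2 - τ) + 2 * δ)) = m * (γ + p * (Real.log 2 - τ) + 2 * δ) := by
    field_simp
  rw [h5] at h4
  have h6 : p * τ * m < 3 * δ * m := by nlinarith
  have h7 : p0 * τ * m ≤ p * τ * m := by gcongr
  have h8 : p0 * τ = 8 * δ := by
    rw [hδ]
    ring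
  rw [h8] at h7
  have h9 : 0 < δ * m := by positivity
  linarith

end Sys
end FHR
namespace FHR
namespace Sys
open Module
variable {d : ℕ} {S : Sys d}

/-- a surjective linear map with prescribed kernel -/
def mkP (K : Submodule ℝ (W d)) : W d →ₗ[ℝ] (Fin (finrank ℝ (W d ⧸ K)) → ℝ) :=
  (finBasis ℝ (W d ⧸ K)).equivFun.toLinearMap ∘ₗ K.mkQ

theorem ker_mkP (K : Submodule ℝ (W d)) : LinearMap.ker (mkP K) = K := by
  unfold mkP
  rw [LinearEquiv.ker_comp, Submodule.ker_mkQ]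

theorem range_mkP (K : Submodule ℝ (W d)) : LinearMap.range (mkP K) = ⊤ := by
  unfold mkP
  rw [LinearMap.range_comp, Submodule.range_mkQ, Submodule.map_top, LinearEquiv.range]

/-- `gamma` as a function of the kernel -/
def gk (S : Sys d) (E : St S.Om) (K : Submodule ℝ (W d)) : ℝ := S.gamma E (mkP K)

variable {E : St S.Om}

theorem gk_eq (hE : S.Stat E) {ι : Type} [Fintype ι] (P : W d →ₗ[ℝ] (ι → ℝ)) :
    S.gk E (LinearMap.ker P) = S.gamma E P := gamma_ker hE (ker_mkP _)

theorem gk_mono (hE : S.Stat E) {K K' : Submodule ℝ (W d)} (h : K ≤ K') : S.gk E K ≤ S.gk E K' :=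
  gamma_mono hE (by rwa [ker_mkP, ker_mkP])

theorem gk_prd (hE : S.Stat E) (K L : Submodule ℝ (W d)) :
    S.gk E (K ⊓ L) = S.gamma E (prd (mkP K) (mkP L)) := by
  rw [← gk_eq hE, ker_prd, ker_mkP, ker_mkP]

theorem gk_submod (hE : S.Stat E) {K K' : Submodule ℝ (W d)} (h : K' ≤ K) (L : Submodule ℝ (W d)) :
    S.gk E K' - S.gk E (K' ⊓ L) ≤ S.gk E K - S.gk E (K ⊓ L) := by
  rw [gk_prd hE, gk_prd hE]
  exact gamma_submod hE (by rwa [ker_mkP, ker_mkP]) _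

theorem gk_bot (hE : S.Stat E) : S.gk E ⊥ = 0 := gamma_inj hE (ker_mkP _)

theorem gk_le (hE : S.Stat E) (K : Submodule ℝ (W d)) : S.gk E K ≤ S.hh E := gamma_le_hh hE _

theorem gk_dim (hE : S.Stat E) {K K' : Submodule ℝ (W d)} (h : K ≤ K') :
    S.gk E K' ≤ S.gk E K + ((finrank ℝ K' : ℝ) - finrank ℝ K) * Real.log 2 := by
  set N : Submodule ℝ (W d ⧸ K) := K'.map K.mkQ with hN
  obtain ⟨f, hf⟩ := N.subtype.exists_leftInverse_of_injective (Submodule.ker_subtype N)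
  set Q : W d →ₗ[ℝ] (Fin (finrank ℝ N) → ℝ) := (finBasis ℝ N).equivFun.toLinearMap ∘ₗ f ∘ₗ K.mkQ with hQ
  have hker : K' ⊓ LinearMap.ker Q = K := by
    refine le_antisymm ?_ (le_inf h ?_)
    · rintro x ⟨hx, hx2⟩
      have h1 : f (K.mkQ x) = 0 := by
        have h2 : (finBasis ℝ N).equivFun (f (K.mkQ x)) = 0 := hx2
        simpa using h2
      have h3 : f (N.subtype ⟨K.mkQ x, Submodule.mem_map_of_mem hx⟩) = ⟨K.mkQ x, Submodule.mem_map_of_mem hx⟩ :=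
        LinearMap.congr_fun hf _
      rw [show N.subtype ⟨K.mkQ x, Submodule.mem_map_of_mem hx⟩ = K.mkQ x from rfl, h1] at h3
      have h4 : K.mkQ x = 0 := (congrArg Subtype.val h3).symm
      simpa using h4
    · intro x hx
      have h1 : K.mkQ x = 0 := by simpa using hx
      rw [LinearMap.mem_ker, hQ]
      simp [LinearMap.comp_apply, h1]
  have h1 := gamma_prd_le hE (mkP K') Q
  have h2 : S.gamma E (prd (mkP K') Q) = S.gk E K := by
    rw [← gk_eq hE, ker_prd, ker_mkP, hker]
  have h3 : finrank ℝ N + finrank ℝ K = finrank ℝ K' := by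
    have h4 := LinearMap.finrank_range_add_finrank_ker (K.mkQ.domRestrict K')
    have h5 : LinearMap.range (K.mkQ.domRestrict K') = N := by
      rw [LinearMap.range_domRestrict]
    have h6 : LinearMap.ker (K.mkQ.domRestrict K') = K.submoduleOf K' := by
      rw [LinearMap.ker_domRestrict, Submodule.ker_mkQ]
      rfl
    rw [h5, h6, (Submodule.submoduleOfEquivOfLe h).finrank_eq] at h4
    exact h4
  rw [h2, Fintype.card_fin] at h1
  have h4 : (finrank ℝ K' : ℝ) = finrank ℝ N + finrank ℝ K := by exact_mod_cast h3.symm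
  rw [h4, add_sub_cancel_right]
  exact h1

theorem ker_Rv {ι : Type} [Fintype ι] {v : ι → ℝ} : LinearMap.ker (Rv v) = ℝ ∙ v := by
  ext w
  rw [LinearMap.mem_ker, Submodule.mem_span_singleton, Rv_apply]
  constructor
  · intro h
    exact ⟨_, (sub_eq_zero.1 h).symm⟩
  · rintro ⟨s, rfl⟩
    rw [← Rv_apply, map_smul]
    by_cases hv : v = 0
    · rw [hv, map_zero, smul_zero]
    · rw [Rv_self hv, smul_zero]

theorem gk_KC (hE : S.Stat E) (hErg : S.Erg E) (a : W d)
    (hfr : ∃ C > 0, ∃ m0, ∀ E, S.Stat E → ∀ m ≥ m0, Nonempty (S.Frame E a C m)) (K : Submodule ℝ (W d))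
    (h : S.gk E (K ⊓ K.comap (mulL a)) < S.gk E K) :
    ∃ K', K ≤ K' ∧ finrank ℝ K' = finrank ℝ K + 1 ∧ S.gk E K + Real.log 2 ≤ S.gk E K' := by
  have e : S.gk E (K ⊓ K.comap (mulL a)) = S.gamma E (prd (mkP K) (mkP K ∘ₗ mulL a)) := by
    rw [← gk_eq hE, ker_prd, LinearMap.ker_comp, ker_mkP]
  rw [e] at h
  obtain ⟨v, hv, h2⟩ := S.KC hE hErg a hfr (mkP K) h
  refine ⟨LinearMap.ker (Rv v ∘ₗ mkP K), ?_, ?_, ?_⟩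
  · conv_lhs => rw [← ker_mkP K]
    exact LinearMap.ker_le_ker_comp _ _
  · rw [LinearMap.ker_comp, ker_Rv]
    have h4 := LinearMap.finrank_range_add_finrank_ker ((mkP K).domRestrict ((ℝ ∙ v).comap (mkP K)))
    have h5 : LinearMap.range ((mkP K).domRestrict ((ℝ ∙ v).comap (mkP K))) = ℝ ∙ v := by
      rw [LinearMap.range_domRestrict, Submodule.map_comap_eq, range_mkP, top_inf_eq]
    have h7 : K ≤ (ℝ ∙ v).comap (mkP K) := by
      conv_lhs => rw [← ker_mkP K]
      exact LinearMap.ker_le_comap _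
    have h6 : LinearMap.ker ((mkP K).domRestrict ((ℝ ∙ v).comap (mkP K))) =
        K.submoduleOf ((ℝ ∙ v).comap (mkP K)) := by
      rw [LinearMap.ker_domRestrict, ker_mkP]
      rfl
    rw [h5, h6, (Submodule.submoduleOfEquivOfLe h7).finrank_eq, finrank_span_singleton hv] at h4
    omega
  · rw [gk_eq hE]
    exact h2

/-- coordinate subspace -/
def CS (T : Finset (Fin d)) : Submodule ℝ (W d) where
  carrier := {x | ∀ j, j ∉ T → x j = 0}
  add_mem' := fun {x y} hx hy j hj => by rw [Pi.add_apply, hx j hj, hy j hj, add_zero]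
  zero_mem' := fun _ _ => rfl
  smul_mem' := fun c x hx j hj => by rw [Pi.smul_apply, hx j hj, smul_zero]

theorem mem_CS {T : Finset (Fin d)} {x : W d} : x ∈ CS T ↔ ∀ j, j ∉ T → x j = 0 := Iff.rfl

theorem CS_mono {T T' : Finset (Fin d)} (h : T ⊆ T') : CS T ≤ CS T' := fun x hx j hj => hx j fun hh => hj (h hh)

theorem finrank_CS (T : Finset (Fin d)) : finrank ℝ (CS T) = T.card := by
  classical
  let f : CS T ≃ₗ[ℝ] (T → ℝ) :=
    { toFun := fun x j => (x : W d) j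
      map_add' := fun x y => rfl
      map_smul' := fun c x => rfl
      invFun := fun z => ⟨fun j => if h : j ∈ T then z ⟨j, h⟩ else 0, fun j hj => dif_neg hj⟩
      left_inv := fun x => by
        ext j
        by_cases h : j ∈ T
        · simp [h]
        · simp [h, x.2 j h]
      right_inv := fun z => by
        funext j
        simp }
  rw [f.finrank_eq, finrank_fintype_fun_eq_card, Fintype.card_coe]

theorem coord_of_inv {a : W d} (ha : ∀ i j, i ≠ j → a i ≠ a j) {K : Submodule ℝ (W d)}
    (h : K ≤ K.comap (mulL a)) : ∃ T : Finset (Fin d), K = CS T := by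
  classical
  have hprod : ∀ (s : Finset (Fin d)) (x : W d), x ∈ K → (fun i => (∏ l ∈ s, (a i - a l)) * x i) ∈ K := by
    intro s
    induction s using Finset.induction_on with
    | empty =>
      intro x hx
      simpa using hx
    | insert l s hl ih =>
      intro x hx
      have h1 := ih x hx
      have h2 := K.sub_mem (h h1) (K.smul_mem (a l) h1)
      convert h2 using 1
      funext i
      rw [Finset.prod_insert hl, mulL_apply, Pi.sub_apply, Pi.mul_apply, Pi.smul_apply, smul_eq_mul]
      ring
  refine ⟨Finset.univ.filter fun j => (Pi.single j (1:ℝ) : W d) ∈ K, le_antisymm ?_ ?_⟩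
  · intro x hx j hj
    by_contra hxj
    refine hj (Finset.mem_filter.2 ⟨Finset.mem_univ _, ?_⟩)
    have h1 := hprod (Finset.univ.erase j) x hx
    have hne : (∏ l ∈ Finset.univ.erase j, (a j - a l)) * x j ≠ 0 := by
      refine mul_ne_zero (Finset.prod_ne_zero_iff.2 fun l hl => sub_ne_zero.2 ?_) hxj
      exact ha j l (Finset.ne_of_mem_erase hl).symm
    have h2 := K.smul_mem ((∏ l ∈ Finset.univ.erase j, (a j - a l)) * x j)⁻¹ h1
    convert h2 using 1
    funext i
    rw [Pi.smul_apply, smul_eq_mul]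
    by_cases hij : i = j
    · subst hij
      rw [Pi.single_eq_same, inv_mul_cancel₀ hne]
    · have hz : ∏ l ∈ Finset.univ.erase j, (a i - a l) = 0 :=
        Finset.prod_eq_zero (i := i) (Finset.mem_erase.2 ⟨hij, Finset.mem_univ _⟩) (sub_self _)
      rw [Pi.single_eq_of_ne hij, hz]
      simp
  · intro x hx
    have e : x = ∑ j, x j • (Pi.single j (1:ℝ) : W d) := by
      funext i
      simp [Finset.sum_apply, Pi.single_apply]
    rw [e]
    refine K.sum_mem fun j _ => ?_
    by_cases hj : (Pi.single j (1:ℝ) : W d) ∈ K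
    · exact K.smul_mem _ hj
    · rw [hx j (fun hh => hj (Finset.mem_filter.1 hh).2), zero_smul]
      exact K.zero_mem

theorem la (hE : S.Stat E) (hErg : S.Erg E) {a : W d} (ha : ∀ i j, i ≠ j → a i ≠ a j)
    (hfr : ∃ C > 0, ∃ m0, ∀ E, S.Stat E → ∀ m ≥ m0, Nonempty (S.Frame E a C m)) {k : ℕ}
    {P0 : Submodule ℝ (W d)} (hM : ∀ T : Finset (Fin d), P0 ⊓ CS T ≠ ⊥ →
      finrank ℝ (P0 ⊓ CS T : Submodule ℝ (W d)) + k ≤ T.card) (h0 : 0 < S.gk E P0) :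
    S.gk E P0 + k * Real.log 2 ≤ S.hh E := by
  classical
  have hl2 : 0 < Real.log 2 := Real.log_pos one_lt_two
  -- minimal P
  obtain ⟨P, ⟨hP0, hPg⟩, hPmin⟩ : ∃ P : Submodule ℝ (W d), (P ≤ P0 ∧ S.gk E P = S.gk E P0) ∧
      ∀ Q : Submodule ℝ (W d), Q ≤ P0 → S.gk E Q = S.gk E P0 → finrank ℝ P ≤ finrank ℝ Q := by
    have hex : ∃ n, ∃ P : Submodule ℝ (W d), (P ≤ P0 ∧ S.gk E P = S.gk E P0) ∧ finrank ℝ P = n :=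
      ⟨_, P0, ⟨le_rfl, rfl⟩, rfl⟩
    obtain ⟨P, hP, hn⟩ := Nat.find_spec hex
    refine ⟨P, hP, fun Q hQ hQ2 => ?_⟩
    rw [hn]
    exact Nat.find_min' hex ⟨Q, ⟨hQ, hQ2⟩, rfl⟩
  -- maximal P1
  obtain ⟨P1, ⟨hP1, hP1g⟩, hP1max⟩ : ∃ P1 : Submodule ℝ (W d), (P ≤ P1 ∧
      S.gk E P + ((finrank ℝ P1 : ℝ) - finrank ℝ P) * Real.log 2 ≤ S.gk E P1) ∧
      ∀ Q : Submodule ℝ (W d), P ≤ Q → S.gk E P + ((finrank ℝ Q : ℝ) - finrank ℝ P) * Real.log 2 ≤ S.gk E Q →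
        finrank ℝ Q ≤ finrank ℝ P1 := by
    have hex : ∃ n, ∃ P1 : Submodule ℝ (W d), (P ≤ P1 ∧
      S.gk E P + ((finrank ℝ P1 : ℝ) - finrank ℝ P) * Real.log 2 ≤ S.gk E P1) ∧ d - finrank ℝ P1 = n :=
      ⟨_, P, ⟨le_rfl, by simp⟩, rfl⟩
    obtain ⟨P1, hP, hn⟩ := Nat.find_spec hex
    refine ⟨P1, hP, fun Q hQ hQ2 => ?_⟩
    have h1 := Nat.find_min' hex ⟨Q, ⟨hQ, hQ2⟩, rfl⟩
    have h2 : finrank ℝ Q ≤ d := by simpa using Submodule.finrank_le Q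
    have h3 : finrank ℝ P1 ≤ d := by simpa using Submodule.finrank_le P1
    omega
  -- P1 is invariant
  have hinv : P1 ≤ P1.comap (mulL a) := by
    by_contra hcon
    have hlt : S.gk E (P1 ⊓ P1.comap (mulL a)) < S.gk E P1 := by
      by_cases hPL : P ≤ P1.comap (mulL a)
      · have h1 := gk_dim hE (le_inf hP1 hPL)
        have h2 : finrank ℝ (P1 ⊓ P1.comap (mulL a) : Submodule ℝ (W d)) < finrank ℝ P1 :=
          Submodule.finrank_lt_finrank_of_lt (inf_lt_left.2 hcon)
        have h3 : ((finrank ℝ (P1 ⊓ P1.comap (mulL a) : Submodule ℝ (W d)) : ℝ) - finrank ℝ P) * Real.log 2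
            < ((finrank ℝ P1 : ℝ) - finrank ℝ P) * Real.log 2 := by
          refine mul_lt_mul_of_pos_right ?_ hl2
          have : (finrank ℝ (P1 ⊓ P1.comap (mulL a) : Submodule ℝ (W d)) : ℝ) < finrank ℝ P1 := by
            exact_mod_cast h2
          linarith
        linarith
      · have h1 := gk_submod hE hP1 (P1.comap (mulL a))
        have h2 : S.gk E (P ⊓ P1.comap (mulL a)) < S.gk E P := by
          refine lt_of_le_of_ne (gk_mono hE inf_le_left) fun heq => ?_
          have h3 := hPmin _ (inf_le_left.trans hP0) (heq.trans hPg)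
          exact absurd (Submodule.finrank_lt_finrank_of_lt (inf_lt_left.2 hPL)) (not_lt.2 h3)
        linarith
    obtain ⟨K', hK', hdim, hg⟩ := gk_KC hE hErg a hfr P1 hlt
    have h1 := hP1max K' (hP1.trans hK') (by
      rw [hdim]
      push_cast
      linarith)
    omega
  obtain ⟨T, hT⟩ := coord_of_inv ha hinv
  have hPne : P ≠ ⊥ := by
    rintro rfl
    rw [gk_bot hE] at hPg
    linarith
  have hPle : P ≤ P0 ⊓ CS T := le_inf hP0 (hT ▸ hP1)
  have hne : P0 ⊓ CS T ≠ ⊥ := fun h => hPne (le_bot_iff.1 (h ▸ hPle))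
  have h1 := hM T hne
  have h2 := Submodule.finrank_mono hPle
  have h3 : finrank ℝ P1 = T.card := by rw [hT, finrank_CS]
  have h4 : (finrank ℝ P : ℝ) + k ≤ finrank ℝ P1 := by
    exact_mod_cast (show finrank ℝ P + k ≤ finrank ℝ P1 by omega)
  have h5 := gk_le hE P1
  have h6 : (k:ℝ) * Real.log 2 ≤ ((finrank ℝ P1 : ℝ) - finrank ℝ P) * Real.log 2 :=
    mul_le_mul_of_nonneg_right (by linarith) hl2.le
  linarith

end Sys
end FHR
namespace FHR

theorem cover_piece (p : ℕ) (hp : 2 ≤ p) (t : ℝ) (ht : 0 < t) (T : Set ℝ) (w : ℝ) (hw : 0 < w)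
    (hwp : (p : ℝ) ^ t * w ≤ 1) (hT : (⨆ _ : T.Nonempty, Metric.ediam T ^ t) < ENNReal.ofReal w) :
    ∃ U : Set ℝ, ∃ m : ℕ, IsOpen U ∧ T ⊆ U ∧ 1 ≤ m ∧ (∀ x ∈ U, ∀ y ∈ U, |x - y| * (p : ℝ) ^ m ≤ 1) ∧
      ((p : ℝ) ^ m) ^ (-t) ≤ (p : ℝ) ^ t * w := by
  have hp0 : (0:ℝ) < p := by positivity
  have hp2 : (2:ℝ) ≤ p := by exact_mod_cast hp
  set ρ := w ^ t⁻¹ with hρ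
  have hρ0 : 0 < ρ := by positivity
  have hρt : ρ ^ t = w := Real.rpow_inv_rpow hw.le ht.ne'
  have hd : Metric.ediam T < ENNReal.ofReal ρ := by
    rcases T.eq_empty_or_nonempty with h | h
    · rw [h, Metric.ediam_empty]
      exact ENNReal.ofReal_pos.2 hρ0
    · rw [iSup_pos h, ← hρt, ← ENNReal.ofReal_rpow_of_pos hρ0] at hT
      exact (ENNReal.rpow_lt_rpow_iff ht).1 hT
  obtain ⟨r, hr, hd'⟩ : ∃ r : ℝ, r < ρ ∧ 0 ≤ r ∧ Metric.ediam T ≤ ENNReal.ofReal r := by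
    obtain ⟨x, hx1, hx2⟩ := exists_between hd
    refine ⟨x.toReal, ?_, ENNReal.toReal_nonneg, ?_⟩
    · rwa [← ENNReal.lt_ofReal_iff_toReal_lt (ne_top_of_lt hx2)]
    · rw [ENNReal.ofReal_toReal (ne_top_of_lt hx2)]
      exact hx1.le
  obtain ⟨hr0, hd'⟩ := hd'
  have hρp : ρ * p ≤ 1 := by
    have h1 : (ρ * p) ^ t ≤ 1 := by
      rw [Real.mul_rpow hρ0.le hp0.le, hρt, mul_comm]
      exact hwp
    by_contra hc
    have := Real.one_lt_rpow (not_le.1 hc) ht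
    linarith
  obtain ⟨m, hm1, hm2⟩ := exists_nat_pow_near_of_lt_one hρ0 (by nlinarith : ρ ≤ 1)
    (y := (p : ℝ)⁻¹) (by positivity) (inv_lt_one_of_one_lt₀ (by linarith))
  refine ⟨Metric.thickening ((ρ - r) / 2) T, m, Metric.isOpen_thickening,
    Metric.self_subset_thickening (by linarith) T, ?_, ?_, ?_⟩
  · rcases Nat.eq_zero_or_pos m with h | h
    · rw [h, zero_add, pow_one, inv_lt_iff_one_lt_mul₀ hp0] at hm1
      linarith
    · exact h
  · intro x hx y hy
    rw [Metric.mem_thickening_iff] at hx hy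
    obtain ⟨x', hx', h1⟩ := hx
    obtain ⟨y', hy', h2⟩ := hy
    have h3 := (Metric.edist_le_ediam_of_mem hx' hy').trans hd'
    rw [edist_dist, ENNReal.ofReal_le_ofReal_iff hr0] at h3
    have h4 : |x - y| ≤ ρ := by
      rw [← Real.dist_eq]
      have := dist_triangle4 x x' y' y
      rw [dist_comm y' y] at this
      linarith
    have h5 : ρ * (p : ℝ) ^ m ≤ 1 := by
      rw [inv_pow, ← one_div, le_div_iff₀ (by positivity)] at hm2
      exact hm2
    exact (mul_le_mul_of_nonneg_right h4 (by positivity)).trans h5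
  · rw [← hρt, ← Real.mul_rpow hp0.le hρ0.le, Real.rpow_neg (by positivity),
      ← Real.inv_rpow (by positivity)]
    refine Real.rpow_le_rpow (by positivity) ?_ ht.le
    rw [pow_succ, inv_pow, ← div_eq_mul_inv, div_lt_iff₀ hp0] at hm1
    linarith

theorem cover_fin (p : ℕ) (hp : 2 ≤ p) (t : NNReal) (ht : 0 < t) (K : Set ℝ) (hK : IsCompact K)
    (hd : dimH K < t) (e : ℝ) (he : 0 < e) :
    ∃ s : Finset ℕ, ∃ U : ℕ → Set ℝ, ∃ m : ℕ → ℕ, K ⊆ ⋃ i ∈ s, U i ∧ (∀ i, 1 ≤ m i) ∧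
      (∀ i, ∀ x ∈ U i, ∀ y ∈ U i, |x - y| * (p : ℝ) ^ m i ≤ 1) ∧
      ∑ i ∈ s, ((p : ℝ) ^ m i) ^ (-(t : ℝ)) ≤ e := by
  have hp0 : (0:ℝ) < p := by positivity
  set c := (p : ℝ) ^ (t : ℝ) with hc
  have hc0 : 0 < c := by positivity
  set ε := min e 1 / (2 * c) with hε
  have hm0 : 0 < min e 1 := lt_min he one_pos
  have hε0 : 0 < ε := by positivity
  have hcε : c * (2 * ε) = min e 1 := by rw [hε]; field_simp
  have h0 := hausdorffMeasure_of_dimH_lt hd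
  rw [Measure.hausdorffMeasure_apply] at h0
  have h1 := (iSup₂_eq_bot.1 h0) 1 one_pos
  have h2 : (⨅ (T : ℕ → Set ℝ) (_ : K ⊆ ⋃ n, T n) (_ : ∀ n, Metric.ediam (T n) ≤ 1),
          ∑' n, ⨆ _ : (T n).Nonempty, Metric.ediam (T n) ^ (t : ℝ)) < ENNReal.ofReal ε := by
    rw [h1]
    exact ENNReal.ofReal_pos.2 hε0
  simp only [iInf_lt_iff] at h2
  obtain ⟨T, hT1, hT2, hT3⟩ := h2
  set a : ℕ → ℝ≥0∞ := fun n => ⨆ _ : (T n).Nonempty, Metric.ediam (T n) ^ (t : ℝ) with ha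
  have hat : ∀ n, a n ≠ ⊤ := fun n => ne_top_of_lt ((ENNReal.le_tsum n).trans_lt hT3)
  have hsum : ∀ s : Finset ℕ, ∑ i ∈ s, (a i).toReal ≤ ε := by
    intro s
    rw [← ENNReal.toReal_sum fun i _ => hat i]
    refine ENNReal.toReal_le_of_le_ofReal hε0.le ((ENNReal.sum_le_tsum s).trans hT3.le)
  set w : ℕ → ℝ := fun n => (a n).toReal + ε * (1 / 2) ^ (n + 1) with hw
  have hgeo : ∀ s : Finset ℕ, ∑ i ∈ s, ε * (1 / 2 : ℝ) ^ (i + 1) ≤ ε := by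
    intro s
    have h3 : HasSum (fun i : ℕ => ε * (1 / 2 : ℝ) ^ (i + 1)) ε := by
      have := (hasSum_geometric_two.mul_left (ε * (1 / 2)))
      have e1 : (fun i : ℕ => ε * (1 / 2 : ℝ) ^ (i + 1)) = fun i => ε * (1 / 2) * (1 / 2) ^ i := by
        funext i; ring
      rw [e1]
      rwa [show ε * (1 / 2) * 2 = ε by ring] at this
    exact sum_le_hasSum s (fun i _ => by positivity) h3
  have hws : ∀ s : Finset ℕ, ∑ i ∈ s, w i ≤ 2 * ε := by
    intro s
    rw [hw]
    simp only
    rw [Finset.sum_add_distrib]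
    linarith [hsum s, hgeo s]
  have hw0 : ∀ n, 0 < w n := fun n => by
    have : 0 ≤ (a n).toReal := ENNReal.toReal_nonneg
    simp only [hw]
    positivity
  have key : ∀ n, ∃ U : Set ℝ, ∃ m : ℕ, IsOpen U ∧ T n ⊆ U ∧ 1 ≤ m ∧
      (∀ x ∈ U, ∀ y ∈ U, |x - y| * (p : ℝ) ^ m ≤ 1) ∧ ((p : ℝ) ^ m) ^ (-(t : ℝ)) ≤ c * w n := by
    intro n
    refine cover_piece p hp t (by exact_mod_cast ht) (T n) (w n) (hw0 n) ?_ ?_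
    · have := hws {n}
      rw [Finset.sum_singleton] at this
      have h4 := mul_le_mul_of_nonneg_left this hc0.le
      rw [hcε] at h4
      exact h4.trans (min_le_right _ _)
    · rw [ENNReal.lt_ofReal_iff_toReal_lt (hat n)]
      have : 0 < ε * (1 / 2) ^ (n + 1) := by positivity
      simp only [hw]
      linarith
  choose U m hU hTU hm hd2 hpw using key
  obtain ⟨s, hs⟩ := hK.elim_finite_subcover U hU (hT1.trans (iUnion_mono hTU))
  refine ⟨s, U, m, hs, hm, hd2, ?_⟩
  calc _ ≤ ∑ i ∈ s, c * w i := Finset.sum_le_sum fun i _ => hpw i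
    _ = c * ∑ i ∈ s, w i := by rw [Finset.mul_sum]
    _ ≤ c * (2 * ε) := mul_le_mul_of_nonneg_left (hws s) hc0.le
    _ ≤ e := by rw [hcε]; exact min_le_left _ _

/-- digits of level `N` -/
def Dg (p : ℕ) (A : Set ℝ) (N : ℕ) : Set ℤ := (fun y : ℝ => ⌊(p : ℝ) ^ N * y⌋) '' A

theorem Dg_finite {p : ℕ} {A : Set ℝ} (hA : ∀ t ∈ A, 0 ≤ t ∧ t ≤ 1) (N : ℕ) : (Dg p A N).Finite := by
  refine (Set.finite_Icc (0:ℤ) ((p : ℤ) ^ N)).subset ?_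
  rintro _ ⟨y, hy, rfl⟩
  obtain ⟨h1, h2⟩ := hA y hy
  refine ⟨Int.floor_nonneg.2 (by positivity), Int.floor_le_iff.2 ?_⟩
  push_cast
  have := mul_le_mul_of_nonneg_left h2 (show (0:ℝ) ≤ (p : ℝ) ^ N by positivity)
  linarith

theorem Dg_count (p : ℕ) (hp : 2 ≤ p) (t : NNReal) (ht : 0 < t) (K A : Set ℝ) (hK : IsCompact K)
    (hd : dimH K < t) (hK1 : ∀ x ∈ K, 0 ≤ x ∧ x ≤ 1) (hAK : A ⊆ K)
    (hinv : ∀ x ∈ K, ∀ n : ℕ, Int.fract ((p : ℝ) ^ n * x) ∈ A) :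
    ∃ C : ℝ, 0 < C ∧ ∀ N, ((Dg p K N).ncard : ℝ) ≤ C * ((p : ℝ) ^ N) ^ (t : ℝ) := by
  classical
  have hp0 : (0:ℝ) < p := by positivity
  have hp1 : (1:ℝ) ≤ p := by exact_mod_cast (by omega : 1 ≤ p)
  obtain ⟨s, U, m, hs, hm, hU, hsum⟩ := cover_fin p hp t ht K hK hd (1 / 2) (by norm_num)
  set M := ∑ i ∈ s, m i with hM
  have hmM : ∀ i ∈ s, m i ≤ M := fun i hi => Finset.single_le_sum (fun _ _ => Nat.zero_le _) hi
  have hfin := Dg_finite (p := p) hK1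
  refine ⟨1 + ∑ N ∈ Finset.range M, ((Dg p K N).ncard : ℝ), by positivity, fun N => ?_⟩
  set C := 1 + ∑ N ∈ Finset.range M, ((Dg p K N).ncard : ℝ) with hC
  have hC0 : 0 < C := by positivity
  induction N using Nat.strong_induction_on with
  | _ N ih =>
  have hone : ∀ N : ℕ, (1:ℝ) ≤ ((p : ℝ) ^ N) ^ (t : ℝ) := fun N =>
    Real.one_le_rpow (one_le_pow₀ hp1) t.2
  rcases lt_or_ge N M with hN | hN
  · have h1 : ((Dg p K N).ncard : ℝ) ≤ ∑ N ∈ Finset.range M, ((Dg p K N).ncard : ℝ) :=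
      Finset.single_le_sum (f := fun N => ((Dg p K N).ncard : ℝ)) (fun _ _ => by positivity)
        (Finset.mem_range.2 hN)
    nlinarith [hone N]
  · -- cover
    have h1 : Dg p K N ⊆ ⋃ i ∈ s, Dg p (K ∩ U i) N := by
      rintro _ ⟨y, hy, rfl⟩
      obtain ⟨i, hi, hyi⟩ := mem_iUnion₂.1 (hs hy)
      exact mem_iUnion₂.2 ⟨i, hi, y, ⟨hy, hyi⟩, rfl⟩
    have h2 : ∀ i ∈ s, (Dg p (K ∩ U i) N).ncard ≤ 2 * (Dg p K (N - m i)).ncard := by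
      intro i hi
      rcases (K ∩ U i).eq_empty_or_nonempty with h | ⟨x0, hx0⟩
      · rw [h]
        simp [Dg]
      have hmi : m i ≤ N := (hmM i hi).trans hN
      have h3 : ∃ z : ℤ, ∀ y ∈ K ∩ U i, ⌊(p : ℝ) ^ m i * y⌋ = z ∨ ⌊(p : ℝ) ^ m i * y⌋ = z + 1 := by
        have hcl : ∀ x ∈ K ∩ U i, ∀ y ∈ K ∩ U i,
            ⌊(p : ℝ) ^ m i * y⌋ ≤ ⌊(p : ℝ) ^ m i * x⌋ + 1 := by
          intro x hx y hy
          have h4 := hU i y hy.2 x hx.2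
          have h5 := (abs_le.1 (show |(p : ℝ) ^ m i * y - (p : ℝ) ^ m i * x| ≤ 1 by
            rw [← mul_sub, abs_mul, abs_of_pos (by positivity), mul_comm]
            exact h4)).2
          rw [← Int.floor_add_one]
          exact Int.floor_mono (by linarith)
        by_cases hz : ∃ x ∈ K ∩ U i, ⌊(p : ℝ) ^ m i * x⌋ < ⌊(p : ℝ) ^ m i * x0⌋
        · obtain ⟨x, hx, hlt⟩ := hz
          refine ⟨⌊(p : ℝ) ^ m i * x⌋, fun y hy => ?_⟩
          have a1 := hcl x hx y hy
          have a2 := hcl y hy x0 hx0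
          omega
        · push Not at hz
          refine ⟨⌊(p : ℝ) ^ m i * x0⌋, fun y hy => ?_⟩
          have a1 := hcl x0 hx0 y hy
          have a2 := hz y hy
          omega
      obtain ⟨z, hz⟩ := h3
      have h4 : Dg p (K ∩ U i) N ⊆ (fun u : ℤ => (p : ℤ) ^ (N - m i) * z + u) '' Dg p K (N - m i)
          ∪ (fun u : ℤ => (p : ℤ) ^ (N - m i) * (z + 1) + u) '' Dg p K (N - m i) := by
        rintro _ ⟨y, hy, rfl⟩
        have h5 := Sys.floor_pow_add (m i) (N - m i) p y
        rw [Nat.add_sub_cancel' hmi] at h5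
        have h6 : ⌊(p : ℝ) ^ (N - m i) * Int.fract ((p : ℝ) ^ m i * y)⌋ ∈ Dg p K (N - m i) :=
          ⟨_, hAK (hinv y hy.1 (m i)), rfl⟩
        rcases hz y hy with h7 | h7
        · left
          exact ⟨_, h6, by simp only; rw [h5, h7]⟩
        · right
          exact ⟨_, h6, by simp only; rw [h5, h7]⟩
      have hf := hfin (N - m i)
      refine (Set.ncard_le_ncard h4 ((hf.image _).union (hf.image _))).trans ?_
      refine (Set.ncard_union_le _ _).trans ?_
      have a1 := Set.ncard_image_le (f := fun u : ℤ => (p : ℤ) ^ (N - m i) * z + u) hf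
      have a2 := Set.ncard_image_le (f := fun u : ℤ => (p : ℤ) ^ (N - m i) * (z + 1) + u) hf
      omega
    have h3 : (Dg p K N).ncard ≤ ∑ i ∈ s, (Dg p (K ∩ U i) N).ncard := by
      refine (Set.ncard_le_ncard h1 ?_).trans ?_
      · exact s.finite_toSet.biUnion fun i _ => Dg_finite (fun x hx => hK1 x hx.1) N
      · exact Finset.set_ncard_biUnion_le s _
    have h4 : ((Dg p K N).ncard : ℝ) ≤ ∑ i ∈ s, 2 * ((Dg p K (N - m i)).ncard : ℝ) := by
      refine (Nat.cast_le.2 h3).trans ?_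
      push_cast
      exact Finset.sum_le_sum fun i hi => by exact_mod_cast h2 i hi
    refine h4.trans ?_
    have h5 : ∀ i ∈ s, 2 * ((Dg p K (N - m i)).ncard : ℝ)
        ≤ 2 * C * ((p : ℝ) ^ N) ^ (t : ℝ) * ((p : ℝ) ^ m i) ^ (-(t : ℝ)) := by
      intro i hi
      have hmi : m i ≤ N := (hmM i hi).trans hN
      have h6 := ih (N - m i) (by have := hm i; omega)
      have h7 : ((p : ℝ) ^ (N - m i)) ^ (t : ℝ) = ((p : ℝ) ^ N) ^ (t : ℝ) * ((p : ℝ) ^ m i) ^ (-(t : ℝ)) := by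
        rw [Real.rpow_neg (by positivity), ← div_eq_mul_inv, ← Real.div_rpow (by positivity) (by positivity),
          pow_sub₀ _ hp0.ne' hmi, div_eq_mul_inv]
      rw [h7] at h6
      linarith
    refine (Finset.sum_le_sum h5).trans ?_
    rw [← Finset.mul_sum]
    have h6 := mul_le_mul_of_nonneg_left hsum (show 0 ≤ 2 * C * ((p : ℝ) ^ N) ^ (t : ℝ) by positivity)
    linarith

namespace Sys
variable {d : ℕ} {S : Sys d}

theorem pow_N_le (n : ℕ) (ω : S.Om) (j : Fin d) : S.p j ^ (S.N n ω j) ≤ S.p j * 2 ^ n := by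
  have h1 := S.lam_ge (S.sh n ω) j
  rw [lam_sh] at h1
  have h2 := S.lam_lt ω j
  have hp := S.p_pos j
  rw [div_mul_eq_mul_div, le_div_iff₀ (by positivity), one_mul] at h1
  have h3 : ((S.p j : ℝ) ^ (S.N n ω j)) ≤ S.p j * 2 ^ n := by
    refine h1.trans ?_
    rw [mul_comm]
    exact mul_le_mul_of_nonneg_right h2.le (by positivity)
  exact_mod_cast h3

theorem lim_log (d : ℕ) (C : ℝ) :
    Tendsto (fun n : ℕ => ((d * Real.log (n + 2) + C) : ℝ) / n) atTop (𝓝 0) := by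
  have h1 : Tendsto (fun n : ℕ => Real.log ((n:ℝ) + 2) / ((n:ℝ) + 2)) atTop (𝓝 0) := by
    have := (Real.isLittleO_log_id_atTop.tendsto_div_nhds_zero).comp
      (tendsto_atTop_add_const_right atTop (2:ℝ) tendsto_natCast_atTop_atTop)
    exact this
  have h2 : Tendsto (fun n : ℕ => ((n:ℝ) + 2) / n) atTop (𝓝 1) := by
    have h3 : Tendsto (fun n : ℕ => 1 + 2 / (n:ℝ)) atTop (𝓝 (1 + 0)) :=
      tendsto_const_nhds.add (tendsto_const_div_atTop_nhds_zero_nat 2)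
    rw [add_zero] at h3
    refine h3.congr' ?_
    filter_upwards [eventually_gt_atTop 0] with n hn
    have hn' : (0:ℝ) < n := by exact_mod_cast hn
    field_simp
  have h4 := ((h1.mul h2).const_mul (d:ℝ)).add (tendsto_const_div_atTop_nhds_zero_nat C)
  simp only [zero_mul, mul_zero, add_zero] at h4
  refine h4.congr fun n => ?_
  have hn2 : (0:ℝ) < (n:ℝ) + 2 := by positivity
  field_simp

theorem hh_le {E : St S.Om} (hE : S.Stat E) (t : Fin d → NNReal) (C : Fin d → ℝ) (hC0 : ∀ j, 0 < C j)
    (hC : ∀ j N, ((Dg (S.p j) (S.A j) N).ncard : ℝ) ≤ C j * (((S.p j : ℝ)) ^ N) ^ (t j : ℝ)) :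
    S.hh E ≤ (∑ j, (t j : ℝ)) * Real.log 2 := by
  classical
  have hfin : ∀ j N, (Dg (S.p j) (S.A j) N).Finite := fun j N =>
    Dg_finite (fun x hx => ⟨(S.hA j x hx).1, (S.hA j x hx).2.le⟩) N
  have main : ∀ n : ℕ, S.hh E * n ≤ (∑ j, (t j : ℝ)) * Real.log 2 * n +
      (d * Real.log (n + 2) + (S.cL + ∑ j, (Real.log (C j) + t j * Real.log (S.p j)))) := by
    intro n
    set K : Fin d → ℕ := fun j => Nat.log (S.p j) (S.p j * 2 ^ n) with hK
    have hNK : ∀ ω j, S.N n ω j ≤ K j := fun ω j =>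
      Nat.le_log_of_pow_le (by have := S.hp j; omega) (pow_N_le n ω j)
    have hmem : ∀ ω j, ⌊(S.p j : ℝ) ^ K j * S.y ω j⌋ ∈ (hfin j (K j)).toFinset := by
      intro ω j
      rw [Set.Finite.mem_toFinset]
      exact ⟨_, S.y_mem ω j, rfl⟩
    obtain ⟨ω0⟩ := E.nonempty_of
    have h1 := E.cH_le_card (S.Wv n) (S.Lv 0) (fun ω => ((fun j : Fin d =>
      ((∑ t ∈ Finset.range (n + 1), S.N t ω j : ℕ) : ZMod (n + 2))),
      (fun j : Fin d => (⟨_, hmem ω j⟩ : (hfin j (K j)).toFinset)))) ?_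
    · have h2 := hL hE n 0
      rw [Fintype.card_prod, Fintype.card_fun, ZMod.card, Fintype.card_fin, Fintype.card_pi] at h1
      have hpos : ∀ j, (0:ℝ) < (Dg (S.p j) (S.A j) (K j)).ncard := fun j => by
        have : (Dg (S.p j) (S.A j) (K j)).Nonempty := ⟨_, _, S.y_mem ω0 j, rfl⟩
        exact_mod_cast (Set.ncard_pos (hfin j (K j))).2 this
      have hcard : ∀ j, Fintype.card (hfin j (K j)).toFinset = (Dg (S.p j) (S.A j) (K j)).ncard := by
        intro j
        rw [Fintype.card_coe, Set.ncard_eq_toFinset_card _ (hfin j (K j))]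
      simp only [hcard] at h1
      push_cast at h1
      rw [Real.log_mul (by positivity) (Finset.prod_pos fun j _ => hpos j).ne', Real.log_pow,
        Real.log_prod fun j _ => (hpos j).ne'] at h1
      have h3 : ∑ j, Real.log ((Dg (S.p j) (S.A j) (K j)).ncard) ≤
          ∑ j, ((Real.log (C j) + t j * Real.log (S.p j)) + t j * Real.log 2 * n) := by
        refine Finset.sum_le_sum fun j _ => ?_
        have hp := S.p_pos j
        have h4 := Real.log_le_log (hpos j) (hC j (K j))
        rw [Real.log_mul (hC0 j).ne' (by positivity), Real.log_rpow (by positivity)] at h4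
        have h5 : ((S.p j : ℝ)) ^ K j ≤ S.p j * 2 ^ n := by
          exact_mod_cast Nat.pow_log_le_self (S.p j) (by have := S.hp j; positivity)
        have h6 := Real.log_le_log (by positivity) h5
        rw [Real.log_mul hp.ne' (by positivity), ← Real.rpow_natCast 2 n, Real.log_rpow (by norm_num)] at h6
        have h7 := mul_le_mul_of_nonneg_left h6 (NNReal.coe_nonneg (t j))
        linarith [show (t j : ℝ) * (Real.log (S.p j) + n * Real.log 2) =
          t j * Real.log (S.p j) + t j * Real.log 2 * n by ring]
      rw [Finset.sum_add_distrib, ← Finset.sum_mul, ← Finset.sum_mul] at h3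
      linarith
    · intro a b k hab
      have e1 := congrArg Prod.fst hab
      have e2 := congrArg Prod.snd hab
      simp only at e1 e2
      have hN := N_seq_eq (S.Lv_close1 k) fun j => congrFun e1 j
      refine cd_of_last hN fun j => ?_
      have e3 : ⌊(S.p j : ℝ) ^ K j * S.y a j⌋ = ⌊(S.p j : ℝ) ^ K j * S.y b j⌋ :=
        congrArg Subtype.val (congrFun e2 j)
      have e4 := floor_pow_add (S.N n b j) (K j - S.N n b j) (S.p j) (S.y a j)
      have e5 := floor_pow_add (S.N n b j) (K j - S.N n b j) (S.p j) (S.y b j)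
      rw [Nat.add_sub_cancel' (hNK b j)] at e4 e5
      have hfl : ∀ u : ℝ, 0 ≤ ⌊(S.p j : ℝ) ^ (K j - S.N n b j) * Int.fract u⌋ ∧
          ⌊(S.p j : ℝ) ^ (K j - S.N n b j) * Int.fract u⌋ < (S.p j : ℤ) ^ (K j - S.N n b j) := by
        intro u
        have hp := S.p_pos j
        have hu := Int.fract_nonneg u
        refine ⟨Int.floor_nonneg.2 (by positivity), Int.floor_lt.2 ?_⟩
        push_cast
        have := mul_lt_mul_of_pos_left (Int.fract_lt_one u)
          (show (0:ℝ) < (S.p j : ℝ) ^ (K j - S.N n b j) by positivity)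
        linarith
      have b1 := hfl ((S.p j : ℝ) ^ S.N n b j * S.y a j)
      have b2 := hfl ((S.p j : ℝ) ^ S.N n b j * S.y b j)
      have hpos := lt_of_le_of_lt b1.1 b1.2
      have c1 := congrArg (· / (S.p j : ℤ) ^ (K j - S.N n b j)) (e4.symm.trans (e3.trans e5))
      rw [Int.mul_add_ediv_left _ _ hpos.ne', Int.mul_add_ediv_left _ _ hpos.ne',
        Int.ediv_eq_zero_of_lt b1.1 b1.2, Int.ediv_eq_zero_of_lt b2.1 b2.2, add_zero, add_zero] at c1
      simp only [cd]
      rw [hN j n le_rfl]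
      exact c1
  set D := S.cL + ∑ j, (Real.log (C j) + t j * Real.log (S.p j)) with hD
  have t1 : Tendsto (fun n : ℕ => ((d * Real.log (n + 2) + D) : ℝ) / n) atTop (𝓝 0) := lim_log d D
  have t2 : Tendsto (fun n : ℕ => (∑ j, (t j : ℝ)) * Real.log 2 + ((d * Real.log (n + 2) + D) : ℝ) / n)
      atTop (𝓝 ((∑ j, (t j : ℝ)) * Real.log 2 + 0)) := tendsto_const_nhds.add t1
  rw [add_zero] at t2
  refine ge_of_tendsto t2 ?_
  filter_upwards [eventually_gt_atTop 0] with n hn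
  have hn0 : (0:ℝ) < n := by exact_mod_cast hn
  have := main n
  rw [← sub_le_iff_le_add', le_div_iff₀ hn0]
  linarith

end Sys
end FHR
namespace FHR

theorem fract_circle (x : ℝ) : ((Int.fract x : ℝ) : AddCircle (1:ℝ)) = (x : AddCircle (1:ℝ)) := by
  rw [Int.fract, AddCircle.coe_sub]
  have : ((⌊x⌋ : ℝ) : AddCircle (1:ℝ)) = 0 := by
    rw [AddCircle.coe_eq_zero_iff]
    exact ⟨⌊x⌋, by simp⟩
  rw [this, sub_zero]

theorem circle_inv {p : ℕ} {B : Set (AddCircle (1:ℝ))} (hB : (fun x => p • x) '' B ⊆ B) {x : ℝ}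
    (hx : (x : AddCircle (1:ℝ)) ∈ B) (n : ℕ) :
    ((Int.fract ((p : ℝ) ^ n * x) : ℝ) : AddCircle (1:ℝ)) ∈ B := by
  rw [fract_circle]
  induction n with
  | zero => simpa using hx
  | succ n ih =>
    have := hB ⟨_, ih, rfl⟩
    simp only at this
    rw [← AddCircle.coe_nsmul, nsmul_eq_mul, ← mul_assoc, ← pow_succ'] at this
    exact this

/-- the system attached to the data of the theorem -/
def mkS {d : ℕ} (p : Fin d → ℕ) (hp : ∀ j, 2 ≤ p j) (B : Fin d → Set (AddCircle (1 : ℝ)))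
    (hBinv : ∀ j, (fun x => (p j) • x) '' B j ⊆ B j) (A : Fin d → Set ℝ)
    (hA : ∀ j, A j = {t : ℝ | t ∈ Set.Ico (0 : ℝ) 1 ∧ (↑t : AddCircle (1 : ℝ)) ∈ B j}) : Sys d where
  p := p
  hp := hp
  A := A
  hA := fun j t ht => by
    rw [hA j] at ht
    exact ht.1
  inv := fun j t ht => by
    rw [hA j] at ht ⊢
    have := circle_inv (hBinv j) ht.2 1
    rw [pow_one] at this
    exact ⟨⟨Int.fract_nonneg _, Int.fract_lt_one _⟩, this⟩

theorem count_of_dim {p : ℕ} (hp : 2 ≤ p) {B : Set (AddCircle (1 : ℝ))} (hBc : IsClosed B)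
    (hBinv : (fun x => p • x) '' B ⊆ B) {A : Set ℝ}
    (hA : A = {t : ℝ | t ∈ Set.Ico (0 : ℝ) 1 ∧ (↑t : AddCircle (1 : ℝ)) ∈ B}) (τ : NNReal) (hτ : 0 < τ) :
    ∃ C : ℝ, 0 < C ∧ ∀ N, ((Dg p A N).ncard : ℝ) ≤
      C * ((p : ℝ) ^ N) ^ (((dimH A).toNNReal + τ : NNReal) : ℝ) := by
  set K : Set ℝ := Set.Icc 0 1 ∩ {x : ℝ | (x : AddCircle (1:ℝ)) ∈ B} with hK
  have hKc : IsCompact K :=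
    isCompact_Icc.inter_right (hBc.preimage (AddCircle.continuous_mk' (1:ℝ)))
  have hAK : A ⊆ K := by
    intro x hx
    rw [hA] at hx
    exact ⟨⟨hx.1.1, hx.1.2.le⟩, hx.2⟩
  have hKA : K ⊆ A ∪ {1} := by
    intro x hx
    rcases eq_or_lt_of_le hx.1.2 with h | h
    · right; exact h
    · left
      rw [hA]
      exact ⟨⟨hx.1.1, h⟩, hx.2⟩
  have hfin : dimH A ≠ ⊤ := by
    have h1 : dimH A ≤ dimH (Set.univ : Set ℝ) := dimH_mono (Set.subset_univ A)
    rw [Real.dimH_univ] at h1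
    exact ne_top_of_le_ne_top ENNReal.one_ne_top h1
  have hdK : dimH K < (((dimH A).toNNReal + τ : NNReal) : ℝ≥0∞) := by
    have h1 := dimH_mono hKA
    rw [dimH_union, dimH_singleton, max_eq_left zero_le] at h1
    refine h1.trans_lt ?_
    rw [ENNReal.coe_add, ENNReal.coe_toNNReal hfin]
    exact ENNReal.lt_add_right hfin (by exact_mod_cast hτ.ne')
  obtain ⟨C, hC, h⟩ := Dg_count p hp ((dimH A).toNNReal + τ) (by positivity) K A hKc hdK
    (fun x hx => hx.1) hAK (fun x hx n => by
      rw [hA]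
      exact ⟨⟨Int.fract_nonneg _, Int.fract_lt_one _⟩, circle_inv hBinv hx.2 n⟩)
  refine ⟨C, hC, fun N => le_trans ?_ (h N)⟩
  have h2 : Dg p A N ⊆ Dg p K N := Set.image_mono hAK
  have h3 : (Dg p K N).Finite := Dg_finite (fun x (hx : x ∈ K) => hx.1) N
  exact Nat.cast_le.2 (Set.ncard_le_ncard h2 h3)

theorem hh_dim {d : ℕ} (S : Sys d) (B : Fin d → Set (AddCircle (1 : ℝ)))
    (hBc : ∀ j, IsClosed (B j))
    (hBinv : ∀ j, (fun x => (S.p j) • x) '' B j ⊆ B j)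
    (hA : ∀ j, S.A j = {t : ℝ | t ∈ Set.Ico (0 : ℝ) 1 ∧ (↑t : AddCircle (1 : ℝ)) ∈ B j})
    {E : St S.Om} (hE : S.Stat E) :
    S.hh E ≤ (∑ j, (dimH (S.A j)).toReal) * Real.log 2 := by
  have h2 : 0 < Real.log 2 := Real.log_pos (by norm_num)
  have key : ∀ τ : NNReal, 0 < τ → S.hh E ≤ (∑ j, (dimH (S.A j)).toReal) * Real.log 2
      + τ * (d * Real.log 2) := by
    intro τ hτ
    choose C hC0 hC using fun j => count_of_dim (S.hp j) (hBc j) (hBinv j) (hA j) τ hτ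
    refine (Sys.hh_le hE (fun j => (dimH (S.A j)).toNNReal + τ) C hC0 hC).trans (le_of_eq ?_)
    push_cast
    rw [Finset.sum_add_distrib, Finset.sum_const, Finset.card_univ, Fintype.card_fin, nsmul_eq_mul]
    ring
  refine le_of_forall_pos_le_add fun e he => ?_
  have hpos : 0 < e / (d * Real.log 2 + 1) := by positivity
  refine (key (Real.toNNReal (e / (d * Real.log 2 + 1))) (Real.toNNReal_pos.2 hpos)).trans ?_
  have : e / (d * Real.log 2 + 1) * (d * Real.log 2) ≤ e := by
    rw [div_mul_eq_mul_div, div_le_iff₀ (by positivity)]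
    nlinarith
  rw [Real.coe_toNNReal _ hpos.le]
  linarith

end FHR

namespace FHR

def pt : St Unit where
  E := { toFun := fun f => f (), map_add' := fun _ _ => rfl, map_smul' := fun _ _ => rfl }
  pos := fun f _ h => h ()
  one := rfl

def unifS (κ : Type) [Fintype κ] [Nonempty κ] : St κ := (St.mix fun _ : κ => pt).map Prod.snd

theorem unif_H {κ : Type} [Fintype κ] [Nonempty κ] (X : RV κ) (h : ∀ a b, X.rel a b → a = b) :
    Real.log (Fintype.card κ) ≤ (unifS κ).H X := by
  have h1 : (unifS κ).H (RV.ofF id) = Real.log (Fintype.card κ) := St.mix_H_lab fun _ : κ => pt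
  rw [← h1]
  exact St.H_mono _ fun a b k => h a b k

/-- telescoping -/
theorem sum_shift (u : ℕ → ℝ) (n N : ℕ) :
    ∑ s ∈ Finset.range N, (u (s + n) - u s) = ∑ s ∈ Finset.range n, (u (N + s) - u s) := by
  rw [Finset.sum_sub_distrib, Finset.sum_sub_distrib]
  have h1 := Finset.sum_range_add u N n
  have h2 := Finset.sum_range_add u n N
  rw [add_comm n N] at h2
  have h3 : ∑ s ∈ Finset.range N, u (s + n) = ∑ s ∈ Finset.range N, u (n + s) :=
    Finset.sum_congr rfl fun s _ => by rw [add_comm]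
  linarith

namespace Sys
variable {d : ℕ} (S : Sys d)

def iphi {κ : Type} (ξ : κ → {x : Fin d → ℝ // ∀ j, x j ∈ S.A j}) (N : ℕ) (z : κ × Fin N) : S.Om :=
  (ξ z.1, z.2)

def istate {κ : Type} [Fintype κ] [Nonempty κ] (ξ : κ → {x : Fin d → ℝ // ∀ j, x j ∈ S.A j}) (N : ℕ)
    [NeZero N] : St S.Om :=
  (St.mix (fun _ : Fin N => unifS κ)).map (S.iphi ξ N)

section
variable {κ : Type} [Fintype κ] [Nonempty κ] (ξ : κ → {x : Fin d → ℝ // ∀ j, x j ∈ S.A j}) (N : ℕ)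
  [NeZero N]

theorem istate_E (f : S.Om → ℝ) : (S.istate ξ N).E f
    = (N : ℝ)⁻¹ * ∑ s ∈ Finset.range N, (unifS κ).E (fun a => f (ξ a, s)) := by
  rw [istate, St.map_E, St.mix_E, Fintype.card_fin]
  congr 1
  exact Fin.sum_univ_eq_sum_range (fun s => (unifS κ).E (fun a => f (ξ a, s))) N

theorem istate_inv (f : S.Om → ℝ) (C : ℝ) (hC : ∀ ω, |f ω| ≤ C) (n : ℕ) :
    |(S.istate ξ N).E (fun ω => f (S.sh n ω)) - (S.istate ξ N).E f| ≤ 2 * n * C / N := by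
  rw [istate_E, istate_E, ← mul_sub, ← Finset.sum_sub_distrib]
  have := sum_shift (fun s => (unifS κ).E (fun a => f (ξ a, s))) n N
  simp only [sh]
  rw [this, abs_mul, abs_inv, Nat.abs_cast, inv_mul_eq_div]
  have hN : (0:ℝ) < N := by exact_mod_cast Nat.pos_of_neZero N
  refine div_le_div_of_nonneg_right ?_ hN.le
  refine (Finset.abs_sum_le_sum_abs _ _).trans ?_
  refine (Finset.sum_le_card_nsmul _ _ (2 * C) fun s _ => ?_).trans ?_
  · refine (abs_sub _ _).trans ?_
    have h1 := (unifS κ).bdd (f := fun a => f (ξ a, N + s)) fun a => hC _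
    have h2 := (unifS κ).bdd (f := fun a => f (ξ a, s)) fun a => hC _
    linarith
  · rw [Finset.card_range, nsmul_eq_mul]
    exact le_of_eq (by ring)

def ih (s : ℕ) : ℝ := (unifS κ).H ((S.Wv s).comap fun a => ((ξ a, 0) : S.Om))

def iY : RV (κ × Fin N) :=
  RV.of (fun z (t : ℕ) => if t ≤ z.2 then S.cd t (ξ z.1, 0) else fun _ => (0, 0)) (Set.finite_range _)

theorem iY_rel {a b : κ} {s : Fin N} : (S.iY ξ N).rel (a, s) (b, s) ↔ (S.Wv s).rel (ξ a, 0) (ξ b, 0) := by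
  unfold iY
  rw [RV.of_rel, Wv_rel]
  constructor
  · intro h t ht j
    have := congrFun h t
    simp only [if_pos ht] at this
    exact congrFun this j
  · intro h
    funext t
    by_cases ht : t ≤ (s : ℕ)
    · simp only [if_pos ht]
      funext j
      exact h t ht j
    · simp only [if_neg ht]

theorem q_zero (x : {x : Fin d → ℝ // ∀ j, x j ∈ S.A j}) : S.q (x, 0) = x.1 := by
  funext j
  have := S.hA j _ (x.2 j)
  simp [q, lam, y, nn_zero]
  exact this

theorem istate_gam {ι : Type} [Fintype ι] (P : W d →ₗ[ℝ] (ι → ℝ)) (hP : ∀ a b, P (ξ a).1 = P (ξ b).1)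
    (hW : ∀ a b, (S.Wv N).rel (ξ a, 0) (ξ b, 0) → a = b) (n : ℕ) :
    n * (Real.log (Fintype.card κ) - Real.log (Fintype.card (S.Wv n).Q)) / N ≤ S.gam (S.istate ξ N) P n := by
  have hN : (0:ℝ) < N := by exact_mod_cast Nat.pos_of_neZero N
  have h1 : (S.Dv P n).comap (S.iphi ξ N) ≤ S.iY ξ N ⊔ St.lab := by
    rintro ⟨a, s⟩ ⟨b, s'⟩ h
    have hs : s = s' := h.2
    subst hs
    have hY := (S.iY_rel ξ N).1 h.1
    have hl : S.lam (ξ a, (s:ℕ)) = S.lam (ξ b, (s:ℕ)) := rfl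
    have e : ∀ a, ((ξ a, (s:ℕ)) : S.Om) = S.sh s (ξ a, 0) := fun a => by simp [sh]
    have hq : P (S.q (ξ a, (s:ℕ))) = P (S.q (ξ b, (s:ℕ))) := by
      rw [e a, e b, q_sh, q_sh, q_zero, q_zero, S.Wv_rho hY]
      rw [map_smul, map_smul, map_sub, map_sub, hP a b]
      rfl
    refine ⟨fl_rel.2 fun i => ?_, fl_rel.2 fun i => ?_⟩
    · simp only [iphi]
      rw [hq]
    · simp only [iphi]
      rw [hl]
  have h2 : ∀ s : Fin N, (unifS κ).cH (((S.Wv n).comap (S.iphi ξ N)).comap fun a => (a, s))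
      ((S.iY ξ N).comap fun a => (a, s)) = S.ih ξ (s + n) - S.ih ξ s := by
    intro s
    have e1 : (S.iY ξ N).comap (fun a => (a, s)) = (S.Wv s).comap fun a => ((ξ a, 0) : S.Om) :=
      RV.ext' fun a b => S.iY_rel ξ N
    have e2 : ((S.Wv n).comap (S.iphi ξ N)).comap (fun a => (a, s))
        = ((S.Wv n).comap (S.sh s)).comap fun a => ((ξ a, 0) : S.Om) := by
      apply RV.ext'
      intro a b
      simp [RV.comap_rel, iphi, sh]
    rw [e1, e2, St.cH, ← RV.comap_sup, sup_comm, ← Wv_add]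
    rfl
  have h3 : (N:ℝ)⁻¹ * ∑ s ∈ Finset.range N, (S.ih ξ (s + n) - S.ih ξ s) ≤ S.gam (S.istate ξ N) P n := by
    unfold gam istate
    rw [St.cH_map]
    refine le_trans ?_ (St.cH_anti _ _ h1)
    rw [St.mix_cH, Fintype.card_fin, Finset.sum_congr rfl fun s _ => h2 s,
      ← Fin.sum_univ_eq_sum_range (fun s => S.ih ξ (s + n) - S.ih ξ s) N]
  refine le_trans ?_ h3
  rw [sum_shift, inv_mul_eq_div]
  refine div_le_div_of_nonneg_right ?_ hN.le
  have mono : ∀ s t, s ≤ t → S.ih ξ s ≤ S.ih ξ t := fun s t h =>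
    St.H_mono _ (RV.comap_mono _ (S.Wv_mono h))
  have hA : Real.log (Fintype.card κ) ≤ S.ih ξ N := unif_H _ fun a b h => hW a b h
  have hB : S.ih ξ n ≤ Real.log (Fintype.card (S.Wv n).Q) :=
    St.H_le_card _ _ (fun a => (S.Wv n).mkq (ξ a, 0)) fun a b h => (RV.mkq_eq (S.Wv n)).1 h
  have := Finset.card_nsmul_le_sum (Finset.range n) (fun s => S.ih ξ (N + s) - S.ih ξ s)
    (Real.log (Fintype.card κ) - Real.log (Fintype.card (S.Wv n).Q)) fun s hs => by
      have k1 := mono N (N + s) (by omega)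
      have k2 := mono s n (Finset.mem_range.1 hs).le
      linarith
  rwa [Finset.card_range, nsmul_eq_mul] at this

end

theorem lim_state {ι : Type} [Fintype ι] (E : ℕ → St S.Om) (P : W d →ₗ[ℝ] (ι → ℝ)) (β C : ℝ)
    (h1 : ∀ f ∈ BF S.Om, ∀ n, Tendsto (fun l => (E l).E (fun ω => f (S.sh n ω)) - (E l).E f) atTop (𝓝 0))
    (h2 : ∀ n : ℕ, ∀ᶠ l in atTop, β * n - C ≤ S.gam (E l) P n) :
    ∃ E', S.Stat E' ∧ β ≤ S.gamma E' P := by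
  obtain ⟨E', hE'⟩ := St.ulim E (hyperfilter ℕ)
  have hs : S.Stat E' := by
    intro n f hf
    have a1 := hE' f hf
    have a2 := hE' (fun ω => f (S.sh n ω)) (BF_comp (S.sh n) hf)
    have a3 := (h1 f hf n).mono_left Nat.hyperfilter_le_atTop
    have := tendsto_nhds_unique (a2.sub a1) a3
    rw [St.map_E]
    linarith
  refine ⟨E', hs, gamma_ge hs P β C fun n => ?_⟩
  exact ge_of_tendsto (St.tendsto_cH hE' _ _) ((h2 n).filter_mono Nat.hyperfilter_le_atTop)

end Sys
end FHR

namespace FHR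
open Module Sys

/-- the linear map with given rows -/
def rowL {d k : ℕ} (r : Fin k → W d) : W d →ₗ[ℝ] (Fin k → ℝ) := (Matrix.of r).mulVecLin

theorem rowL_apply {d k : ℕ} (r : Fin k → W d) (x : W d) (i : Fin k) : rowL r x i = ∑ j, r i j * x j := rfl

theorem mds_eq {d k : ℕ} {r : Fin k → W d}
    (hz : ∀ T : Finset (Fin d), k ≤ T.card → ∀ c : Fin k → ℝ, (∀ j ∈ T, ∑ i, c i * r i j = 0) → c = 0)
    (T : Finset (Fin d)) (hT : k ≤ T.card) :
    finrank ℝ (LinearMap.ker (rowL r) ⊓ CS T : Submodule ℝ (W d)) + k = T.card := by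
  classical
  set L := (rowL r).domRestrict (CS T) with hL
  have hs : LinearMap.range L = ⊤ := by
    by_contra hne
    obtain ⟨f, hf, hle⟩ := Submodule.exists_le_ker_of_lt_top _ (lt_top_iff_ne_top.2 hne)
    apply hf
    have hfc : ∀ v, f v = ∑ i, f (Pi.single i 1) * v i := by
      intro v
      have := LinearMap.pi_apply_eq_sum_univ f v
      rw [this]
      refine Finset.sum_congr rfl fun i _ => ?_
      rw [smul_eq_mul, mul_comm]
      congr 2
      funext j
      simp [Pi.single_apply, eq_comm]
    have hc := hz T hT (fun i => f (Pi.single i 1)) fun j hj => by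
      have hm : (Pi.single j 1 : W d) ∈ CS T := by
        rw [mem_CS]
        intro i hi
        have hij : i ≠ j := fun h => hi (h ▸ hj)
        simp [hij]
      have h1 : f (L ⟨_, hm⟩) = 0 := hle ⟨_, rfl⟩
      rw [hfc] at h1
      rw [← h1]
      refine Finset.sum_congr rfl fun i _ => ?_
      congr 1
      simp [hL, rowL_apply, Pi.single_apply]
    apply LinearMap.ext
    intro v
    rw [hfc]
    simp only [LinearMap.zero_apply]
    exact Finset.sum_eq_zero fun i _ => by
      have := congrFun hc i
      simp only [Pi.zero_apply] at this
      rw [this, zero_mul]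
  have h1 := LinearMap.finrank_range_add_finrank_ker L
  rw [hs, finrank_top, finrank_CS, finrank_pi, Fintype.card_fin] at h1
  have h2 : LinearMap.ker (rowL r) ⊓ CS T = (LinearMap.ker L).map (CS T).subtype := by
    rw [hL, LinearMap.ker_domRestrict, Submodule.map_comap_subtype, inf_comm]
  rw [h2, Submodule.finrank_map_subtype_eq]
  omega

theorem mds {d k : ℕ} (hk : k ≤ d) {r : Fin k → W d}
    (hz : ∀ T : Finset (Fin d), k ≤ T.card → ∀ c : Fin k → ℝ, (∀ j ∈ T, ∑ i, c i * r i j = 0) → c = 0)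
    (T : Finset (Fin d)) (hne : LinearMap.ker (rowL r) ⊓ CS T ≠ ⊥) :
    finrank ℝ (LinearMap.ker (rowL r) ⊓ CS T : Submodule ℝ (W d)) + k ≤ T.card := by
  rcases le_or_gt k T.card with h | h
  · exact (mds_eq hz T h).le
  · exfalso
    obtain ⟨T', hTT, hc⟩ := Finset.exists_superset_card_eq (s := T) (n := k) h.le (by simpa using hk)
    have := mds_eq hz T' hc.ge
    have h0 : finrank ℝ (LinearMap.ker (rowL r) ⊓ CS T' : Submodule ℝ (W d)) = 0 := by omega
    rw [Submodule.finrank_eq_zero] at h0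
    exact hne (le_bot_iff.1 (h0 ▸ inf_le_inf_left _ (CS_mono hTT)))

/-- upper bound for `gamma` of stationary states, under the no-zeros condition -/
theorem gamma_bound {d k : ℕ} (hk : k ≤ d) (S : Sys d)
    (hindep : ∀ i j, i ≠ j → Irrational (Real.log (S.p i) / Real.log (S.p j)))
    (B : Fin d → Set (AddCircle (1 : ℝ)))
    (hBc : ∀ j, IsClosed (B j))
    (hBinv : ∀ j, (fun x => (S.p j) • x) '' B j ⊆ B j)
    (hA : ∀ j, S.A j = {t : ℝ | t ∈ Set.Ico (0 : ℝ) 1 ∧ (↑t : AddCircle (1 : ℝ)) ∈ B j})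
    {r : Fin k → W d}
    (hz : ∀ T : Finset (Fin d), k ≤ T.card → ∀ c : Fin k → ℝ, (∀ j ∈ T, ∑ i, c i * r i j = 0) → c = 0)
    {E : St S.Om} (hE : S.Stat E) :
    S.gamma E (rowL r) ≤ max (∑ j, (dimH (S.A j)).toReal - k) 0 * Real.log 2 := by
  have hl2 : 0 < Real.log 2 := Real.log_pos one_lt_two
  obtain ⟨E', hE', hle, herg⟩ := Sys.exists_erg hE (rowL r)
  refine hle.trans ?_
  rcases le_or_gt (S.gamma E' (rowL r)) 0 with h0 | h0
  · exact h0.trans (mul_nonneg (le_max_right _ _) hl2.le)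
  obtain ⟨a, ha, hk'⟩ := kronecker (fun j => Real.log (S.p j))
    (fun j => Real.log_pos (by linarith [S.two_le_p j])) (Real.log 2) hl2 hindep
  obtain ⟨C, hC, m0, hfr⟩ := S.exists_frame a hk'
  rw [← Sys.gk_eq hE' (rowL r)] at h0 ⊢
  have h1 := Sys.la hE' herg ha ⟨C, hC, m0, fun E h m hm => hfr E h m hm⟩ (mds hk hz) h0
  have h2 := hh_dim S B hBc hBinv hA hE'
  have h3 := mul_le_mul_of_nonneg_right (le_max_left (∑ j, (dimH (S.A j)).toReal - k) 0) hl2.le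
  rw [sub_mul] at h3
  linarith

end FHR

namespace FHR
open Module Sys

/-- compact set of row systems -/
def Kset (d k : ℕ) (η : ℝ) : Set (Fin k → Fin d → ℝ) :=
  {r | ‖r‖ ≤ 1 ∧ ∀ T : Finset (Fin d), k ≤ T.card → ∀ c : Fin k → ℝ, ∑ i, c i ^ 2 = 1 →
    ∃ j ∈ T, η ≤ |∑ i, c i * r i j|}

theorem Kset_compact (d k : ℕ) (η : ℝ) : IsCompact (Kset d k η) := by
  refine Metric.isCompact_of_isClosed_isBounded ?_ ?_
  · have : Kset d k η = {r | ‖r‖ ≤ 1} ∩ ⋂ (T : Finset (Fin d)) (_ : k ≤ T.card) (c : Fin k → ℝ)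
        (_ : ∑ i, c i ^ 2 = 1), ⋃ j ∈ T, {r | η ≤ |∑ i, c i * r i j|} := by
      ext r
      simp [Kset]
    rw [this]
    refine (isClosed_le continuous_norm continuous_const).inter ?_
    refine isClosed_iInter fun T => isClosed_iInter fun _ => isClosed_iInter fun c => isClosed_iInter fun _ => ?_
    refine Set.Finite.isClosed_biUnion T.finite_toSet fun j _ => ?_
    exact isClosed_le continuous_const (by fun_prop)
  · refine (Metric.isBounded_closedBall (x := (0 : Fin k → Fin d → ℝ)) (r := 1)).subset ?_
    intro r hr
    rw [mem_closedBall_zero_iff]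
    exact hr.1

theorem Kset_hz {d k : ℕ} {η : ℝ} (hη : 0 < η) {r : Fin k → Fin d → ℝ} (hr : r ∈ Kset d k η)
    (T : Finset (Fin d)) (hT : k ≤ T.card) (c : Fin k → ℝ) (hc : ∀ j ∈ T, ∑ i, c i * r i j = 0) : c = 0 := by
  by_contra hne
  have hpos : 0 < ∑ i, c i ^ 2 := by
    obtain ⟨i, hi⟩ := Function.ne_iff.1 hne
    exact Finset.sum_pos' (fun i _ => sq_nonneg _) ⟨i, Finset.mem_univ _, by
      have : c i ≠ 0 := hi
      positivity⟩
  set s := Real.sqrt (∑ i, c i ^ 2) with hs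
  have hs0 : 0 < s := Real.sqrt_pos.2 hpos
  obtain ⟨j, hj, h⟩ := hr.2 T hT (fun i => c i / s) (by
    have : ∑ i, (c i / s) ^ 2 = (∑ i, c i ^ 2) / s ^ 2 := by
      rw [Finset.sum_div]
      exact Finset.sum_congr rfl fun i _ => by rw [div_pow]
    rw [this, hs, Real.sq_sqrt hpos.le, div_self hpos.ne'])
  have : ∑ i, c i / s * r i j = (∑ i, c i * r i j) / s := by
    rw [Finset.sum_div]
    exact Finset.sum_congr rfl fun i _ => by ring
  rw [this, hc j hj, zero_div, abs_zero] at h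
  linarith

theorem rowL_sub_le {d k : ℕ} (r r' : Fin k → Fin d → ℝ) (x : W d) :
    ‖rowL r x - rowL r' x‖ ≤ d * ‖r - r'‖ * ‖x‖ := by
  refine (pi_norm_le_iff_of_nonneg (by positivity)).2 fun i => ?_
  rw [Pi.sub_apply, rowL_apply, rowL_apply, ← Finset.sum_sub_distrib]
  refine (norm_sum_le _ _).trans ?_
  refine (Finset.sum_le_card_nsmul _ _ (‖r - r'‖ * ‖x‖) fun j _ => ?_).trans ?_
  · rw [← sub_mul, norm_mul]
    refine mul_le_mul ?_ (norm_le_pi_norm x j) (norm_nonneg _) (norm_nonneg _)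
    exact (norm_le_pi_norm ((r - r') i) j).trans (norm_le_pi_norm (r - r') i)
  · rw [Finset.card_univ, Fintype.card_fin, nsmul_eq_mul, mul_assoc]

namespace Sys
variable {d : ℕ} (S : Sys d)

theorem y_zero (x : {x : Fin d → ℝ // ∀ j, x j ∈ S.A j}) : S.y (x, 0) = x.1 := by
  funext j
  have := S.hA j _ (x.2 j)
  simp [y, nn_zero]
  exact this

/-- one step: a state attached to a large separated set -/
theorem step {k : ℕ} (r : Fin k → Fin d → ℝ) {D δ g c0 : ℝ} (hD : 1 ≤ D) (hδ : 0 < δ) (hδ1 : δ ≤ 1)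
    (hg : 0 ≤ g) (hc0 : 1 ≤ c0) (F : Finset {x : Fin d → ℝ // ∀ j, x j ∈ S.A j})
    (hP : ∀ a ∈ F, ∀ b ∈ F, rowL r a.1 = rowL r b.1)
    (hF : ∀ a ∈ F, ∀ b ∈ F, a ≠ b → δ ≤ D * ‖a.1 - b.1‖)
    (hcard : c0 * δ ^ (-g) < F.card) :
    ∃ (N : ℕ) (E : St S.Om), 0 < N ∧ c0 ≤ Fintype.card (S.Wv N).Q ∧
      (∀ f : S.Om → ℝ, ∀ C, (∀ ω, |f ω| ≤ C) → ∀ n : ℕ,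
        |E.E (fun ω => f (S.sh n ω)) - E.E f| ≤ 2 * n * C / N) ∧
      ∀ n : ℕ, n * (g * (N * Real.log 2 - Real.log (4 * D * S.M))
        - Real.log (Fintype.card (S.Wv n).Q)) / N ≤ S.gam E (rowL r) n := by
  have hM := S.one_le_M
  have hl2 : 0 < Real.log 2 := Real.log_pos one_lt_two
  obtain ⟨N0, h1, h2⟩ : ∃ N0 : ℕ, (2:ℝ) ^ N0 ≤ D * S.M / δ ∧ D * S.M / δ < 2 ^ (N0 + 1) := by
    have : 1 ≤ D * S.M / δ := by
      rw [le_div_iff₀ hδ]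
      nlinarith
    exact exists_nat_pow_near this one_lt_two
  have hpow : 1 ≤ δ ^ (-g) := Real.one_le_rpow_of_pos_of_le_one_of_nonpos hδ hδ1 (by linarith)
  have hcF : c0 < F.card := lt_of_le_of_lt (by nlinarith) hcard
  have hFpos : 0 < F.card := by
    have : (0:ℝ) < F.card := by linarith
    exact_mod_cast this
  have : Nonempty F := (Finset.card_pos.1 hFpos).to_subtype
  have hW : ∀ a b : F, (S.Wv (N0 + 1)).rel (a.1, 0) (b.1, 0) → a = b := by
    intro a b h
    by_contra hne
    have h3 := S.y_close h
    rw [y_zero, y_zero] at h3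
    have h4 := hF a.1 a.2 b.1 b.2 fun h => hne (Subtype.ext h)
    have h5 : D * ‖a.1.1 - b.1.1‖ ≤ D * (S.M / 2 ^ (N0 + 1)) := mul_le_mul_of_nonneg_left h3 (by linarith)
    rw [div_lt_iff₀ hδ] at h2
    have h6 : D * (S.M / 2 ^ (N0 + 1)) < δ := by
      rw [← mul_div_assoc, div_lt_iff₀ (by positivity)]
      linarith
    linarith
  refine ⟨N0 + 1, S.istate (fun a : F => a.1) (N0 + 1), Nat.succ_pos _, ?_, ?_, ?_⟩
  · refine hcF.le.trans ?_
    have : Fintype.card F ≤ Fintype.card (S.Wv (N0 + 1)).Q :=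
      Fintype.card_le_of_injective (fun a : F => (S.Wv (N0 + 1)).mkq (a.1, 0)) fun a b h =>
        hW a b ((RV.mkq_eq _).1 h)
    rw [Fintype.card_coe] at this
    exact_mod_cast this
  · intro f C hC n
    exact S.istate_inv _ _ f C hC n
  · intro n
    refine le_trans ?_ (S.istate_gam _ _ (rowL r) (fun a b => hP _ a.2 _ b.2) hW n)
    refine div_le_div_of_nonneg_right ?_ (Nat.cast_nonneg _)
    refine mul_le_mul_of_nonneg_left (sub_le_sub_right ?_ _) (Nat.cast_nonneg _)
    rw [Fintype.card_coe]
    have k1 : Real.log (δ ^ (-g)) ≤ Real.log F.card :=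
      Real.log_le_log (by positivity) (by nlinarith)
    rw [Real.log_rpow hδ] at k1
    refine le_trans ?_ k1
    have k2 := Real.log_le_log (by positivity) h1
    rw [Real.log_pow, Real.log_div (by positivity) hδ.ne'] at k2
    have k3 : Real.log (4 * D * S.M) = 2 * Real.log 2 + Real.log (D * S.M) := by
      rw [mul_assoc, Real.log_mul (by norm_num) (by positivity), show (4:ℝ) = 2 ^ 2 by norm_num, Real.log_pow]
      norm_num
    rw [k3]
    push_cast
    rw [show -g * Real.log δ = g * (- Real.log δ) by ring]
    refine mul_le_mul_of_nonneg_left ?_ hg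
    linarith

end Sys

/-- uniform counting bound -/
theorem count_bound {d k : ℕ} (hk : k ≤ d) (S : Sys d)
    (hindep : ∀ i j, i ≠ j → Irrational (Real.log (S.p i) / Real.log (S.p j)))
    (B : Fin d → Set (AddCircle (1 : ℝ)))
    (hBc : ∀ j, IsClosed (B j))
    (hBinv : ∀ j, (fun x => (S.p j) • x) '' B j ⊆ B j)
    (hA : ∀ j, S.A j = {t : ℝ | t ∈ Set.Ico (0 : ℝ) 1 ∧ (↑t : AddCircle (1 : ℝ)) ∈ B j})
    {ε η D : ℝ} (hε : 0 < ε) (hη : 0 < η) (hD : 1 ≤ D) :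
    ∃ C : ℝ, 0 < C ∧ ∀ r ∈ Kset d k η, ∀ δ : ℝ, 0 < δ → δ ≤ 1 →
      ∀ F : Finset {x : Fin d → ℝ // ∀ j, x j ∈ S.A j},
      (∀ a ∈ F, ∀ b ∈ F, rowL r a.1 = rowL r b.1) →
      (∀ a ∈ F, ∀ b ∈ F, a ≠ b → δ ≤ D * ‖a.1 - b.1‖) →
      (F.card : ℝ) ≤ C * δ ^ (-(max (∑ j, (dimH (S.A j)).toReal - k) 0) - ε) := by
  by_contra hcon
  push Not at hcon
  set g0 := max (∑ j, (dimH (S.A j)).toReal - k) 0 with hg0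
  have hg0' : 0 ≤ g0 := le_max_right _ _
  set g := g0 + ε with hg
  have hl2 : 0 < Real.log 2 := Real.log_pos one_lt_two
  have key : ∀ l : ℕ, ∃ r ∈ Kset d k η, ∃ (N : ℕ) (E : St S.Om), 0 < N ∧
      ((l:ℝ) + 1) ≤ Fintype.card (S.Wv N).Q ∧
      (∀ f : S.Om → ℝ, ∀ C, (∀ ω, |f ω| ≤ C) → ∀ n : ℕ,
        |E.E (fun ω => f (S.sh n ω)) - E.E f| ≤ 2 * n * C / N) ∧
      ∀ n : ℕ, n * (g * (N * Real.log 2 - Real.log (4 * D * S.M))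
        - Real.log (Fintype.card (S.Wv n).Q)) / N ≤ S.gam E (rowL r) n := by
    intro l
    obtain ⟨r, hr, δ, hδ, hδ1, F, hP, hF, hc⟩ := hcon (l + 1) (by positivity)
    refine ⟨r, hr, S.step r hD hδ hδ1 (by linarith) (by linarith [(Nat.cast_nonneg l : (0:ℝ) ≤ l)]) F hP hF ?_⟩
    rwa [show -g = -g0 - ε by rw [hg]; ring]
  choose r hr N E hN hcard hinv hgam using key
  obtain ⟨r0, hr0, θ, hθ, hlim⟩ := (Kset_compact d k η).tendsto_subseq hr
  have hNt : Tendsto N atTop atTop := by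
    refine tendsto_atTop.2 fun b => ?_
    obtain ⟨L, hL⟩ := exists_nat_ge (∑ n ∈ Finset.range b, (Fintype.card (S.Wv n).Q : ℝ))
    filter_upwards [eventually_ge_atTop L] with l hl
    by_contra hlt
    push Not at hlt
    have h1 := Finset.single_le_sum (f := fun n => (Fintype.card (S.Wv n).Q : ℝ)) (fun _ _ => Nat.cast_nonneg _)
      (Finset.mem_range.2 hlt)
    have h2 := hcard l
    have h3 : (L:ℝ) ≤ l := by exact_mod_cast hl
    linarith
  have hNθ : Tendsto (fun l => (N (θ l) : ℝ)) atTop atTop :=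
    tendsto_natCast_atTop_atTop.comp (hNt.comp hθ.tendsto_atTop)
  obtain ⟨E', hE', hge⟩ := S.lim_state (fun l => E (θ l)) (rowL r0) (g * Real.log 2)
    (1 + Fintype.card (Fin k) * KK (1 * (2 * S.M) + 1)) (by
      rintro f ⟨C, hC⟩ n
      refine squeeze_zero_norm (fun l => hinv (θ l) f C hC n) ?_
      exact hNθ.const_div_atTop _) (by
      intro n
      have e1 : ∀ᶠ l in atTop, n * (g * Real.log (4 * D * S.M) + Real.log (Fintype.card (S.Wv n).Q))
          / (N (θ l) : ℝ) < 1 :=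
        (hNθ.const_div_atTop _).eventually_lt_const one_pos
      have e2 : ∀ᶠ l in atTop, d * ‖r0 - r (θ l)‖ < 1 / 2 ^ n := by
        have : Tendsto (fun l => d * ‖r0 - r (θ l)‖) atTop (𝓝 (d * ‖r0 - r0‖)) :=
          ((tendsto_const_nhds.sub hlim).norm).const_mul _
        rw [sub_self, norm_zero, mul_zero] at this
        exact this.eventually_lt_const (by positivity)
      filter_upwards [e1, e2] with l h1 h2
      have h3 := S.gam_perturb (E (θ l)) (P := rowL r0) (P' := rowL (r (θ l))) (n := n) (c := 1) (fun x =>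
        (rowL_sub_le _ _ x).trans (mul_le_mul_of_nonneg_right h2.le (norm_nonneg _))) zero_le_one
      have h4 := hgam (θ l) n
      have hNp : (0:ℝ) < N (θ l) := by exact_mod_cast hN (θ l)
      have h5 : n * (g * (N (θ l) * Real.log 2 - Real.log (4 * D * S.M))
        - Real.log (Fintype.card (S.Wv n).Q)) / N (θ l) = g * Real.log 2 * n
          - n * (g * Real.log (4 * D * S.M) + Real.log (Fintype.card (S.Wv n).Q)) / (N (θ l) : ℝ) := by
        field_simp
        ring
      linarith)
  have hle := gamma_bound hk S hindep B hBc hBinv hA (Kset_hz hη hr0) hE'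
  rw [← hg0] at hle
  rw [hg] at hge
  nlinarith

end FHR

namespace FHR
open Module Sys

theorem etaCount_le {d : ℕ} {η : ℝ} {V : Submodule ℝ (Euc d)} {v : Euc d} (hv : v ∈ V) (h : ‖v‖ = 1) :
    etaCount η v ≤ Zeta η V := by
  refine le_csSup ⟨d, ?_⟩ ⟨v, hv, h, rfl⟩
  rintro _ ⟨w, -, -, rfl⟩
  unfold etaCount
  exact (Set.ncard_le_ncard (Set.subset_univ _)).trans (by simp)

theorem zeroCount_le {d : ℕ} {V : Submodule ℝ (Euc d)} {v : Euc d} (hv : v ∈ V) (h : ‖v‖ = 1) :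
    zeroCount v ≤ Zzero V := by
  refine le_csSup ⟨d, ?_⟩ ⟨v, hv, h, rfl⟩
  rintro _ ⟨w, -, -, rfl⟩
  unfold zeroCount
  exact (Set.ncard_le_ncard (Set.subset_univ _)).trans (by simp)

theorem exists_eta {d k : ℕ} (V : Submodule ℝ (Euc d)) (h : Zzero V ≤ k) : ∃ η : ℝ, 0 < η ∧ Zeta η V ≤ k := by
  by_contra hcon
  push Not at hcon
  have h1 : ∀ n : ℕ, ∃ v : Euc d, v ∈ (V : Set (Euc d)) ∩ Metric.sphere 0 1 ∧ k < etaCount (1 / ((n:ℝ) + 1)) v := by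
    intro n
    by_contra hc
    push Not at hc
    refine absurd (hcon (1 / ((n:ℝ) + 1)) (by positivity)) (not_lt.2 ?_)
    refine csSup_le' ?_
    rintro _ ⟨v, hv, hn, rfl⟩
    exact hc v ⟨hv, by simpa using hn⟩
  choose v hv hc using h1
  have hK : IsCompact ((V : Set (Euc d)) ∩ Metric.sphere 0 1) :=
    (isCompact_sphere 0 1).inter_left V.closed_of_finiteDimensional
  obtain ⟨w, hw, θ, hθ, hlim⟩ := hK.tendsto_subseq hv
  have hev : ∀ᶠ n in atTop, ∀ j, w j ≠ 0 → 1 / (((θ n : ℕ) : ℝ) + 1) ≤ |v (θ n) j| := by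
    refine eventually_all.2 fun j => ?_
    by_cases hj : w j = 0
    · exact Eventually.of_forall fun n h => absurd hj h
    · have t1 : Tendsto (fun n => |v (θ n) j|) atTop (𝓝 |w j|) := by
        have : Continuous fun x : Euc d => |x j| := by fun_prop
        exact (this.tendsto w).comp hlim
      have t2 : Tendsto (fun n => 1 / (((θ n : ℕ) : ℝ) + 1)) atTop (𝓝 0) :=
        tendsto_one_div_add_atTop_nhds_zero_nat.comp hθ.tendsto_atTop
      filter_upwards [t2.eventually_lt t1 (abs_pos.2 hj)] with n hn _
      exact hn.le
  obtain ⟨n, hn⟩ := hev.exists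
  have h2 : etaCount (1 / (((θ n : ℕ) : ℝ) + 1)) (v (θ n)) ≤ zeroCount w := by
    refine Set.ncard_le_ncard (fun j hj => ?_) (Set.toFinite _)
    by_contra hne
    exact absurd (hn j hne) (not_le.2 hj)
  have h3 := zeroCount_le hw.1 (by simpa using hw.2)
  have h4 := hc (θ n)
  omega

theorem euc_norm_le {d : ℕ} (x : Euc d) : ‖x‖ ≤ d * ‖(fun j => x j : Fin d → ℝ)‖ := by
  rw [EuclideanSpace.norm_eq]
  refine Real.sqrt_le_iff.2 ⟨by positivity, ?_⟩
  refine (Finset.sum_le_card_nsmul _ _ (‖(fun j => x j : Fin d → ℝ)‖ ^ 2) fun j _ => ?_).trans ?_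
  · exact pow_le_pow_left₀ (norm_nonneg _) (norm_le_pi_norm (fun j => x j : Fin d → ℝ) j) 2
  · rw [Finset.card_univ, Fintype.card_fin, nsmul_eq_mul, mul_pow]
    refine mul_le_mul_of_nonneg_right ?_ (by positivity)
    rcases Nat.eq_zero_or_pos d with rfl | h
    · simp
    · have : (1:ℝ) ≤ d := by exact_mod_cast h
      nlinarith

/-- rows from a subspace -/
theorem exists_rows {d k : ℕ} (hk : 1 ≤ k) {η : ℝ} (V : Submodule ℝ (Euc d)) (hV : finrank ℝ V = k)
    (hZ : Zeta η V ≤ k - 1) : ∃ r ∈ Kset d k η, ∀ x ∈ Vᗮ, ∀ i, ∑ j, r i j * x j = 0 := by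
  classical
  let b := (stdOrthonormalBasis ℝ V).reindex (finCongr hV)
  refine ⟨fun i j => (b i : Euc d) j, ⟨?_, ?_⟩, ?_⟩
  · refine (pi_norm_le_iff_of_nonneg zero_le_one).2 fun i => (pi_norm_le_iff_of_nonneg zero_le_one).2 fun j => ?_
    have h1 : ‖(b i : Euc d)‖ = 1 := b.orthonormal.1 i
    rw [← h1]
    exact PiLp.norm_apply_le _ _
  · intro T hT c hc
    by_contra hcon
    push Not at hcon
    let v : V := ∑ i, c i • b i
    have hv1 : ‖(v : Euc d)‖ = 1 := by
      have h0 : ‖v‖ ^ 2 = 1 := by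
        have h1 : b.repr v = WithLp.toLp 2 c := by
          have := b.sum_repr_symm (WithLp.toLp 2 c)
          apply b.repr.symm.injective
          rw [← this]
          simp [v]
        rw [← b.repr.norm_map v, h1, EuclideanSpace.norm_sq_eq, ← hc]
        simp
      have h2 : ‖(v : Euc d)‖ = ‖v‖ := rfl
      rw [h2]
      exact (pow_eq_one_iff_of_nonneg (norm_nonneg v) two_ne_zero).1 h0
    have h2 : ∀ j, (v : Euc d) j = ∑ i, c i * (b i : Euc d) j := by
      intro j
      simp [v]
    have h3 := etaCount_le (η := η) v.2 hv1
    have h4 : T.card ≤ etaCount η (v : Euc d) := by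
      unfold etaCount
      rw [← Set.ncard_coe_finset]
      refine Set.ncard_le_ncard (fun j hj => ?_) (Set.toFinite _)
      have := hcon j hj
      rw [← h2 j] at this
      exact this
    omega
  · intro x hx i
    have := (Submodule.mem_orthogonal V x).1 hx (b i) (b i).2
    rw [← this, PiLp.inner_apply]
    exact Finset.sum_congr rfl fun j _ => by simp [mul_comm]

theorem part2 (d : ℕ) (hd : 1 ≤ d)
    (p : Fin d → ℕ) (hp : ∀ j, 2 ≤ p j)
    (hindep : ∀ i j, i ≠ j → Irrational (Real.log (p i) / Real.log (p j)))
    (B : Fin d → Set (AddCircle (1 : ℝ)))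
    (hBclosed : ∀ j, IsClosed (B j))
    (hBinv : ∀ j, (fun x => (p j) • x) '' B j ⊆ B j)
    (A : Fin d → Set ℝ)
    (hA : ∀ j, A j = {t : ℝ | t ∈ Set.Ico (0 : ℝ) 1 ∧ (↑t : AddCircle (1 : ℝ)) ∈ B j})
    (k : ℕ) (hk : 1 ≤ k) (hkd : k ≤ d) (ε : ℝ) (hε : 0 < ε) (η : ℝ) (hη : 0 < η) :
      ∃ C : ℝ, 0 < C ∧
        ∀ V : Submodule ℝ (Euc d), Module.finrank ℝ V = k → Zeta η V ≤ k - 1 →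
          ∀ P : AffineSubspace ℝ (Euc d), P.direction = Vᗮ →
            ∀ δ : ℝ, 0 < δ → δ ≤ 1 →
              ∀ F : Finset (Euc d),
                ↑F ⊆ {x : Euc d | ∀ j, x j ∈ A j} ∩ (P : Set (Euc d)) →
                IsDeltaSep F δ →
                (F.card : ℝ) ≤ C * δ ^ (-(max (∑ j, (dimH (A j)).toReal - k) 0) - ε) := by
  classical
  let S := mkS p hp B hBinv A hA
  have hD : (1:ℝ) ≤ d := by exact_mod_cast hd
  obtain ⟨C, hC, hmain⟩ := count_bound hkd S hindep B hBclosed hBinv hA hε hη hD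
  refine ⟨C, hC, fun V hV hZ P hP δ hδ hδ1 F hF hsep => ?_⟩
  obtain ⟨r, hr, hrV⟩ := exists_rows hk V hV hZ
  let φ : F → {x : Fin d → ℝ // ∀ j, x j ∈ S.A j} := fun x => ⟨fun j => x.1 j, (hF x.2).1⟩
  have hφ : Function.Injective φ := by
    intro a b h
    apply Subtype.ext
    ext j
    exact congrFun (congrArg Subtype.val h) j
  have h1 := hmain r hr δ hδ hδ1 (Finset.univ.image φ) ?_ ?_
  · rw [Finset.card_image_of_injective _ hφ, Finset.card_univ, Fintype.card_coe] at h1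
    exact h1
  · intro a ha b hb
    obtain ⟨x, -, rfl⟩ := Finset.mem_image.1 ha
    obtain ⟨y, -, rfl⟩ := Finset.mem_image.1 hb
    funext i
    rw [rowL_apply, rowL_apply, ← sub_eq_zero, ← Finset.sum_sub_distrib]
    have hxy : x.1 - y.1 ∈ Vᗮ := by
      rw [← hP]
      exact AffineSubspace.vsub_mem_direction (hF x.2).2 (hF y.2).2
    rw [← hrV _ hxy i]
    exact Finset.sum_congr rfl fun j _ => by simp [φ, mul_sub]
  · intro a ha b hb hne
    obtain ⟨x, -, rfl⟩ := Finset.mem_image.1 ha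
    obtain ⟨y, -, rfl⟩ := Finset.mem_image.1 hb
    have h2 : x.1 ≠ y.1 := fun h => hne (congrArg φ (Subtype.ext h))
    have h3 := hsep x.1 x.2 y.1 y.2 h2
    rw [dist_eq_norm] at h3
    exact h3.trans (euc_norm_le _)

theorem ubdim_le {X : Type*} [PseudoMetricSpace X] (E : Set X) (g : ℝ) (hg : 0 ≤ g)
    (h : ∀ ε : ℝ, 0 < ε → ∃ C : ℝ, 0 < C ∧ ∀ δ : ℝ, 0 < δ → δ ≤ 1 → ∀ F : Finset X, ↑F ⊆ E →
      IsDeltaSep F δ → (F.card : ℝ) ≤ C * δ ^ (-g - ε)) : ubdim E ≤ g := by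
  refine le_of_forall_pos_le_add fun ε hε => ?_
  obtain ⟨C, hC, hb⟩ := h (ε / 2) (by positivity)
  have hsmall : ∀ᶠ δ : ℝ in 𝓝[>] 0, 0 < δ ∧ δ < 1 := by
    filter_upwards [self_mem_nhdsWithin, mem_nhdsWithin_of_mem_nhds (Iio_mem_nhds (zero_lt_one' ℝ))] with δ h1 h2
    exact ⟨h1, h2⟩
  have hlog : Tendsto (fun δ : ℝ => Real.log (1 / δ)) (𝓝[>] 0) atTop := by
    simp only [one_div]
    exact Real.tendsto_log_atTop.comp tendsto_inv_nhdsGT_zero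
  have hC1 : ∀ᶠ δ : ℝ in 𝓝[>] 0, Real.log (max C 1) / Real.log (1 / δ) < ε / 2 :=
    (hlog.const_div_atTop _).eventually_lt_const (by positivity)
  unfold ubdim
  refine limsup_le_of_le ?_ ?_
  · refine isCoboundedUnder_le_of_eventually_le (x := 0) _ ?_
    filter_upwards [hsmall] with δ hδ
    refine div_nonneg (Real.log_natCast_nonneg _) (Real.log_nonneg ?_)
    rw [le_div_iff₀ hδ.1]
    linarith
  · filter_upwards [hsmall, hC1] with δ hδ h1
    have hl : 0 < Real.log (1 / δ) := Real.log_pos (by rw [lt_div_iff₀ hδ.1]; linarith)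
    have hmem : packingNumber E δ ∈ {n : ℕ | ∃ F : Finset X, ↑F ⊆ E ∧ IsDeltaSep F δ ∧ F.card = n} := by
      refine Nat.sSup_mem ⟨0, ∅, by simp, by simp [IsDeltaSep], rfl⟩ ⟨⌈C * δ ^ (-g - ε / 2)⌉₊, ?_⟩
      rintro _ ⟨F, hF, hs, rfl⟩
      exact_mod_cast (hb δ hδ.1 hδ.2.le F hF hs).trans (Nat.le_ceil _)
    obtain ⟨F, hF, hs, hcard⟩ := hmem
    have h2 := hb δ hδ.1 hδ.2.le F hF hs
    rw [hcard] at h2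
    have hpos : 0 < δ ^ (-g - ε / 2) := Real.rpow_pos_of_pos hδ.1 _
    have e1 : Real.log (δ ^ (-g - ε / 2)) = (g + ε / 2) * Real.log (1 / δ) := by
      rw [Real.log_rpow hδ.1, one_div, Real.log_inv]
      ring
    have hC0 : 0 ≤ Real.log (max C 1) := Real.log_nonneg (le_max_right _ _)
    have h3 : Real.log (packingNumber E δ) ≤ Real.log (max C 1) + (g + ε / 2) * Real.log (1 / δ) := by
      rcases Nat.eq_zero_or_pos (packingNumber E δ) with h0 | h0
      · rw [h0, Nat.cast_zero, Real.log_zero]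
        positivity
      · rw [← e1, ← Real.log_mul (by positivity) hpos.ne']
        refine Real.log_le_log (by exact_mod_cast h0) (h2.trans ?_)
        exact mul_le_mul_of_nonneg_right (le_max_left _ _) hpos.le
    rw [div_lt_iff₀ hl] at h1
    rw [div_le_iff₀ hl]
    nlinarith

end FHR

/-- Theorem 1.5 (higher-rank Furstenberg slicing). -/
theorem furstenberg_higher_rank (d : ℕ) (hd : 1 ≤ d)
    (p : Fin d → ℕ) (hp : ∀ j, 2 ≤ p j)
    (hindep : ∀ i j, i ≠ j → Irrational (Real.log (p i) / Real.log (p j)))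
    (B : Fin d → Set (AddCircle (1 : ℝ)))
    (hBclosed : ∀ j, IsClosed (B j))
    (hBinv : ∀ j, (fun x => (p j) • x) '' B j ⊆ B j)
    (A : Fin d → Set ℝ)
    (hA : ∀ j, A j = {t : ℝ | t ∈ Set.Ico (0 : ℝ) 1 ∧ (↑t : AddCircle (1 : ℝ)) ∈ B j}) :
    -- (1) upper box dimension of affine slices
    (∀ k : ℕ, 1 ≤ k → k ≤ d →
      ∀ P : AffineSubspace ℝ (Euc d), Module.finrank ℝ P.direction = d - k →
        Zzero P.directionᗮ ≤ k - 1 →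
        ubdim ({x : Euc d | ∀ j, x j ∈ A j} ∩ (P : Set (Euc d))) ≤
          max (∑ j, (dimH (A j)).toReal - k) 0) ∧
    -- (2) uniform packing-number bound
    (∀ k : ℕ, 1 ≤ k → k ≤ d → ∀ ε : ℝ, 0 < ε → ∀ η : ℝ, 0 < η →
      ∃ C : ℝ, 0 < C ∧
        ∀ V : Submodule ℝ (Euc d), Module.finrank ℝ V = k → Zeta η V ≤ k - 1 →
          ∀ P : AffineSubspace ℝ (Euc d), P.direction = Vᗮ →
            ∀ δ : ℝ, 0 < δ → δ ≤ 1 →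
              ∀ F : Finset (Euc d),
                ↑F ⊆ {x : Euc d | ∀ j, x j ∈ A j} ∩ (P : Set (Euc d)) →
                IsDeltaSep F δ →
                (F.card : ℝ) ≤ C * δ ^ (-(max (∑ j, (dimH (A j)).toReal - k) 0) - ε)) := by
  refine ⟨fun k hk hkd P hfin hZ => ?_, fun k hk hkd ε hε η hη =>
    FHR.part2 d hd p hp hindep B hBclosed hBinv A hA k hk hkd ε hε η hη⟩
  obtain ⟨η, hη, hZη⟩ := FHR.exists_eta P.directionᗮ hZ
  refine FHR.ubdim_le _ _ (le_max_right _ _) fun ε hε => ?_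
  obtain ⟨C, hC, hb⟩ := FHR.part2 d hd p hp hindep B hBclosed hBinv A hA k hk hkd ε hε η hη
  have hV : Module.finrank ℝ P.directionᗮ = k := by
    have h1 := Submodule.finrank_add_finrank_orthogonal P.direction
    rw [finrank_euclideanSpace, Fintype.card_fin] at h1
    omega
  refine ⟨C, hC, fun δ hδ hδ1 F hF hs => ?_⟩
  exact hb P.directionᗮ hV hZη P (Submodule.orthogonal_orthogonal _).symm δ hδ hδ1 F hF hs

end
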